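/- Let S be a compact, orientable, two-dimensional embedded C^∞ submanifold of ℝ³ without boundary. There exist constants c > 0 and h₀ > 0, depending only on S and γ₀, such that for every admissible quasi-uniform triangulation T_h with h ≤ h₀, the solution u of −Δ_S u + u = f and the lifted discrete solution U_h satisfy the L²-error estimate ( ∫_S (u − U_h)² )^{1/2} ≤ c h² ( ∫_S f² )^{1/2}. -/

import Mathlib

open MeasureTheory Metric
open scoped RealInnerProductSpace ENNReal NNReal

noncomputable section

/-- Ambient Euclidean space `ℝ³`. -/
abbrev E3 : Type := EuclideanSpace ℝ (Fin 3)

/-- The tangential gradient of `w : E3 → ℝ` along the set `A` at `x`, with values projected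
onto the subspace `P`: the orthogonal projection onto `P` of the Riesz representative of the
derivative of `w` within `A` at `x`. -/
def tGrad (A : Set E3) (P : Submodule ℝ E3) (w : E3 → ℝ) (x : E3) : E3 :=
  (Submodule.orthogonalProjectionOnto P ((InnerProductSpace.toDual ℝ E3).symm (fderivWithin ℝ w A x)) : E3)

/-- A compact, orientable, two-dimensional embedded `C^∞` submanifold of `ℝ³` without boundary,
described by a global smooth unit normal field `n` and local smooth regular defining functions. -/
structure SmoothSurface where
  S : Set E3
  n : E3 → E3
  compact : IsCompact S
  nonempty : S.Nonempty
  localLevel : ∀ x ∈ S, ∃ U : Set E3, ∃ F : E3 → ℝ, IsOpen U ∧ x ∈ U ∧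
    ContDiff ℝ (⊤ : ℕ∞) F ∧ S ∩ U = {y ∈ U | F y = 0} ∧
    (∀ y ∈ U, gradient F y ≠ 0) ∧
    (∀ y, y ∈ S ∩ U → ∃ t : ℝ, gradient F y = t • n y)
  n_unit : ∀ x ∈ S, ‖n x‖ = 1
  n_smooth : ∃ U : Set E3, IsOpen U ∧ S ⊆ U ∧ ContDiffOn ℝ (⊤ : ℕ∞) n U

namespace SmoothSurface

variable (Srf : SmoothSurface)

/-- The tangent plane of `S` at `x`, as the orthogonal complement of the normal. -/
def tangent (x : E3) : Submodule ℝ E3 := (ℝ ∙ Srf.n x)ᗮ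

/-- The tangential gradient `∇_S w` on the surface. -/
def grad (w : E3 → ℝ) (x : E3) : E3 := tGrad Srf.S (Srf.tangent x) w x

/-- The bilinear form `a(v,w) = ∫_S (⟨∇_S v, ∇_S w⟩ + v w)` (w.r.t. 2-dimensional
Hausdorff measure on `S`). -/
def aForm (v w : E3 → ℝ) : ℝ :=
  ∫ x in Srf.S, (⟪Srf.grad v x, Srf.grad w x⟫ + v x * w x) ∂μH[2]

end SmoothSurface

/-- The (closed, flat) triangle with vertices `t.1, t.2.1, t.2.2`. -/
def triOf (t : E3 × E3 × E3) : Set E3 := convexHull ℝ {t.1, t.2.1, t.2.2}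

/-- The vertex set of a triangle. -/
def vertsOf (t : E3 × E3 × E3) : Set E3 := {t.1, t.2.1, t.2.2}

/-- The plane spanned by a triangle. -/
def planeOf (t : E3 × E3 × E3) : Set E3 := (affineSpan ℝ (vertsOf t) : Set E3)

/-- The direction (2-dimensional linear subspace) of the plane of a triangle. -/
def dirOf (t : E3 × E3 × E3) : Submodule ℝ E3 := (affineSpan ℝ (vertsOf t)).direction

/-- The triangle-wise tangential gradient `∇_{S_h} w` on the triangle `t`. -/
def gradTri (t : E3 × E3 × E3) (w : E3 → ℝ) (x : E3) : E3 := tGrad (triOf t) (dirOf t) w x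

/-- An admissible quasi-uniform triangulation `T_h` of the surface `Srf` with mesh parameter `h`
and quasi-uniformity constant `γ₀`, together with the nearest-point projection `a` defined on
a tubular neighbourhood `N` of the surface. -/
structure Triangulation (Srf : SmoothSurface) (γ₀ h : ℝ) where
  T : Finset (E3 × E3 × E3)
  a : E3 → E3
  N : Set E3
  T_nonempty : T.Nonempty
  indep : ∀ t ∈ T, AffineIndependent ℝ ![t.1, t.2.1, t.2.2]
  verts_on : ∀ t ∈ T, vertsOf t ⊆ Srf.S
  meet : ∀ t ∈ T, ∀ t' ∈ T, t ≠ t' →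
    triOf t ∩ triOf t' = ∅ ∨
    (∃ v, v ∈ vertsOf t ∩ vertsOf t' ∧ triOf t ∩ triOf t' = {v}) ∨
    (∃ v w, v ≠ w ∧ v ∈ vertsOf t ∩ vertsOf t' ∧ w ∈ vertsOf t ∩ vertsOf t' ∧
      triOf t ∩ triOf t' = segment ℝ v w)
  diam_le : ∀ t ∈ T, Metric.diam (triOf t) ≤ h
  disk : ∀ t ∈ T, ∃ y ∈ triOf t, closedBall y (γ₀ * h) ∩ planeOf t ⊆ triOf t
  N_open : IsOpen N
  S_sub : Srf.S ⊆ N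
  Sh_sub : (⋃ t ∈ T, triOf t) ⊆ N
  a_smooth : ContDiffOn ℝ (⊤ : ℕ∞) a N
  a_mem : ∀ x ∈ N, a x ∈ Srf.S
  a_nearest : ∀ x ∈ N, ∀ y ∈ Srf.S, dist x (a x) ≤ dist x y
  a_unique : ∀ x ∈ N, ∀ y ∈ Srf.S, dist x y = dist x (a x) → y = a x
  a_bij : Set.BijOn a (⋃ t ∈ T, triOf t) Srf.S

namespace Triangulation

variable {Srf : SmoothSurface} {γ₀ h : ℝ} (Tr : Triangulation Srf γ₀ h)

/-- The polyhedral surface `S_h`, the union of the triangles. -/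
def Sh : Set E3 := ⋃ t ∈ Tr.T, triOf t

/-- Membership in the finite element space `V_h` of continuous, piecewise affine functions
on `S_h` (as functions `E3 → ℝ`; only the values on `S_h` are relevant). -/
def IsVh (v : E3 → ℝ) : Prop :=
  ContinuousOn v Tr.Sh ∧
  ∀ t ∈ Tr.T, ∃ (L : E3 →ₗ[ℝ] ℝ) (c : ℝ), ∀ x ∈ triOf t, v x = L x + c


/-- The discrete bilinear form
`a_h(v,w) = ∫_{S_h} (⟨∇_{S_h} v, ∇_{S_h} w⟩ + v w)`, computed triangle by triangle. -/
def ahForm (v w : E3 → ℝ) : ℝ :=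
  ∑ t ∈ Tr.T, ∫ x in triOf t,
    (⟪gradTri t v x, gradTri t w x⟫ + v x * w x) ∂μH[2]

/-- The lift of a function on `S_h` to a function on `S` via the inverse of `a|_{S_h}`. -/
def liftS (w : E3 → ℝ) : E3 → ℝ := fun y => w (Function.invFunOn Tr.a Tr.Sh y)

/-- The lift of `f : S → ℝ` to `S_h` is `f ∘ a`. -/
def liftSh (f : E3 → ℝ) : E3 → ℝ := fun x => f (Tr.a x)

end Triangulation

/-- `f` is smooth in a neighbourhood of the set `A`. -/
def SmoothNear (f : E3 → ℝ) (A : Set E3) : Prop :=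
  ∃ V : Set E3, IsOpen V ∧ A ⊆ V ∧ ContDiffOn ℝ (⊤ : ℕ∞) f V

/-- `u` is the (weak, hence smooth) solution of `-Δ_S u + u = f` on the surface `Srf`. -/
def IsSolution (Srf : SmoothSurface) (f u : E3 → ℝ) : Prop :=
  SmoothNear u Srf.S ∧
  ∀ φ : E3 → ℝ, ContDiff ℝ (⊤ : ℕ∞) φ → Srf.aForm u φ = ∫ x in Srf.S, f x * φ x ∂μH[2]

/-- `uh` is the discrete Galerkin solution in `V_h` with data the lift `f ∘ a` of `f`. -/
def Triangulation.IsDiscreteSolution {Srf : SmoothSurface} {γ₀ h : ℝ}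
    (Tr : Triangulation Srf γ₀ h) (f uh : E3 → ℝ) : Prop :=
  Tr.IsVh uh ∧
  ∀ φh : E3 → ℝ, Tr.IsVh φh →
    Tr.ahForm uh φh = ∫ x in Tr.Sh, f (Tr.a x) * φh x ∂μH[2]

/-- Orthogonal projection onto the affine tangent plane of `S` at `z₀`. -/
def SmoothSurface.P0 (Srf : SmoothSurface) (z₀ : E3) (x : E3) : E3 :=
  z₀ + (Submodule.orthogonalProjectionOnto (Srf.tangent z₀) (x - z₀) : E3)

/-- `r(x) = ‖P₀(x) − z₀‖`, the distance of the tangential projection of `x` to `z₀`. -/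
def SmoothSurface.rfn (Srf : SmoothSurface) (z₀ : E3) (x : E3) : ℝ :=
  ‖Srf.P0 z₀ x - z₀‖

/-- The affine tangent plane `z₀ + T_{z₀}S`. -/
def SmoothSurface.tplane (Srf : SmoothSurface) (z₀ : E3) : Set E3 :=
  {x : E3 | x - z₀ ∈ Srf.tangent z₀}

/-- The disk `D = B₁₀₀(z₀)` in the affine tangent plane at `z₀`. -/
def SmoothSurface.disk100 (Srf : SmoothSurface) (z₀ : E3) : Set E3 :=
  Srf.tplane z₀ ∩ closedBall z₀ 100

/-- `r₁ > 0` is a graph radius for `S`: uniformly in `z₀ ∈ S`, the piece `B_{2r₁}(z₀) ∩ S`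
is a graph over the tangent plane at `z₀`, in particular `P₀` is injective on it. -/
def SmoothSurface.IsGraphRadius (Srf : SmoothSurface) (r₁ : ℝ) : Prop :=
  0 < r₁ ∧ r₁ ≤ 1 ∧ ∀ z₀ ∈ Srf.S, Set.InjOn (Srf.P0 z₀) (Srf.S ∩ closedBall z₀ (2 * r₁))

/-- `ζ` is an admissible smooth cutoff at `z₀`: supported in the ball of radius `3r₁/2`,
equal to `1` on the ball of radius `r₁`, with `C²`-bounds at most `Cζ` (uniform in `z₀`). -/
def IsCutoff (z₀ : E3) (r₁ Cζ : ℝ) (ζ : E3 → ℝ) : Prop :=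
  ContDiff ℝ (⊤ : ℕ∞) ζ ∧ tsupport ζ ⊆ closedBall z₀ (3 / 2 * r₁) ∧
  (∀ x ∈ closedBall z₀ r₁, ζ x = 1) ∧
  ∀ x : E3, |ζ x| + ‖fderiv ℝ ζ x‖ + ‖fderiv ℝ (fderiv ℝ ζ) x‖ ≤ Cζ

/-- `v` is the Neumann Green's function with pole `z₀` of `−Δ + 1` on the disk
`D = B₁₀₀(z₀)` in the tangent plane at `z₀`: it is smooth away from the pole, satisfies
`∫_D (⟨∇v, ∇φ⟩ + v φ) = φ(z₀)` for every smooth test function, and differs from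
`(1/2π) log‖· − z₀‖` by an `H²(D)`-function with norm at most `CG`. -/
def SmoothSurface.IsGreen (Srf : SmoothSurface) (z₀ : E3) (CG : ℝ) (v : E3 → ℝ) : Prop :=
  ContDiffOn ℝ (⊤ : ℕ∞) v (Srf.disk100 z₀ \ {z₀}) ∧
  (∀ φ : E3 → ℝ, ContDiff ℝ (⊤ : ℕ∞) φ →
    ∫ x in Srf.disk100 z₀,
      (⟪tGrad (Srf.disk100 z₀) (Srf.tangent z₀) v x,
        tGrad (Srf.disk100 z₀) (Srf.tangent z₀) φ x⟫ + v x * φ x) ∂μH[2] = φ z₀) ∧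
  (∫ x in Srf.disk100 z₀,
      ((v x - (1 / (2 * Real.pi)) * Real.log ‖x - z₀‖) ^ 2 +
        ‖fderivWithin ℝ (fun y => v y - (1 / (2 * Real.pi)) * Real.log ‖y - z₀‖)
            (Srf.disk100 z₀) x‖ ^ 2 +
        ‖fderivWithin ℝ
            (fun y => fderivWithin ℝ
              (fun y' => v y' - (1 / (2 * Real.pi)) * Real.log ‖y' - z₀‖)
              (Srf.disk100 z₀) y)
            (Srf.disk100 z₀) x‖ ^ 2) ∂μH[2]) ≤ CG

/-- The approximate Green's function `g̃(x) = ζ(x) v(P₀(x))` on `S`. -/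
def approxGreen (Srf : SmoothSurface) (z₀ : E3) (ζ v : E3 → ℝ) : E3 → ℝ :=
  fun x => ζ x * v (Srf.P0 z₀ x)

/-- The cut-off lifted logarithm `l̃(x) = ζ(x) log r(x)` on `S`. -/
def cutLog (Srf : SmoothSurface) (z₀ : E3) (ζ : E3 → ℝ) : E3 → ℝ :=
  fun x => ζ x * Real.log (Srf.rfn z₀ x)

/-- `lh` is the discrete (Galerkin) projection of the function `w` on `S`:
`a_h(lh, v_h) = a(w, V_h)` for all `v_h ∈ V_h`, where `V_h` is the lift of `v_h` to `S`. -/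
def Triangulation.IsDiscreteProjection {Srf : SmoothSurface} {γ₀ h : ℝ}
    (Tr : Triangulation Srf γ₀ h) (w lh : E3 → ℝ) : Prop :=
  Tr.IsVh lh ∧ ∀ vh : E3 → ℝ, Tr.IsVh vh → Tr.ahForm lh vh = Srf.aForm w (Tr.liftS vh)



end

open MeasureTheory Metric
open scoped RealInnerProductSpace ENNReal NNReal

noncomputable section

/-- A tubular neighbourhood with smooth nearest point projection. -/
structure Tube (Srf : SmoothSurface) where
  a : E3 → E3
  N : Set E3
  N_open : IsOpen N
  S_sub : Srf.S ⊆ N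
  a_smooth : ContDiffOn ℝ (⊤ : ℕ∞) a N
  a_mem : ∀ x ∈ N, a x ∈ Srf.S
  a_nearest : ∀ x ∈ N, ∀ y ∈ Srf.S, dist x (a x) ≤ dist x y
  a_unique : ∀ x ∈ N, ∀ y ∈ Srf.S, dist x y = dist x (a x) → y = a x

def Triangulation.tube {Srf : SmoothSurface} {γ₀ h : ℝ} (Tr : Triangulation Srf γ₀ h) : Tube Srf where
  a := Tr.a
  N := Tr.N
  N_open := Tr.N_open
  S_sub := Tr.S_sub
  a_smooth := Tr.a_smooth
  a_mem := Tr.a_mem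
  a_nearest := Tr.a_nearest
  a_unique := Tr.a_unique

namespace Tube

variable {Srf : SmoothSurface} (Tb : Tube Srf)

lemma a_self {x : E3} (hx : x ∈ Srf.S) : Tb.a x = x := by
  have h := Tb.a_nearest x (Tb.S_sub hx) x hx
  rw [dist_self] at h
  exact (dist_le_zero.1 h).symm

lemma a_a {x : E3} (hx : x ∈ Tb.N) : Tb.a (Tb.a x) = Tb.a x := Tb.a_self (Tb.a_mem x hx)

lemma a_contDiffAt {x : E3} (hx : x ∈ Tb.N) : ContDiffAt ℝ (⊤ : ℕ∞) Tb.a x :=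
  Tb.a_smooth.contDiffAt (Tb.N_open.mem_nhds hx)

lemma a_diff {x : E3} (hx : x ∈ Tb.N) : DifferentiableAt ℝ Tb.a x :=
  (Tb.a_contDiffAt hx).differentiableAt (by simp)

lemma n_contDiffAt (Srf : SmoothSurface) {x : E3} (hx : x ∈ Srf.S) :
    ContDiffAt ℝ (⊤ : ℕ∞) Srf.n x := by
  obtain ⟨U, hU, hS, h⟩ := Srf.n_smooth
  exact h.contDiffAt (hU.mem_nhds (hS hx))

/-- local level function, simplified -/
lemma exists_level (Srf : SmoothSurface) {x : E3} (hx : x ∈ Srf.S) :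
    ∃ (F : E3 → ℝ) (t : ℝ), t ≠ 0 ∧ DifferentiableAt ℝ F x ∧
      (∀ v, fderiv ℝ F x v = t * ⟪Srf.n x, v⟫) ∧
      (∀ᶠ y in nhds x, (y ∈ Srf.S ↔ F y = 0)) ∧ Continuous F := by
  obtain ⟨U, F, hU, hxU, hF, hSU, hg, hn⟩ := Srf.localLevel x hx
  obtain ⟨t, ht⟩ := hn x ⟨hx, hxU⟩
  refine ⟨F, t, ?_, (hF.differentiable (by simp)) x, ?_, ?_, hF.continuous⟩
  · rintro rfl
    exact hg x hxU (by simpa using ht)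
  · intro v
    have : ⟪gradient F x, v⟫ = fderiv ℝ F x v := by
      simp [gradient]
    rw [← this, ht, inner_smul_left]
    simp
  · filter_upwards [hU.mem_nhds hxU] with y hy
    constructor
    · intro h
      have : y ∈ Srf.S ∩ U := ⟨h, hy⟩
      rw [hSU] at this
      exact this.2
    · intro h
      have : y ∈ {y ∈ U | F y = 0} := ⟨hy, h⟩
      rw [← hSU] at this
      exact this.1

lemma inner_n_da {x : E3} (hx : x ∈ Tb.N) (v : E3) :
    ⟪Srf.n (Tb.a x), fderiv ℝ Tb.a x v⟫ = 0 := by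
  obtain ⟨F, t, ht, hF, hd, hS, -⟩ := exists_level Srf (Tb.a_mem x hx)
  have h1 : HasFDerivAt (F ∘ Tb.a) ((fderiv ℝ F (Tb.a x)).comp (fderiv ℝ Tb.a x)) x :=
    hF.hasFDerivAt.comp x (Tb.a_diff hx).hasFDerivAt
  have h2 : F ∘ Tb.a =ᶠ[nhds x] fun _ => (0:ℝ) := by
    have h3 := (Tb.a_diff hx).continuousAt.eventually hS
    filter_upwards [h3, Tb.N_open.mem_nhds hx] with y hy hyN
    exact hy.1 (Tb.a_mem y hyN)
  have h4 : HasFDerivAt (F ∘ Tb.a) (0 : E3 →L[ℝ] ℝ) x :=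
    (hasFDerivAt_const (0:ℝ) x).congr_of_eventuallyEq h2
  have h5 := h1.unique h4
  have h6 := DFunLike.congr_fun h5 v
  simp [hd, ht] at h6
  exact h6

/-- Points of `S` near `x + s τ`. -/
lemma exists_near (Srf : SmoothSurface) {x τ : E3} (hx : x ∈ Srf.S) (hτ : ⟪Srf.n x, τ⟫ = 0) {ε : ℝ}
    (hε : 0 < ε) :
    ∀ᶠ s in nhdsWithin (0:ℝ) (Set.Ioi 0), ∃ y ∈ Srf.S, dist (x + s • τ) y ≤ s * ε := by
  obtain ⟨F, t, ht, hF, hd, hS, hFc⟩ := exists_level Srf hx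
  have hFx : F x = 0 := (hS.self_of_nhds).1 hx
  have hn := Srf.n_unit x hx
  have key : ∀ θ : ℝ, Filter.Tendsto (fun s : ℝ => s⁻¹ * (t * F (x + s • (τ + θ • Srf.n x))))
      (nhdsWithin (0:ℝ) (Set.Ioi 0)) (nhds (t^2 * θ)) := by
    intro θ
    have h0 : HasDerivAt (fun s : ℝ => x + s • (τ + θ • Srf.n x)) (τ + θ • Srf.n x) 0 := by
      simpa using ((hasDerivAt_id (0:ℝ)).smul_const (τ + θ • Srf.n x)).const_add x
    have h1 : HasDerivAt (fun s : ℝ => F (x + s • (τ + θ • Srf.n x)))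
        (fderiv ℝ F x (τ + θ • Srf.n x)) 0 := by
      have : HasFDerivAt F (fderiv ℝ F x) (x + (0:ℝ) • (τ + θ • Srf.n x)) := by
        simpa using hF.hasFDerivAt
      exact this.comp_hasDerivAt (0:ℝ) h0
    have h2 : HasDerivAt (fun s : ℝ => t * F (x + s • (τ + θ • Srf.n x))) (t^2 * θ) 0 := by
      have := h1.const_mul t
      have e : t * fderiv ℝ F x (τ + θ • Srf.n x) = t^2 * θ := by
        rw [hd, inner_add_right, hτ, inner_smul_right, real_inner_self_eq_norm_sq, hn]
        ring
      rw [e] at this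
      exact this
    have h3 := h2.tendsto_slope_zero_right
    simpa [hFx] using h3
  have hcont : Filter.Tendsto (fun s : ℝ => s * (‖τ‖ + ε)) (nhdsWithin (0:ℝ) (Set.Ioi 0)) (nhds 0) := by
    have : Continuous fun s : ℝ => s * (‖τ‖ + ε) := by fun_prop
    have h := this.tendsto 0
    simp only [zero_mul] at h
    exact h.mono_left nhdsWithin_le_nhds
  obtain ⟨r, hr, hball⟩ := Metric.eventually_nhds_iff.1 hS
  have h1 := (key ε).eventually (lt_mem_nhds (show (0:ℝ) < t^2 * ε by positivity))
  have h2 := (key (-ε)).eventually (gt_mem_nhds (show t^2 * (-ε) < (0:ℝ) by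
    have : 0 < t^2 * ε := by positivity
    linarith))
  filter_upwards [h1, h2, self_mem_nhdsWithin, hcont.eventually (gt_mem_nhds hr)] with s hs1 hs2 hs hs3
  have hs : 0 < s := hs
  have hp : 0 < t * F (x + s • (τ + ε • Srf.n x)) := by
    by_contra hcon
    push Not at hcon
    exact absurd hs1 (not_lt.2 (mul_nonpos_of_nonneg_of_nonpos (by positivity) hcon))
  have hm : t * F (x + s • (τ + (-ε) • Srf.n x)) < 0 := by
    by_contra hcon
    push Not at hcon
    exact absurd hs2 (not_lt.2 (mul_nonneg (by positivity) hcon))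
  have hc : ContinuousOn (fun θ : ℝ => t * F (x + s • (τ + θ • Srf.n x))) (Set.Icc (-ε) ε) := by
    apply Continuous.continuousOn
    fun_prop
  obtain ⟨θ, hθ, h0⟩ := intermediate_value_Icc (by linarith) hc ⟨hm.le, hp.le⟩
  have hθ' : |θ| ≤ ε := abs_le.2 hθ
  refine ⟨x + s • (τ + θ • Srf.n x), ?_, ?_⟩
  · rw [hball]
    · rcases mul_eq_zero.1 h0 with h | h
      · exact absurd h ht
      · exact h
    · rw [dist_eq_norm, add_sub_cancel_left, norm_smul, Real.norm_eq_abs, abs_of_pos hs]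
      refine lt_of_le_of_lt ?_ hs3
      gcongr
      refine (norm_add_le _ _).trans ?_
      rw [norm_smul, hn, mul_one]
      gcongr
      exact hθ'
  · rw [dist_eq_norm]
    have : x + s • τ - (x + s • (τ + θ • Srf.n x)) = -(s • θ • Srf.n x) := by
      rw [smul_add]; abel
    rw [this, norm_neg, norm_smul, norm_smul, hn, Real.norm_eq_abs, abs_of_pos hs, mul_one]
    gcongr
    exact hθ'

lemma hasDerivAt_a_line {x : E3} (hx : x ∈ Tb.N) (τ : E3) :
    HasDerivAt (fun s : ℝ => Tb.a (x + s • τ)) (fderiv ℝ Tb.a x τ) 0 := by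
  have h0 : HasDerivAt (fun s : ℝ => x + s • τ) τ 0 := by
    simpa using ((hasDerivAt_id (0:ℝ)).smul_const τ).const_add x
  have : HasFDerivAt Tb.a (fderiv ℝ Tb.a x) (x + (0:ℝ) • τ) := by
    simpa using (Tb.a_diff hx).hasFDerivAt
  exact this.comp_hasDerivAt (0:ℝ) h0

lemma tendsto_a_line {x : E3} (hx : x ∈ Srf.S) (τ : E3) :
    Filter.Tendsto (fun s : ℝ => s⁻¹ • ((x + s • τ) - Tb.a (x + s • τ)))
      (nhdsWithin (0:ℝ) (Set.Ioi 0)) (nhds (τ - fderiv ℝ Tb.a x τ)) := by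
  have h0 : HasDerivAt (fun s : ℝ => x + s • τ) τ 0 := by
    simpa using ((hasDerivAt_id (0:ℝ)).smul_const τ).const_add x
  have h := (h0.sub (Tb.hasDerivAt_a_line (Tb.S_sub hx) τ)).tendsto_slope_zero_right
  simpa [Tb.a_self hx] using h

lemma eventually_line_N {x : E3} (hx : x ∈ Tb.N) (τ : E3) :
    ∀ᶠ s in nhdsWithin (0:ℝ) (Set.Ioi 0), x + s • τ ∈ Tb.N := by
  have hc : Continuous fun s : ℝ => x + s • τ := by fun_prop
  have : Filter.Tendsto (fun s : ℝ => x + s • τ) (nhds 0) (nhds x) := by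
    simpa using hc.tendsto 0
  exact (this.mono_left nhdsWithin_le_nhds).eventually (Tb.N_open.mem_nhds hx)

lemma da_tangent {x τ : E3} (hx : x ∈ Srf.S) (hτ : ⟪Srf.n x, τ⟫ = 0) :
    fderiv ℝ Tb.a x τ = τ := by
  have h1 := (Tb.tendsto_a_line hx τ).norm
  have h2 : ‖τ - fderiv ℝ Tb.a x τ‖ ≤ 0 := by
    refine le_of_forall_pos_le_add fun ε hε => ?_
    rw [zero_add]
    refine le_of_tendsto h1 ?_
    filter_upwards [exists_near Srf hx hτ hε, self_mem_nhdsWithin,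
      Tb.eventually_line_N (Tb.S_sub hx) τ] with s hs hs0 hsN
    obtain ⟨y, hy, hd⟩ := hs
    have hs0 : 0 < s := hs0
    have := (Tb.a_nearest _ hsN y hy).trans hd
    rw [norm_smul, ← dist_eq_norm, norm_inv, Real.norm_eq_abs, abs_of_pos hs0, inv_mul_le_iff₀ hs0]
    exact this
  have := norm_le_zero_iff.1 h2
  exact (sub_eq_zero.1 this).symm

lemma da_normal {x : E3} (hx : x ∈ Srf.S) : fderiv ℝ Tb.a x (Srf.n x) = 0 := by
  have h1 := (Tb.tendsto_a_line hx (Srf.n x)).norm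
  have hn := Srf.n_unit x hx
  have h2 : ‖Srf.n x - fderiv ℝ Tb.a x (Srf.n x)‖ ≤ 1 := by
    refine le_of_tendsto h1 ?_
    filter_upwards [self_mem_nhdsWithin,
      Tb.eventually_line_N (Tb.S_sub hx) (Srf.n x)] with s hs0 hsN
    have hs0 : 0 < s := hs0
    have := Tb.a_nearest _ hsN x hx
    rw [norm_smul, ← dist_eq_norm, norm_inv, Real.norm_eq_abs, abs_of_pos hs0, inv_mul_le_iff₀ hs0]
    refine this.trans ?_
    rw [dist_eq_norm, add_sub_cancel_left, norm_smul, hn, Real.norm_eq_abs, abs_of_pos hs0]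
  have h3 := Tb.inner_n_da (Tb.S_sub hx) (Srf.n x)
  rw [Tb.a_self hx] at h3
  have h4 : ‖Srf.n x - fderiv ℝ Tb.a x (Srf.n x)‖ ^ 2 = 1 + ‖fderiv ℝ Tb.a x (Srf.n x)‖ ^ 2 := by
    rw [norm_sub_sq_real, h3, hn]; ring
  have h5 : ‖fderiv ℝ Tb.a x (Srf.n x)‖ ^ 2 ≤ 0 := by
    have := pow_le_pow_left₀ (norm_nonneg _) h2 2
    linarith
  exact norm_eq_zero.1 (pow_eq_zero_iff (two_ne_zero) |>.1 (le_antisymm h5 (by positivity)))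

lemma da_S {x : E3} (hx : x ∈ Srf.S) (v : E3) :
    fderiv ℝ Tb.a x v = v - ⟪Srf.n x, v⟫ • Srf.n x := by
  have hn := Srf.n_unit x hx
  have h1 : ⟪Srf.n x, v - ⟪Srf.n x, v⟫ • Srf.n x⟫ = 0 := by
    rw [inner_sub_right, inner_smul_right, real_inner_self_eq_norm_sq, hn]; ring
  have h2 := Tb.da_tangent hx h1
  rw [map_sub, map_smul, Tb.da_normal hx] at h2
  simpa using h2

lemma inner_sub_a {x τ : E3} (hx : x ∈ Tb.N) (hτ : ⟪Srf.n (Tb.a x), τ⟫ = 0) :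
    ⟪x - Tb.a x, τ⟫ = 0 := by
  have hy := Tb.a_mem x hx
  have h1 := Tb.hasDerivAt_a_line (Tb.S_sub hy) τ
  rw [Tb.da_tangent hy hτ] at h1
  have h2 : HasDerivAt (fun s : ℝ => ‖x - Tb.a (Tb.a x + s • τ)‖ ^ 2) (2 * ⟪x - Tb.a x, -τ⟫) 0 := by
    have := (h1.const_sub x).norm_sq
    simpa [Tb.a_a hx] using this
  have h3 : IsLocalMin (fun s : ℝ => ‖x - Tb.a (Tb.a x + s • τ)‖ ^ 2) 0 := by
    have hc : Continuous fun s : ℝ => Tb.a x + s • τ := by fun_prop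
    have : Filter.Tendsto (fun s : ℝ => Tb.a x + s • τ) (nhds 0) (nhds (Tb.a x)) := by
      simpa using hc.tendsto 0
    filter_upwards [this.eventually (Tb.N_open.mem_nhds (Tb.S_sub hy))] with s hs
    simp only [zero_smul, add_zero, Tb.a_a hx]
    rw [← dist_eq_norm, ← dist_eq_norm]
    gcongr
    exact Tb.a_nearest x hx _ (Tb.a_mem _ hs)
  have h4 := h3.hasDerivAt_eq_zero h2
  rw [inner_neg_right] at h4
  linarith

/-- the extended normal -/
def nu (x : E3) : E3 := Srf.n (Tb.a x)

/-- the signed distance -/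
def q (x : E3) : ℝ := ⟪x - Tb.a x, Tb.nu x⟫

lemma nu_unit {x : E3} (hx : x ∈ Tb.N) : ‖Tb.nu x‖ = 1 := Srf.n_unit _ (Tb.a_mem x hx)

lemma nu_S {x : E3} (hx : x ∈ Srf.S) : Tb.nu x = Srf.n x := by rw [nu, Tb.a_self hx]

lemma nu_contDiffAt {x : E3} (hx : x ∈ Tb.N) : ContDiffAt ℝ (⊤ : ℕ∞) Tb.nu x :=
  (n_contDiffAt Srf (Tb.a_mem x hx)).comp x (Tb.a_contDiffAt hx)

lemma nu_diff {x : E3} (hx : x ∈ Tb.N) : DifferentiableAt ℝ Tb.nu x :=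
  (Tb.nu_contDiffAt hx).differentiableAt (by simp)

lemma q_contDiffAt {x : E3} (hx : x ∈ Tb.N) : ContDiffAt ℝ (⊤ : ℕ∞) Tb.q x :=
  (contDiffAt_id.sub (Tb.a_contDiffAt hx)).inner ℝ (Tb.nu_contDiffAt hx)

lemma sub_a {x : E3} (hx : x ∈ Tb.N) : x - Tb.a x = Tb.q x • Tb.nu x := by
  have hn := Tb.nu_unit hx
  have h1 : ∀ v, ⟪x - Tb.a x, v - ⟪Tb.nu x, v⟫ • Tb.nu x⟫ = 0 := fun v =>
    Tb.inner_sub_a hx (by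
      change ⟪Tb.nu x, _⟫ = 0
      rw [inner_sub_right, inner_smul_right, real_inner_self_eq_norm_sq, hn]; ring)
  refine ext_inner_right ℝ fun v => ?_
  have := h1 v
  rw [inner_sub_right, inner_smul_right] at this
  rw [inner_smul_left]
  simp only [q, conj_trivial]
  linarith

lemma a_eq {x : E3} (hx : x ∈ Tb.N) : Tb.a x = x - Tb.q x • Tb.nu x := by
  rw [← Tb.sub_a hx]; abel

lemma abs_q {x : E3} (hx : x ∈ Tb.N) : |Tb.q x| = dist x (Tb.a x) := by
  rw [dist_eq_norm, Tb.sub_a hx, norm_smul, Tb.nu_unit hx, mul_one, Real.norm_eq_abs]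

lemma q_S {x : E3} (hx : x ∈ Srf.S) : Tb.q x = 0 := by
  rw [q, Tb.a_self hx]; simp

lemma inner_nu_dnu {x : E3} (hx : x ∈ Tb.N) (v : E3) : ⟪Tb.nu x, fderiv ℝ Tb.nu x v⟫ = 0 := by
  have h1 : HasFDerivAt (fun y => ⟪Tb.nu y, Tb.nu y⟫) _ x :=
    (Tb.nu_diff hx).hasFDerivAt.inner ℝ (Tb.nu_diff hx).hasFDerivAt
  have h2 : (fun y => ⟪Tb.nu y, Tb.nu y⟫) =ᶠ[nhds x] fun _ => (1:ℝ) := by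
    filter_upwards [Tb.N_open.mem_nhds hx] with y hy
    rw [real_inner_self_eq_norm_sq, Tb.nu_unit hy]; norm_num
  have h4 := h1.unique ((hasFDerivAt_const (1:ℝ) x).congr_of_eventuallyEq h2)
  have h6 := DFunLike.congr_fun h4 v
  simp [fderivInnerCLM_apply] at h6
  rw [real_inner_comm] at h6
  have := real_inner_comm (Tb.nu x) (fderiv ℝ Tb.nu x v)
  linarith

lemma dq {x : E3} (hx : x ∈ Tb.N) (v : E3) : fderiv ℝ Tb.q x v = ⟪Tb.nu x, v⟫ := by
  have h1 : HasFDerivAt Tb.q _ x :=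
    ((hasFDerivAt_id x).sub (Tb.a_diff hx).hasFDerivAt).inner ℝ (Tb.nu_diff hx).hasFDerivAt
  rw [h1.fderiv]
  simp only [id_eq, ContinuousLinearMap.coe_comp, Function.comp_apply,
    ContinuousLinearMap.prod_apply, fderivInnerCLM_apply]
  have h2 := Tb.inner_n_da hx v
  have h3 := Tb.inner_nu_dnu hx v
  change ⟪Tb.nu x, _⟫ = 0 at h2
  have e : ((id : E3 → E3) - Tb.a) x = Tb.q x • Tb.nu x := Tb.sub_a hx
  rw [e, inner_smul_left, h3]
  simp only [ContinuousLinearMap.sub_apply, ContinuousLinearMap.id_apply, inner_sub_left]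
  have h5 := real_inner_comm (Tb.nu x) (fderiv ℝ Tb.a x v)
  have h6 := real_inner_comm (Tb.nu x) v
  simp
  linarith

/-- `Da = I - ν νᵀ - q Dν` -/
lemma da {x : E3} (hx : x ∈ Tb.N) (v : E3) :
    fderiv ℝ Tb.a x v = v - ⟪Tb.nu x, v⟫ • Tb.nu x - Tb.q x • fderiv ℝ Tb.nu x v := by
  have hq : DifferentiableAt ℝ Tb.q x := (Tb.q_contDiffAt hx).differentiableAt (by simp)
  have h1 : HasFDerivAt (fun y => y - Tb.q y • Tb.nu y) _ x :=
    (hasFDerivAt_id x).sub (hq.hasFDerivAt.smul (Tb.nu_diff hx).hasFDerivAt)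
  have h2 : Tb.a =ᶠ[nhds x] fun y => y - Tb.q y • Tb.nu y := by
    filter_upwards [Tb.N_open.mem_nhds hx] with y hy using Tb.a_eq hy
  rw [h2.fderiv_eq, h1.fderiv]
  simp [Tb.dq hx]
  abel

end Tube
end

open MeasureTheory Metric
open scoped RealInnerProductSpace ENNReal NNReal

noncomputable section

namespace Tube

variable {Srf : SmoothSurface} (Tb : Tube Srf)

/-- smooth on the tube -/
def Sm {G : Type*} [NormedAddCommGroup G] [NormedSpace ℝ G] (F : E3 → G) : Prop :=
  ∀ x ∈ Tb.N, ContDiffAt ℝ ((⊤ : ℕ∞) : WithTop ℕ∞) F x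

section
variable {Tb}
variable {G : Type*} [NormedAddCommGroup G] [NormedSpace ℝ G] {F : E3 → G}

lemma Sm.diff (hF : Tb.Sm F) {x : E3} (hx : x ∈ Tb.N) : DifferentiableAt ℝ F x :=
  (hF x hx).differentiableAt (by simp)

lemma Sm.contAt (hF : Tb.Sm F) {x : E3} (hx : x ∈ Tb.N) : ContinuousAt F x :=
  (hF x hx).continuousAt

lemma Sm.contOn (hF : Tb.Sm F) {A : Set E3} (hA : A ⊆ Tb.N) : ContinuousOn F A :=
  fun _ hx => (hF.contAt (hA hx)).continuousWithinAt

lemma Sm.fderiv (hF : Tb.Sm F) : Tb.Sm (fderiv ℝ F) := fun x hx =>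
  (hF x hx).fderiv_right (by norm_cast)

lemma Sm.dir (hF : Tb.Sm F) (v : E3) : Tb.Sm (fun x => _root_.fderiv ℝ F x v) := fun x hx =>
  (hF.fderiv x hx).clm_apply contDiffAt_const

lemma Sm.comp_a {G' : Type*} [NormedAddCommGroup G'] [NormedSpace ℝ G'] {H : E3 → G'}
    (hH : ∀ x ∈ Srf.S, ContDiffAt ℝ ((⊤ : ℕ∞) : WithTop ℕ∞) H x) : Tb.Sm (fun x => H (Tb.a x)) :=
  fun x hx => (hH _ (Tb.a_mem x hx)).comp x (Tb.a_contDiffAt hx)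

end

lemma sm_a : Tb.Sm Tb.a := fun _ hx => Tb.a_contDiffAt hx
lemma sm_nu : Tb.Sm Tb.nu := fun _ hx => Tb.nu_contDiffAt hx
lemma sm_q : Tb.Sm Tb.q := fun _ hx => Tb.q_contDiffAt hx

lemma exists_delta : ∃ δ > 0, δ ≤ 1 ∧ cthickening δ Srf.S ⊆ Tb.N := by
  obtain ⟨δ, hδ, h⟩ := Srf.compact.exists_cthickening_subset_open Tb.N_open Tb.S_sub
  exact ⟨min δ 1, by positivity, min_le_right _ _, (cthickening_mono (min_le_left _ _) _).trans h⟩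

lemma ball_sub {δ : ℝ} {z : E3} (hz : z ∈ Srf.S) : closedBall z δ ⊆ cthickening δ Srf.S :=
  closedBall_subset_cthickening hz δ

section
variable {Tb}
variable {G : Type*} [NormedAddCommGroup G] [NormedSpace ℝ G] {F : E3 → G}

lemma Sm.bounds0 (hF : Tb.Sm F) {δ : ℝ} (hK : cthickening δ Srf.S ⊆ Tb.N) :
    ∃ C ≥ 0, ∀ x ∈ cthickening δ Srf.S, ‖F x‖ ≤ C := by
  have hc : IsCompact (cthickening δ Srf.S) := Srf.compact.cthickening
  obtain ⟨C, hC⟩ := hc.exists_bound_of_continuousOn (hF.contOn hK)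
  exact ⟨max C 0, le_max_right _ _, fun x hx => (hC x hx).trans (le_max_left _ _)⟩

lemma Sm.bounds (hF : Tb.Sm F) {δ : ℝ} (hK : cthickening δ Srf.S ⊆ Tb.N) :
    ∃ C ≥ 0, (∀ x ∈ cthickening δ Srf.S, ‖F x‖ ≤ C) ∧
      (∀ x ∈ cthickening δ Srf.S, ‖_root_.fderiv ℝ F x‖ ≤ C) ∧
      (∀ z ∈ Srf.S, ∀ x ∈ closedBall z δ, ∀ y ∈ closedBall z δ, ‖F y - F x‖ ≤ C * ‖y - x‖) ∧
      (∀ z ∈ Srf.S, ∀ x ∈ closedBall z δ, ∀ y ∈ closedBall z δ,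
        ‖F y - F x - _root_.fderiv ℝ F x (y - x)‖ ≤ C * ‖y - x‖ ^ 2) := by
  obtain ⟨C0, h0, hC0⟩ := hF.bounds0 hK
  obtain ⟨C1, h1, hC1⟩ := hF.fderiv.bounds0 hK
  obtain ⟨C2, h2, hC2⟩ := hF.fderiv.fderiv.bounds0 hK
  refine ⟨C0 + C1 + C2, by positivity, fun x hx => (hC0 x hx).trans (by linarith),
    fun x hx => (hC1 x hx).trans (by linarith), ?_, ?_⟩
  · intro z hz x hx y hy
    refine (Convex.norm_image_sub_le_of_norm_fderiv_le (𝕜 := ℝ) (s := closedBall z δ) (C := C1)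
      (fun w hw => hF.diff (hK (ball_sub hz hw))) (fun w hw => hC1 w (ball_sub hz hw))
      (convex_closedBall _ _) hx hy).trans ?_
    gcongr; linarith
  · intro z hz x hx y hy
    have hl : ∀ w ∈ closedBall z δ, ‖_root_.fderiv ℝ F w - _root_.fderiv ℝ F x‖ ≤ C2 * ‖w - x‖ := by
      intro w hw
      exact Convex.norm_image_sub_le_of_norm_fderiv_le (𝕜 := ℝ) (s := closedBall z δ) (C := C2)
        (fun w hw => hF.fderiv.diff (hK (ball_sub hz hw))) (fun w hw => hC2 w (ball_sub hz hw))
        (convex_closedBall _ _) hx hw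
    have hs : segment ℝ x y ⊆ closedBall z δ := (convex_closedBall _ _).segment_subset hx hy
    refine (Convex.norm_image_sub_le_of_norm_fderiv_le' (𝕜 := ℝ) (s := segment ℝ x y)
      (C := C2 * ‖y - x‖) (φ := _root_.fderiv ℝ F x)
      (fun w hw => hF.diff (hK (ball_sub hz (hs hw)))) (fun w hw => ?_)
      (convex_segment _ _) (left_mem_segment ..) (right_mem_segment ..)).trans ?_
    · refine (hl w (hs hw)).trans ?_
      gcongr
      obtain ⟨θ, hθ, rfl⟩ := (segment_eq_image' ℝ x y) ▸ hw
      rw [add_sub_cancel_left, norm_smul, Real.norm_eq_abs, abs_of_nonneg hθ.1]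
      exact mul_le_of_le_one_left (norm_nonneg _) hθ.2
    · rw [mul_assoc, ← sq]
      gcongr; linarith
end

/-- normal Taylor estimates on S -/
lemma normal_bounds {δ : ℝ} (hδ : 0 < δ) (hK : cthickening δ Srf.S ⊆ Tb.N) : ∃ C ≥ 0, ∀ x ∈ Srf.S, ∀ y ∈ Srf.S,
    ‖Srf.n x - Srf.n y‖ ≤ C * ‖x - y‖ ∧ |⟪Srf.n x, x - y⟫| ≤ C * ‖x - y‖ ^ 2 ∧
    |⟪Srf.n x + Srf.n y, x - y⟫| ≤ C * ‖x - y‖ ^ 3 := by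
  obtain ⟨C1, h1, -, -, hn, hnt⟩ := Tb.sm_nu.bounds hK
  obtain ⟨C2, h2, -, -, -, hq⟩ := Tb.sm_q.bounds hK
  obtain ⟨C3, h3, hb3⟩ := Tb.sm_nu.fderiv.fderiv.bounds0 hK
  have hdq : ∀ x ∈ Tb.N, fderiv ℝ Tb.q x = innerSL ℝ (Tb.nu x) := by
    intro x hx; ext v; rw [Tb.dq hx]; rfl
  refine ⟨C1 + C2 + (4 * C1 + 4 * C3) + 2 / δ + 1 / δ + 2 / δ ^ 2, by positivity, fun x hx y hy => ?_⟩
  have hun := Srf.n_unit x hx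
  have hun' := Srf.n_unit y hy
  rcases le_or_gt ‖x - y‖ δ with hd | hd
  · have hyx : x ∈ closedBall y δ := by rwa [mem_closedBall, dist_eq_norm]
    have hyy : y ∈ closedBall y δ := mem_closedBall_self hδ.le
    have e1 : ‖Srf.n x - Srf.n y‖ ≤ C1 * ‖x - y‖ := by
      have := hn y hy y hyy x hyx
      rwa [Tb.nu_S hx, Tb.nu_S hy] at this
    have e2 : |⟪Srf.n x, x - y⟫| ≤ C2 * ‖x - y‖ ^ 2 := by
      have := hq y hy x hyx y hyy
      rw [Tb.dq (Tb.S_sub hx), Tb.q_S hx, Tb.q_S hy, Tb.nu_S hx] at this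
      rw [norm_sub_rev x y]
      rw [← neg_sub y x, inner_neg_right]
      simpa using this
    refine ⟨e1.trans ?_, e2.trans ?_, ?_⟩
    · gcongr
      have : 0 ≤ C2 + (4 * C1 + 4 * C3) + 2 / δ + 1 / δ + 2 / δ ^ 2 := by positivity
      linarith
    · gcongr
      have : 0 ≤ C1 + (4 * C1 + 4 * C3) + 2 / δ + 1 / δ + 2 / δ ^ 2 := by positivity
      linarith
    · -- trapezoid rule
      set d := x - y with hd'
      let p : ℝ → E3 := fun t => y + t • d
      have hp : ∀ t ∈ Set.Icc (0:ℝ) 1, p t ∈ closedBall y δ := by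
        intro t ht
        rw [mem_closedBall, dist_eq_norm, add_sub_cancel_left, norm_smul, Real.norm_eq_abs,
          abs_of_nonneg ht.1]
        exact (mul_le_of_le_one_left (norm_nonneg _) ht.2).trans hd
      have hpN : ∀ t ∈ Set.Icc (0:ℝ) 1, p t ∈ Tb.N := fun t ht => hK (ball_sub hy (hp t ht))
      have hpd : ∀ t, HasDerivAt p d t := by
        intro t
        have := ((hasDerivAt_id t).smul_const d).const_add y
        simp only [one_smul] at this
        exact this
      let ψ : ℝ → ℝ := fun t => Tb.q (p t) - t / 2 * (⟪Tb.nu y, d⟫ + ⟪Tb.nu (p t), d⟫)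
      have hdψ : ∀ t ∈ Set.Icc (0:ℝ) 1, HasDerivAt ψ
          (⟪Tb.nu (p t), d⟫ - (1 / 2 * (⟪Tb.nu y, d⟫ + ⟪Tb.nu (p t), d⟫) +
            t / 2 * ⟪fderiv ℝ Tb.nu (p t) d, d⟫)) t := by
        intro t ht
        have a1 : HasDerivAt (fun t => Tb.q (p t)) ⟪Tb.nu (p t), d⟫ t := by
          have := (Tb.sm_q.diff (hpN t ht)).hasFDerivAt.comp_hasDerivAt t (hpd t)
          rwa [Tb.dq (hpN t ht)] at this
        have a2 : HasDerivAt (fun t => Tb.nu (p t)) (fderiv ℝ Tb.nu (p t) d) t :=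
          (Tb.nu_diff (hpN t ht)).hasFDerivAt.comp_hasDerivAt t (hpd t)
        have a3 : HasDerivAt (fun t => ⟪Tb.nu (p t), d⟫) ⟪fderiv ℝ Tb.nu (p t) d, d⟫ t := by
          simpa using a2.inner ℝ (hasDerivAt_const t d)
        have a4 : HasDerivAt (fun t : ℝ => t / 2) (1 / 2) t := (hasDerivAt_id t).div_const 2
        exact a1.sub (a4.mul (a3.const_add _))
      have hbd : ∀ t ∈ Set.Icc (0:ℝ) 1, ‖⟪Tb.nu (p t), d⟫ - (1 / 2 * (⟪Tb.nu y, d⟫ + ⟪Tb.nu (p t), d⟫) +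
            t / 2 * ⟪fderiv ℝ Tb.nu (p t) d, d⟫)‖ ≤ C1 * ‖d‖ ^ 3 := by
        intro t ht
        have b1 := hnt y hy (p t) (hp t ht) y hyy
        have b2 : y - p t = - (t • d) := by simp [p]
        have b3 : ⟪Tb.nu (p t), d⟫ - (1 / 2 * (⟪Tb.nu y, d⟫ + ⟪Tb.nu (p t), d⟫) +
            t / 2 * ⟪fderiv ℝ Tb.nu (p t) d, d⟫) =
            - (1 / 2 * ⟪Tb.nu y - Tb.nu (p t) - fderiv ℝ Tb.nu (p t) (y - p t), d⟫) := by
          rw [b2, map_neg, map_smul, inner_sub_left, inner_sub_left, inner_neg_left, inner_smul_left]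
          simp only [conj_trivial]
          ring
        rw [b3, norm_neg, norm_mul]
        have b4 : ‖y - p t‖ ≤ ‖d‖ := by
          rw [b2, norm_neg, norm_smul, Real.norm_eq_abs, abs_of_nonneg ht.1]
          exact mul_le_of_le_one_left (norm_nonneg _) ht.2
        have b5 := norm_inner_le_norm (𝕜 := ℝ) (Tb.nu y - Tb.nu (p t) - fderiv ℝ Tb.nu (p t) (y - p t)) d
        have b6 : C1 * ‖y - p t‖ ^ 2 ≤ C1 * ‖d‖ ^ 2 := by gcongr
        have b7 := mul_le_mul_of_nonneg_right (b1.trans b6) (norm_nonneg d)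
        have b8 : 0 ≤ C1 * ‖d‖ ^ 2 * ‖d‖ := by positivity
        norm_num at *
        nlinarith
      have hfin := norm_image_sub_le_of_norm_deriv_le_segment_01' (f := ψ)
        (fun t ht => (hdψ t ht).hasDerivWithinAt) (fun t ht => hbd t ⟨ht.1, ht.2.le⟩)
      have hp1 : p 1 = x := by simp [p, d]
      have hp0 : p 0 = y := by simp [p]
      have hψ : ψ 1 - ψ 0 = - (1/2 * ⟪Srf.n x + Srf.n y, d⟫) := by
        simp only [ψ, hp1, hp0, Tb.q_S hx, Tb.q_S hy, Tb.nu_S hx, Tb.nu_S hy, inner_add_left]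
        ring
      rw [hψ, norm_neg, norm_mul, Real.norm_eq_abs, Real.norm_eq_abs] at hfin
      have : |⟪Srf.n x + Srf.n y, d⟫| ≤ 2 * C1 * ‖d‖ ^ 3 := by
        rw [abs_of_nonneg (by norm_num : (0:ℝ) ≤ 1/2)] at hfin
        linarith
      refine this.trans ?_
      gcongr
      have : 0 ≤ C2 + 4 * C3 + 2 / δ + 1 / δ + 2 / δ ^ 2 := by positivity
      linarith
  · have hpos : 0 < ‖x - y‖ := hδ.trans hd
    have f1 : 1 ≤ 1 / δ * ‖x - y‖ := by rw [one_div, inv_mul_eq_div, le_div_iff₀ hδ]; linarith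
    have f2 : 1 ≤ 1 / δ ^ 2 * ‖x - y‖ ^ 2 := by
      rw [one_div, inv_mul_eq_div, le_div_iff₀ (by positivity), one_mul]; gcongr
    have i1 : |⟪Srf.n x, x - y⟫| ≤ ‖x - y‖ := by
      have := abs_real_inner_le_norm (Srf.n x) (x - y)
      rwa [hun, one_mul] at this
    have i2 : |⟪Srf.n x + Srf.n y, x - y⟫| ≤ 2 * ‖x - y‖ := by
      refine (abs_real_inner_le_norm _ (x - y)).trans ?_
      gcongr
      refine (norm_add_le _ _).trans ?_
      rw [hun, hun']; norm_num
    refine ⟨?_, i1.trans ?_, i2.trans ?_⟩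
    · refine (norm_sub_le _ _).trans ?_
      rw [hun, hun']
      have : 2 / δ * ‖x - y‖ ≤ (C1 + C2 + (4 * C1 + 4 * C3) + 2 / δ + 1 / δ + 2 / δ ^ 2) * ‖x - y‖ := by
        gcongr
        have : 0 ≤ C1 + C2 + (4 * C1 + 4 * C3) + 1 / δ + 2 / δ ^ 2 := by positivity
        linarith
      have e : 2 / δ * ‖x - y‖ = 2 * (1 / δ * ‖x - y‖) := by ring
      linarith
    · have : 1 / δ * ‖x - y‖ ^ 2 ≤ (C1 + C2 + (4 * C1 + 4 * C3) + 2 / δ + 1 / δ + 2 / δ ^ 2) * ‖x - y‖ ^ 2 := by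
        gcongr
        have : 0 ≤ C1 + C2 + (4 * C1 + 4 * C3) + 2 / δ + 2 / δ ^ 2 := by positivity
        linarith
      have e : 1 / δ * ‖x - y‖ ^ 2 = (1 / δ * ‖x - y‖) * ‖x - y‖ := by ring
      nlinarith
    · have : 2 / δ ^ 2 * ‖x - y‖ ^ 3 ≤ (C1 + C2 + (4 * C1 + 4 * C3) + 2 / δ + 1 / δ + 2 / δ ^ 2) * ‖x - y‖ ^ 3 := by
        gcongr
        have : 0 ≤ C1 + C2 + (4 * C1 + 4 * C3) + 2 / δ + 1 / δ := by positivity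
        linarith
      have e : 2 / δ ^ 2 * ‖x - y‖ ^ 3 = 2 * (1 / δ ^ 2 * ‖x - y‖ ^ 2) * ‖x - y‖ := by ring
      nlinarith

/-- normal fibres -/
lemma exists_fiber : ∃ δ > 0, δ ≤ 1 ∧ cthickening δ Srf.S ⊆ Tb.N ∧
    ∀ y ∈ Srf.S, ∀ s : ℝ, |s| ≤ δ → Tb.a (y + s • Srf.n y) = y := by
  obtain ⟨δ, hδ, hδ1, hK⟩ := Tb.exists_delta
  obtain ⟨C, hC, hb⟩ := Tb.normal_bounds hδ hK
  refine ⟨min δ (1 / (8 * (C + 1))), by positivity, (min_le_left _ _).trans hδ1,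
    (cthickening_mono (min_le_left _ _) _).trans hK, fun y hy s hs => ?_⟩
  have hun := Srf.n_unit y hy
  have hs1 : |s| ≤ δ := hs.trans (min_le_left _ _)
  have hs2 : |s| ≤ 1 / (8 * (C + 1)) := hs.trans (min_le_right _ _)
  set x := y + s • Srf.n y with hx
  have hxy : dist x y = |s| := by
    rw [dist_eq_norm, hx, add_sub_cancel_left, norm_smul, hun, mul_one, Real.norm_eq_abs]
  have hxN : x ∈ Tb.N := hK (ball_sub hy (by rw [mem_closedBall, hxy]; exact hs1))
  set y' := Tb.a x with hy'
  have hy'S : y' ∈ Srf.S := Tb.a_mem x hxN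
  have hq : |Tb.q x| ≤ |s| := by
    rw [Tb.abs_q hxN, ← hxy]; exact Tb.a_nearest x hxN y hy
  set r := ‖y' - y‖ with hr
  have hr2 : r ≤ 2 * |s| := by
    have : dist y' y ≤ dist x y' + dist x y := dist_triangle_left _ _ _
    rw [hr, ← dist_eq_norm]
    rw [← Tb.abs_q hxN, hxy] at this
    linarith
  have hun' := Srf.n_unit y' hy'S
  obtain ⟨h1, h2, -⟩ := hb y' hy'S y hy
  have e1 : x - y' = Tb.q x • Srf.n y' := Tb.sub_a hxN
  have e2 : y' - y = (s - Tb.q x) • Srf.n y' - s • (Srf.n y' - Srf.n y) := by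
    have : y' - y = s • Srf.n y - Tb.q x • Srf.n y' := by rw [← e1, hx]; abel
    rw [this]; module
  have e3 : s - Tb.q x = ⟪Srf.n y', y' - y⟫ + s * ⟪Srf.n y', Srf.n y' - Srf.n y⟫ := by
    conv_rhs => rw [e2]
    rw [inner_sub_right, inner_smul_right, inner_smul_right, real_inner_self_eq_norm_sq, hun']
    ring
  have e4 : |⟪Srf.n y', Srf.n y' - Srf.n y⟫| ≤ C * r := by
    have := abs_real_inner_le_norm (Srf.n y') (Srf.n y' - Srf.n y)
    rw [hun', one_mul] at this
    exact this.trans h1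
  have e5 : |s - Tb.q x| ≤ C * r ^ 2 + |s| * (C * r) := by
    rw [e3]
    refine (abs_add_le _ _).trans ?_
    rw [abs_mul]
    gcongr
  have e6 : r ≤ |s - Tb.q x| + |s| * (C * r) := by
    calc r = ‖(s - Tb.q x) • Srf.n y' - s • (Srf.n y' - Srf.n y)‖ := by rw [hr, ← e2]
      _ ≤ ‖(s - Tb.q x) • Srf.n y'‖ + ‖s • (Srf.n y' - Srf.n y)‖ := norm_sub_le _ _
      _ ≤ _ := by
        rw [norm_smul, norm_smul, hun', mul_one, Real.norm_eq_abs, Real.norm_eq_abs]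
        gcongr
  have hr0 : 0 ≤ r := norm_nonneg _
  have e7 : C * r ^ 2 ≤ C * r * (2 * |s|) := by
    have : C * r ^ 2 = C * r * r := by ring
    rw [this]; gcongr
  have e8 : r ≤ (4 * C * |s|) * r := by nlinarith
  have e9 : 4 * C * |s| ≤ 1 / 2 := by
    calc 4 * C * |s| ≤ 4 * C * (1 / (8 * (C + 1))) := by gcongr
      _ ≤ 1 / 2 := by
        rw [mul_one_div, div_le_iff₀ (by positivity)]; linarith
  have : r ≤ 0 := by nlinarith
  have := norm_le_zero_iff.1 this
  exact sub_eq_zero.1 this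

end Tube
end

open MeasureTheory Metric
open scoped RealInnerProductSpace ENNReal NNReal

noncomputable section

/-- A tube with a good radius `δ`. -/
structure Geo (Srf : SmoothSurface) extends Tube Srf where
  δ : ℝ
  δ_pos : 0 < δ
  δ_le : δ ≤ 1
  K_sub : cthickening δ Srf.S ⊆ N
  fiber : ∀ y ∈ Srf.S, ∀ s : ℝ, |s| ≤ δ → a (y + s • Srf.n y) = y

def Tube.geo {Srf : SmoothSurface} (Tb : Tube Srf) : Geo Srf where
  toTube := Tb
  δ := Tb.exists_fiber.choose
  δ_pos := Tb.exists_fiber.choose_spec.1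
  δ_le := Tb.exists_fiber.choose_spec.2.1
  K_sub := Tb.exists_fiber.choose_spec.2.2.1
  fiber := Tb.exists_fiber.choose_spec.2.2.2

lemma tGrad_mem (A : Set E3) (P : Submodule ℝ E3) (w : E3 → ℝ) (x : E3) : tGrad A P w x ∈ P :=
  Submodule.coe_mem _

lemma tGrad_inner (A : Set E3) (P : Submodule ℝ E3) (w : E3 → ℝ) (x : E3) {τ : E3} (hτ : τ ∈ P) :
    ⟪tGrad A P w x, τ⟫ = fderivWithin ℝ w A x τ := by
  have := Submodule.inner_orthogonalProjectionOnto_eq_of_mem_left (K := P) ⟨τ, hτ⟩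
    ((InnerProductSpace.toDual ℝ E3).symm (fderivWithin ℝ w A x))
  rw [tGrad, real_inner_comm]
  refine (this : _).trans ?_
  rw [real_inner_comm]
  simp

lemma SmoothSurface.mem_tangent (Srf : SmoothSurface) {x v : E3} : v ∈ Srf.tangent x ↔ ⟪Srf.n x, v⟫ = 0 :=
  Submodule.mem_orthogonal_singleton_iff_inner_right

lemma SmoothSurface.inner_n_grad (Srf : SmoothSurface) (w : E3 → ℝ) (x : E3) :
    ⟪Srf.n x, Srf.grad w x⟫ = 0 := Srf.mem_tangent.1 (tGrad_mem _ _ _ _)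

namespace Tube
variable {Srf : SmoothSurface} (Tb : Tube Srf)

lemma infDist_eq {x : E3} (hx : x ∈ Tb.N) : infDist x Srf.S = |Tb.q x| := by
  rw [Tb.abs_q hx]
  apply le_antisymm (infDist_le_dist_of_mem (Tb.a_mem x hx))
  exact (le_infDist Srf.nonempty).2 fun y hy => Tb.a_nearest x hx y hy

lemma grad_inner {w : E3 → ℝ} {y : E3} (hy : y ∈ Srf.S)
    (hd : DifferentiableAt ℝ (fun x => w (Tb.a x)) y) (v : E3) :
    ⟪Srf.grad w y, v⟫ = fderiv ℝ (fun x => w (Tb.a x)) y v := by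
  have h1 : HasFDerivWithinAt w (fderiv ℝ (fun x => w (Tb.a x)) y) Srf.S y :=
    (hd.hasFDerivAt.hasFDerivWithinAt).congr (fun x hx => by simp [Tb.a_self hx]) (by simp [Tb.a_self hy])
  have h2 : HasFDerivWithinAt w (fderivWithin ℝ w Srf.S y) Srf.S y :=
    h1.differentiableWithinAt.hasFDerivWithinAt
  have h3 : HasFDerivWithinAt w (fderivWithin ℝ w Srf.S y) Srf.S (Tb.a y) := by
    rwa [Tb.a_self hy]
  have h4 : HasFDerivAt (fun x => w (Tb.a x)) ((fderivWithin ℝ w Srf.S y).comp (fderiv ℝ Tb.a y)) y := by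
    have := h3.comp (t := Srf.S) y ((Tb.a_diff (Tb.S_sub hy)).hasFDerivAt.hasFDerivWithinAt (s := Tb.N))
      (fun x hx => Tb.a_mem x hx)
    exact this.hasFDerivAt (Tb.N_open.mem_nhds (Tb.S_sub hy))
  rw [h4.fderiv]
  simp only [ContinuousLinearMap.coe_comp, Function.comp_apply]
  rw [Tb.da_S hy]
  have h5 : v - ⟪Srf.n y, v⟫ • Srf.n y ∈ Srf.tangent y := by
    rw [Srf.mem_tangent, inner_sub_right, inner_smul_right, real_inner_self_eq_norm_sq, Srf.n_unit y hy]
    ring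
  rw [← tGrad_inner _ _ _ _ h5]
  change _ = ⟪Srf.grad w y, _⟫
  have h6 := Srf.inner_n_grad w y
  rw [real_inner_comm] at h6
  rw [inner_sub_right, inner_smul_right, h6]
  simp

lemma grad_eq {w : E3 → ℝ} {y : E3} (hy : y ∈ Srf.S)
    (hd : DifferentiableAt ℝ (fun x => w (Tb.a x)) y) :
    Srf.grad w y = gradient (fun x => w (Tb.a x)) y := by
  refine ext_inner_right ℝ fun v => ?_
  rw [Tb.grad_inner hy hd]
  simp [gradient]

end Tube

namespace Geo
variable {Srf : SmoothSurface} (G : Geo Srf)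

lemma thick_sub : thickening G.δ Srf.S ⊆ G.N := (thickening_subset_cthickening _ _).trans G.K_sub

lemma S_thick {r : ℝ} (hr : 0 < r) : Srf.S ⊆ thickening r Srf.S := self_subset_thickening hr _

lemma mem_thick {x : E3} {r : ℝ} (hx : x ∈ G.N) : x ∈ thickening r Srf.S ↔ |G.q x| < r := by
  rw [mem_thickening_iff_infDist_lt Srf.nonempty, G.infDist_eq hx]

lemma eq_fiber {x : E3} (hx : x ∈ G.N) : x = G.a x + G.q x • Srf.n (G.a x) := by
  have := G.sub_a hx
  rw [Tube.nu] at this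
  rw [← this]; abel

lemma fiber_mem {y : E3} (hy : y ∈ Srf.S) {s : ℝ} (hs : |s| ≤ G.δ) : y + s • Srf.n y ∈ G.N := by
  apply G.K_sub (Tube.ball_sub hy _)
  rw [mem_closedBall, dist_eq_norm, add_sub_cancel_left, norm_smul, Srf.n_unit y hy, mul_one]
  exact hs

lemma fiber_q {y : E3} (hy : y ∈ Srf.S) {s : ℝ} (hs : |s| ≤ G.δ) : G.q (y + s • Srf.n y) = s := by
  rw [Tube.q, Tube.nu, G.fiber y hy s hs, add_sub_cancel_left, inner_smul_left,
    real_inner_self_eq_norm_sq, Srf.n_unit y hy]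
  simp

lemma a_line {x : E3} (hx : x ∈ thickening G.δ Srf.S) :
    ∀ᶠ s in nhds (0:ℝ), G.a (x + s • G.nu x) = G.a x := by
  have hxN := G.thick_sub hx
  have hq := (G.mem_thick hxN).1 hx
  have hc : Continuous fun s : ℝ => |G.q x + s| := by fun_prop
  have := hc.tendsto 0
  simp only [add_zero] at this
  filter_upwards [this.eventually (gt_mem_nhds hq)] with s hs
  have e : x + s • G.nu x = G.a x + (G.q x + s) • Srf.n (G.a x) := by
    have := G.eq_fiber hxN
    calc x + s • G.nu x = (G.a x + G.q x • Srf.n (G.a x)) + s • Srf.n (G.a x) := by rw [← this]; rfl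
      _ = _ := by module
  rw [e, G.fiber _ (G.a_mem x hxN) _ hs.le]

/-- functions of `a` are constant along normals -/
lemma fderiv_nu {H : Type*} [NormedAddCommGroup H] [NormedSpace ℝ H] {w : E3 → H} {x : E3}
    (hx : x ∈ thickening G.δ Srf.S) (hd : DifferentiableAt ℝ (fun x => w (G.a x)) x) :
    fderiv ℝ (fun x => w (G.a x)) x (G.nu x) = 0 := by
  have h0 : HasDerivAt (fun s : ℝ => x + s • G.nu x) (G.nu x) 0 := by
    simpa using ((hasDerivAt_id (0:ℝ)).smul_const (G.nu x)).const_add x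
  have h1 : HasFDerivAt (fun x => w (G.a x)) (fderiv ℝ (fun x => w (G.a x)) x) (x + (0:ℝ) • G.nu x) := by
    simpa using hd.hasFDerivAt
  have h2 := h1.comp_hasDerivAt (0:ℝ) h0
  have h3 : ((fun x => w (G.a x)) ∘ fun s : ℝ => x + s • G.nu x) =ᶠ[nhds 0] fun _ => w (G.a x) := by
    filter_upwards [G.a_line hx] with s hs
    simp [hs]
  exact h2.unique ((hasDerivAt_const (0:ℝ) _).congr_of_eventuallyEq h3)

lemma da_nu {x : E3} (hx : x ∈ thickening G.δ Srf.S) : fderiv ℝ G.a x (G.nu x) = 0 :=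
  G.fderiv_nu (w := id) hx (G.a_diff (G.thick_sub hx))

lemma dnu_nu {x : E3} (hx : x ∈ thickening G.δ Srf.S) : fderiv ℝ G.nu x (G.nu x) = 0 :=
  G.fderiv_nu (w := Srf.n) hx (G.nu_diff (G.thick_sub hx))

end Geo
end

open MeasureTheory Metric
open scoped RealInnerProductSpace ENNReal NNReal

noncomputable section

abbrev E2 : Type := EuclideanSpace ℝ (Fin 2)

instance haarE3 : (μH[3] : Measure E3).IsAddHaarMeasure := by
  have h := isAddHaarMeasure_hausdorffMeasure (E := E3)
  simpa using h

instance haarE2 : (μH[2] : Measure E2).IsAddHaarMeasure := by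
  have h := isAddHaarMeasure_hausdorffMeasure (E := E2)
  simpa using h

/-- the unit ball in `E2 × ℝ` with Euclidean norm -/
def ball23 : Set (E2 × ℝ) := {z | ‖z.1‖ ^ 2 + z.2 ^ 2 < 1}

/-- coarea constant -/
def kap : ℝ≥0∞ := (μH[3] : Measure E3) (ball 0 1) / ((μH[2] : Measure E2).prod (volume : Measure ℝ)) ball23

lemma isOpen_ball23 : IsOpen ball23 := by
  apply isOpen_lt <;> fun_prop

lemma meas_ball23_ne_zero : ((μH[2] : Measure E2).prod (volume : Measure ℝ)) ball23 ≠ 0 :=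
  (isOpen_ball23.measure_pos _ ⟨(0, 0), by simp [ball23]⟩).ne'

lemma meas_ball23_ne_top : ((μH[2] : Measure E2).prod (volume : Measure ℝ)) ball23 ≠ ∞ := by
  have : ball23 ⊆ (closedBall (0:E2) 1) ×ˢ (Set.Icc (-1:ℝ) 1) := by
    rintro ⟨p, s⟩ h
    simp only [ball23, Set.mem_setOf_eq] at h
    have h1 : ‖p‖ ^ 2 ≤ 1 ^ 2 := by nlinarith [sq_nonneg s]
    have h2 : s ^ 2 ≤ 1 ^ 2 := by nlinarith [sq_nonneg ‖p‖]
    refine ⟨by simpa using (pow_le_pow_iff_left₀ (norm_nonneg _) zero_le_one two_ne_zero).1 h1,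
      abs_le.1 (by simpa using sq_le_sq.1 h2)⟩
  refine ((measure_mono this).trans_lt ?_).ne
  rw [Measure.prod_prod]
  exact ENNReal.mul_lt_top (isCompact_closedBall _ _).measure_lt_top (isCompact_Icc).measure_lt_top

lemma kap_ne_zero : kap ≠ 0 := by
  rw [kap]
  exact ENNReal.div_ne_zero.2 ⟨(measure_ball_pos _ _ one_pos).ne', meas_ball23_ne_top⟩

lemma kap_ne_top : kap ≠ ∞ := by
  rw [kap]
  exact ENNReal.div_ne_top measure_ball_lt_top.ne meas_ball23_ne_zero

lemma exists_frame {n : E3} (hn : ‖n‖ = 1) : ∃ (L : E2 →ₗᵢ[ℝ] E3),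
    (∀ v, ⟪n, v⟫ = 0 ↔ v ∈ Set.range L) := by
  have horth : Orthonormal ℝ (({2} : Set (Fin 3)).domRestrict (fun _ : Fin 3 => n)) := by
    constructor
    · intro i; exact hn
    · intro i j hij; exact absurd (Subsingleton.elim i j) hij
  obtain ⟨b, hb⟩ := Orthonormal.exists_orthonormalBasis_extension_of_card_eq (ι := Fin 3) (𝕜 := ℝ)
    (E := E3) (by simp) horth
  have hb2 : b 2 = n := by simpa using hb 2 rfl
  have h00 : ⟪b 0, b 0⟫ = 1 := by simp
  have h01 : ⟪b 0, b 1⟫ = 0 := b.orthonormal.2 (by decide)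
  have h10 : ⟪b 1, b 0⟫ = 0 := b.orthonormal.2 (by decide)
  have h11 : ⟪b 1, b 1⟫ = 1 := by simp
  have h20 : ⟪b 2, b 0⟫ = 0 := b.orthonormal.2 (by decide)
  have h21 : ⟪b 2, b 1⟫ = 0 := b.orthonormal.2 (by decide)
  let l : E2 →ₗ[ℝ] E3 :=
    { toFun := fun p => p 0 • b 0 + p 1 • b 1
      map_add' := by intro p p'; simp; module
      map_smul' := by intro c p; simp; module }
  refine ⟨⟨l, ?_⟩, ?_⟩
  · intro p
    have h1 : ‖l p‖ ^ 2 = ‖p‖ ^ 2 := by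
      rw [← real_inner_self_eq_norm_sq, EuclideanSpace.norm_sq_eq]
      change ⟪p 0 • b 0 + p 1 • b 1, p 0 • b 0 + p 1 • b 1⟫ = _
      simp only [inner_add_left, inner_add_right, inner_smul_left, inner_smul_right, h00, h01, h10, h11]
      simp
      ring
    exact (pow_left_inj₀ (norm_nonneg _) (norm_nonneg _) two_ne_zero).1 h1
  · intro v
    constructor
    · intro hv
      refine ⟨!₂[⟪b 0, v⟫, ⟪b 1, v⟫], ?_⟩
      have := b.sum_repr' v
      rw [Fin.sum_univ_three, hb2, hv, zero_smul, add_zero] at this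
      exact this
    · rintro ⟨p, rfl⟩
      change ⟪n, p 0 • b 0 + p 1 • b 1⟫ = 0
      rw [← hb2, inner_add_right, inner_smul_right, inner_smul_right, h20, h21]; simp

/-- cylinder formula -/
lemma cyl_measure {n : E3} (hn : ‖n‖ = 1) {F : Set E3} (hF : ∀ v ∈ F, ⟪n, v⟫ = 0) {δ : ℝ} (hδ : 0 < δ) :
    (μH[3] : Measure E3) {z | ∃ p ∈ F, ∃ s : ℝ, |s| < δ ∧ z = p + s • n} =
      kap * ENNReal.ofReal (2 * δ) * μH[2] F := by
  obtain ⟨L, hL⟩ := exists_frame hn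
  have hLn : ∀ p, ⟪n, L p⟫ = 0 := fun p => (hL _).2 ⟨p, rfl⟩
  let l : (E2 × ℝ) →ₗ[ℝ] E3 :=
    { toFun := fun z => L z.1 + z.2 • n
      map_add' := by intro p p'; simp; module
      map_smul' := by intro c p; simp [mul_smul] }
  have hnorm : ∀ z, ‖l z‖ ^ 2 = ‖z.1‖ ^ 2 + z.2 ^ 2 := by
    intro z
    change ‖L z.1 + z.2 • n‖ ^ 2 = _
    have : ⟪L z.1, n⟫ = 0 := by rw [real_inner_comm]; exact hLn _
    rw [norm_add_sq_real, inner_smul_right, this, norm_smul, hn, L.norm_map]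
    simp
  have hinj : Function.Injective l := by
    rw [← LinearMap.ker_eq_bot, LinearMap.ker_eq_bot']
    intro z hz
    have := hnorm z
    rw [hz] at this
    simp only [norm_zero] at this
    have h1 : ‖z.1‖ ^ 2 = 0 := by nlinarith [sq_nonneg ‖z.1‖, sq_nonneg z.2]
    have h2 : z.2 ^ 2 = 0 := by nlinarith [sq_nonneg ‖z.1‖, sq_nonneg z.2]
    ext1
    · simpa using h1
    · simpa using h2
  let e : (E2 × ℝ) ≃L[ℝ] E3 := (LinearMap.linearEquivOfInjective l hinj (by simp)).toContinuousLinearEquiv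
  have he : ∀ z, e z = L z.1 + z.2 • n := fun z => rfl
  have henorm : ∀ z, ‖e z‖ ^ 2 = ‖z.1‖ ^ 2 + z.2 ^ 2 := hnorm
  let M := Measure.map e.symm (μH[3] : Measure E3)
  haveI : M.IsAddHaarMeasure := e.symm.isAddHaarMeasure_map _
  have hM : ∀ A, M A = μH[3] (e '' A) := by
    intro A
    have := (e.symm.toHomeomorph.toMeasurableEquiv).map_apply (μ := (μH[3] : Measure E3)) A
    change M A = _ at this
    rw [this]
    congr 1
    ext z
    constructor
    · intro h; exact ⟨e.symm z, h, by simp⟩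
    · rintro ⟨w, hw, rfl⟩
      change e.symm (e w) ∈ A
      simpa using hw
  obtain ⟨c, hc⟩ : ∃ c : ℝ≥0∞, M = c • ((μH[2] : Measure E2).prod (volume : Measure ℝ)) :=
    ⟨_, Measure.isAddLeftInvariant_eq_smul M ((μH[2] : Measure E2).prod (volume : Measure ℝ))⟩
  have hck : c = kap := by
    have h1 : M ball23 = μH[3] (ball (0:E3) 1) := by
      rw [hM]
      congr 1
      ext z
      constructor
      · rintro ⟨w, hw, rfl⟩
        have : ‖e w‖ ^ 2 < 1 := by rw [henorm]; exact hw
        rw [mem_ball_zero_iff]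
        nlinarith [norm_nonneg (e w)]
      · intro hz
        rw [mem_ball_zero_iff] at hz
        refine ⟨e.symm z, ?_, by simp⟩
        have := henorm (e.symm z)
        simp only [ContinuousLinearEquiv.apply_symm_apply] at this
        simp only [ball23, Set.mem_setOf_eq, ← this]
        nlinarith [norm_nonneg z]
    rw [hc, Measure.smul_apply, smul_eq_mul] at h1
    rw [kap, ENNReal.eq_div_iff meas_ball23_ne_zero meas_ball23_ne_top, ← h1, mul_comm]
  have h2 := hM ((L ⁻¹' F) ×ˢ Set.Ioo (-δ) δ)
  rw [hc, Measure.smul_apply, smul_eq_mul, Measure.prod_prod, Real.volume_Ioo, hck] at h2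
  have h3 : (μH[2] : Measure E2) (L ⁻¹' F) = μH[2] F := by
    rw [← L.isometry.hausdorffMeasure_image (Or.inl (by norm_num)), Set.image_preimage_eq_of_subset]
    intro v hv
    exact (hL v).1 (hF v hv)
  have h4 : {z | ∃ p ∈ F, ∃ s : ℝ, |s| < δ ∧ z = p + s • n} = e '' ((L ⁻¹' F) ×ˢ Set.Ioo (-δ) δ) := by
    ext z
    constructor
    · rintro ⟨p, hp, s, hs, rfl⟩
      obtain ⟨p', rfl⟩ := (hL p).1 (hF p hp)
      exact ⟨(p', s), ⟨hp, abs_lt.1 hs⟩, he _⟩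
    · rintro ⟨⟨p, s⟩, ⟨hp, hs⟩, rfl⟩
      exact ⟨L p, hp, s, abs_lt.2 hs, he _⟩
  rw [h4, ← h2, h3]
  have : δ - -δ = 2 * δ := by ring
  rw [this]
  ring

end

open MeasureTheory Metric
open scoped RealInnerProductSpace ENNReal NNReal

noncomputable section

lemma hausdorff_le_of_anti {X Y : Type*} [EMetricSpace X] [MeasurableSpace X] [BorelSpace X]
    [EMetricSpace Y] [MeasurableSpace Y] [BorelSpace Y]
    {f : X → Y} {s : Set X} {K : ℝ≥0} {d : ℝ} (hd : 0 ≤ d)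
    (h : ∀ x ∈ s, ∀ y ∈ s, edist x y ≤ K * edist (f x) (f y)) :
    μH[d] s ≤ (K : ℝ≥0∞) ^ d * μH[d] (f '' s) := by
  have h1 : AntilipschitzWith K (fun x : s => f x) := fun x y => h x x.2 y y.2
  have h2 := h1.le_hausdorffMeasure_image hd Set.univ
  have h3 : (fun x : s => f x) '' Set.univ = f '' s := by
    ext; simp
  have h4 : μH[d] (Set.univ : Set s) = μH[d] s := by
    rw [← (isometry_subtype_coe (s := s)).hausdorffMeasure_image (Or.inl hd)]
    simp
  rwa [h3, h4] at h2

/-- locally comparable measures are comparable -/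
lemma measure_le_of_local {ρ ν : Measure E3} {ε : ℝ} (hε : 0 < ε)
    (h : ∀ E, MeasurableSet E → (∃ z, E ⊆ closedBall z ε) → ρ E ≤ ν E) : ρ ≤ ν := by
  rw [Measure.le_iff]
  intro E hE
  let u := TopologicalSpace.denseSeq E3
  let B : ℕ → Set E3 := fun i => closedBall (u i) ε
  have hB : ∀ i, MeasurableSet (disjointed B i) := fun i =>
    MeasurableSet.disjointed (fun i => isClosed_closedBall.measurableSet) i
  have hU : ⋃ i, disjointed B i = Set.univ := by
    rw [iUnion_disjointed, Set.eq_univ_iff_forall]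
    intro x
    obtain ⟨i, hi⟩ := (TopologicalSpace.denseRange_denseSeq E3).exists_dist_lt x hε
    exact Set.mem_iUnion.2 ⟨i, by simpa [B, u] using hi.le⟩
  have hd : Pairwise (Function.onFun Disjoint fun i => E ∩ disjointed B i) := fun i j hij =>
    ((disjoint_disjointed B) hij).mono Set.inter_subset_right Set.inter_subset_right
  have hs : E = ⋃ i, E ∩ disjointed B i := by rw [← Set.inter_iUnion, hU, Set.inter_univ]
  rw [hs, measure_iUnion hd (fun i => hE.inter (hB i)), measure_iUnion hd (fun i => hE.inter (hB i))]
  exact ENNReal.tsum_le_tsum fun i => h _ (hE.inter (hB i))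
    ⟨u i, Set.inter_subset_right.trans (disjointed_subset B i)⟩

/-- comparison of integrals for comparable measures -/
lemma integral_compare {X : Type*} [MeasurableSpace X] {ρ ν : Measure X} {η : ℝ} (hη : 0 ≤ η)
    (h1 : ρ ≤ ENNReal.ofReal (1 + η) • ν) (h2 : ν ≤ ENNReal.ofReal (1 + η) • ρ) {g : X → ℝ}
    (hg : Integrable g ν) : Integrable g ρ ∧ |∫ x, g x ∂ρ - ∫ x, g x ∂ν| ≤ η * ∫ x, |g x| ∂ν := by
  have hintg : ∀ f : X → ℝ, Integrable f ν → Integrable f ρ := fun f hf =>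
    (hf.smul_measure ENNReal.ofReal_ne_top).mono_measure h1
  have hpos : ∀ f : X → ℝ, Integrable f ν → (∀ x, 0 ≤ f x) → |∫ x, f x ∂ρ - ∫ x, f x ∂ν| ≤ η * ∫ x, f x ∂ν := by
    intro f hf h0
    have hfρ := hintg f hf
    have a1 : ∫ x, f x ∂ρ ≤ (1 + η) * ∫ x, f x ∂ν := by
      have := integral_mono_measure h1 (Filter.Eventually.of_forall h0) (hf.smul_measure ENNReal.ofReal_ne_top)
      rw [integral_smul_measure, ENNReal.toReal_ofReal (by linarith)] at this
      exact this
    have a2 : ∫ x, f x ∂ν ≤ (1 + η) * ∫ x, f x ∂ρ := by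
      have := integral_mono_measure h2 (Filter.Eventually.of_forall h0) (hfρ.smul_measure ENNReal.ofReal_ne_top)
      rw [integral_smul_measure, ENNReal.toReal_ofReal (by linarith)] at this
      exact this
    have b1 : 0 ≤ ∫ x, f x ∂ρ := integral_nonneg h0
    have b2 : 0 ≤ ∫ x, f x ∂ν := integral_nonneg h0
    rw [abs_le]
    constructor
    · by_contra hcon
      push Not at hcon
      have c1 : ∫ x, f x ∂ρ < ∫ x, f x ∂ν - η * ∫ x, f x ∂ν := by linarith
      have c2 : (1 + η) * ∫ x, f x ∂ρ < (1 + η) * (∫ x, f x ∂ν - η * ∫ x, f x ∂ν) :=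
        mul_lt_mul_of_pos_left c1 (by linarith)
      nlinarith [mul_nonneg (mul_nonneg hη hη) b2]
    · linarith
  refine ⟨hintg g hg, ?_⟩
  have p1 := hpos (fun x => max (g x) 0) hg.pos_part (fun x => le_max_right _ _)
  have p2 := hpos (fun x => max (-g x) 0) hg.neg_part (fun x => le_max_right _ _)
  have e : ∀ x, g x = max (g x) 0 - max (-g x) 0 := fun x => by
    rcases le_total (g x) 0 with h | h
    · rw [max_eq_right h, max_eq_left (by linarith)]; ring
    · rw [max_eq_left h, max_eq_right (by linarith)]; ring
  have e' : ∀ x, |g x| = max (g x) 0 + max (-g x) 0 := fun x => by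
    rcases le_total (g x) 0 with h | h
    · rw [max_eq_right h, max_eq_left (by linarith), abs_of_nonpos h]; ring
    · rw [max_eq_left h, max_eq_right (by linarith), abs_of_nonneg h]; ring
  have q1 : ∫ x, g x ∂ρ = ∫ x, max (g x) 0 ∂ρ - ∫ x, max (-g x) 0 ∂ρ := by
    rw [← integral_sub (hintg _ hg.pos_part) (hintg _ hg.neg_part)]
    exact integral_congr_ae (Filter.Eventually.of_forall e)
  have q2 : ∫ x, g x ∂ν = ∫ x, max (g x) 0 ∂ν - ∫ x, max (-g x) 0 ∂ν := by
    rw [← integral_sub hg.pos_part hg.neg_part]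
    exact integral_congr_ae (Filter.Eventually.of_forall e)
  have q3 : ∫ x, |g x| ∂ν = ∫ x, max (g x) 0 ∂ν + ∫ x, max (-g x) 0 ∂ν := by
    rw [← integral_add hg.pos_part hg.neg_part]
    exact integral_congr_ae (Filter.Eventually.of_forall e')
  rw [q1, q2, q3]
  have := abs_sub (∫ x, max (g x) 0 ∂ρ - ∫ x, max (g x) 0 ∂ν) (∫ x, max (-g x) 0 ∂ρ - ∫ x, max (-g x) 0 ∂ν)
  have e3 : ∫ x, max (g x) 0 ∂ρ - ∫ x, max (-g x) 0 ∂ρ - (∫ x, max (g x) 0 ∂ν - ∫ x, max (-g x) 0 ∂ν)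
    = (∫ x, max (g x) 0 ∂ρ - ∫ x, max (g x) 0 ∂ν) - (∫ x, max (-g x) 0 ∂ρ - ∫ x, max (-g x) 0 ∂ν) := by ring
  rw [e3]
  linarith

namespace Geo
variable {Srf : SmoothSurface} (G : Geo Srf)

/-- flattening map -/
def flat (z0 : E3) (x : E3) : E3 :=
  (G.a x - z0) - ⟪Srf.n z0, G.a x - z0⟫ • Srf.n z0 + G.q x • Srf.n z0

/-- tube over E -/
def tub (ε : ℝ) (E : Set E3) : Set E3 := thickening ε Srf.S ∩ G.a ⁻¹' E

lemma flat_S {z0 y : E3} (hy : y ∈ Srf.S) : G.flat z0 y = (y - z0) - ⟪Srf.n z0, y - z0⟫ • Srf.n z0 := by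
  rw [flat, G.a_self hy, G.q_S hy]; simp

lemma flat_lip : ∃ C ≥ 0, ∀ ε : ℝ, 0 < ε → 2 * ε ≤ G.δ → ∀ z0 ∈ Srf.S,
    ∀ x ∈ closedBall z0 (2 * ε), ∀ y ∈ closedBall z0 (2 * ε),
      ‖(G.flat z0 x - x) - (G.flat z0 y - y)‖ ≤ C * ε * ‖x - y‖ := by
  obtain ⟨C1, hC1, -, hd1, -, -⟩ := G.sm_a.bounds G.K_sub
  obtain ⟨C2, hC2, -, hd2, hl2, -⟩ := G.sm_nu.bounds G.K_sub
  refine ⟨2 * C2 * C1 + 2 * C2 + 2 * C2, by positivity, fun ε hε hεδ z0 hz0 x hx y hy => ?_⟩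
  have hbs : closedBall z0 (2 * ε) ⊆ closedBall z0 G.δ := closedBall_subset_closedBall hεδ
  have hK : ∀ w ∈ closedBall z0 (2 * ε), w ∈ cthickening G.δ Srf.S := fun w hw =>
    Tube.ball_sub hz0 (hbs hw)
  have hz0b : z0 ∈ closedBall z0 G.δ := mem_closedBall_self G.δ_pos.le
  have hdiff : ∀ w ∈ closedBall z0 (2 * ε), HasFDerivAt (fun x => G.flat z0 x - x)
      (fderiv ℝ G.a w - ((innerSL ℝ (Srf.n z0)).comp (fderiv ℝ G.a w)).smulRight (Srf.n z0)
        + (fderiv ℝ G.q w).smulRight (Srf.n z0) - ContinuousLinearMap.id ℝ E3) w := by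
    intro w hw
    have hwN := G.K_sub (hK w hw)
    have a1 := (G.a_diff hwN).hasFDerivAt
    have a2 := (G.sm_q.diff hwN).hasFDerivAt
    have a3 : HasFDerivAt (fun x => G.a x - z0) (fderiv ℝ G.a w) w := a1.sub_const z0
    have a4 : HasFDerivAt (fun x => ⟪Srf.n z0, G.a x - z0⟫)
        ((innerSL ℝ (Srf.n z0)).comp (fderiv ℝ G.a w)) w :=
      (innerSL ℝ (Srf.n z0)).hasFDerivAt.comp w a3
    exact ((a3.sub (a4.smul_const _)).add (a2.smul_const _)).sub (hasFDerivAt_id w)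
  have := (convex_closedBall z0 (2 * ε)).norm_image_sub_le_of_norm_hasFDerivWithin_le
    (fun w hw => (hdiff w hw).hasFDerivWithinAt) (C := (2 * C2 * C1 + 2 * C2 + 2 * C2) * ε) (fun w hw => ?_) hy hx
  · exact this
  · refine ContinuousLinearMap.opNorm_le_bound _ (by positivity) fun v => ?_
    have hwN := G.K_sub (hK w hw)
    have e : (fderiv ℝ G.a w - ((innerSL ℝ (Srf.n z0)).comp (fderiv ℝ G.a w)).smulRight (Srf.n z0)
        + (fderiv ℝ G.q w).smulRight (Srf.n z0) - ContinuousLinearMap.id ℝ E3) v =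
        - (⟪Srf.n z0 - G.nu w, fderiv ℝ G.a w v⟫ • Srf.n z0) + ⟪G.nu w, v⟫ • (Srf.n z0 - G.nu w)
          - G.q w • fderiv ℝ G.nu w v := by
      have h1 := G.inner_n_da hwN v
      have h2 := G.da hwN v
      have h3 := G.dq hwN v
      change ⟪G.nu w, _⟫ = 0 at h1
      simp only [_root_.sub_apply, _root_.add_apply, ContinuousLinearMap.smulRight_apply,
        ContinuousLinearMap.comp_apply, innerSL_apply_apply, ContinuousLinearMap.id_apply, h3, inner_sub_left, h1]
      have h4 : fderiv ℝ G.a w v - v = - ⟪G.nu w, v⟫ • G.nu w - G.q w • fderiv ℝ G.nu w v := by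
        rw [h2]; module
      calc _ = (fderiv ℝ G.a w v - v) - ⟪Srf.n z0, fderiv ℝ G.a w v⟫ • Srf.n z0 + ⟪G.nu w, v⟫ • Srf.n z0 := by abel
        _ = _ := by rw [h4]; module
    rw [e]
    have hn0 := Srf.n_unit z0 hz0
    have b1 : ‖Srf.n z0 - G.nu w‖ ≤ C2 * (2 * ε) := by
      have := hl2 z0 hz0 w (hbs hw) z0 hz0b
      rw [G.nu_S hz0] at this
      refine this.trans ?_
      gcongr
      rw [← dist_eq_norm, dist_comm]; exact hw
    have b2 : |G.q w| ≤ 2 * ε := by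
      rw [G.abs_q hwN]; exact (G.a_nearest w hwN z0 hz0).trans hw
    have b3 : ‖fderiv ℝ G.a w v‖ ≤ C1 * ‖v‖ :=
      (ContinuousLinearMap.le_opNorm _ _).trans (by gcongr; exact hd1 w (hK w hw))
    have b4 : ‖fderiv ℝ G.nu w v‖ ≤ C2 * ‖v‖ :=
      (ContinuousLinearMap.le_opNorm _ _).trans (by gcongr; exact hd2 w (hK w hw))
    have b5 : |⟪G.nu w, v⟫| ≤ ‖v‖ := by
      have := abs_real_inner_le_norm (G.nu w) v
      rwa [G.nu_unit hwN, one_mul] at this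
    calc _ ≤ ‖⟪Srf.n z0 - G.nu w, fderiv ℝ G.a w v⟫ • Srf.n z0‖ + ‖⟪G.nu w, v⟫ • (Srf.n z0 - G.nu w)‖
          + ‖G.q w • fderiv ℝ G.nu w v‖ := by
          refine (norm_sub_le _ _).trans ?_
          gcongr
          refine (norm_add_le _ _).trans ?_
          rw [norm_neg]
      _ ≤ (C2 * (2 * ε)) * (C1 * ‖v‖) + ‖v‖ * (C2 * (2 * ε)) + (2 * ε) * (C2 * ‖v‖) := by
          rw [norm_smul, norm_smul, norm_smul, hn0, mul_one, Real.norm_eq_abs, Real.norm_eq_abs, Real.norm_eq_abs]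
          gcongr
          exact (abs_real_inner_le_norm _ _).trans (by gcongr)
      _ = _ := by ring

lemma tub_sub {ε : ℝ} (hε : 0 < ε) (hεδ : 2 * ε ≤ G.δ) {z0 : E3} {E : Set E3}
    (hE : E ⊆ closedBall z0 ε) : G.tub ε E ⊆ closedBall z0 (2 * ε) := by
  rintro x ⟨hx, hxE⟩
  have hxN : x ∈ G.N := G.thick_sub (thickening_mono (by linarith) _ hx)
  have h1 := (G.mem_thick hxN).1 hx
  rw [G.abs_q hxN] at h1
  have h2 : dist (G.a x) z0 ≤ ε := hE hxE
  rw [mem_closedBall]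
  linarith [dist_triangle x (G.a x) z0]

lemma flat_tub {ε : ℝ} (hε : 0 < ε) (hεδ : 2 * ε ≤ G.δ) {z0 : E3} {E : Set E3} (hES : E ⊆ Srf.S) :
    G.flat z0 '' (G.tub ε E) = {z | ∃ p ∈ G.flat z0 '' E, ∃ s : ℝ, |s| < ε ∧ z = p + s • Srf.n z0} := by
  ext z
  constructor
  · rintro ⟨x, ⟨hx, hxE⟩, rfl⟩
    have hxN : x ∈ G.N := G.thick_sub (thickening_mono (by linarith) _ hx)
    refine ⟨G.flat z0 (G.a x), ⟨_, hxE, rfl⟩, G.q x, (G.mem_thick hxN).1 hx, ?_⟩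
    rw [G.flat_S (G.a_mem x hxN)]; rfl
  · rintro ⟨p, ⟨y, hy, rfl⟩, s, hs, rfl⟩
    have hsδ : |s| ≤ G.δ := by linarith
    have hyS := hES hy
    refine ⟨y + s • Srf.n y, ⟨?_, ?_⟩, ?_⟩
    · rw [G.mem_thick (G.fiber_mem hyS hsδ), G.fiber_q hyS hsδ]; exact hs
    · change G.a _ ∈ E
      rwa [G.fiber y hyS s hsδ]
    · rw [G.flat_S hyS, flat, G.fiber y hyS s hsδ, G.fiber_q hyS hsδ]

lemma tube_local : ∃ C ≥ 0, ∃ ε0 > 0, 2 * ε0 ≤ G.δ ∧ ∀ ε : ℝ, 0 < ε → ε ≤ ε0 → ∀ z0 ∈ Srf.S,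
    ∀ E ⊆ Srf.S, E ⊆ closedBall z0 ε →
      μH[3] (G.tub ε E) ≤ ENNReal.ofReal (1 + C * ε) * (kap * ENNReal.ofReal (2 * ε) * μH[2] E) ∧
      kap * ENNReal.ofReal (2 * ε) * μH[2] E ≤ ENNReal.ofReal (1 + C * ε) * μH[3] (G.tub ε E) := by
  obtain ⟨C, hC, hl⟩ := G.flat_lip
  have hδ := G.δ_pos
  refine ⟨62 * C, by positivity, min (G.δ / 2) (1 / (2 * (C + 1))), by positivity, ?_, ?_⟩
  · linarith [min_le_left (G.δ / 2) (1 / (2 * (C + 1)))]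
  intro ε hε hε0 z0 hz0 E hES hEz
  have hεδ : 2 * ε ≤ G.δ := by linarith [min_le_left (G.δ / 2) (1 / (2 * (C + 1)))]
  have hCε : C * ε ≤ 1 / 2 := by
    calc C * ε ≤ C * (1 / (2 * (C + 1))) := by gcongr; exact hε0.trans (min_le_right _ _)
      _ ≤ 1 / 2 := by rw [mul_one_div, div_le_iff₀ (by positivity)]; linarith
  have hCε0 : 0 ≤ C * ε := by positivity
  set M : ℝ := 1 + 2 * (C * ε) with hM
  have hM0 : 0 ≤ M := by positivity
  have hM1 : 1 ≤ M := by linarith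
  have hM2 : M ≤ 2 := by linarith
  have hM5 : M ^ 5 ≤ 1 + 62 * C * ε := by
    have e : M ^ 5 - 1 = (M - 1) * (1 + M + M ^ 2 + M ^ 3 + M ^ 4) := by ring
    have h2 : M ^ 2 ≤ 2 ^ 2 := by gcongr
    have h3 : M ^ 3 ≤ 2 ^ 3 := by gcongr
    have h4 : M ^ 4 ≤ 2 ^ 4 := by gcongr
    have : (M - 1) * (1 + M + M ^ 2 + M ^ 3 + M ^ 4) ≤ (M - 1) * 31 := by
      gcongr
      linarith
    have e2 : (M - 1) * 31 = 62 * C * ε := by rw [hM]; ring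
    linarith
  -- bilipschitz
  have hlip : LipschitzOnWith M.toNNReal (G.flat z0) (closedBall z0 (2 * ε)) := by
    rw [lipschitzOnWith_iff_dist_le_mul]
    intro x hx y hy
    have := hl ε hε hεδ z0 hz0 x hx y hy
    rw [Real.coe_toNNReal _ hM0, dist_eq_norm, dist_eq_norm]
    have e : G.flat z0 x - G.flat z0 y = ((G.flat z0 x - x) - (G.flat z0 y - y)) + (x - y) := by abel
    rw [e]
    refine (norm_add_le _ _).trans ?_
    rw [hM]
    nlinarith [norm_nonneg (x - y)]
  have hanti : ∀ x ∈ closedBall z0 (2 * ε), ∀ y ∈ closedBall z0 (2 * ε),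
      edist x y ≤ M.toNNReal * edist (G.flat z0 x) (G.flat z0 y) := by
    intro x hx y hy
    have := hl ε hε hεδ z0 hz0 x hx y hy
    have e : x - y = (G.flat z0 x - G.flat z0 y) - ((G.flat z0 x - x) - (G.flat z0 y - y)) := by abel
    have h1 : ‖x - y‖ ≤ ‖G.flat z0 x - G.flat z0 y‖ + C * ε * ‖x - y‖ := by
      calc ‖x - y‖ = ‖(G.flat z0 x - G.flat z0 y) - ((G.flat z0 x - x) - (G.flat z0 y - y))‖ := by rw [← e]
        _ ≤ _ := (norm_sub_le _ _).trans (by gcongr)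
    have h2 : dist x y ≤ M * dist (G.flat z0 x) (G.flat z0 y) := by
      rw [dist_eq_norm, dist_eq_norm, hM]
      have : (1 - C * ε) * ‖x - y‖ ≤ ‖G.flat z0 x - G.flat z0 y‖ := by linarith
      nlinarith [norm_nonneg (x - y), mul_nonneg hCε0 (norm_nonneg (x - y)),
        mul_nonneg (mul_nonneg hCε0 (norm_nonneg (x - y))) (sub_nonneg.2 hCε)]
    rw [edist_dist, edist_dist, ← ENNReal.ofReal_coe_nnreal, Real.coe_toNNReal _ hM0,
      ← ENNReal.ofReal_mul hM0]
    exact ENNReal.ofReal_le_ofReal h2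
  have hT := G.tub_sub hε hεδ hEz
  have hE2 : E ⊆ closedBall z0 (2 * ε) := hEz.trans (closedBall_subset_closedBall (by linarith))
  have m1 := (hlip.mono hT).hausdorffMeasure_image_le (show (0:ℝ) ≤ 3 by norm_num)
  have m2 := (hlip.mono hE2).hausdorffMeasure_image_le (show (0:ℝ) ≤ 2 by norm_num)
  have m3 := hausdorff_le_of_anti (d := 3) (by norm_num) (fun x hx y hy => hanti x (hT hx) y (hT hy))
  have m4 := hausdorff_le_of_anti (d := 2) (by norm_num) (fun x hx y hy => hanti x (hE2 hx) y (hE2 hy))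
  have hn0 := Srf.n_unit z0 hz0
  have hcyl := cyl_measure hn0 (F := G.flat z0 '' E) (by
    rintro _ ⟨y, hy, rfl⟩
    rw [G.flat_S (hES hy), inner_sub_right, inner_smul_right, real_inner_self_eq_norm_sq, hn0]
    ring) hε
  rw [← G.flat_tub hε hεδ hES] at hcyl
  rw [hcyl] at m1 m3
  have hMe : ((M.toNNReal : ℝ≥0∞)) ^ (3:ℝ) * (M.toNNReal : ℝ≥0∞) ^ (2:ℝ) ≤ ENNReal.ofReal (1 + 62 * C * ε) := by
    rw [← ENNReal.rpow_add _ _ (by simpa using hM0.lt_of_ne (by linarith)) (by simp)]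
    have : (3:ℝ) + 2 = (5:ℕ) := by norm_num
    rw [this, ENNReal.rpow_natCast]
    change (ENNReal.ofReal M) ^ 5 ≤ _
    rw [← ENNReal.ofReal_pow hM0]
    exact ENNReal.ofReal_le_ofReal hM5
  constructor
  · calc μH[3] (G.tub ε E) ≤ (M.toNNReal : ℝ≥0∞) ^ (3:ℝ) * (kap * ENNReal.ofReal (2 * ε) * μH[2] (G.flat z0 '' E)) := m3
      _ ≤ (M.toNNReal : ℝ≥0∞) ^ (3:ℝ) * (kap * ENNReal.ofReal (2 * ε) * ((M.toNNReal : ℝ≥0∞) ^ (2:ℝ) * μH[2] E)) := by gcongr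
      _ = ((M.toNNReal : ℝ≥0∞) ^ (3:ℝ) * (M.toNNReal : ℝ≥0∞) ^ (2:ℝ)) * (kap * ENNReal.ofReal (2 * ε) * μH[2] E) := by ring
      _ ≤ _ := by gcongr
  · calc kap * ENNReal.ofReal (2 * ε) * μH[2] E ≤ kap * ENNReal.ofReal (2 * ε) * ((M.toNNReal : ℝ≥0∞) ^ (2:ℝ) * μH[2] (G.flat z0 '' E)) := by gcongr
      _ = (M.toNNReal : ℝ≥0∞) ^ (2:ℝ) * (kap * ENNReal.ofReal (2 * ε) * μH[2] (G.flat z0 '' E)) := by ring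
      _ ≤ (M.toNNReal : ℝ≥0∞) ^ (2:ℝ) * ((M.toNNReal : ℝ≥0∞) ^ (3:ℝ) * μH[3] (G.tub ε E)) := by gcongr
      _ = ((M.toNNReal : ℝ≥0∞) ^ (3:ℝ) * (M.toNNReal : ℝ≥0∞) ^ (2:ℝ)) * μH[3] (G.tub ε E) := by ring
      _ ≤ _ := by gcongr

end Geo
end

open MeasureTheory Metric
open scoped RealInnerProductSpace ENNReal NNReal

noncomputable section

/-- surface measure -/
def SmoothSurface.mu (Srf : SmoothSurface) : Measure E3 := (μH[2] : Measure E3).restrict Srf.S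

namespace Geo
variable {Srf : SmoothSurface} (G : Geo Srf)

lemma a_aemeas {ε : ℝ} (hεδ : ε ≤ G.δ) :
    AEMeasurable G.a ((μH[3] : Measure E3).restrict (thickening ε Srf.S)) :=
  (G.sm_a.contOn ((thickening_mono hεδ _).trans G.thick_sub)).aemeasurable isOpen_thickening.measurableSet

/-- normalised tube measure pushed to the surface -/
def M (ε : ℝ) : Measure E3 := (kap * ENNReal.ofReal (2 * ε))⁻¹ •
  Measure.map G.a ((μH[3] : Measure E3).restrict (thickening ε Srf.S))

lemma k_ne {ε : ℝ} (hε : 0 < ε) : kap * ENNReal.ofReal (2 * ε) ≠ 0 ∧ kap * ENNReal.ofReal (2 * ε) ≠ ∞ :=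
  ⟨mul_ne_zero kap_ne_zero (by simpa using hε), ENNReal.mul_ne_top kap_ne_top ENNReal.ofReal_ne_top⟩

lemma M_apply {ε : ℝ} (hεδ : ε ≤ G.δ) {E : Set E3} (hE : MeasurableSet E) :
    G.M ε E = (kap * ENNReal.ofReal (2 * ε))⁻¹ * μH[3] (G.tub ε (Srf.S ∩ E)) := by
  rw [M, Measure.smul_apply, Measure.map_apply_of_aemeasurable (G.a_aemeas hεδ) hE,
    Measure.restrict_apply' isOpen_thickening.measurableSet, smul_eq_mul]
  congr 2
  ext x
  simp only [tub, Set.mem_inter_iff, Set.mem_preimage]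
  constructor
  · rintro ⟨h1, h2⟩
    exact ⟨h2, G.a_mem x (G.thick_sub (thickening_mono hεδ _ h2)), h1⟩
  · rintro ⟨h1, h2, h3⟩
    exact ⟨h3, h1⟩

lemma S_meas : MeasurableSet Srf.S := Srf.compact.isClosed.measurableSet

lemma M_compare : ∃ C ≥ 0, ∃ ε0 > 0, 2 * ε0 ≤ G.δ ∧ ∀ ε : ℝ, 0 < ε → ε ≤ ε0 →
    G.M ε ≤ ENNReal.ofReal (1 + C * ε) • Srf.mu ∧ Srf.mu ≤ ENNReal.ofReal (1 + C * ε) • G.M ε := by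
  obtain ⟨C, hC, ε0, hε0, hε0δ, h⟩ := G.tube_local
  refine ⟨C, hC, ε0, hε0, hε0δ, fun ε hε hεε => ?_⟩
  have hεδ : ε ≤ G.δ := by linarith
  obtain ⟨k0, kt⟩ := k_ne hε
  have key : ∀ z : E3, ∀ E : Set E3, MeasurableSet E → E ⊆ closedBall z (ε / 2) →
      μH[3] (G.tub ε (Srf.S ∩ E)) ≤ ENNReal.ofReal (1 + C * ε) * (kap * ENNReal.ofReal (2 * ε) * Srf.mu E) ∧
      kap * ENNReal.ofReal (2 * ε) * Srf.mu E ≤ ENNReal.ofReal (1 + C * ε) * μH[3] (G.tub ε (Srf.S ∩ E)) := by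
    intro z E hE hEz
    have e : Srf.mu E = μH[2] (Srf.S ∩ E) := by
      rw [SmoothSurface.mu, Measure.restrict_apply hE, Set.inter_comm]
    rw [e]
    rcases (Srf.S ∩ E).eq_empty_or_nonempty with h0 | ⟨z0, hz0S, hz0E⟩
    · rw [h0]; simp [tub]
    · refine h ε hε hεε z0 hz0S _ Set.inter_subset_left ?_
      rintro y ⟨_, hy⟩
      have h1 := hEz hy
      have h2 := hEz hz0E
      rw [mem_closedBall] at *
      calc dist y z0 ≤ dist y z + dist z0 z := dist_triangle_right _ _ _
        _ ≤ ε := by linarith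
  constructor
  · refine measure_le_of_local (half_pos hε) fun E hE ⟨z, hEz⟩ => ?_
    rw [G.M_apply hεδ hE, Measure.smul_apply, smul_eq_mul, ← ENNReal.div_eq_inv_mul,
      ENNReal.div_le_iff k0 kt]
    refine (key z E hE hEz).1.trans (le_of_eq ?_)
    ring
  · refine measure_le_of_local (half_pos hε) fun E hE ⟨z, hEz⟩ => ?_
    rw [Measure.smul_apply, G.M_apply hεδ hE, smul_eq_mul]
    have := (key z E hE hEz).2
    rw [mul_comm (kap * _) (Srf.mu E), ← ENNReal.le_div_iff_mul_le (Or.inl k0) (Or.inl kt)] at this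
    refine this.trans (le_of_eq ?_)
    rw [ENNReal.div_eq_inv_mul]; ring

lemma thick_lt_top {ε : ℝ} : (μH[3] : Measure E3) (thickening ε Srf.S) < ∞ :=
  (Srf.compact.isBounded.thickening).measure_lt_top

lemma mu_finite (G : Geo Srf) : IsFiniteMeasure Srf.mu := by
  obtain ⟨C, hC, ε0, hε0, hε0δ, h⟩ := G.M_compare
  refine ⟨lt_of_le_of_lt ((h ε0 hε0 le_rfl).2 _) ?_⟩
  rw [Measure.smul_apply, G.M_apply (by linarith) MeasurableSet.univ, smul_eq_mul]
  refine ENNReal.mul_lt_top ENNReal.ofReal_lt_top (ENNReal.mul_lt_top ?_ ?_)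
  · rw [ENNReal.inv_lt_top]; exact pos_iff_ne_zero.2 (k_ne hε0).1
  · exact (measure_mono Set.inter_subset_left).trans_lt thick_lt_top

/-- Ahlfors regularity -/
lemma ahlfors (G : Geo Srf) : ∃ c > 0, ∃ C > 0, ∃ ε0 > 0, ∀ ε : ℝ, 0 < ε → ε ≤ ε0 → ∀ z ∈ Srf.S,
    c * ε ^ 2 ≤ Srf.mu.real (closedBall z ε) ∧ Srf.mu.real (closedBall z ε) ≤ C * ε ^ 2 := by
  have := G.mu_finite
  obtain ⟨C, hC, ε0, hε0, hε0δ, h⟩ := G.tube_local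
  set v : ℝ := (μH[3] : Measure E3).real (ball 0 1) with hv
  have hv0 : 0 < v := by
    rw [hv, measureReal_def, ENNReal.toReal_pos_iff]
    exact ⟨Metric.measure_ball_pos _ _ one_pos, measure_ball_lt_top⟩
  set κ := kap.toReal with hκ
  have hκ0 : 0 < κ := ENNReal.toReal_pos kap_ne_zero kap_ne_top
  refine ⟨v / (16 * (1 + C * ε0) * κ), by positivity, (1 + C * ε0) * 4 * v / κ, by positivity, ε0, hε0, ?_⟩
  intro ε hε hεε z hz
  obtain ⟨h1, h2⟩ := h ε hε hεε z hz (Srf.S ∩ closedBall z ε) Set.inter_subset_left Set.inter_subset_right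
  have e : Srf.mu (closedBall z ε) = μH[2] (Srf.S ∩ closedBall z ε) := by
    rw [SmoothSurface.mu, Measure.restrict_apply measurableSet_closedBall, Set.inter_comm]
  rw [← e] at h1 h2
  set X := Srf.mu (closedBall z ε) with hX
  have hXt : X ≠ ∞ := measure_ne_top _ _
  have hT : μH[3] (G.tub ε (Srf.S ∩ closedBall z ε)) ≠ ∞ :=
    ((measure_mono Set.inter_subset_left).trans_lt thick_lt_top).ne
  have h1r := ENNReal.toReal_mono (by finiteness [(k_ne hε).2]) h1
  have h2r := ENNReal.toReal_mono (by finiteness) h2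
  have hC1 : 0 ≤ 1 + C * ε := by positivity
  rw [ENNReal.toReal_mul, ENNReal.toReal_mul, ENNReal.toReal_mul, ENNReal.toReal_ofReal hC1,
    ENNReal.toReal_ofReal (by positivity)] at h1r
  rw [ENNReal.toReal_mul, ENNReal.toReal_mul, ENNReal.toReal_mul, ENNReal.toReal_ofReal hC1,
    ENNReal.toReal_ofReal (by positivity)] at h2r
  have hfr : Module.finrank ℝ E3 = 3 := by simp
  have hup : (μH[3] (G.tub ε (Srf.S ∩ closedBall z ε))).toReal ≤ (2 * ε) ^ 3 * v := by
    have hs : G.tub ε (Srf.S ∩ closedBall z ε) ⊆ closedBall z (2 * ε) := by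
      rintro x ⟨hx, hxa⟩
      have hxN : x ∈ G.N := G.thick_sub (thickening_mono (by linarith) _ hx)
      have h3 : dist x (G.a x) < ε := by rw [← G.abs_q hxN]; exact (G.mem_thick hxN).1 hx
      have h4 : dist (G.a x) z ≤ ε := hxa.2
      rw [mem_closedBall]
      linarith [dist_triangle x (G.a x) z]
    have := measureReal_mono (μ := (μH[3] : Measure E3)) hs measure_closedBall_lt_top.ne
    rw [measureReal_def] at this
    refine this.trans (le_of_eq ?_)
    rw [measureReal_def, Measure.addHaar_closedBall _ _ (by positivity), ENNReal.toReal_mul,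
      ENNReal.toReal_ofReal (by positivity), hfr, hv, measureReal_def]
  have hlo : (ε / 2) ^ 3 * v ≤ (μH[3] (G.tub ε (Srf.S ∩ closedBall z ε))).toReal := by
    have hs : ball z (ε / 2) ⊆ G.tub ε (Srf.S ∩ closedBall z ε) := by
      intro x hx
      rw [mem_ball] at hx
      have hxt : x ∈ thickening ε Srf.S := mem_thickening_iff.2 ⟨z, hz, by linarith⟩
      have hxN : x ∈ G.N := G.thick_sub (thickening_mono (by linarith) _ hxt)
      refine ⟨hxt, G.a_mem x hxN, ?_⟩
      have := G.a_nearest x hxN z hz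
      rw [mem_closedBall]
      linarith [dist_triangle_left (G.a x) z x]
    have := measureReal_mono (μ := (μH[3] : Measure E3)) hs hT
    rw [measureReal_def, measureReal_def] at this
    refine le_trans (le_of_eq ?_) this
    rw [Measure.addHaar_ball _ _ (by positivity), ENNReal.toReal_mul,
      ENNReal.toReal_ofReal (by positivity), hfr, hv, measureReal_def]
  have hXr : Srf.mu.real (closedBall z ε) = X.toReal := rfl
  rw [hXr]
  have hX0 : 0 ≤ X.toReal := ENNReal.toReal_nonneg
  have hC2 : 1 + C * ε ≤ 1 + C * ε0 := by gcongr
  constructor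
  · rw [div_mul_eq_mul_div, div_le_iff₀ (by positivity)]
    have : (ε / 2) ^ 3 * v ≤ (1 + C * ε0) * (κ * (2 * ε) * X.toReal) :=
      hlo.trans (h1r.trans (by gcongr))
    have h5 : ε * (v * ε ^ 2) ≤ ε * (X.toReal * (16 * (1 + C * ε0) * κ)) := by nlinarith
    exact le_of_mul_le_mul_left h5 hε
  · rw [div_mul_eq_mul_div, le_div_iff₀ hκ0]
    have : κ * (2 * ε) * X.toReal ≤ (1 + C * ε0) * ((2 * ε) ^ 3 * v) := by
      refine h2r.trans ?_
      gcongr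
    have h5 : (2 * ε) * (X.toReal * κ) ≤ (2 * ε) * ((1 + C * ε0) * 4 * v * ε ^ 2) := by nlinarith
    exact le_of_mul_le_mul_left h5 (by positivity)

/-- passage from tube integrals to the surface -/
lemma tube_limit (G : Geo Srf) {g F : E3 → ℝ} (hg : Integrable g Srf.mu) {C' ε1 : ℝ} (hε1 : 0 < ε1)
    (hF : ∀ ε, 0 < ε → ε ≤ ε1 → IntegrableOn F (thickening ε Srf.S) μH[3] ∧
      ∫ x in thickening ε Srf.S, F x ∂μH[3] = 0 ∧
      ∀ᵐ x ∂(μH[3] : Measure E3).restrict (thickening ε Srf.S), |F x - g (G.a x)| ≤ C' * ε) :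
    ∫ x, g x ∂Srf.mu = 0 := by
  have := G.mu_finite
  obtain ⟨C, hC, ε0, hε0, hε0δ, h⟩ := G.M_compare
  have key : ∀ ε, 0 < ε → ε ≤ min ε0 ε1 →
      |∫ x, g x ∂Srf.mu| ≤ (|C'| * (1 + C * ε0) * Srf.mu.real Set.univ + C * ∫ x, |g x| ∂Srf.mu) * ε := by
    intro ε hε hεm
    have hεε0 := hεm.trans (min_le_left _ _)
    have hεδ : ε ≤ G.δ := by linarith
    obtain ⟨hi, h0, hb⟩ := hF ε hε (hεm.trans (min_le_right _ _))
    obtain ⟨hM1, hM2⟩ := h ε hε hεε0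
    have hη : 0 ≤ C * ε := by positivity
    obtain ⟨gi, gd⟩ := integral_compare hη hM1 hM2 hg
    obtain ⟨k0, kt⟩ := k_ne hε
    set k := kap * ENNReal.ofReal (2 * ε)
    set T := (μH[3] : Measure E3).restrict (thickening ε Srf.S) with hT
    have hTf : IsFiniteMeasure T := ⟨by rw [hT, Measure.restrict_apply_univ]; exact thick_lt_top⟩
    have gi' : Integrable g (Measure.map G.a T) := by
      rw [M, integrable_smul_measure (ENNReal.inv_ne_zero.2 kt) (ENNReal.inv_ne_top.2 k0)] at gi
      exact gi
    have gT : Integrable (fun x => g (G.a x)) T := (integrable_map_measure gi'.1 (G.a_aemeas hεδ)).1 gi'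
    have e1 : ∫ x, g x ∂(G.M ε) = k⁻¹.toReal * ∫ x, g (G.a x) ∂T := by
      rw [M, integral_smul_measure, integral_map (G.a_aemeas hεδ) gi'.1, smul_eq_mul]
    have e2 : |∫ x, g (G.a x) ∂T| ≤ |C'| * ε * T.real Set.univ := by
      have : ∫ x, g (G.a x) ∂T = - ∫ x, (F x - g (G.a x)) ∂T := by
        rw [integral_sub hi gT]
        have : ∫ x, F x ∂T = 0 := h0
        rw [this]; ring
      rw [this, abs_neg, ← Real.norm_eq_abs]
      refine norm_integral_le_of_norm_le_const ?_
      filter_upwards [hb] with x hx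
      rw [Real.norm_eq_abs]
      refine hx.trans ?_
      gcongr
      exact le_abs_self _
    have e3 : k⁻¹.toReal * T.real Set.univ ≤ (1 + C * ε0) * Srf.mu.real Set.univ := by
      have h3 : G.M ε Set.univ = k⁻¹ * T Set.univ := by
        rw [M, Measure.smul_apply, Measure.map_apply_of_aemeasurable (G.a_aemeas hεδ) MeasurableSet.univ]
        rfl
      have h4 := hM1 Set.univ
      rw [h3, Measure.smul_apply, smul_eq_mul] at h4
      have h5 := ENNReal.toReal_mono (by finiteness) h4
      rw [ENNReal.toReal_mul, ENNReal.toReal_mul, ENNReal.toReal_ofReal (by positivity)] at h5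
      rw [measureReal_def, measureReal_def]
      refine h5.trans ?_
      gcongr
    have e4 : |∫ x, g x ∂(G.M ε)| ≤ |C'| * ε * ((1 + C * ε0) * Srf.mu.real Set.univ) := by
      rw [e1, abs_mul, abs_of_nonneg ENNReal.toReal_nonneg]
      calc k⁻¹.toReal * |∫ x, g (G.a x) ∂T| ≤ k⁻¹.toReal * (|C'| * ε * T.real Set.univ) := by gcongr
        _ = |C'| * ε * (k⁻¹.toReal * T.real Set.univ) := by ring
        _ ≤ _ := by gcongr
    have e5 : |∫ x, g x ∂Srf.mu| ≤ |∫ x, g x ∂(G.M ε)| + |∫ x, g x ∂(G.M ε) - ∫ x, g x ∂Srf.mu| := by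
      have := abs_sub_abs_le_abs_sub (∫ x, g x ∂Srf.mu) (∫ x, g x ∂(G.M ε))
      rw [abs_sub_comm] at this
      linarith
    calc _ ≤ _ := e5
      _ ≤ |C'| * ε * ((1 + C * ε0) * Srf.mu.real Set.univ) + C * ε * ∫ x, |g x| ∂Srf.mu := by gcongr
      _ = _ := by ring
  set B := |C'| * (1 + C * ε0) * Srf.mu.real Set.univ + C * ∫ x, |g x| ∂Srf.mu with hB
  have hB0 : 0 ≤ B := by
    have : 0 ≤ ∫ x, |g x| ∂Srf.mu := integral_nonneg fun _ => abs_nonneg _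
    positivity
  have hm : 0 < min ε0 ε1 := lt_min hε0 hε1
  by_contra hne
  have hpos : 0 < |∫ x, g x ∂Srf.mu| := abs_pos.2 hne
  set I := |∫ x, g x ∂Srf.mu| with hI
  have h1 := key (min (min ε0 ε1) (I / (2 * (B + 1)))) (by positivity) (min_le_left _ _)
  have h2 : B * min (min ε0 ε1) (I / (2 * (B + 1))) ≤ B * (I / (2 * (B + 1))) := by
    gcongr; exact min_le_right _ _
  have h3 : B * (I / (2 * (B + 1))) ≤ I / 2 := by
    rw [mul_div_assoc', div_le_div_iff₀ (by positivity) two_pos]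
    nlinarith
  linarith

end Geo
end

open MeasureTheory Metric
open scoped RealInnerProductSpace ENNReal NNReal Topology

noncomputable section

/-- standard basis vector -/
def ei (i : Fin 3) : E3 := EuclideanSpace.single i 1

lemma norm_ei (i : Fin 3) : ‖ei i‖ = 1 := by simp [ei]

/-- partial derivative -/
def pd (i : Fin 3) (F : E3 → ℝ) (x : E3) : ℝ := fderiv ℝ F x (ei i)

/-- Laplacian -/
def lap (F : E3 → ℝ) (x : E3) : ℝ := ∑ i, pd i (pd i F) x

lemma measurable_pd (i : Fin 3) (F : E3 → ℝ) : Measurable (pd i F) := measurable_fderiv_apply_const ℝ F (ei i)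

lemma measurable_lap (F : E3 → ℝ) : Measurable (lap F) := by
  unfold lap; exact Finset.measurable_sum _ fun i _ => measurable_pd i _

lemma abs_pd_le (i : Fin 3) (F : E3 → ℝ) (x : E3) : |pd i F x| ≤ ‖fderiv ℝ F x‖ := by
  have := (fderiv ℝ F x).le_opNorm (ei i)
  rwa [norm_ei, mul_one] at this

lemma expand (v : E3) : v = ∑ i, v i • ei i := by
  ext j
  simp [ei, Fin.sum_univ_three]
  fin_cases j <;> simp

lemma inner_ei (v : E3) (i : Fin 3) : ⟪v, ei i⟫ = v i := by
  rw [ei, EuclideanSpace.inner_single_right]; simp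

lemma sum_inner_ei (v w : E3) : ∑ i, ⟪v, ei i⟫ * ⟪w, ei i⟫ = ⟪v, w⟫ := by
  simp_rw [inner_ei]
  rw [PiLp.inner_apply]
  refine Finset.sum_congr rfl fun i _ => ?_
  simp [mul_comm]

lemma lin_expand (L : E3 →L[ℝ] ℝ) (v : E3) : L v = ∑ i, v i * L (ei i) := by
  conv_lhs => rw [expand v]
  simp [map_sum]

lemma abs_coord_le (v : E3) (i : Fin 3) : |v i| ≤ ‖v‖ := by
  rw [← inner_ei]
  have := abs_real_inner_le_norm v (ei i)
  rwa [norm_ei, mul_one] at this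

lemma clm_norm_le (L : E3 →L[ℝ] ℝ) {C : ℝ} (hC : 0 ≤ C) (h : ∀ i, |L (ei i)| ≤ C) : ‖L‖ ≤ 3 * C := by
  refine L.opNorm_le_bound (by positivity) fun v => ?_
  rw [lin_expand]
  refine (Finset.abs_sum_le_sum_abs _ _).trans ?_
  calc ∑ i, |v i * L (ei i)| ≤ ∑ i : Fin 3, ‖v‖ * C := by
        refine Finset.sum_le_sum fun i _ => ?_
        rw [abs_mul]
        exact mul_le_mul (abs_coord_le v i) (h i) (abs_nonneg _) (norm_nonneg _)
    _ = 3 * C * ‖v‖ := by simp; ring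

namespace Tube
variable {Srf : SmoothSurface} (Tb : Tube Srf)
variable {Tb}

lemma Sm.add {H : Type*} [NormedAddCommGroup H] [NormedSpace ℝ H] {F F' : E3 → H} (h : Tb.Sm F) (h' : Tb.Sm F') : Tb.Sm (fun x => F x + F' x) :=
  fun x hx => (h x hx).add (h' x hx)
lemma Sm.sub {H : Type*} [NormedAddCommGroup H] [NormedSpace ℝ H] {F F' : E3 → H} (h : Tb.Sm F) (h' : Tb.Sm F') : Tb.Sm (fun x => F x - F' x) :=
  fun x hx => (h x hx).sub (h' x hx)
lemma Sm.mul {F F' : E3 → ℝ} (h : Tb.Sm F) (h' : Tb.Sm F') : Tb.Sm (fun x => F x * F' x) :=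
  fun x hx => (h x hx).mul (h' x hx)
lemma Sm.sum {ι : Type*} {s : Finset ι} {F : ι → E3 → ℝ} (h : ∀ i ∈ s, Tb.Sm (F i)) : Tb.Sm (fun x => ∑ i ∈ s, F i x) :=
  fun x hx => ContDiffAt.sum fun i hi => h i hi x hx
lemma Sm.pd {F : E3 → ℝ} (h : Tb.Sm F) (i : Fin 3) : Tb.Sm (pd i F) := h.dir (ei i)
lemma Sm.lap {F : E3 → ℝ} (h : Tb.Sm F) : Tb.Sm (lap F) := Sm.sum fun i _ => (h.pd i).pd i
lemma Sm.congr {F F' : E3 → ℝ} (h : Tb.Sm F) (e : ∀ x ∈ Tb.N, F' x = F x) : Tb.Sm F' :=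
  fun x hx => (h x hx).congr_of_eventuallyEq (by filter_upwards [Tb.N_open.mem_nhds hx] with y hy using e y hy)

lemma Sm.lip {H : Type*} [NormedAddCommGroup H] [NormedSpace ℝ H] {F : E3 → H} (h : Tb.Sm F) {K : Set E3}
    (hK : IsCompact K) (hKN : K ⊆ Tb.N) : ∃ L, LipschitzOnWith L F K := by
  refine LocallyLipschitzOn.exists_lipschitzOnWith_of_compact hK ?_
  intro x hx
  obtain ⟨L, t, ht, h'⟩ := ((h x (hKN hx)).of_le (by exact_mod_cast le_top) : ContDiffAt ℝ 1 F x).exists_lipschitzOnWith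
  exact ⟨L, t, mem_nhdsWithin_of_mem_nhds ht, h'⟩

end Tube

namespace Geo
variable {Srf : SmoothSurface} (G : Geo Srf)

/-- Lipschitz functions on the tube which are constant along normals -/
structure LipA (Φ : E3 → ℝ) : Prop where
  lip : ∃ L, LipschitzOnWith L Φ (cthickening G.δ Srf.S)
  inv : ∀ x ∈ thickening G.δ Srf.S, Φ x = Φ (G.a x)

/-- smooth functions on the tube which are constant along normals -/
structure SmA (W : E3 → ℝ) : Prop where
  sm : G.Sm W
  inv : ∀ x ∈ thickening G.δ Srf.S, W x = W (G.a x)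

variable {G}

lemma compact_K : IsCompact (cthickening G.δ Srf.S) := Srf.compact.cthickening

lemma SmA.lipA {W : E3 → ℝ} (h : G.SmA W) : G.LipA W := ⟨h.sm.lip compact_K G.K_sub, h.inv⟩

lemma lipA_of_lip {φ : E3 → ℝ} {L : ℝ≥0} (h : LipschitzOnWith L φ Srf.S) : G.LipA (fun x => φ (G.a x)) := by
  obtain ⟨L', hL'⟩ := G.sm_a.lip compact_K G.K_sub
  refine ⟨⟨L * L', h.comp hL' fun x hx => G.a_mem x (G.K_sub hx)⟩, fun x hx => ?_⟩
  simp only [G.a_a (G.thick_sub hx)]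

lemma smA_of_smooth {w : E3 → ℝ} (h : ∀ x ∈ Srf.S, ContDiffAt ℝ ((⊤ : ℕ∞) : WithTop ℕ∞) w x) : G.SmA (fun x => w (G.a x)) :=
  ⟨Tube.Sm.comp_a (Tb := G.toTube) h, fun x hx => by simp only [G.a_a (G.thick_sub hx)]⟩

lemma thick_nhds {x : E3} (hx : x ∈ thickening G.δ Srf.S) : thickening G.δ Srf.S ∈ 𝓝 x :=
  isOpen_thickening.mem_nhds hx

lemma a_thick {x : E3} (hx : x ∈ thickening G.δ Srf.S) : G.a x ∈ thickening G.δ Srf.S :=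
  S_thick G.δ_pos (G.a_mem x (G.thick_sub hx))

lemma inv_fderiv {H : Type*} [NormedAddCommGroup H] [NormedSpace ℝ H] {Φ : E3 → H}
    (h : ∀ x ∈ thickening G.δ Srf.S, Φ x = Φ (G.a x)) {x : E3} (hx : x ∈ thickening G.δ Srf.S)
    (hd : DifferentiableAt ℝ Φ (G.a x)) :
    HasFDerivAt Φ ((fderiv ℝ Φ (G.a x)).comp (fderiv ℝ G.a x)) x := by
  have h1 : HasFDerivAt (fun z => Φ (G.a z)) ((fderiv ℝ Φ (G.a x)).comp (fderiv ℝ G.a x)) x :=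
    hd.hasFDerivAt.comp x (G.a_diff (G.thick_sub hx)).hasFDerivAt
  refine h1.congr_of_eventuallyEq ?_
  filter_upwards [thick_nhds hx] with z hz using h z hz

lemma inv_diff {H : Type*} [NormedAddCommGroup H] [NormedSpace ℝ H] {Φ : E3 → H}
    (h : ∀ x ∈ thickening G.δ Srf.S, Φ x = Φ (G.a x)) {x : E3} (hx : x ∈ thickening G.δ Srf.S)
    (hd : DifferentiableAt ℝ Φ x) : DifferentiableAt ℝ Φ (G.a x) := by
  set s := G.q x
  have hxN := G.thick_sub hx
  have hs : |s| < G.δ := (G.mem_thick hxN).1 hx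
  have haS := G.a_mem x hxN
  have haN := G.S_sub haS
  let θ : E3 → E3 := fun y => G.a y + s • G.nu y
  have hθd : DifferentiableAt ℝ θ (G.a x) := (G.a_diff haN).add ((G.nu_diff haN).const_smul s)
  have hθx : θ (G.a x) = x := by
    change G.a (G.a x) + s • G.nu (G.a x) = x
    rw [G.a_self haS, G.nu_S haS]
    exact (G.eq_fiber hxN).symm
  have h1 : DifferentiableAt ℝ (fun y => Φ (θ y)) (G.a x) := by
    have hd' : DifferentiableAt ℝ Φ (θ (G.a x)) := by rw [hθx]; exact hd
    exact hd'.comp (G.a x) hθd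
  refine h1.congr_of_eventuallyEq ?_
  filter_upwards [thick_nhds (a_thick hx)] with y hy
  have hyN := G.thick_sub hy
  have hyS := G.a_mem y hyN
  have h2 : θ y ∈ thickening G.δ Srf.S := by
    have := G.fiber_q hyS hs.le
    change G.a y + s • Srf.n (G.a y) ∈ _
    rw [G.mem_thick (G.fiber_mem hyS hs.le)]
    rwa [this]
  rw [h _ h2, h y hy]
  congr 1
  exact (G.fiber _ hyS s hs.le).symm

lemma ae_of_ae_tube {ε : ℝ} {p : E3 → Prop} (hε : 0 < ε)
    (hp : MeasurableSet {y | p y})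
    (h : ∀ᵐ x ∂(μH[3] : Measure E3).restrict (thickening ε Srf.S), p (G.a x)) : ∀ᵐ y ∂Srf.mu, p y := by
  obtain ⟨C, hC, ε0, hε0, hε0δ, hM⟩ := G.M_compare
  have hε' : 0 < min ε ε0 := lt_min hε hε0
  have h2 := (hM _ hε' (min_le_right _ _)).2
  have h' : ∀ᵐ x ∂(μH[3] : Measure E3).restrict (thickening (min ε ε0) Srf.S), p (G.a x) :=
    ae_restrict_of_ae_restrict_of_subset (thickening_mono (min_le_left _ _) _) h
  rw [← ae_map_iff (G.a_aemeas (by linarith [min_le_right ε ε0])) hp] at h'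
  have h3 : Srf.mu ≪ Measure.map G.a ((μH[3] : Measure E3).restrict (thickening (min ε ε0) Srf.S)) :=
    (Measure.absolutelyContinuous_of_le h2).trans
      ((Measure.smul_absolutelyContinuous).trans Measure.smul_absolutelyContinuous)
  exact h3.ae_le h'

lemma ae_tube_of_ae (G : Geo Srf) : ∃ ε0 > 0, 2 * ε0 ≤ G.δ ∧ ∀ ε, 0 < ε → ε ≤ ε0 → ∀ p : E3 → Prop, (∀ᵐ y ∂Srf.mu, p y) →
    ∀ᵐ x ∂(μH[3] : Measure E3).restrict (thickening ε Srf.S), p (G.a x) := by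
  obtain ⟨C, hC, ε0, hε0, hε0δ, hM⟩ := G.M_compare
  refine ⟨ε0, hε0, hε0δ, fun ε hε hεε p hp => ?_⟩
  have h1 := (hM _ hε hεε).1
  obtain ⟨k0, kt⟩ := k_ne hε
  have h3 : Measure.map G.a ((μH[3] : Measure E3).restrict (thickening ε Srf.S)) ≪ Srf.mu := by
    have h4 : G.M ε ≪ Srf.mu := (Measure.absolutelyContinuous_of_le h1).trans Measure.smul_absolutelyContinuous
    exact (Measure.absolutelyContinuous_smul (ENNReal.inv_ne_zero.2 kt)).trans h4
  exact ae_of_ae_map (G.a_aemeas (by linarith)) (h3.ae_le hp)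

lemma LipA.extend {Φ : E3 → ℝ} (h : G.LipA Φ) : ∃ L, ∃ Ψ : E3 → ℝ, LipschitzWith L Ψ ∧
    Set.EqOn Φ Ψ (cthickening G.δ Srf.S) := by
  obtain ⟨L, hL⟩ := h.lip
  obtain ⟨Ψ, h1, h2⟩ := hL.extend_real
  exact ⟨L, Ψ, h1, h2⟩

lemma LipA.ae_diff_tube {Φ : E3 → ℝ} (h : G.LipA Φ) :
    ∀ᵐ x ∂(μH[3] : Measure E3).restrict (thickening G.δ Srf.S), DifferentiableAt ℝ Φ x := by
  obtain ⟨L, Ψ, h1, h2⟩ := h.extend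
  filter_upwards [ae_restrict_of_ae (h1.ae_differentiableAt (μ := (μH[3] : Measure E3))),
    ae_restrict_mem isOpen_thickening.measurableSet] with x hx hxT
  refine hx.congr_of_eventuallyEq ?_
  filter_upwards [thick_nhds hxT] with z hz using h2 (thickening_subset_cthickening _ _ hz)

lemma LipA.ae_diff {Φ : E3 → ℝ} (h : G.LipA Φ) : ∀ᵐ y ∂Srf.mu, DifferentiableAt ℝ Φ y := by
  refine ae_of_ae_tube (G := G) G.δ_pos (measurableSet_of_differentiableAt ℝ Φ) ?_
  filter_upwards [h.ae_diff_tube, ae_restrict_mem isOpen_thickening.measurableSet] with x hx hxT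
  exact inv_diff h.inv hxT hx

end Geo
end

open MeasureTheory Metric
open scoped RealInnerProductSpace ENNReal NNReal Topology

noncomputable section

/-- Green integrand -/
def Gr (Φ W : E3 → ℝ) (x : E3) : ℝ := ∑ i, pd i Φ x * pd i W x + Φ x * lap W x

namespace Geo
variable {Srf : SmoothSurface} {G : Geo Srf}

lemma indicator_smooth {F : E3 → ℝ} (hF : G.Sm F) {r : ℝ} (hr : r ≤ G.δ)
    (h0 : ∀ x ∈ G.N, x ∉ cthickening r Srf.S → F x = 0) :
    ContDiff ℝ ((⊤ : ℕ∞) : WithTop ℕ∞) ((cthickening r Srf.S).indicator F) ∧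
    HasCompactSupport ((cthickening r Srf.S).indicator F) := by
  constructor
  · rw [contDiff_iff_contDiffAt]
    intro x
    by_cases hx : x ∈ G.N
    · refine (hF x hx).congr_of_eventuallyEq ?_
      filter_upwards [G.N_open.mem_nhds hx] with y hy
      by_cases hy' : y ∈ cthickening r Srf.S
      · rw [Set.indicator_of_mem hy']
      · rw [Set.indicator_of_notMem hy', h0 y hy hy']
    · have hx' : x ∉ cthickening r Srf.S := fun h => hx (G.K_sub (cthickening_mono hr _ h))
      refine (contDiffAt_const (c := (0 : ℝ))).congr_of_eventuallyEq ?_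
      filter_upwards [isClosed_cthickening.isOpen_compl.mem_nhds hx'] with y hy
      exact Set.indicator_of_notMem hy _
  · exact HasCompactSupport.intro Srf.compact.cthickening fun x hx => Set.indicator_of_notMem hx _

lemma indicator_eq {F : E3 → ℝ} {r : ℝ} 
    (h0 : ∀ x ∈ G.N, x ∉ cthickening r Srf.S → F x = 0) {x : E3} (hx : x ∈ G.N) :
    (cthickening r Srf.S).indicator F x = F x := by
  by_cases hy' : x ∈ cthickening r Srf.S
  · rw [Set.indicator_of_mem hy']
  · rw [Set.indicator_of_notMem hy', h0 x hx hy']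

lemma SmA.fderiv_nu {W : E3 → ℝ} (h : G.SmA W) {x : E3} (hx : x ∈ thickening G.δ Srf.S) :
    fderiv ℝ W x (G.nu x) = 0 := by
  have hx' := inv_fderiv h.inv hx (h.sm.diff (G.S_sub (G.a_mem x (G.thick_sub hx))))
  rw [hx'.fderiv, ContinuousLinearMap.comp_apply, G.da_nu hx, map_zero]

lemma LipA.fderiv_le {Φ : E3 → ℝ} (h : G.LipA Φ) : ∃ L : ℝ≥0, ∀ x ∈ thickening G.δ Srf.S, ‖fderiv ℝ Φ x‖ ≤ L := by
  obtain ⟨L, hL⟩ := h.lip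
  exact ⟨L, fun x hx => norm_fderiv_le_of_lipschitzOn ℝ (thick_nhds hx) (hL.mono (thickening_subset_cthickening _ _))⟩

lemma LipA.bdd {Φ : E3 → ℝ} (h : G.LipA Φ) : ∃ C ≥ 0, ∀ x ∈ cthickening G.δ Srf.S, |Φ x| ≤ C := by
  obtain ⟨L, hL⟩ := h.lip
  obtain ⟨C, hC⟩ := compact_K.exists_bound_of_continuousOn (hL.continuousOn)
  exact ⟨max C 0, le_max_right _ _, fun x hx => (hC x hx).trans (le_max_left _ _)⟩

lemma LipA.contOn {Φ : E3 → ℝ} (h : G.LipA Φ) : ContinuousOn Φ (cthickening G.δ Srf.S) := by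
  obtain ⟨L, hL⟩ := h.lip
  exact hL.continuousOn

lemma LipA.aesm {Φ : E3 → ℝ} (h : G.LipA Φ) {ε : ℝ} (hε : ε ≤ G.δ) :
    AEStronglyMeasurable Φ ((μH[3] : Measure E3).restrict (thickening ε Srf.S)) :=
  (h.contOn.mono ((thickening_subset_cthickening _ _).trans (cthickening_mono hε _))).aestronglyMeasurable
    isOpen_thickening.measurableSet

lemma LipA.aesm_S {Φ : E3 → ℝ} (h : G.LipA Φ) : AEStronglyMeasurable Φ Srf.mu :=
  (h.contOn.mono (self_subset_cthickening _)).aestronglyMeasurable S_meas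

lemma S_sub_thick (G : Geo Srf) : Srf.S ⊆ thickening G.δ Srf.S := S_thick G.δ_pos

lemma gr_bdd {Φ W : E3 → ℝ} (hΦ : G.LipA Φ) (hW : G.SmA W) :
    ∃ C ≥ 0, ∀ x ∈ thickening G.δ Srf.S, |Gr Φ W x| ≤ C := by
  obtain ⟨L, hL⟩ := hΦ.fderiv_le
  obtain ⟨C, hC, hb⟩ := hΦ.bdd
  obtain ⟨C1, hC1, hb1⟩ := hW.sm.fderiv.bounds0 G.K_sub
  obtain ⟨C2, hC2, hb2⟩ := hW.sm.lap.bounds0 G.K_sub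
  refine ⟨3 * (L * C1) + C * C2, by positivity, fun x hx => ?_⟩
  have hx' := thickening_subset_cthickening _ _ hx
  unfold Gr
  refine (abs_add_le _ _).trans (add_le_add ?_ ?_)
  · refine (Finset.abs_sum_le_sum_abs _ _).trans ?_
    calc _ ≤ ∑ i : Fin 3, L * C1 := by
          refine Finset.sum_le_sum fun i _ => ?_
          rw [abs_mul]
          exact mul_le_mul ((abs_pd_le _ _ _).trans (hL x hx)) ((abs_pd_le _ _ _).trans (hb1 x hx')) (abs_nonneg _) L.2
      _ = _ := by simp
  · rw [abs_mul]; exact mul_le_mul (hb x hx') (hb2 x hx') (abs_nonneg _) hC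

lemma gr_int {Φ W : E3 → ℝ} (hΦ : G.LipA Φ) (hW : G.SmA W) {ε : ℝ} (hε : ε ≤ G.δ) :
    IntegrableOn (Gr Φ W) (thickening ε Srf.S) μH[3] := by
  obtain ⟨C, hC, hb⟩ := gr_bdd hΦ hW
  have : IsFiniteMeasure ((μH[3] : Measure E3).restrict (thickening ε Srf.S)) :=
    ⟨by rw [Measure.restrict_apply_univ]; exact thick_lt_top⟩
  refine Integrable.of_bound (C := C) ?_ ?_
  · unfold Gr
    refine AEStronglyMeasurable.add ?_ ?_
    · exact (Finset.measurable_sum _ fun i _ => (measurable_pd i Φ).mul (measurable_pd i W)).aestronglyMeasurable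
    · exact (hΦ.aesm hε).mul (measurable_lap W).aestronglyMeasurable
  · filter_upwards [ae_restrict_mem isOpen_thickening.measurableSet] with x hx
    exact hb x (thickening_mono hε _ hx)

lemma gr_int_S {Φ W : E3 → ℝ} (hΦ : G.LipA Φ) (hW : G.SmA W) : Integrable (Gr Φ W) Srf.mu := by
  have := G.mu_finite
  obtain ⟨C, hC, hb⟩ := gr_bdd hΦ hW
  refine Integrable.of_bound (C := C) ?_ ?_
  · unfold Gr
    refine AEStronglyMeasurable.add ?_ ?_
    · exact (Finset.measurable_sum _ fun i _ => (measurable_pd i Φ).mul (measurable_pd i W)).aestronglyMeasurable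
    · exact hΦ.aesm_S.mul (measurable_lap W).aestronglyMeasurable
  · filter_upwards [ae_restrict_mem S_meas] with x hx
    exact hb x (G.S_sub_thick hx)

lemma sm_bdd_int {F : E3 → ℝ} {ε : ℝ}
    (hm : AEStronglyMeasurable F ((μH[3] : Measure E3).restrict (thickening ε Srf.S))) {C : ℝ}
    (hb : ∀ x ∈ thickening ε Srf.S, |F x| ≤ C) : IntegrableOn F (thickening ε Srf.S) μH[3] := by
  have : IsFiniteMeasure ((μH[3] : Measure E3).restrict (thickening ε Srf.S)) :=
    ⟨by rw [Measure.restrict_apply_univ]; exact thick_lt_top⟩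
  refine Integrable.of_bound (C := C) hm ?_
  filter_upwards [ae_restrict_mem isOpen_thickening.measurableSet] with x hx
  exact hb x hx

/-- Green with smooth normal cutoff -/
lemma green_chi {Φ W : E3 → ℝ} (hΦ : G.LipA Φ) (hW : G.SmA W) {χ : ℝ → ℝ}
    (hχ : ContDiff ℝ ((⊤ : ℕ∞) : WithTop ℕ∞) χ) {r : ℝ} (hr : r < G.δ) (hr0 : 0 ≤ r)
    (h0 : ∀ s, r ≤ |s| → χ s = 0) :
    ∫ x in thickening G.δ Srf.S, χ (G.q x) * Gr Φ W x ∂μH[3] = 0 := by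
  obtain ⟨L, Ψ, hΨ, hΦΨ⟩ := hΦ.extend
  set T := thickening G.δ Srf.S with hT
  have hTm : MeasurableSet T := isOpen_thickening.measurableSet
  set K := cthickening r Srf.S with hK
  have hKT : K ⊆ T := cthickening_subset_thickening' G.δ_pos hr _
  have hX : G.Sm (fun x => χ (G.q x)) := fun x hx => hχ.contDiffAt.comp x (G.sm_q x hx)
  let g : Fin 3 → E3 → ℝ := fun i x => χ (G.q x) * pd i W x
  have hg : ∀ i, G.Sm (g i) := fun i => hX.mul (hW.sm.pd i)
  have hg0 : ∀ i, ∀ x ∈ G.N, x ∉ K → g i x = 0 := by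
    intro i x hx hxK
    change χ (G.q x) * _ = 0
    rw [h0, zero_mul]
    rw [← G.infDist_eq hx]
    by_contra hlt
    exact hxK (thickening_subset_cthickening _ _ ((G.mem_thick hx).2 (by rw [← G.infDist_eq hx]; linarith)))
  have hs := fun i => indicator_smooth (G := G) (hg i) hr.le (hg0 i)
  -- by parts
  have hpart : ∀ i, ∫ x, lineDeriv ℝ Ψ x (ei i) * K.indicator (g i) x ∂(μH[3] : Measure E3)
      = ∫ x, lineDeriv ℝ (K.indicator (g i)) x (-(ei i)) * Ψ x ∂(μH[3] : Measure E3) := by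
    intro i
    obtain ⟨D, hD⟩ := ContDiff.lipschitzWith_of_hasCompactSupport (hs i).2 (hs i).1 (by simp)
    exact hΨ.integral_lineDeriv_mul_eq hD (hs i).2 _
  have hl : ∀ i, ∫ x, lineDeriv ℝ Ψ x (ei i) * K.indicator (g i) x ∂(μH[3] : Measure E3)
      = ∫ x in T, pd i Φ x * g i x ∂(μH[3] : Measure E3) := by
    intro i
    rw [← integral_indicator hTm]
    refine integral_congr_ae ?_
    filter_upwards [hΨ.ae_differentiableAt (μ := (μH[3] : Measure E3))] with x hx
    by_cases hxT : x ∈ T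
    · rw [Set.indicator_of_mem hxT, hx.lineDeriv_eq_fderiv, indicator_eq (hg0 i) (G.thick_sub hxT)]
      congr 1
      have : Φ =ᶠ[𝓝 x] Ψ := by
        filter_upwards [thick_nhds hxT] with z hz using hΦΨ (thickening_subset_cthickening _ _ hz)
      rw [pd, this.fderiv_eq]
    · rw [Set.indicator_of_notMem hxT, Set.indicator_of_notMem (fun h => hxT (hKT h)), mul_zero]
  have hrr : ∀ i, ∫ x, lineDeriv ℝ (K.indicator (g i)) x (-(ei i)) * Ψ x ∂(μH[3] : Measure E3)
      = ∫ x in T, - (pd i (g i) x * Φ x) ∂(μH[3] : Measure E3) := by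
    intro i
    rw [← integral_indicator hTm]
    refine integral_congr_ae (Filter.Eventually.of_forall fun x => ?_)
    have hd : DifferentiableAt ℝ (K.indicator (g i)) x := ((hs i).1.differentiable (by simp)) x
    change lineDeriv ℝ (K.indicator (g i)) x (-(ei i)) * Ψ x = _
    rw [hd.lineDeriv_eq_fderiv, map_neg]
    by_cases hxT : x ∈ T
    · rw [Set.indicator_of_mem hxT]
      have : K.indicator (g i) =ᶠ[𝓝 x] g i := by
        filter_upwards [thick_nhds hxT] with z hz using indicator_eq (hg0 i) (G.thick_sub hz)
      rw [this.fderiv_eq, hΦΨ (thickening_subset_cthickening _ _ hxT), pd]; ring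
    · rw [Set.indicator_of_notMem hxT]
      have : K.indicator (g i) =ᶠ[𝓝 x] fun _ => 0 := by
        have hx' : x ∉ K := fun h => hxT (hKT h)
        filter_upwards [isClosed_cthickening.isOpen_compl.mem_nhds hx'] with y hy
        exact Set.indicator_of_notMem hy _
      rw [this.fderiv_eq]; simp
  obtain ⟨LΦ, hLΦ⟩ := hΦ.fderiv_le
  obtain ⟨CΦ, hCΦ, hbΦ⟩ := hΦ.bdd
  have hi1 : ∀ i, IntegrableOn (fun x => pd i Φ x * g i x) T μH[3] := by
    intro i
    obtain ⟨C, hC, hb⟩ := (hg i).bounds0 G.K_sub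
    refine sm_bdd_int ?_ (C := LΦ * C) fun x hx => ?_
    · refine (measurable_pd i Φ).aestronglyMeasurable.mul ?_
      exact ((hg i).contOn G.thick_sub).aestronglyMeasurable hTm
    · rw [abs_mul]
      exact mul_le_mul ((abs_pd_le _ _ _).trans (hLΦ x hx)) (hb x (thickening_subset_cthickening _ _ hx)) (abs_nonneg _) LΦ.2
  have hi2 : ∀ i, IntegrableOn (fun x => -(pd i (g i) x * Φ x)) T μH[3] := by
    intro i
    obtain ⟨C, hC, hb⟩ := ((hg i).pd i).bounds0 G.K_sub
    refine sm_bdd_int ?_ (C := C * CΦ) fun x hx => ?_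
    · exact ((measurable_pd i (g i)).aestronglyMeasurable.mul (hΦ.aesm le_rfl)).neg
    · rw [abs_neg, abs_mul]
      have hx' := thickening_subset_cthickening _ _ hx
      exact mul_le_mul (hb x hx') (hbΦ x hx') (abs_nonneg _) hC
  have hsum : ∫ x in T, ∑ i, (pd i Φ x * g i x - -(pd i (g i) x * Φ x)) ∂μH[3] = 0 := by
    have hi3 : ∀ i, IntegrableOn (fun x => pd i Φ x * g i x - -(pd i (g i) x * Φ x)) T μH[3] :=
      fun i => (hi1 i).sub (hi2 i)
    rw [integral_finsetSum _ fun i _ => hi3 i]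
    refine Finset.sum_eq_zero fun i _ => ?_
    rw [integral_sub (hi1 i) (hi2 i), ← hl, ← hrr, hpart, sub_self]
  rw [← hsum]
  refine setIntegral_congr_fun hTm fun x hx => ?_
  have hxN := G.thick_sub hx
  have hdg : ∀ i, pd i (g i) x = χ (G.q x) * pd i (pd i W) x + deriv χ (G.q x) * ⟪G.nu x, ei i⟫ * pd i W x := by
    intro i
    have h1 : HasFDerivAt (fun x => χ (G.q x)) (deriv χ (G.q x) • fderiv ℝ G.q x) x :=
      ((hχ.differentiable (by simp)).differentiableAt.hasDerivAt).comp_hasFDerivAt x (G.sm_q.diff hxN).hasFDerivAt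
    have h2 := h1.mul ((hW.sm.pd i).diff hxN).hasFDerivAt
    have h3 : fderiv ℝ (g i) x = _ := h2.fderiv
    rw [pd, h3]
    simp only [_root_.add_apply, _root_.smul_apply, smul_eq_mul, G.dq hxN]
    rw [← pd]; ring
  have hz : ∑ i, ⟪G.nu x, ei i⟫ * pd i W x = 0 := by
    rw [← hW.fderiv_nu hx, lin_expand]
    simp only [inner_ei]; rfl
  change χ (G.q x) * Gr Φ W x = ∑ i, (pd i Φ x * g i x - -(pd i (g i) x * Φ x))
  have e : ∀ i, pd i Φ x * g i x - -(pd i (g i) x * Φ x) = χ (G.q x) * (pd i Φ x * pd i W x)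
      + χ (G.q x) * Φ x * pd i (pd i W) x + (deriv χ (G.q x) * Φ x) * (⟪G.nu x, ei i⟫ * pd i W x) := by
    intro i
    rw [hdg]
    change pd i Φ x * (χ (G.q x) * pd i W x) - _ = _
    ring
  simp only [e, Finset.sum_add_distrib, ← Finset.mul_sum, hz]
  unfold Gr lap; ring

lemma green_tube {Φ W : E3 → ℝ} (hΦ : G.LipA Φ) (hW : G.SmA W) {ε : ℝ} (hε : 0 < ε) (hεδ : ε < G.δ) :
    ∫ x in thickening ε Srf.S, Gr Φ W x ∂μH[3] = 0 := by
  have hlt : ∀ k : ℕ, ε * (1 - 1 / ((k : ℝ) + 2)) < ε := by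
    intro k
    have : 0 < 1 / ((k : ℝ) + 2) := by positivity
    nlinarith
  have hps : ∀ k : ℕ, 0 < ε * (1 - 1 / ((k : ℝ) + 2)) := by
    intro k
    have : 1 / ((k : ℝ) + 2) < 1 := by rw [div_lt_one (by positivity)]; linarith [(k.cast_nonneg : (0:ℝ) ≤ k)]
    exact mul_pos hε (by linarith)
  let b : ℕ → ContDiffBump (0 : ℝ) := fun k => ⟨ε * (1 - 1 / ((k : ℝ) + 2)), ε, hps k, hlt k⟩
  have hz : ∀ k, ∫ x in thickening G.δ Srf.S, b k (G.q x) * Gr Φ W x ∂μH[3] = 0 := by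
    intro k
    refine green_chi hΦ hW (b k).contDiff hεδ hε.le fun s hs => ?_
    exact (b k).zero_of_le_dist (by simpa using hs)
  have hsub : thickening ε Srf.S ⊆ thickening G.δ Srf.S := thickening_mono hεδ.le _
  have hTm : MeasurableSet (thickening G.δ Srf.S) := isOpen_thickening.measurableSet
  have hTεm : MeasurableSet (thickening ε Srf.S) := isOpen_thickening.measurableSet
  have hlim : Filter.Tendsto (fun k => ∫ x in thickening G.δ Srf.S, b k (G.q x) * Gr Φ W x ∂μH[3]) Filter.atTop
      (𝓝 (∫ x in thickening G.δ Srf.S, (thickening ε Srf.S).indicator (Gr Φ W) x ∂μH[3])) := by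
    refine tendsto_integral_of_dominated_convergence (fun x => |Gr Φ W x|) ?_ (gr_int hΦ hW le_rfl).abs ?_ ?_
    · intro k
      refine AEStronglyMeasurable.mul ?_ (gr_int hΦ hW le_rfl).1
      exact ((b k).continuous.comp_continuousOn (G.sm_q.contOn G.thick_sub)).aestronglyMeasurable hTm
    · intro k
      refine Filter.Eventually.of_forall fun x => ?_
      rw [norm_mul, Real.norm_eq_abs, Real.norm_eq_abs, abs_of_nonneg (b k).nonneg]
      exact mul_le_of_le_one_left (abs_nonneg _) (b k).le_one
    · filter_upwards [ae_restrict_mem hTm] with x hx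
      have hxN := G.thick_sub hx
      by_cases hxε : x ∈ thickening ε Srf.S
      · rw [Set.indicator_of_mem hxε]
        have hq : |G.q x| < ε := (G.mem_thick hxN).1 hxε
        refine tendsto_const_nhds.congr' ?_
        have ht : Filter.Tendsto (fun k : ℕ => ε * (1 - 1 / ((k : ℝ) + 2))) Filter.atTop (𝓝 (ε * (1 - 0))) := by
          refine Filter.Tendsto.const_mul _ (tendsto_const_nhds.sub ?_)
          refine Filter.Tendsto.div_atTop tendsto_const_nhds ?_
          exact Filter.tendsto_atTop_add_const_right _ _ tendsto_natCast_atTop_atTop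
        filter_upwards [ht.eventually (lt_mem_nhds (a := |G.q x|) (by simpa using hq))] with k hk
        rw [(b k).one_of_mem_closedBall, one_mul]
        rw [mem_closedBall, Real.dist_eq, sub_zero]
        exact hk.le
      · rw [Set.indicator_of_notMem hxε]
        have hq : ε ≤ |G.q x| := by
          by_contra h
          exact hxε ((G.mem_thick hxN).2 (by linarith))
        refine tendsto_const_nhds.congr fun k => ?_
        rw [(b k).zero_of_le_dist (by simpa using hq), zero_mul]
  simp only [hz] at hlim
  have := tendsto_nhds_unique tendsto_const_nhds hlim
  rw [setIntegral_indicator hTεm, Set.inter_eq_right.2 hsub] at this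
  exact this.symm

/-- Green's formula on the surface -/
theorem green {Φ W : E3 → ℝ} (hΦ : G.LipA Φ) (hW : G.SmA W) : ∫ y, Gr Φ W y ∂Srf.mu = 0 := by
  obtain ⟨ε0, hε0, hε0δ, hae⟩ := G.ae_tube_of_ae
  obtain ⟨L, hL⟩ := hΦ.fderiv_le
  obtain ⟨CΦ, hCΦ, hbΦ⟩ := hΦ.bdd
  obtain ⟨C1, hC1, hb1, -, hl1, -⟩ := hW.sm.fderiv.bounds G.K_sub
  obtain ⟨C2, hC2, -, -, hl2, -⟩ := hW.sm.lap.bounds G.K_sub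
  obtain ⟨C3, hC3, hb3, -, hl3, -⟩ := G.sm_a.fderiv.bounds G.K_sub
  have hδ := G.δ_pos
  refine G.tube_limit (F := Gr Φ W) (gr_int_S hΦ hW) (C' := 3 * (L * C3 * C1 + L * C1) + CΦ * C2) (ε1 := ε0) hε0 fun ε hε hεε => ?_
  have hεδ : ε < G.δ := by linarith
  refine ⟨gr_int hΦ hW hεδ.le, green_tube hΦ hW hε hεδ, ?_⟩
  filter_upwards [hae ε hε hεε _ hΦ.ae_diff, ae_restrict_mem isOpen_thickening.measurableSet] with x hd hx
  have hxT := thickening_mono hεδ.le _ hx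
  have hxN := G.thick_sub hxT
  have haS := G.a_mem x hxN
  have haT := a_thick hxT
  have hq : ‖x - G.a x‖ ≤ ε := by
    rw [← dist_eq_norm, ← G.abs_q hxN]; exact ((G.mem_thick hxN).1 hx).le
  have hxb : x ∈ closedBall (G.a x) G.δ := by rw [mem_closedBall, dist_eq_norm]; linarith
  have hab : G.a x ∈ closedBall (G.a x) G.δ := mem_closedBall_self G.δ_pos.le
  have hfd := (inv_fderiv hΦ.inv hxT hd).fderiv
  have hfda := (inv_fderiv hΦ.inv haT (by rwa [G.a_a hxN])).fderiv
  rw [G.a_a hxN] at hfda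
  have e1 : ∀ i, |pd i Φ x - pd i Φ (G.a x)| ≤ L * (C3 * ε) := by
    intro i
    have : pd i Φ x - pd i Φ (G.a x) = fderiv ℝ Φ (G.a x) ((fderiv ℝ G.a x - fderiv ℝ G.a (G.a x)) (ei i)) := by
      have h9 := DFunLike.congr_fun hfda (ei i)
      rw [ContinuousLinearMap.comp_apply] at h9
      rw [pd, pd, hfd, h9, _root_.sub_apply, map_sub, ContinuousLinearMap.comp_apply]
    rw [this, ← Real.norm_eq_abs]
    refine (ContinuousLinearMap.le_opNorm _ _).trans ?_
    gcongr
    · exact hL _ haT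
    · refine (ContinuousLinearMap.le_opNorm _ _).trans ?_
      rw [norm_ei, mul_one]
      refine (hl3 _ haS _ hab _ hxb).trans ?_
      gcongr
  have e2 : ∀ i, |pd i W x - pd i W (G.a x)| ≤ C1 * ε := by
    intro i
    have : pd i W x - pd i W (G.a x) = (fderiv ℝ W x - fderiv ℝ W (G.a x)) (ei i) := by simp [pd, _root_.sub_apply]
    rw [this, ← Real.norm_eq_abs]
    refine (ContinuousLinearMap.le_opNorm _ _).trans ?_
    rw [norm_ei, mul_one]
    refine (hl1 _ haS _ hab _ hxb).trans ?_
    gcongr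
  have e3 : |lap W x - lap W (G.a x)| ≤ C2 * ε := by
    rw [← Real.norm_eq_abs]
    refine (hl2 _ haS _ hab _ hxb).trans ?_
    gcongr
  have hxK := thickening_subset_cthickening _ _ hxT
  have haK := thickening_subset_cthickening _ _ haT
  have e : Gr Φ W x - Gr Φ W (G.a x) = ∑ i, ((pd i Φ x - pd i Φ (G.a x)) * pd i W x
      + pd i Φ (G.a x) * (pd i W x - pd i W (G.a x))) + Φ (G.a x) * (lap W x - lap W (G.a x)) := by
    unfold Gr
    rw [hΦ.inv x hxT]
    have : ∀ i, ((pd i Φ x - pd i Φ (G.a x)) * pd i W x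
      + pd i Φ (G.a x) * (pd i W x - pd i W (G.a x))) = pd i Φ x * pd i W x - pd i Φ (G.a x) * pd i W (G.a x) := by
      intro i; ring
    simp only [this, Finset.sum_sub_distrib]
    ring
  rw [e]
  refine (abs_add_le _ _).trans ?_
  have f1 : |∑ i, ((pd i Φ x - pd i Φ (G.a x)) * pd i W x
      + pd i Φ (G.a x) * (pd i W x - pd i W (G.a x)))| ≤ ∑ i : Fin 3, (L * (C3 * ε) * C1 + L * (C1 * ε)) := by
    refine (Finset.abs_sum_le_sum_abs _ _).trans (Finset.sum_le_sum fun i _ => ?_)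
    refine (abs_add_le _ _).trans ?_
    rw [abs_mul, abs_mul]
    gcongr
    · exact e1 i
    · exact (abs_pd_le _ _ _).trans (hb1 x hxK)
    · exact (abs_pd_le _ _ _).trans (hL _ haT)
    · exact e2 i
  have f2 : |Φ (G.a x) * (lap W x - lap W (G.a x))| ≤ CΦ * (C2 * ε) := by
    rw [abs_mul]; gcongr; exact hbΦ _ haK
  rw [Finset.sum_const, Finset.card_univ, Fintype.card_fin] at f1
  simp only [nsmul_eq_mul, Nat.cast_ofNat] at f1
  nlinarith [f1, f2]

end Geo
end

open MeasureTheory Metric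
open scoped RealInnerProductSpace ENNReal NNReal Topology

noncomputable section
namespace Geo
variable {Srf : SmoothSurface} {G : Geo Srf}

lemma sm_int {F : E3 → ℝ} (h : G.Sm F) : Integrable F Srf.mu := by
  have := G.mu_finite
  obtain ⟨C, hC, hb⟩ := h.bounds0 G.K_sub
  refine Integrable.of_bound (C := C) ((h.contOn G.S_sub).aestronglyMeasurable S_meas) ?_
  filter_upwards [ae_restrict_mem S_meas] with x hx
  exact hb x (self_subset_cthickening _ hx)

lemma inner_grad {φ w : E3 → ℝ} {y : E3} (hy : y ∈ Srf.S) (h1 : DifferentiableAt ℝ (fun x => φ (G.a x)) y)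
    (h2 : DifferentiableAt ℝ (fun x => w (G.a x)) y) :
    ⟪Srf.grad φ y, Srf.grad w y⟫ = ∑ i, pd i (fun x => φ (G.a x)) y * pd i (fun x => w (G.a x)) y := by
  rw [← sum_inner_ei]
  refine Finset.sum_congr rfl fun i _ => ?_
  rw [G.grad_inner hy h1, G.grad_inner hy h2]; rfl

lemma aForm_eq {φ w : E3 → ℝ} (h1 : G.LipA (fun x => φ (G.a x))) (h2 : G.LipA (fun x => w (G.a x))) :
    Srf.aForm φ w = ∫ y, (∑ i, pd i (fun x => φ (G.a x)) y * pd i (fun x => w (G.a x)) y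
      + φ (G.a y) * w (G.a y)) ∂Srf.mu := by
  unfold SmoothSurface.aForm
  change ∫ x, _ ∂Srf.mu = _
  refine integral_congr_ae ?_
  filter_upwards [h1.ae_diff, h2.ae_diff, ae_restrict_mem S_meas] with y d1 d2 hy
  rw [inner_grad hy d1 d2, G.a_self hy]

/-- every `Sm` function has a globally smooth representative with the same values on S -/
lemma exists_global {F : E3 → ℝ} (hF : G.Sm F) : ∃ φ : E3 → ℝ, ContDiff ℝ ((⊤ : ℕ∞) : WithTop ℕ∞) φ ∧ ∀ y ∈ Srf.S, φ y = F y := by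
  have hδ := G.δ_pos
  let b : ContDiffBump (0 : ℝ) := ⟨G.δ / 4, G.δ / 2, by positivity, by linarith⟩
  have hX : G.Sm (fun x => b (G.q x) * F x) :=
    Tube.Sm.mul (fun x hx => b.contDiff.contDiffAt.comp x (G.sm_q x hx)) hF
  have h0 : ∀ x ∈ G.N, x ∉ cthickening (G.δ / 2) Srf.S → b (G.q x) * F x = 0 := by
    intro x hx hxK
    rw [b.zero_of_le_dist, zero_mul]
    change G.δ / 2 ≤ _
    rw [Real.dist_eq, sub_zero]
    by_contra hlt
    exact hxK (thickening_subset_cthickening _ _ ((G.mem_thick hx).2 (by linarith)))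
  refine ⟨_, (indicator_smooth hX (by linarith) h0).1, fun y hy => ?_⟩
  rw [indicator_eq h0 (G.S_sub hy), G.q_S hy, b.one_of_mem_closedBall (by simp; exact b.rIn_pos.le), one_mul]

lemma smoothNear_smA {f : E3 → ℝ} (h : SmoothNear f Srf.S) : G.SmA (fun x => f (G.a x)) := by
  obtain ⟨V, hV, hSV, hf⟩ := h
  exact smA_of_smooth fun x hx => hf.contDiffAt (hV.mem_nhds (hSV hx))

lemma green_gr {Φ W : E3 → ℝ} (hΦ : G.LipA Φ) (hW : G.SmA W) :
    Integrable (fun y => ∑ i, pd i Φ y * pd i W y) Srf.mu ∧ Integrable (fun y => Φ y * lap W y) Srf.mu ∧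
    ∫ y, ∑ i, pd i Φ y * pd i W y ∂Srf.mu = - ∫ y, Φ y * lap W y ∂Srf.mu := by
  have h2 : Integrable (fun y => Φ y * lap W y) Srf.mu := by
    have := G.mu_finite
    obtain ⟨C, hC, hb⟩ := hW.sm.lap.bounds0 G.K_sub
    obtain ⟨C', hC', hb'⟩ := hΦ.bdd
    refine Integrable.of_bound (C := C' * C) (hΦ.aesm_S.mul (measurable_lap W).aestronglyMeasurable) ?_
    filter_upwards [ae_restrict_mem S_meas] with x hx
    have hx' := self_subset_cthickening (δ := G.δ) _ hx
    rw [norm_mul]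
    exact mul_le_mul (hb' x hx') (hb x hx') (abs_nonneg _) hC'
  have h1 : Integrable (fun y => ∑ i, pd i Φ y * pd i W y) Srf.mu := by
    refine ((gr_int_S hΦ hW).sub h2).congr (Filter.Eventually.of_forall fun y => ?_)
    simp [Gr]
  refine ⟨h1, h2, ?_⟩
  have h3 := green hΦ hW
  unfold Gr at h3
  rw [integral_add h1 h2] at h3
  linarith

lemma strong {f u : E3 → ℝ} (hf : SmoothNear f Srf.S) (hu : IsSolution Srf f u) (G : Geo Srf) :
    ∀ᵐ y ∂Srf.mu, f y = u y - lap (fun x => u (G.a x)) y := by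
  have hU := smoothNear_smA (G := G) hu.1
  have hF := smoothNear_smA (G := G) hf
  set U := fun x => u (G.a x) with hUd
  set F := fun x => f (G.a x) with hFd
  let ρ : E3 → ℝ := fun x => F x - (U x - lap U x)
  have hρ : G.Sm ρ := hF.sm.sub (hU.sm.sub hU.sm.lap)
  obtain ⟨φ, hφ, hφρ⟩ := exists_global hρ
  have hΦ : G.SmA (fun x => φ (G.a x)) := smA_of_smooth fun x _ => hφ.contDiffAt
  have h1 := hu.2 φ hφ
  rw [aForm_eq hU.lipA hΦ.lipA] at h1
  change _ = ∫ x, f x * φ x ∂Srf.mu at h1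
  obtain ⟨i1, i2, hg⟩ := green_gr hΦ.lipA hU
  have i3 : Integrable (fun y => U y * φ (G.a y)) Srf.mu := sm_int (hU.sm.mul hΦ.sm)
  have e1 : ∫ y, (∑ i, pd i (fun x => u (G.a x)) y * pd i (fun x => φ (G.a x)) y + u (G.a y) * φ (G.a y)) ∂Srf.mu
      = ∫ y, φ (G.a y) * (U y - lap U y) ∂Srf.mu := by
    have : ∀ y, (∑ i, pd i (fun x => u (G.a x)) y * pd i (fun x => φ (G.a x)) y + u (G.a y) * φ (G.a y))
        = (∑ i, pd i (fun x => φ (G.a x)) y * pd i U y) + U y * φ (G.a y) := by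
      intro y; congr 1; exact Finset.sum_congr rfl fun i _ => mul_comm _ _
    simp only [this]
    rw [integral_add i1 i3, hg, ← sub_eq_neg_add, ← integral_sub i3 i2]
    congr 1; ext y; ring
  rw [e1] at h1
  have i4 : Integrable (fun y => φ (G.a y) * (U y - lap U y)) Srf.mu := sm_int (hΦ.sm.mul (hU.sm.sub hU.sm.lap))
  have i5 : Integrable (fun y => φ (G.a y) * F y) Srf.mu := sm_int (hΦ.sm.mul hF.sm)
  have e2 : ∫ x, f x * φ x ∂Srf.mu = ∫ y, φ (G.a y) * F y ∂Srf.mu := by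
    refine integral_congr_ae ?_
    filter_upwards [ae_restrict_mem S_meas] with y hy
    rw [hFd]; simp only [G.a_self hy]; ring
  rw [e2] at h1
  have e3 : ∫ y, ρ y ^ 2 ∂Srf.mu = 0 := by
    rw [← sub_eq_zero.2 h1.symm, ← integral_sub i5 i4]
    refine integral_congr_ae ?_
    filter_upwards [ae_restrict_mem S_meas] with y hy
    rw [G.a_self hy, hφρ y hy]; ring
  have e4 := (integral_eq_zero_iff_of_nonneg (fun y => sq_nonneg _) (sm_int (by simpa [sq] using hρ.mul hρ : G.Sm (fun y => ρ y ^ 2)))).1 e3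
  filter_upwards [e4, ae_restrict_mem S_meas] with y hy hyS
  have : ρ y = 0 := by simpa using hy
  have h6 : F y - (U y - lap U y) = 0 := this
  simp only [hFd, hUd, G.a_self hyS] at h6 ⊢
  linarith

end Geo
end

open MeasureTheory Metric
open scoped RealInnerProductSpace ENNReal NNReal Topology

noncomputable section

lemma pd_congr {F F' : E3 → ℝ} {x : E3} (h : F =ᶠ[𝓝 x] F') (i : Fin 3) : pd i F x = pd i F' x := by
  unfold pd; rw [h.fderiv_eq]

lemma pd_ev {F F' : E3 → ℝ} {x : E3} (h : F =ᶠ[𝓝 x] F') (i : Fin 3) : pd i F =ᶠ[𝓝 x] pd i F' := by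
  filter_upwards [h.fderiv (𝕜 := ℝ)] with y hy
  unfold pd; rw [hy]

lemma lap_congr {F F' : E3 → ℝ} {x : E3} (h : F =ᶠ[𝓝 x] F') : lap F x = lap F' x := by
  unfold lap
  exact Finset.sum_congr rfl fun i _ => pd_congr (pd_ev h i) i

lemma pd_add {F F' : E3 → ℝ} {x : E3} (h : DifferentiableAt ℝ F x) (h' : DifferentiableAt ℝ F' x) (i : Fin 3) :
    pd i (fun y => F y + F' y) x = pd i F x + pd i F' x := by
  unfold pd; rw [fderiv_fun_add h h']; rfl

lemma pd_sub {F F' : E3 → ℝ} {x : E3} (h : DifferentiableAt ℝ F x) (h' : DifferentiableAt ℝ F' x) (i : Fin 3) :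
    pd i (fun y => F y - F' y) x = pd i F x - pd i F' x := by
  unfold pd; rw [fderiv_fun_sub h h']; rfl

lemma pd_mul {F F' : E3 → ℝ} {x : E3} (h : DifferentiableAt ℝ F x) (h' : DifferentiableAt ℝ F' x) (i : Fin 3) :
    pd i (fun y => F y * F' y) x = F x * pd i F' x + F' x * pd i F x := by
  unfold pd; rw [fderiv_fun_mul h h']; rfl

lemma pd_sum {ι : Type*} {s : Finset ι} {F : ι → E3 → ℝ} {x : E3} (h : ∀ k ∈ s, DifferentiableAt ℝ (F k) x) (i : Fin 3) :
    pd i (fun y => ∑ k ∈ s, F k y) x = ∑ k ∈ s, pd i (F k) x := by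
  unfold pd; rw [fderiv_fun_sum h]; simp

lemma fderiv_eq_pd (F : E3 → ℝ) (x v : E3) : fderiv ℝ F x v = ∑ i, v i * pd i F x := lin_expand _ v

lemma pd_comm {F : E3 → ℝ} {x : E3} (h : ContDiffAt ℝ ((⊤ : ℕ∞) : WithTop ℕ∞) F x) (i j : Fin 3) :
    pd i (pd j F) x = pd j (pd i F) x := by
  have hd : DifferentiableAt ℝ (fderiv ℝ F) x :=
    (h.fderiv_right (m := 1) (by norm_cast)).differentiableAt (by simp)
  have key : ∀ k l, pd k (pd l F) x = fderiv ℝ (fderiv ℝ F) x (ei k) (ei l) := by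
    intro k l
    unfold pd
    have := hd.hasFDerivAt.clm_apply (hasFDerivAt_const (ei l) x)
    rw [this.fderiv]; simp
  rw [key, key]
  exact (h.isSymmSndFDerivAt (by simp; norm_cast)).eq _ _

namespace Tube
variable {Srf : SmoothSurface} {Tb : Tube Srf}

lemma ev {p : E3 → Prop} {x : E3} (hx : x ∈ Tb.N) (h : ∀ y ∈ Tb.N, p y) : ∀ᶠ y in 𝓝 x, p y := by
  filter_upwards [Tb.N_open.mem_nhds hx] with y hy using h y hy

lemma Sm.lap_add {F F' : E3 → ℝ} (h : Tb.Sm F) (h' : Tb.Sm F') {x : E3} (hx : x ∈ Tb.N) :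
    _root_.lap (fun y => F y + F' y) x = _root_.lap F x + _root_.lap F' x := by
  unfold _root_.lap
  rw [← Finset.sum_add_distrib]
  refine Finset.sum_congr rfl fun i _ => ?_
  rw [pd_congr (ev hx fun y hy => pd_add (h.diff hy) (h'.diff hy) i) i, pd_add ((h.pd i).diff hx) ((h'.pd i).diff hx)]

lemma Sm.lap_sub {F F' : E3 → ℝ} (h : Tb.Sm F) (h' : Tb.Sm F') {x : E3} (hx : x ∈ Tb.N) :
    _root_.lap (fun y => F y - F' y) x = _root_.lap F x - _root_.lap F' x := by
  unfold _root_.lap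
  rw [← Finset.sum_sub_distrib]
  refine Finset.sum_congr rfl fun i _ => ?_
  rw [pd_congr (ev hx fun y hy => pd_sub (h.diff hy) (h'.diff hy) i) i, pd_sub ((h.pd i).diff hx) ((h'.pd i).diff hx)]

lemma Sm.lap_mul {F F' : E3 → ℝ} (h : Tb.Sm F) (h' : Tb.Sm F') {x : E3} (hx : x ∈ Tb.N) :
    _root_.lap (fun y => F y * F' y) x = F x * _root_.lap F' x + F' x * _root_.lap F x + 2 * ∑ i, _root_.pd i F x * _root_.pd i F' x := by
  unfold _root_.lap
  rw [Finset.mul_sum, Finset.mul_sum, Finset.mul_sum, ← Finset.sum_add_distrib, ← Finset.sum_add_distrib]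
  refine Finset.sum_congr rfl fun i _ => ?_
  rw [pd_congr (ev hx fun y hy => pd_mul (h.diff hy) (h'.diff hy) i) i,
    pd_add ((h.mul (h'.pd i)).diff hx) ((h'.mul (h.pd i)).diff hx), pd_mul (h.diff hx) ((h'.pd i).diff hx),
    pd_mul (h'.diff hx) ((h.pd i).diff hx)]
  ring

lemma Sm.pd_lap {F : E3 → ℝ} (h : Tb.Sm F) (i : Fin 3) {x : E3} (hx : x ∈ Tb.N) :
    _root_.pd i (_root_.lap F) x = _root_.lap (_root_.pd i F) x := by
  have : _root_.pd i (_root_.lap F) x = ∑ k, _root_.pd i (_root_.pd k (_root_.pd k F)) x :=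
    pd_sum (fun k _ => ((h.pd k).pd k).diff hx) i
  rw [this]; unfold _root_.lap
  refine Finset.sum_congr rfl fun k _ => ?_
  rw [pd_comm ((h.pd k) x hx), pd_congr (ev hx fun y hy => pd_comm (h y hy) i k)]

lemma Sm.coord {F : E3 → E3} (h : Tb.Sm F) (k : Fin 3) : Tb.Sm (fun x => F x k) := by
  intro x hx
  exact (EuclideanSpace.proj (𝕜 := ℝ) k).contDiff.contDiffAt.comp x (h x hx)

lemma pd_coord {F : E3 → E3} {x : E3} (h : DifferentiableAt ℝ F x) (k i : Fin 3) :
    _root_.pd i (fun x => F x k) x = (_root_.fderiv ℝ F x (ei i)) k := by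
  unfold _root_.pd
  have := (EuclideanSpace.proj (𝕜 := ℝ) k).hasFDerivAt.comp x h.hasFDerivAt
  have h2 : _root_.fderiv ℝ (fun x => F x k) x = _ := this.fderiv
  rw [h2]; rfl

lemma Sm.sq {F : E3 → ℝ} (h : Tb.Sm F) : Tb.Sm (fun x => F x ^ 2) := by simpa [pow_two] using h.mul h
lemma Sm.comp_a' {F : E3 → ℝ} (h : Tb.Sm F) : Tb.Sm (fun x => F (Tb.a x)) := Sm.comp_a fun x hx => h x (Tb.S_sub hx)

/-- first derivative of F ∘ a -/
lemma Sm.pd_comp_a {F : E3 → ℝ} (h : Tb.Sm F) (j : Fin 3) {x : E3} (hx : x ∈ Tb.N) :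
    _root_.pd j (fun x => F (Tb.a x)) x = ∑ k, _root_.pd k F (Tb.a x) * _root_.pd j (fun x => Tb.a x k) x := by
  have h1 := (h.diff (Tb.S_sub (Tb.a_mem x hx))).hasFDerivAt.comp x (Tb.a_diff hx).hasFDerivAt
  have h2 : _root_.fderiv ℝ (fun x => F (Tb.a x)) x = _ := h1.fderiv
  conv_lhs => unfold _root_.pd
  rw [h2, ContinuousLinearMap.comp_apply, lin_expand]
  refine Finset.sum_congr rfl fun k _ => ?_
  rw [pd_coord (Tb.a_diff hx)]; unfold _root_.pd; ring

lemma pd_a {x : E3} (hx : x ∈ Tb.N) (k j : Fin 3) :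
    _root_.pd j (fun x => Tb.a x k) x = (ei j) k - Tb.nu x j * Tb.nu x k - Tb.q x * _root_.pd j (fun x => Tb.nu x k) x := by
  rw [pd_coord (Tb.a_diff hx), Tb.da hx, pd_coord (Tb.nu_diff hx), inner_ei]
  simp

lemma ei_apply (j k : Fin 3) : (ei j) k = if k = j then 1 else 0 := by
  simp [ei]

lemma lap_a (G : Geo Srf) {y : E3} (hy : y ∈ Srf.S) (k : Fin 3) : _root_.lap (fun x => G.a x k) y = - (Srf.n y k * _root_.lap G.q y) := by
  have hyN := G.S_sub hy
  have h1 : (fun x => G.a x k) =ᶠ[𝓝 y] fun x => x k - G.q x * G.nu x k :=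
    ev (Tb := G.toTube) hyN fun x hx => by simp only [G.a_eq hx]; simp
  have hid : G.Sm (fun x : E3 => x k) := Sm.coord (F := id) (fun x _ => contDiffAt_id) k
  rw [lap_congr h1, Sm.lap_sub hid (G.sm_q.mul (G.sm_nu.coord k)) hyN, G.sm_q.lap_mul (G.sm_nu.coord k) hyN, G.q_S hy]
  have h2 : _root_.lap (fun x : E3 => x k) y = 0 := by
    unfold _root_.lap
    refine Finset.sum_eq_zero fun i _ => ?_
    have : _root_.pd i (fun x : E3 => x k) = fun _ => (ei i) k := by
      ext x; rw [pd_coord (F := fun x => x) differentiableAt_id]; simp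
    rw [this]; unfold _root_.pd; simp
  have h3 : ∑ i, _root_.pd i G.q y * _root_.pd i (fun x => G.nu x k) y = 0 := by
    have e := G.dnu_nu (Geo.S_thick G.δ_pos hy)
    have e2 : _root_.fderiv ℝ (fun x => G.nu x k) y (G.nu y) = 0 := by
      have := (EuclideanSpace.proj (𝕜 := ℝ) k).hasFDerivAt.comp y (G.nu_diff hyN).hasFDerivAt
      have h2 : _root_.fderiv ℝ (fun x => G.nu x k) y = _ := this.fderiv
      rw [h2, ContinuousLinearMap.comp_apply, e]; simp
    rw [fderiv_eq_pd] at e2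
    rw [← e2]
    refine Finset.sum_congr rfl fun i _ => ?_
    congr 1
    unfold _root_.pd
    rw [G.dq hyN, inner_ei]
  rw [h2, h3, G.nu_S hy]; ring

/-- Laplacian of F ∘ a on S -/
lemma Sm.lap_comp_a (G : Geo Srf) {F : E3 → ℝ} (h : G.Sm F) {y : E3} (hy : y ∈ Srf.S) :
    _root_.lap (fun x => F (G.a x)) y = _root_.lap F y - (∑ k, ∑ l, Srf.n y k * Srf.n y l * _root_.pd l (_root_.pd k F) y)
      - _root_.lap G.q y * ∑ k, Srf.n y k * _root_.pd k F y := by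
  have hyN := G.S_sub hy
  have e1 : ∀ j, _root_.pd j (_root_.pd j (fun x => F (G.a x))) y =
      ∑ k, (F (G.a y) * 0 + (_root_.pd k F y * _root_.pd j (_root_.pd j (fun x => G.a x k)) y
        + _root_.pd j (fun x => G.a x k) y * ∑ l, _root_.pd l (_root_.pd k F) y * _root_.pd j (fun x => G.a x l) y)) := by
    intro j
    rw [pd_congr (ev (Tb := G.toTube) hyN fun x hx => Sm.pd_comp_a h j hx) j,
      pd_sum (fun k _ => ((h.pd k).comp_a'.mul ((G.sm_a.coord k).pd j)).diff hyN)]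
    refine Finset.sum_congr rfl fun k _ => ?_
    rw [pd_mul (((h.pd k).comp_a').diff hyN) (((G.sm_a.coord k).pd j).diff hyN), Sm.pd_comp_a (h.pd k) j hyN, G.a_self hy]
    ring
  have hn : ∑ i, Srf.n y i * Srf.n y i = 1 := by
    have := sum_inner_ei (Srf.n y) (Srf.n y)
    rw [real_inner_self_eq_norm_sq, Srf.n_unit y hy] at this
    simp_rw [inner_ei] at this
    linarith
  have e2 : ∀ k, ∑ j, _root_.pd j (_root_.pd j (fun x => G.a x k)) y = - (Srf.n y k * _root_.lap G.q y) := fun k => lap_a G hy k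
  have e3 : ∀ k j, _root_.pd j (fun x => G.a x k) y = (ei j) k - Srf.n y j * Srf.n y k := by
    intro k j; rw [pd_a hyN, G.q_S hy, G.nu_S hy]; ring
  conv_lhs => unfold _root_.lap
  simp only [e1, mul_zero, zero_add, Finset.sum_add_distrib]
  rw [Finset.sum_comm]
  simp only [← Finset.mul_sum, e2, e3, ei_apply]
  rw [show _root_.lap F y = ∑ i, _root_.pd i (_root_.pd i F) y from rfl]
  simp only [Fin.sum_univ_three] at hn ⊢
  simp
  linear_combination (Srf.n y 0 * Srf.n y 0 * _root_.pd 0 (_root_.pd 0 F) y + Srf.n y 0 * Srf.n y 1 * _root_.pd 1 (_root_.pd 0 F) y + Srf.n y 0 * Srf.n y 2 * _root_.pd 2 (_root_.pd 0 F) y + Srf.n y 1 * Srf.n y 0 * _root_.pd 0 (_root_.pd 1 F) y + Srf.n y 1 * Srf.n y 1 * _root_.pd 1 (_root_.pd 1 F) y + Srf.n y 1 * Srf.n y 2 * _root_.pd 2 (_root_.pd 1 F) y + Srf.n y 2 * Srf.n y 0 * _root_.pd 0 (_root_.pd 2 F) y + Srf.n y 2 * Srf.n y 1 * _root_.pd 1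 (_root_.pd 2 F) y + Srf.n y 2 * Srf.n y 2 * _root_.pd 2 (_root_.pd 2 F) y) * hn

end Tube
end

open MeasureTheory Metric
open scoped RealInnerProductSpace ENNReal NNReal Topology

noncomputable section
namespace Geo
variable {Srf : SmoothSurface} {G : Geo Srf}

lemma sum_n_pd {W : E3 → ℝ} (h : G.SmA W) {y : E3} (hy : y ∈ Srf.S) : ∑ k, Srf.n y k * pd k W y = 0 := by
  have := h.fderiv_nu (S_thick G.δ_pos hy)
  rwa [G.nu_S hy, fderiv_eq_pd] at this

lemma energy {W : E3 → ℝ} (h : G.SmA W) :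
    ∫ y, W y ^ 2 ∂Srf.mu ≤ ∫ y, (W y - lap W y) ^ 2 ∂Srf.mu ∧
    ∫ y, ∑ i, pd i W y ^ 2 ∂Srf.mu ≤ ∫ y, (W y - lap W y) ^ 2 ∂Srf.mu := by
  obtain ⟨i1, i2, hg⟩ := green_gr h.lipA h
  have e1 : ∫ y, ∑ i, pd i W y ^ 2 ∂Srf.mu = ∫ y, ∑ i, pd i W y * pd i W y ∂Srf.mu := by simp only [sq]
  rw [← e1, ← integral_neg] at hg
  have j1 : Integrable (fun y => W y ^ 2) Srf.mu := sm_int h.sm.sq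
  have j2 : Integrable (fun y => (W y - lap W y) ^ 2) Srf.mu := sm_int (h.sm.sub h.sm.lap).sq
  have h3 : ∫ y, -(W y * lap W y) ∂Srf.mu ≤ ∫ y, ((1/2) * (W y - lap W y) ^ 2 - (1/2) * W y ^ 2) ∂Srf.mu := by
    refine integral_mono i2.neg ((j2.const_mul _).sub (j1.const_mul _)) fun y => ?_
    simp only
    nlinarith [sq_nonneg (lap W y)]
  rw [integral_sub (j2.const_mul _) (j1.const_mul _), integral_const_mul, integral_const_mul] at h3
  have p1 : 0 ≤ ∫ y, W y ^ 2 ∂Srf.mu := integral_nonneg fun y => sq_nonneg _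
  have p2 : 0 ≤ ∫ y, (W y - lap W y) ^ 2 ∂Srf.mu := integral_nonneg fun y => sq_nonneg _
  have p3 : 0 ≤ ∫ y, ∑ i, pd i W y ^ 2 ∂Srf.mu := integral_nonneg fun y => Finset.sum_nonneg fun i _ => sq_nonneg _
  constructor <;> linarith

/-- the correction term -/
def bet (G : Geo Srf) (W : E3 → ℝ) (i : Fin 3) (x : E3) : ℝ := ∑ k, pd k W (G.a x) * pd i (fun x => G.nu x k) x

lemma bet_sm {W : E3 → ℝ} (h : G.SmA W) (i : Fin 3) : G.Sm (bet G W i) :=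
  Tube.Sm.sum fun k _ => (h.sm.pd k).comp_a'.mul ((G.sm_nu.coord k).pd i)

lemma pd_bet {W : E3 → ℝ} (h : G.SmA W) (i : Fin 3) {x : E3} (hx : x ∈ thickening G.δ Srf.S) :
    pd i W x = pd i W (G.a x) - G.q x * bet G W i x := by
  have hxN := G.thick_sub hx
  have h1 : pd i W x = pd i (fun x => W (G.a x)) x := by
    refine pd_congr ?_ i
    filter_upwards [thick_nhds hx] with y hy using h.inv y hy
  have h2 := sum_n_pd h (G.a_mem x hxN)
  rw [h1, h.sm.pd_comp_a i hxN, bet]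
  simp only [Tube.pd_a hxN, Tube.ei_apply]
  change ∑ k, G.nu x k * _ = 0 at h2
  have h3 : ∀ k : Fin 3, pd k W (G.a x) * ((if k = i then 1 else 0) - G.nu x i * G.nu x k - G.q x * pd i (fun x => G.nu x k) x)
     = (if k = i then pd k W (G.a x) else 0) - G.nu x i * (G.nu x k * pd k W (G.a x)) - G.q x * (pd k W (G.a x) * pd i (fun x => G.nu x k) x) := by
    intro k; split_ifs <;> ring
  simp only [h3, Finset.sum_sub_distrib, ← Finset.mul_sum, h2]
  simp

lemma bet_bound (G : Geo Srf) : ∃ C ≥ 0, ∀ W, G.SmA W → ∀ i, ∀ y ∈ Srf.S,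
    |bet G W i y| ≤ C * ∑ k, |pd k W y| ∧ |lap (fun x => G.q x * bet G W i x) y| ≤ C * ∑ k, |pd k W y| := by
  obtain ⟨C1, hC1, hb1⟩ := G.sm_q.lap.bounds0 G.K_sub
  have h2 : ∀ k i : Fin 3, ∃ C ≥ 0, ∀ x ∈ cthickening G.δ Srf.S, ‖pd i (fun x => G.nu x k) x‖ ≤ C := fun k i =>
    ((G.sm_nu.coord k).pd i).bounds0 G.K_sub
  have h3 : ∀ k i : Fin 3, ∃ C ≥ 0, ∀ x ∈ cthickening G.δ Srf.S, ‖fderiv ℝ (pd i (fun x => G.nu x k)) x‖ ≤ C := fun k i =>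
    ((G.sm_nu.coord k).pd i).fderiv.bounds0 G.K_sub
  choose D hD hDb using h2
  choose E hE hEb using h3
  let D0 := ∑ k, ∑ i, D k i
  let E0 := ∑ k, ∑ i, E k i
  have hD0 : ∀ k i, D k i ≤ D0 := fun k i =>
    (Finset.single_le_sum (f := fun i => D k i) (fun j _ => hD k j) (Finset.mem_univ i)).trans
      (Finset.single_le_sum (f := fun k => ∑ i, D k i) (fun j _ => Finset.sum_nonneg fun l _ => hD j l) (Finset.mem_univ k))
  have hE0 : ∀ k i, E k i ≤ E0 := fun k i =>
    (Finset.single_le_sum (f := fun i => E k i) (fun j _ => hE k j) (Finset.mem_univ i)).trans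
      (Finset.single_le_sum (f := fun k => ∑ i, E k i) (fun j _ => Finset.sum_nonneg fun l _ => hE j l) (Finset.mem_univ k))
  have hD0p : 0 ≤ D0 := (hD 0 0).trans (hD0 0 0)
  have hE0p : 0 ≤ E0 := (hE 0 0).trans (hE0 0 0)
  refine ⟨D0 + C1 * D0 + 2 * E0, by positivity, fun W h i y hy => ?_⟩
  have hyN := G.S_sub hy
  have hyK := self_subset_cthickening (δ := G.δ) _ hy
  set P := ∑ k, |pd k W y| with hP
  have hPp : 0 ≤ P := Finset.sum_nonneg fun k _ => abs_nonneg _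
  have b1 : |bet G W i y| ≤ D0 * P := by
    rw [bet, hP, Finset.mul_sum, G.a_self hy]
    refine (Finset.abs_sum_le_sum_abs _ _).trans (Finset.sum_le_sum fun k _ => ?_)
    rw [abs_mul, mul_comm]
    exact mul_le_mul_of_nonneg_right ((hDb k i y hyK).trans (hD0 k i)) (abs_nonneg _)
  have b2 : |∑ j, pd j G.q y * pd j (bet G W i) y| ≤ E0 * P := by
    have e0 : ∀ j, pd j G.q y = Srf.n y j := by
      intro j; unfold pd; rw [G.dq hyN, inner_ei, G.nu_S hy]
    have e1 : ∀ j, pd j (bet G W i) y = ∑ k, (pd k W y * pd j (pd i (fun x => G.nu x k)) y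
        + pd i (fun x => G.nu x k) y * pd j (fun x => pd k W (G.a x)) y) := by
      intro j
      have : pd j (bet G W i) y = ∑ k, pd j (fun x => pd k W (G.a x) * pd i (fun x => G.nu x k) x) y :=
        pd_sum (fun k _ => ((h.sm.pd k).comp_a'.mul ((G.sm_nu.coord k).pd i)).diff hyN) j
      rw [this]
      refine Finset.sum_congr rfl fun k _ => ?_
      rw [pd_mul (((h.sm.pd k).comp_a').diff hyN) (((G.sm_nu.coord k).pd i).diff hyN), G.a_self hy]
    have e2 : ∀ k, ∑ j, Srf.n y j * pd j (fun x => pd k W (G.a x)) y = 0 := fun k =>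
      sum_n_pd (smA_of_smooth fun x hx => (h.sm.pd k) x (G.S_sub hx)) hy
    have e3 : ∀ k, ∑ j, Srf.n y j * pd j (pd i (fun x => G.nu x k)) y = fderiv ℝ (pd i (fun x => G.nu x k)) y (Srf.n y) :=
      fun k => (fderiv_eq_pd _ _ _).symm
    have e4 : ∑ j, pd j G.q y * pd j (bet G W i) y = ∑ k, pd k W y * fderiv ℝ (pd i (fun x => G.nu x k)) y (Srf.n y) := by
      simp only [e0, e1, Finset.mul_sum]
      rw [Finset.sum_comm]
      refine Finset.sum_congr rfl fun k _ => ?_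
      have : ∀ j, Srf.n y j * (pd k W y * pd j (pd i (fun x => G.nu x k)) y
        + pd i (fun x => G.nu x k) y * pd j (fun x => pd k W (G.a x)) y) =
        pd k W y * (Srf.n y j * pd j (pd i (fun x => G.nu x k)) y) + pd i (fun x => G.nu x k) y * (Srf.n y j * pd j (fun x => pd k W (G.a x)) y) := by
        intro j; ring
      simp only [this, Finset.sum_add_distrib, ← Finset.mul_sum, e2, e3]
      ring
    rw [e4, hP, Finset.mul_sum]
    refine (Finset.abs_sum_le_sum_abs _ _).trans (Finset.sum_le_sum fun k _ => ?_)
    rw [abs_mul, mul_comm]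
    refine mul_le_mul_of_nonneg_right ?_ (abs_nonneg _)
    have := (fderiv ℝ (pd i (fun x => G.nu x k)) y).le_opNorm (Srf.n y)
    rw [Srf.n_unit y hy, mul_one] at this
    exact this.trans ((hEb k i y hyK).trans (hE0 k i))
  constructor
  · refine b1.trans (mul_le_mul_of_nonneg_right ?_ hPp)
    have : 0 ≤ C1 * D0 := by positivity
    linarith
  · rw [G.sm_q.lap_mul (bet_sm h i) hyN, G.q_S hy, zero_mul, zero_add]
    refine (abs_add_le _ _).trans ?_
    rw [abs_mul, abs_mul, abs_two]
    have b3 : |bet G W i y| * |lap G.q y| ≤ D0 * P * C1 :=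
      mul_le_mul b1 (hb1 y hyK) (abs_nonneg _) (by positivity)
    have : 0 ≤ D0 * P := by positivity
    nlinarith

theorem H2 (G : Geo Srf) : ∃ C ≥ 0, ∀ W, G.SmA W →
    ∫ y, ∑ i, ∑ j, pd j (pd i W) y ^ 2 ∂Srf.mu ≤ C * ∫ y, (W y - lap W y) ^ 2 ∂Srf.mu := by
  obtain ⟨C, hC, hb⟩ := bet_bound G
  refine ⟨2 * (4 + 3 * C) + 18 * C ^ 2 * 3, by positivity, fun W h => ?_⟩
  obtain ⟨en1, en2⟩ := energy h
  have hV : ∀ i, G.SmA (fun x => pd i W (G.a x)) := fun i => smA_of_smooth fun x hx => (h.sm.pd i) x (G.S_sub hx)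
  set V : Fin 3 → E3 → ℝ := fun i x => pd i W (G.a x) with hVd
  have hΛ : G.SmA (fun x => lap W (G.a x)) := smA_of_smooth fun x hx => h.sm.lap x (G.S_sub hx)
  set Λ : E3 → ℝ := fun x => lap W (G.a x) with hΛd
  set Q : Fin 3 → E3 → ℝ := fun i x => G.q x * bet G W i x with hQd
  have hQ : ∀ i, G.Sm (Q i) := fun i => G.sm_q.mul (bet_sm h i)
  -- local identity
  have hloc : ∀ i, ∀ y ∈ Srf.S, pd i W =ᶠ[𝓝 y] fun x => V i x - Q i x := by
    intro i y hy
    filter_upwards [thick_nhds (S_thick G.δ_pos hy)] with x hx using pd_bet h i hx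
  have hlapV : ∀ i, ∀ y ∈ Srf.S, lap (V i) y = pd i (lap W) y + lap (Q i) y := by
    intro i y hy
    have := lap_congr (hloc i y hy)
    rw [(hV i).sm.lap_sub (hQ i) (G.S_sub hy), ← h.sm.pd_lap i (G.S_sub hy)] at this
    linarith
  have hpdV : ∀ i j, ∀ y ∈ Srf.S, pd j (pd i W) y = pd j (V i) y - Srf.n y j * bet G W i y := by
    intro i j y hy
    have hyN := G.S_sub hy
    rw [pd_congr (hloc i y hy) j, pd_sub ((hV i).sm.diff hyN) ((hQ i).diff hyN)]
    congr 1
    rw [hQd, pd_mul (G.sm_q.diff hyN) ((bet_sm h i).diff hyN), G.q_S hy]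
    have : pd j G.q y = Srf.n y j := by unfold pd; rw [G.dq hyN, inner_ei, G.nu_S hy]
    rw [this]; ring
  have hpdΛ : ∀ y ∈ Srf.S, ∑ i, pd i Λ y * pd i W y = ∑ i, pd i (lap W) y * pd i W y := by
    intro y hy
    have hyN := G.S_sub hy
    have e : ∀ i, pd i Λ y = pd i (lap W) y - Srf.n y i * ∑ k, Srf.n y k * pd k (lap W) y := by
      intro i
      rw [hΛd, h.sm.lap.pd_comp_a i hyN, G.a_self hy]
      simp only [Tube.pd_a hyN, G.q_S hy, G.nu_S hy, Tube.ei_apply]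
      have : ∀ k : Fin 3, pd k (lap W) y * ((if k = i then 1 else 0) - Srf.n y i * Srf.n y k - 0 * pd i (fun x => G.nu x k) y)
        = (if k = i then pd k (lap W) y else 0) - Srf.n y i * (Srf.n y k * pd k (lap W) y) := by
        intro k; split_ifs <;> ring
      simp only [this, Finset.sum_sub_distrib, ← Finset.mul_sum]
      simp
    have e2 := sum_n_pd h hy
    set s := ∑ k, Srf.n y k * pd k (lap W) y
    have e3 : ∀ i, pd i Λ y * pd i W y = pd i (lap W) y * pd i W y - s * (Srf.n y i * pd i W y) := by
      intro i; rw [e]; ring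
    simp only [e3, Finset.sum_sub_distrib, ← Finset.mul_sum, e2]; ring
  -- integrals
  have I1 : ∀ i, ∫ y, ∑ j, pd j (V i) y * pd j (V i) y ∂Srf.mu = - ∫ y, V i y * lap (V i) y ∂Srf.mu :=
    fun i => (green_gr (hV i).lipA (hV i)).2.2
  have I2 : ∫ y, ∑ i, pd i (lap W) y * pd i W y ∂Srf.mu = - ∫ y, lap W y ^ 2 ∂Srf.mu := by
    have := (green_gr hΛ.lipA h).2.2
    have e1 : ∫ y, ∑ i, pd i (lap W) y * pd i W y ∂Srf.mu = ∫ y, ∑ i, pd i Λ y * pd i W y ∂Srf.mu := by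
      refine integral_congr_ae ?_
      filter_upwards [ae_restrict_mem S_meas] with y hy using (hpdΛ y hy).symm
    rw [e1, this]
    congr 1
    refine integral_congr_ae ?_
    filter_upwards [ae_restrict_mem S_meas] with y hy
    rw [hΛd]; simp only [G.a_self hy]; ring
  have sumsm : G.Sm (fun y => ∑ k, pd k W y ^ 2) := Tube.Sm.sum fun k _ => (h.sm.pd k).sq
  have I3 : ∫ y, ∑ i, ∑ j, pd j (V i) y * pd j (V i) y ∂Srf.mu ≤
      ∫ y, lap W y ^ 2 ∂Srf.mu + 3 * C * ∫ y, ∑ k, pd k W y ^ 2 ∂Srf.mu := by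
    have k1 : ∀ i ∈ Finset.univ, Integrable (fun y => ∑ j, pd j (V i) y * pd j (V i) y) Srf.mu := fun i _ =>
      (green_gr (hV i).lipA (hV i)).1
    have k2 : ∀ i ∈ Finset.univ, Integrable (fun y => V i y * lap (V i) y) Srf.mu := fun i _ =>
      (green_gr (hV i).lipA (hV i)).2.1
    rw [integral_finsetSum _ k1]
    simp only [I1]
    rw [Finset.sum_neg_distrib, ← integral_finsetSum _ k2]
    have e1 : ∫ y, ∑ i, V i y * lap (V i) y ∂Srf.mu = ∫ y, (∑ i, pd i (lap W) y * pd i W y + ∑ i, pd i W y * lap (Q i) y) ∂Srf.mu := by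
      refine integral_congr_ae ?_
      filter_upwards [ae_restrict_mem S_meas] with y hy
      rw [← Finset.sum_add_distrib]
      refine Finset.sum_congr rfl fun i _ => ?_
      rw [hlapV i y hy, hVd]; simp only [G.a_self hy]; ring
    have s1 : G.Sm (fun y => ∑ i, pd i (lap W) y * pd i W y) := Tube.Sm.sum fun i _ => (h.sm.lap.pd i).mul (h.sm.pd i)
    have s2 : G.Sm (fun y => ∑ i, pd i W y * lap (Q i) y) := Tube.Sm.sum fun i _ => (h.sm.pd i).mul (hQ i).lap
    rw [e1, integral_add (sm_int s1) (sm_int s2), I2, neg_add, neg_neg, ← integral_const_mul, ← integral_neg]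
    refine add_le_add le_rfl ?_
    refine integral_mono_ae (sm_int s2).neg ((sm_int sumsm).const_mul _) ?_
    filter_upwards [ae_restrict_mem S_meas] with y hy
    have hq : ∀ i, |pd i W y * lap (Q i) y| ≤ |pd i W y| * (C * ∑ k, |pd k W y|) := fun i => by
      rw [abs_mul]; exact mul_le_mul_of_nonneg_left ((hb W h i y hy).2) (abs_nonneg _)
    have h4 : -∑ i, pd i W y * lap (Q i) y ≤ ∑ i, |pd i W y| * (C * ∑ k, |pd k W y|) := by
      refine (neg_le_abs _).trans ((Finset.abs_sum_le_sum_abs _ _).trans (Finset.sum_le_sum fun i _ => hq i))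
    refine h4.trans ?_
    rw [← Finset.sum_mul]
    simp only [Fin.sum_univ_three, ← sq_abs (pd _ W y)]
    generalize |pd 0 W y| = a
    generalize |pd 1 W y| = b
    generalize |pd 2 W y| = c
    have : (a + b + c) * (a+b+c) ≤ 3 * (a^2+b^2+c^2) := by
      nlinarith [sq_nonneg (a-b), sq_nonneg (b-c), sq_nonneg (a-c)]
    nlinarith
  have s3 : G.Sm (fun y => ∑ i, ∑ j, pd j (pd i W) y ^ 2) := Tube.Sm.sum fun i _ => Tube.Sm.sum fun j _ => ((h.sm.pd i).pd j).sq
  have s4 : G.Sm (fun y => ∑ i, ∑ j, pd j (V i) y * pd j (V i) y) :=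
    Tube.Sm.sum fun i _ => Tube.Sm.sum fun j _ => ((hV i).sm.pd j).mul ((hV i).sm.pd j)
  have I4 : ∫ y, ∑ i, ∑ j, pd j (pd i W) y ^ 2 ∂Srf.mu ≤
      ∫ y, (2 * ∑ i, ∑ j, pd j (V i) y * pd j (V i) y + 18 * C ^ 2 * 3 * ∑ k, pd k W y ^ 2) ∂Srf.mu := by
    refine integral_mono_ae (sm_int s3) (((sm_int s4).const_mul _).add ((sm_int sumsm).const_mul _)) ?_
    filter_upwards [ae_restrict_mem S_meas] with y hy
    have hP : (∑ k, |pd k W y|) ^ 2 ≤ 3 * ∑ k, pd k W y ^ 2 := by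
      simp only [Fin.sum_univ_three, ← sq_abs (pd _ W y)]
      generalize |pd 0 W y| = a
      generalize |pd 1 W y| = b
      generalize |pd 2 W y| = c
      nlinarith [sq_nonneg (a-b), sq_nonneg (b-c), sq_nonneg (a-c)]
    have hbb : ∀ i, bet G W i y ^ 2 ≤ C ^ 2 * (3 * ∑ k, pd k W y ^ 2) := by
      intro i
      rw [← sq_abs]
      calc |bet G W i y| ^ 2 ≤ (C * ∑ k, |pd k W y|) ^ 2 := by
            gcongr; exact (hb W h i y hy).1
        _ = C ^ 2 * (∑ k, |pd k W y|) ^ 2 := by ring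
        _ ≤ _ := by gcongr
    have hij : ∀ i j, pd j (pd i W) y ^ 2 ≤ 2 * (pd j (V i) y * pd j (V i) y) + 2 * (C ^ 2 * (3 * ∑ k, pd k W y ^ 2)) := by
      intro i j
      rw [hpdV i j y hy]
      have h1 : (Srf.n y j) ^ 2 ≤ 1 := by
        have := abs_coord_le (Srf.n y) j
        rw [Srf.n_unit y hy] at this
        rw [← sq_abs]; exact pow_le_one₀ (abs_nonneg _) this
      have h2 := hbb i
      have h3 : (Srf.n y j * bet G W i y) ^ 2 ≤ C ^ 2 * (3 * ∑ k, pd k W y ^ 2) := by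
        rw [mul_pow]
        calc _ ≤ 1 * bet G W i y ^ 2 := by gcongr
          _ ≤ _ := by rw [one_mul]; exact h2
      nlinarith [sq_nonneg (pd j (V i) y + Srf.n y j * bet G W i y)]
    calc ∑ i, ∑ j, pd j (pd i W) y ^ 2 ≤ ∑ i, ∑ j, (2 * (pd j (V i) y * pd j (V i) y) + 2 * (C ^ 2 * (3 * ∑ k, pd k W y ^ 2))) :=
          Finset.sum_le_sum fun i _ => Finset.sum_le_sum fun j _ => hij i j
      _ = _ := by
        simp only [Finset.sum_add_distrib, ← Finset.mul_sum]
        simp; ring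
  rw [integral_add ((sm_int s4).const_mul _) ((sm_int sumsm).const_mul _), integral_const_mul, integral_const_mul] at I4
  have I5 : ∫ y, lap W y ^ 2 ∂Srf.mu ≤ 4 * ∫ y, (W y - lap W y) ^ 2 ∂Srf.mu := by
    have j1 : Integrable (fun y => W y ^ 2) Srf.mu := sm_int h.sm.sq
    have j2 : Integrable (fun y => (W y - lap W y) ^ 2) Srf.mu := sm_int (h.sm.sub h.sm.lap).sq
    have : ∫ y, lap W y ^ 2 ∂Srf.mu ≤ ∫ y, (2 * W y ^ 2 + 2 * (W y - lap W y) ^ 2) ∂Srf.mu := by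
      refine integral_mono (sm_int h.sm.lap.sq) ((j1.const_mul _).add (j2.const_mul _)) fun y => ?_
      simp only
      nlinarith [sq_nonneg (W y + (W y - lap W y))]
    rw [integral_add (j1.const_mul _) (j2.const_mul _), integral_const_mul, integral_const_mul] at this
    linarith
  set X := ∫ y, (W y - lap W y) ^ 2 ∂Srf.mu
  set Y := ∫ y, ∑ k, pd k W y ^ 2 ∂Srf.mu
  have z1 : 3 * C * Y ≤ 3 * C * X := by gcongr
  have z2 : 18 * C ^ 2 * 3 * Y ≤ 18 * C ^ 2 * 3 * X := by gcongr
  linarith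

end Geo
end

open MeasureTheory Metric
open scoped RealInnerProductSpace ENNReal NNReal Topology

noncomputable section

/-- bump function -/
def eta0 : ContDiffBump (0 : ℝ) := ⟨1, 2, by norm_num, by norm_num⟩
def eta (s : ℝ) : ℝ := eta0 s
lemma eta_smooth : ContDiff ℝ ((⊤ : ℕ∞) : WithTop ℕ∞) eta := eta0.contDiff
lemma eta_nonneg (s : ℝ) : 0 ≤ eta s := eta0.nonneg
lemma eta_le (s : ℝ) : eta s ≤ 1 := eta0.le_one
lemma eta_one {s : ℝ} (h : |s| ≤ 1) : eta s = 1 := eta0.one_of_mem_closedBall (by simpa [eta0] using h)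
lemma eta_zero {s : ℝ} (h : 2 ≤ |s|) : eta s = 0 := eta0.zero_of_le_dist (by simpa [Real.dist_eq, eta0] using h)
def eta1 : ℝ → ℝ := deriv eta
def eta2 : ℝ → ℝ := deriv eta1
lemma eta1_smooth : ContDiff ℝ ((⊤ : ℕ∞) : WithTop ℕ∞) eta1 := (contDiff_infty_iff_deriv.1 eta_smooth).2
lemma eta2_smooth : ContDiff ℝ ((⊤ : ℕ∞) : WithTop ℕ∞) eta2 := (contDiff_infty_iff_deriv.1 eta1_smooth).2
lemma eta_d (s : ℝ) : HasDerivAt eta (eta1 s) s := (eta_smooth.differentiable (by simp) s).hasDerivAt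
lemma eta1_d (s : ℝ) : HasDerivAt eta1 (eta2 s) s := (eta1_smooth.differentiable (by simp) s).hasDerivAt
lemma eta1_zero {s : ℝ} (h : 2 < |s|) : eta1 s = 0 := by
  have : eta =ᶠ[𝓝 s] fun _ => 0 := by
    filter_upwards [(isOpen_lt continuous_const continuous_abs).mem_nhds h] with t ht using eta_zero (le_of_lt ht)
  unfold eta1; rw [this.deriv_eq]; simp
lemma eta2_zero {s : ℝ} (h : 2 < |s|) : eta2 s = 0 := by
  have : eta1 =ᶠ[𝓝 s] fun _ => 0 := by
    filter_upwards [(isOpen_lt continuous_const continuous_abs).mem_nhds h] with t ht using eta1_zero ht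
  unfold eta2; rw [this.deriv_eq]; simp
lemma eta_bound : ∃ C ≥ 0, ∀ s, |eta1 s| ≤ C ∧ |eta2 s| ≤ C := by
  obtain ⟨C1, h1⟩ := (isCompact_Icc (a := (-2:ℝ)) (b := 2)).exists_bound_of_continuousOn eta1_smooth.continuous.continuousOn
  obtain ⟨C2, h2⟩ := (isCompact_Icc (a := (-2:ℝ)) (b := 2)).exists_bound_of_continuousOn eta2_smooth.continuous.continuousOn
  refine ⟨max (max C1 C2) 0, le_max_right _ _, fun s => ?_⟩
  by_cases hs : 2 < |s|
  · rw [eta1_zero hs, eta2_zero hs]; simp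
  · have : s ∈ Set.Icc (-2:ℝ) 2 := abs_le.1 (not_lt.1 hs)
    exact ⟨(h1 s this).trans ((le_max_left _ _).trans (le_max_left _ _)), (h2 s this).trans ((le_max_right _ _).trans (le_max_left _ _))⟩

/-- the kernel -/
def ker (c : ℝ) (z : E3) : ℝ := eta (c * ‖z‖ ^ 2)

lemma ker_smooth (c : ℝ) : ContDiff ℝ ((⊤ : ℕ∞) : WithTop ℕ∞) (ker c) :=
  eta_smooth.comp (contDiff_const.mul (contDiff_norm_sq ℝ))

lemma pd_normsq (c : ℝ) (z : E3) : HasFDerivAt (fun z : E3 => c * ‖z‖ ^ 2) (c • (2 • innerSL ℝ z)) z :=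
  (hasStrictFDerivAt_norm_sq z).hasFDerivAt.const_mul c

lemma pd_radial {θ θ' : ℝ → ℝ} (h : ∀ s, HasDerivAt θ (θ' s) s) (c : ℝ) (k : Fin 3) (z : E3) :
    pd k (fun z => θ (c * ‖z‖ ^ 2)) z = 2 * c * z k * θ' (c * ‖z‖ ^ 2) := by
  have h1 := (h (c * ‖z‖ ^ 2)).comp_hasFDerivAt z (pd_normsq c z)
  have h2 : fderiv ℝ (fun z => θ (c * ‖z‖ ^ 2)) z = _ := h1.fderiv
  unfold pd; rw [h2]
  simp [inner_ei]
  ring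

lemma pd_ker (c : ℝ) (k : Fin 3) : pd k (ker c) = fun z => 2 * c * z k * eta1 (c * ‖z‖ ^ 2) := by
  ext z; exact pd_radial eta_d c k z

lemma pd_pd_ker (c : ℝ) (l k : Fin 3) (z : E3) : pd l (pd k (ker c)) z =
    4 * c ^ 2 * z k * z l * eta2 (c * ‖z‖ ^ 2) + (if l = k then 2 * c * eta1 (c * ‖z‖ ^ 2) else 0) := by
  rw [pd_ker]
  have hd : DifferentiableAt ℝ (fun z : E3 => 2 * c * z k) z :=
    ((EuclideanSpace.proj (𝕜 := ℝ) k).differentiableAt).const_mul _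
  have hd' : DifferentiableAt ℝ (fun z : E3 => eta1 (c * ‖z‖ ^ 2)) z :=
    ((eta1_smooth.comp (contDiff_const.mul (contDiff_norm_sq ℝ))).differentiable (by simp)) z
  rw [pd_mul hd hd', pd_radial eta1_d]
  have : pd l (fun z : E3 => 2 * c * z k) z = 2 * c * if l = k then 1 else 0 := by
    have h1 := ((EuclideanSpace.proj (𝕜 := ℝ) k).hasFDerivAt (x := z)).const_mul (2 * c)
    have h2 : fderiv ℝ (fun z : E3 => 2 * c * z k) z = _ := h1.fderiv
    unfold pd; rw [h2]; simp [ei]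
    grind
  rw [this]
  split_ifs <;> ring

lemma ker_cpt {c : ℝ} (hc : 0 < c) : HasCompactSupport (ker c) := by
  refine HasCompactSupport.of_support_subset_isCompact (isCompact_closedBall (0 : E3) (2 / c + 1)) ?_
  intro z hz
  rw [mem_closedBall_zero_iff]
  by_contra hlt
  push Not at hlt
  refine hz (eta_zero ?_)
  have h1 : 2 / c < ‖z‖ ^ 2 := by
    have : 0 < 2 / c := by positivity
    nlinarith
  rw [div_lt_iff₀ hc] at h1
  rw [abs_of_nonneg (by positivity)]; nlinarith

lemma pd_cpt {F : E3 → ℝ} (h : HasCompactSupport F) (k : Fin 3) : HasCompactSupport (pd k F) := by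
  refine (h.fderiv (𝕜 := ℝ)).comp_left (g := fun L : E3 →L[ℝ] ℝ => L (ei k)) (by simp)

lemma pd_smooth {F : E3 → ℝ} (h : ContDiff ℝ ((⊤ : ℕ∞) : WithTop ℕ∞) F) (k : Fin 3) : ContDiff ℝ ((⊤ : ℕ∞) : WithTop ℕ∞) (pd k F) :=
  (h.fderiv_right (m := ((⊤ : ℕ∞) : WithTop ℕ∞)) (by norm_cast)).clm_apply contDiff_const

/-- smoothing by convolution on the surface -/
def cv (Srf : SmoothSurface) (ψ g : E3 → ℝ) (x : E3) : ℝ := ∫ y, ψ y * g (x - y) ∂Srf.mu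

lemma cv_smooth (Srf : SmoothSurface) {ψ g : E3 → ℝ} (hψ : Integrable ψ Srf.mu) (hg : ContDiff ℝ ((⊤ : ℕ∞) : WithTop ℕ∞) g)
    (hc : HasCompactSupport g) : ContDiff ℝ ((⊤ : ℕ∞) : WithTop ℕ∞) (cv Srf ψ g) :=
  hc.contDiff_convolution_right (ContinuousLinearMap.lsmul ℝ ℝ) hψ.locallyIntegrable hg

lemma pd_cv (Srf : SmoothSurface) [IsFiniteMeasure Srf.mu] {ψ g : E3 → ℝ} (hψ : Integrable ψ Srf.mu) (hg : ContDiff ℝ ((⊤ : ℕ∞) : WithTop ℕ∞) g)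
    (hc : HasCompactSupport g) (k : Fin 3) : pd k (cv Srf ψ g) = cv Srf ψ (pd k g) := by
  ext x
  have hgc : Continuous (fderiv ℝ g) := hg.continuous_fderiv (by simp)
  obtain ⟨C, hC⟩ := (hc.fderiv (𝕜 := ℝ)).exists_bound_of_continuous hgc
  obtain ⟨C', hC'⟩ := hc.exists_bound_of_continuous hg.continuous
  have hm : ∀ x : E3, Continuous (fun y => g (x - y)) := fun x => hg.continuous.comp (by fun_prop)
  have hm' : Continuous (fun y => fderiv ℝ g (x - y)) := hgc.comp (by fun_prop)
  have hF' : AEStronglyMeasurable (fun y => ψ y • fderiv ℝ g (x - y)) Srf.mu := hψ.1.smul hm'.aestronglyMeasurable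
  have hbd : ∀ᵐ y ∂Srf.mu, ∀ x ∈ (Set.univ : Set E3), ‖ψ y • fderiv ℝ g (x - y)‖ ≤ C * ‖ψ y‖ := by
    refine Filter.Eventually.of_forall fun y x _ => ?_
    rw [norm_smul, mul_comm]
    exact mul_le_mul_of_nonneg_right (hC _) (norm_nonneg _)
  have h1 := hasFDerivAt_integral_of_dominated_of_fderiv_le (𝕜 := ℝ) (μ := Srf.mu) (F := fun x y => ψ y * g (x - y))
    (F' := fun x y => ψ y • fderiv ℝ g (x - y)) (x₀ := x) (s := Set.univ) (bound := fun y => C * ‖ψ y‖) Filter.univ_mem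
    (Filter.Eventually.of_forall fun x => hψ.1.mul (hm x).aestronglyMeasurable)
    (hψ.mul_bdd (c := C') (hm x).aestronglyMeasurable (Filter.Eventually.of_forall fun y => hC' _)) hF' hbd
    (hψ.norm.const_mul C) (Filter.Eventually.of_forall fun y x _ => by
      have h2 : HasFDerivAt g (fderiv ℝ g (x - y)) (x - y) := (hg.differentiable (by simp) _).hasFDerivAt
      have h3 : HasFDerivAt (fun x => g (x - y)) (fderiv ℝ g (x - y)) x := by
        have := h2.comp x ((hasFDerivAt_id x).sub_const y)
        rw [ContinuousLinearMap.comp_id] at this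
        exact this
      exact h3.const_mul _)
  have hI : Integrable (fun y => ψ y • fderiv ℝ g (x - y)) Srf.mu :=
    (hψ.norm.const_mul C).mono' hF' (hbd.mono fun y hy => hy x trivial)
  have h2 : fderiv ℝ (cv Srf ψ g) x = _ := h1.fderiv
  rw [pd, h2, ContinuousLinearMap.integral_apply hI]
  rfl

lemma pd_shift (g : E3 → ℝ) (x : E3) (k : Fin 3) : pd k (fun y => g (y - x)) = fun y => pd k g (y - x) := by
  ext y; unfold pd; rw [fderiv_comp_sub]

lemma cv_int (Srf : SmoothSurface) {ψ g : E3 → ℝ} (hψ : Integrable ψ Srf.mu) (hg : Continuous g)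
    (hc : HasCompactSupport g) (x : E3) : Integrable (fun y => ψ y * g (x - y)) Srf.mu := by
  obtain ⟨C, hC⟩ := hc.exists_bound_of_continuous hg
  exact hψ.mul_bdd (c := C) (by fun_prop : Continuous fun y => g (x - y)).aestronglyMeasurable (Filter.Eventually.of_forall fun y => hC _)

end

open MeasureTheory Metric
open scoped RealInnerProductSpace ENNReal NNReal Topology

noncomputable section

lemma cs_lint {α : Type*} [MeasurableSpace α] (μ : Measure α) {f g : α → ℝ≥0∞} (hf : AEMeasurable f μ) (hg : AEMeasurable g μ) :
    (∫⁻ x, f x * g x ∂μ) ^ 2 ≤ (∫⁻ x, f x ^ 2 ∂μ) * (∫⁻ x, g x ^ 2 ∂μ) := by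
  have h := ENNReal.lintegral_mul_le_Lp_mul_Lq μ Real.HolderConjugate.two_two hf hg
  have h2 := pow_le_pow_left' h 2
  rw [mul_pow, ← ENNReal.rpow_natCast, ← ENNReal.rpow_natCast ((∫⁻ a, f a ^ (2 : ℝ) ∂μ) ^ _),
    ← ENNReal.rpow_natCast ((∫⁻ a, g a ^ (2 : ℝ) ∂μ) ^ _), ← ENNReal.rpow_mul, ← ENNReal.rpow_mul] at h2
  simpa using h2

set_option maxHeartbeats 400000 in
/-- Schur test -/
lemma schur_gen {X : Type*} [MetricSpace X] [MeasurableSpace X] [BorelSpace X] [SecondCountableTopology X] (μ : Measure X) [IsFiniteMeasure μ] (S : Set X) {ψ : X → ℝ} (hψ : Measurable ψ) {K : X → X → ℝ} {κ A r : ℝ} (hκ : 0 ≤ κ) (hA : 0 ≤ A)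
    (hK : ∀ x ∈ S, ∀ y ∈ S, |K x y| ≤ κ) (hK0 : ∀ x ∈ S, ∀ y ∈ S, r < dist x y → K x y = 0)
    (hS : ∀ᵐ x ∂μ, x ∈ S)
    (hμ : ∀ z ∈ S, μ (closedBall z r) ≤ ENNReal.ofReal A) :
    ∫⁻ x, ‖∫ y, ψ y * K x y ∂μ‖ₑ ^ 2 ∂μ ≤ ENNReal.ofReal (κ * A) ^ 2 * ∫⁻ y, ‖ψ y‖ₑ ^ 2 ∂μ := by
  set I : X → X → ℝ≥0∞ := fun x y => ({p : X × X | dist p.1 p.2 ≤ r}.indicator 1 (x, y)) with hI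
  have hIm : Measurable (Function.uncurry I) := by
    have : Function.uncurry I = {p : X × X | dist p.1 p.2 ≤ r}.indicator 1 := by ext ⟨x, y⟩; rfl
    rw [this]
    exact measurable_one.indicator (isClosed_le (by fun_prop) continuous_const).measurableSet
  have hI2 : ∀ x y, I x y ^ 2 = I x y := by
    intro x y
    by_cases h : dist x y ≤ r <;> simp [hI, h]
  have hIx : ∀ x, Measurable (I x) := fun x => hIm.comp measurable_prodMk_left
  have hintg : ∀ x, ∫⁻ y, I x y ∂μ = μ (closedBall x r) := by
    intro x
    have : I x = (closedBall x r).indicator 1 := by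
      ext y
      by_cases h : dist x y ≤ r
      · have h' : y ∈ closedBall x r := by rwa [mem_closedBall, dist_comm]
        simp [hI, h, h']
      · have h' : y ∉ closedBall x r := by rwa [mem_closedBall, dist_comm]
        simp only [hI]
        rw [Set.indicator_of_notMem h', Set.indicator_of_notMem (by simpa using h)]
    rw [this, lintegral_indicator_one measurableSet_closedBall]
  have hsymm : ∀ x y, I x y = I y x := by
    intro x y
    simp only [hI, Set.indicator_apply, Set.mem_ofPred_eq, dist_comm, Pi.one_apply]
  have hpt : ∀ x ∈ S, ‖∫ y, ψ y * K x y ∂μ‖ₑ ^ 2 ≤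
      ENNReal.ofReal κ ^ 2 * (ENNReal.ofReal A * ∫⁻ y, I x y * ‖ψ y‖ₑ ^ 2 ∂μ) := by
    intro x hx
    have h1 : ‖∫ y, ψ y * K x y ∂μ‖ₑ ≤ ENNReal.ofReal κ * ∫⁻ y, I x y * (I x y * ‖ψ y‖ₑ) ∂μ := by
      refine (enorm_integral_le_lintegral_enorm _).trans ?_
      rw [← lintegral_const_mul' _ _ (by finiteness)]
      refine lintegral_mono_ae ?_
      filter_upwards [hS] with y hy
      by_cases h : dist x y ≤ r
      · have : I x y = 1 := by simp [hI, h]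
        rw [this, one_mul, one_mul, enorm_mul, mul_comm]
        gcongr
        rw [Real.enorm_eq_ofReal_abs]
        exact ENNReal.ofReal_le_ofReal (hK x hx y hy)
      · rw [hK0 x hx y hy (not_le.1 h)]; simp
    calc ‖∫ y, ψ y * K x y ∂μ‖ₑ ^ 2 ≤ (ENNReal.ofReal κ * ∫⁻ y, I x y * (I x y * ‖ψ y‖ₑ) ∂μ) ^ 2 := by gcongr
      _ ≤ ENNReal.ofReal κ ^ 2 * ((∫⁻ y, I x y ^ 2 ∂μ) * ∫⁻ y, (I x y * ‖ψ y‖ₑ) ^ 2 ∂μ) := by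
        rw [mul_pow]
        gcongr
        exact cs_lint _ (hIx x).aemeasurable ((hIx x).mul hψ.enorm).aemeasurable
      _ ≤ _ := by
        gcongr
        · simp only [hI2, hintg]; exact hμ x hx
        · rw [mul_pow, hI2]
  calc ∫⁻ x, ‖∫ y, ψ y * K x y ∂μ‖ₑ ^ 2 ∂μ
      ≤ ∫⁻ x, ENNReal.ofReal κ ^ 2 * (ENNReal.ofReal A * ∫⁻ y, I x y * ‖ψ y‖ₑ ^ 2 ∂μ) ∂μ := by
        refine lintegral_mono_ae ?_
        filter_upwards [hS] with x hx using hpt x hx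
    _ = ENNReal.ofReal κ ^ 2 * (ENNReal.ofReal A * ∫⁻ x, ∫⁻ y, I x y * ‖ψ y‖ₑ ^ 2 ∂μ ∂μ) := by
        rw [lintegral_const_mul' _ _ (by finiteness), lintegral_const_mul' _ _ (by finiteness)]
    _ = ENNReal.ofReal κ ^ 2 * (ENNReal.ofReal A * ∫⁻ y, ∫⁻ x, I x y * ‖ψ y‖ₑ ^ 2 ∂μ ∂μ) := by
        rw [lintegral_lintegral_swap]
        refine Measurable.aemeasurable ?_
        exact hIm.mul ((hψ.enorm.pow_const 2).comp measurable_snd)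
    _ ≤ ENNReal.ofReal κ ^ 2 * (ENNReal.ofReal A * ∫⁻ y, ENNReal.ofReal A * ‖ψ y‖ₑ ^ 2 ∂μ) := by
        refine mul_le_mul le_rfl (mul_le_mul le_rfl ?_ (zero_le) (zero_le)) (zero_le) (zero_le)
        refine lintegral_mono_ae ?_
        filter_upwards [hS] with y hy
        have : ∀ x, I x y * ‖ψ y‖ₑ ^ 2 = ‖ψ y‖ₑ ^ 2 * I y x := fun x => by rw [hsymm, mul_comm]
        simp only [this]
        rw [lintegral_const_mul _ (hIx y), hintg, mul_comm]
        gcongr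
        exact hμ y hy
    _ = _ := by
        rw [lintegral_const_mul' _ _ (by finiteness), ENNReal.ofReal_mul hκ]; ring

namespace Geo
variable {Srf : SmoothSurface}

/-- real version of the Schur test -/
lemma schur_real (G : Geo Srf) {ψ : E3 → ℝ} (hψ : Measurable ψ) (hψ2 : Integrable (fun y => ψ y ^ 2) Srf.mu) {K : E3 → E3 → ℝ} {κ A r : ℝ} (hκ : 0 ≤ κ) (hA : 0 ≤ A)
    (hK : ∀ x ∈ Srf.S, ∀ y ∈ Srf.S, |K x y| ≤ κ) (hK0 : ∀ x ∈ Srf.S, ∀ y ∈ Srf.S, r < dist x y → K x y = 0)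
    (hμ : ∀ z ∈ Srf.S, Srf.mu.real (closedBall z r) ≤ A) :
    ∫ x, (∫ y, ψ y * K x y ∂Srf.mu) ^ 2 ∂Srf.mu ≤ (κ * A) ^ 2 * ∫ y, ψ y ^ 2 ∂Srf.mu := by
  have := G.mu_finite
  have h := schur_gen Srf.mu Srf.S hψ hκ hA hK hK0 (ae_restrict_mem Geo.S_meas) (fun z hz => by
    rw [← ENNReal.ofReal_toReal (measure_ne_top Srf.mu _)]
    exact ENNReal.ofReal_le_ofReal (hμ z hz))
  have e1 : ∀ f : E3 → ℝ, ∀ x, ‖f x‖ₑ ^ 2 = ENNReal.ofReal (f x ^ 2) := by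
    intro f x
    rw [Real.enorm_eq_ofReal_abs, ← ENNReal.ofReal_pow (abs_nonneg _), sq_abs]
  by_cases hi : Integrable (fun x => (∫ y, ψ y * K x y ∂Srf.mu) ^ 2) Srf.mu
  · rw [lintegral_congr (e1 _), lintegral_congr (e1 _), ← ofReal_integral_eq_lintegral_ofReal hi (Filter.Eventually.of_forall fun x => sq_nonneg _),
      ← ofReal_integral_eq_lintegral_ofReal hψ2 (Filter.Eventually.of_forall fun x => sq_nonneg _), ← ENNReal.ofReal_pow (by positivity),
      ← ENNReal.ofReal_mul (by positivity)] at h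
    exact (ENNReal.ofReal_le_ofReal_iff (mul_nonneg (by positivity) (integral_nonneg fun y => sq_nonneg _))).1 h
  · rw [integral_undef hi]
    exact mul_nonneg (by positivity) (integral_nonneg fun y => sq_nonneg _)

end Geo
end

open MeasureTheory Metric
open scoped RealInnerProductSpace ENNReal NNReal Topology

noncomputable section

namespace Geo
variable {Srf : SmoothSurface}

/-- the surface Laplacian of the kernel -/
def Lop (G : Geo Srf) (c : ℝ) (x z : E3) : ℝ :=
  4 * c ^ 2 * eta2 (c * ‖z‖ ^ 2) * (‖z‖ ^ 2 - ⟪Srf.n x, z⟫ ^ 2) + 4 * c * eta1 (c * ‖z‖ ^ 2)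
    - lap G.q x * (2 * c * eta1 (c * ‖z‖ ^ 2) * ⟪Srf.n x, z⟫)

lemma inner3 (v w : E3) : ⟪v, w⟫ = v 0 * w 0 + v 1 * w 1 + v 2 * w 2 := by
  simp [PiLp.inner_apply, Fin.sum_univ_three]; ring

lemma normsq3 (v : E3) : ‖v‖ ^ 2 = v 0 ^ 2 + v 1 ^ 2 + v 2 ^ 2 := by
  rw [EuclideanSpace.norm_sq_eq, Fin.sum_univ_three]; simp

lemma Lop_eq (G : Geo Srf) (c : ℝ) {x : E3} (hx : x ∈ Srf.S) (z : E3) :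
    G.Lop c x z = ∑ k, pd k (pd k (ker c)) z - (∑ k, ∑ l, Srf.n x k * Srf.n x l * pd l (pd k (ker c)) z)
      - lap G.q x * ∑ k, Srf.n x k * pd k (ker c) z := by
  have hn : ‖Srf.n x‖ ^ 2 = 1 := by rw [Srf.n_unit x hx]; norm_num
  rw [normsq3] at hn
  have e1 : ∀ k, pd k (ker c) z = 2 * c * z k * eta1 (c * ‖z‖ ^ 2) := fun k => by rw [pd_ker]
  simp only [pd_pd_ker, e1, Lop]
  rw [inner3]
  simp only [Fin.sum_univ_three]
  simp only [if_true, Fin.isValue, reduceIte, one_ne_zero, zero_ne_one, Fin.reduceEq]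
  set A := eta2 (c * ‖z‖ ^ 2)
  set B := eta1 (c * ‖z‖ ^ 2)
  rw [normsq3 z]
  linear_combination (2 * c * B) * hn

lemma lap_ker_shift (G : Geo Srf) (c : ℝ) (x : E3) {y : E3} (hy : y ∈ Srf.S) :
    lap (fun y => ker c (G.a y - x)) y = G.Lop c y (y - x) := by
  have hF : G.Sm (fun y => ker c (y - x)) := fun y _ => ((ker_smooth c).comp (contDiff_id.sub contDiff_const)).contDiffAt
  rw [Tube.Sm.lap_comp_a G hF hy, Lop_eq G c hy]
  simp only [lap, pd_shift]

lemma lap_cv (G : Geo Srf) {c : ℝ} (hc : 0 < c) {ψ : E3 → ℝ} (hψ : Integrable ψ Srf.mu) {x : E3} (hx : x ∈ Srf.S) :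
    lap (fun y => cv Srf ψ (ker c) (G.a y)) x = ∫ y, ψ y * G.Lop c x (x - y) ∂Srf.mu := by
  have := G.mu_finite
  have hF : G.Sm (cv Srf ψ (ker c)) := fun y _ => (cv_smooth Srf hψ (ker_smooth c) (ker_cpt hc)).contDiffAt
  rw [Tube.Sm.lap_comp_a G hF hx]
  have i1 : ∀ k, Integrable (fun y => ψ y * pd k (ker c) (x - y)) Srf.mu := fun k =>
    cv_int Srf hψ (pd_smooth (ker_smooth c) k).continuous (pd_cpt (ker_cpt hc) k) x
  have i2 : ∀ k l, Integrable (fun y => ψ y * pd l (pd k (ker c)) (x - y)) Srf.mu := fun k l =>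
    cv_int Srf hψ (pd_smooth (pd_smooth (ker_smooth c) k) l).continuous (pd_cpt (pd_cpt (ker_cpt hc) k) l) x
  have e1 : ∀ k, pd k (cv Srf ψ (ker c)) = cv Srf ψ (pd k (ker c)) := fun k => pd_cv Srf hψ (ker_smooth c) (ker_cpt hc) k
  have e2 : ∀ k l, pd l (cv Srf ψ (pd k (ker c))) = cv Srf ψ (pd l (pd k (ker c))) := fun k l =>
    pd_cv Srf hψ (pd_smooth (ker_smooth c) k) (pd_cpt (ker_cpt hc) k) l
  have e0 : lap (cv Srf ψ (ker c)) x = ∑ k, cv Srf ψ (pd k (pd k (ker c))) x := by simp only [lap, e1, e2]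
  rw [e0]
  simp only [e1, e2]
  have e3 : ∀ y, ψ y * G.Lop c x (x - y) = (∑ k, ψ y * pd k (pd k (ker c)) (x - y)
      - ∑ k, ∑ l, Srf.n x k * Srf.n x l * (ψ y * pd l (pd k (ker c)) (x - y)))
      - lap G.q x * ∑ k, Srf.n x k * (ψ y * pd k (ker c) (x - y)) := by
    intro y
    rw [Lop_eq G c hx]
    simp only [mul_sub, Finset.mul_sum]
    congr 1
    · congr 1
      refine Finset.sum_congr rfl fun k _ => Finset.sum_congr rfl fun l _ => by ring
    · refine Finset.sum_congr rfl fun k _ => by ring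
  simp only [e3]
  have j1 : Integrable (fun y => ∑ k, ψ y * pd k (pd k (ker c)) (x - y)) Srf.mu := integrable_finsetSum _ fun k _ => i2 k k
  have j2' : ∀ k, Integrable (fun y => ∑ l, Srf.n x k * Srf.n x l * (ψ y * pd l (pd k (ker c)) (x - y))) Srf.mu :=
    fun k => integrable_finsetSum _ fun l _ => (i2 k l).const_mul _
  have j2 : Integrable (fun y => ∑ k, ∑ l, Srf.n x k * Srf.n x l * (ψ y * pd l (pd k (ker c)) (x - y))) Srf.mu :=
    integrable_finsetSum _ fun k _ => j2' k
  have j3 : Integrable (fun y => ∑ k, Srf.n x k * (ψ y * pd k (ker c) (x - y))) Srf.mu :=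
    integrable_finsetSum _ fun k _ => (i1 k).const_mul _
  rw [integral_sub (f := fun y => ∑ k, ψ y * pd k (pd k (ker c)) (x - y) - ∑ k, ∑ l, Srf.n x k * Srf.n x l * (ψ y * pd l (pd k (ker c)) (x - y))) (j1.sub j2) (j3.const_mul _), integral_sub j1 j2, integral_const_mul,
    integral_finsetSum _ fun k _ => i2 k k, integral_finsetSum _ fun k _ => j2' k,
    integral_finsetSum _ fun k _ => (i1 k).const_mul _]
  simp only [integral_const_mul]
  congr 1
  congr 1
  refine Finset.sum_congr rfl fun k _ => ?_
  rw [integral_finsetSum _ fun l _ => (i2 k l).const_mul _]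
  simp only [integral_const_mul]
  rfl

/-- kernel of the commutator -/
lemma comm_bound (G : Geo Srf) : ∃ C ≥ 0, ∀ ε : ℝ, 0 < ε → ε ≤ 1 → ∀ x ∈ Srf.S, ∀ y ∈ Srf.S,
    |G.Lop ((ε ^ 2)⁻¹) y (y - x) - G.Lop ((ε ^ 2)⁻¹) x (x - y)| ≤ C * ε ∧
    (2 * ε < dist x y → G.Lop ((ε ^ 2)⁻¹) y (y - x) - G.Lop ((ε ^ 2)⁻¹) x (x - y) = 0) := by
  obtain ⟨B, hB, hη⟩ := eta_bound
  obtain ⟨C, hC, hn⟩ := G.normal_bounds G.δ_pos G.K_sub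
  obtain ⟨Q, hQ, hq⟩ := (G.sm_q.lap).bounds0 G.K_sub
  obtain ⟨L, hL⟩ := (G.sm_q.lap).lip Srf.compact G.S_sub
  refine ⟨128 * B * C ^ 2 + 16 * B * Q * C + 16 * B * L * C, by positivity, ?_⟩
  intro ε hε hε1 x hx y hy
  set c := (ε ^ 2)⁻¹ with hc
  have hc0 : 0 < c := by positivity
  set z := x - y with hz
  have hz' : y - x = -z := by rw [hz]; abel
  have e : G.Lop c y (y - x) - G.Lop c x z = 4 * c ^ 2 * eta2 (c * ‖z‖ ^ 2) * (⟪Srf.n x + Srf.n y, z⟫ * ⟪Srf.n x - Srf.n y, z⟫)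
      + 2 * c * eta1 (c * ‖z‖ ^ 2) * (lap G.q x * ⟪Srf.n x + Srf.n y, z⟫ + (lap G.q y - lap G.q x) * ⟪Srf.n y, z⟫) := by
    rw [hz']
    simp only [Lop, norm_neg, inner_neg_right, inner_add_left, inner_sub_left]
    ring
  rw [e]
  have h0 : 2 * ε < ‖z‖ → eta1 (c * ‖z‖ ^ 2) = 0 ∧ eta2 (c * ‖z‖ ^ 2) = 0 := by
    intro h
    have : 2 < |c * ‖z‖ ^ 2| := by
      rw [abs_of_nonneg (by positivity), hc, inv_mul_eq_div, lt_div_iff₀ (by positivity)]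
      nlinarith
    exact ⟨eta1_zero this, eta2_zero this⟩
  constructor
  · by_cases h : 2 * ε < ‖z‖
    · rw [(h0 h).1, (h0 h).2]
      simp
      positivity
    · push Not at h
      obtain ⟨n1, -, n3⟩ := hn x hx y hy
      obtain ⟨-, n2', -⟩ := hn y hy x hx
      have n2 : |⟪Srf.n y, z⟫| ≤ C * ‖z‖ ^ 2 := by
        rw [hz', inner_neg_right, abs_neg, norm_neg] at n2'
        exact n2'
      have n1' : |⟪Srf.n x - Srf.n y, z⟫| ≤ C * ‖z‖ ^ 2 := by
        refine (abs_real_inner_le_norm _ _).trans ?_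
        calc _ ≤ C * ‖z‖ * ‖z‖ := by gcongr
          _ = _ := by ring
      have hqx : |lap G.q x| ≤ Q := hq x (self_subset_cthickening _ hx)
      have hqd : |lap G.q y - lap G.q x| ≤ L * ‖z‖ := by
        have := hL.dist_le_mul y hy x hx
        rwa [Real.dist_eq, dist_eq_norm, hz', norm_neg] at this
      have hcε : c * ε ^ 2 = 1 := by rw [hc]; field_simp
      have hz0 := norm_nonneg z
      have z3 : ‖z‖ ^ 3 ≤ 8 * ε ^ 3 := by
        calc ‖z‖ ^ 3 ≤ (2 * ε) ^ 3 := by gcongr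
          _ = _ := by ring
      have z5 : ‖z‖ ^ 5 ≤ 32 * ε ^ 5 := by
        calc ‖z‖ ^ 5 ≤ (2 * ε) ^ 5 := by gcongr
          _ = _ := by ring
      have t1 : |4 * c ^ 2 * eta2 (c * ‖z‖ ^ 2) * (⟪Srf.n x + Srf.n y, z⟫ * ⟪Srf.n x - Srf.n y, z⟫)| ≤ 128 * B * C ^ 2 * ε := by
        rw [abs_mul, abs_mul, abs_mul ⟪_, _⟫, abs_of_nonneg (by positivity : 0 ≤ 4 * c ^ 2)]
        calc _ ≤ 4 * c ^ 2 * B * ((C * ‖z‖ ^ 3) * (C * ‖z‖ ^ 2)) := by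
              gcongr
              exact (hη _).2
          _ = 4 * c ^ 2 * B * C ^ 2 * ‖z‖ ^ 5 := by ring
          _ ≤ 4 * c ^ 2 * B * C ^ 2 * (32 * ε ^ 5) := by gcongr
          _ = 128 * B * C ^ 2 * ε * (c * ε ^ 2) ^ 2 := by ring
          _ = _ := by rw [hcε]; ring
      have t2 : |2 * c * eta1 (c * ‖z‖ ^ 2) * (lap G.q x * ⟪Srf.n x + Srf.n y, z⟫ + (lap G.q y - lap G.q x) * ⟪Srf.n y, z⟫)|
          ≤ (16 * B * Q * C + 16 * B * L * C) * ε := by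
        rw [abs_mul, abs_mul (2 * c), abs_of_nonneg (by positivity : 0 ≤ 2 * c)]
        have : |lap G.q x * ⟪Srf.n x + Srf.n y, z⟫ + (lap G.q y - lap G.q x) * ⟪Srf.n y, z⟫| ≤ Q * (C * ‖z‖ ^ 3) + L * ‖z‖ * (C * ‖z‖ ^ 2) := by
          refine (abs_add_le _ _).trans ?_
          rw [abs_mul, abs_mul]
          gcongr
        calc _ ≤ 2 * c * B * (Q * (C * ‖z‖ ^ 3) + L * ‖z‖ * (C * ‖z‖ ^ 2)) := by
              gcongr
              exact (hη _).1
          _ = 2 * c * B * (Q * C + L * C) * ‖z‖ ^ 3 := by ring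
          _ ≤ 2 * c * B * (Q * C + L * C) * (8 * ε ^ 3) := by gcongr
          _ = (16 * B * Q * C + 16 * B * L * C) * ε * (c * ε ^ 2) := by ring
          _ = _ := by rw [hcε]; ring
      refine (abs_add_le _ _).trans ?_
      linarith
  · intro h
    rw [dist_eq_norm] at h
    rw [(h0 h).1, (h0 h).2]; ring

end Geo
end

open MeasureTheory Metric
open scoped RealInnerProductSpace ENNReal NNReal Topology

noncomputable section

lemma ker_nonneg (c : ℝ) (z : E3) : 0 ≤ ker c z := eta_nonneg _
lemma ker_le (c : ℝ) (z : E3) : ker c z ≤ 1 := eta_le _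
lemma ker_neg (c : ℝ) (z : E3) : ker c (-z) = ker c z := by unfold ker; rw [norm_neg]
lemma ker_one {ε : ℝ} (hε : 0 < ε) {z : E3} (hz : ‖z‖ ≤ ε) : ker ((ε ^ 2)⁻¹) z = 1 := by
  refine eta_one ?_
  rw [abs_of_nonneg (by positivity), inv_mul_eq_div, div_le_one (by positivity)]
  gcongr
lemma ker_zero {ε : ℝ} (hε : 0 < ε) {z : E3} (hz : 2 * ε < ‖z‖) : ker ((ε ^ 2)⁻¹) z = 0 := by
  refine eta_zero ?_
  rw [abs_of_nonneg (by positivity), inv_mul_eq_div, le_div_iff₀ (by positivity)]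
  nlinarith

namespace Geo
variable {Srf : SmoothSurface}

lemma int_of_sq (G : Geo Srf) {ψ : E3 → ℝ} (hψ : AEStronglyMeasurable ψ Srf.mu) (hψ2 : Integrable (fun y => ψ y ^ 2) Srf.mu) : Integrable ψ Srf.mu := by
  have := G.mu_finite
  exact ((memLp_two_iff_integrable_sq hψ).2 hψ2).integrable (by norm_num)

lemma sm_bdd_S (G : Geo Srf) {F : E3 → ℝ} (h : G.Sm F) : ∃ C, ∀ᵐ y ∂Srf.mu, ‖F y‖ ≤ C := by
  obtain ⟨C, -, hC⟩ := h.bounds0 G.K_sub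
  exact ⟨C, by filter_upwards [ae_restrict_mem S_meas] with y hy using hC y (self_subset_cthickening _ hy)⟩

lemma sm_mul_int (G : Geo Srf) {F ψ : E3 → ℝ} (h : G.Sm F) (hψ : Integrable ψ Srf.mu) : Integrable (fun y => F y * ψ y) Srf.mu := by
  obtain ⟨C, hC⟩ := G.sm_bdd_S h
  exact hψ.bdd_mul (c := C) (sm_int h).1 hC

lemma v_bound (G : Geo Srf) : ∃ C ≥ 0, ∃ ε0 > 0, ∀ ε : ℝ, 0 < ε → ε ≤ ε0 → ∀ ψ : E3 → ℝ, Measurable ψ →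
    Integrable (fun y => ψ y ^ 2) Srf.mu → (∀ W, G.SmA W → ∫ y, (W y - lap W y) * ψ y ∂Srf.mu = 0) →
    ∫ x, cv Srf ψ (ker ((ε ^ 2)⁻¹)) x ^ 2 ∂Srf.mu ≤ C * ε ^ 6 * ∫ y, ψ y ^ 2 ∂Srf.mu := by
  obtain ⟨K, hK, hcb⟩ := G.comm_bound
  obtain ⟨c1, hc1, C1, hC1, ε0, hε0, hah⟩ := G.ahlfors
  refine ⟨(K * (C1 * 4)) ^ 2, by positivity, min (ε0 / 2) 1, by positivity, ?_⟩
  intro ε hε hεle ψ hψ hψ2 horth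
  have hε1 : ε ≤ 1 := hεle.trans (min_le_right _ _)
  have hε2 : 2 * ε ≤ ε0 := by have := hεle.trans (min_le_left _ _); linarith
  have hi := G.int_of_sq hψ.aestronglyMeasurable hψ2
  set c := (ε ^ 2)⁻¹ with hc
  have hc0 : 0 < c := by positivity
  set V : E3 → ℝ := fun y => cv Srf ψ (ker c) (G.a y) with hV
  have hVA : G.SmA V := smA_of_smooth fun x _ => (cv_smooth Srf hi (ker_smooth c) (ker_cpt hc0)).contDiffAt
  have key : ∀ x ∈ Srf.S, V x - lap V x = ∫ y, ψ y * (G.Lop c y (y - x) - G.Lop c x (x - y)) ∂Srf.mu := by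
    intro x hx
    set W : E3 → ℝ := fun y => ker c (G.a y - x) with hW
    have hWA : G.SmA W := smA_of_smooth (w := fun y => ker c (y - x)) fun y _ =>
      ((ker_smooth c).comp (contDiff_id.sub contDiff_const)).contDiffAt
    have h0 := horth W hWA
    have i1 := G.sm_mul_int hWA.sm hi
    have i2 := G.sm_mul_int hWA.sm.lap hi
    have i2' : Integrable (fun y => ψ y * G.Lop c y (y - x)) Srf.mu := by
      refine i2.congr ?_
      filter_upwards [ae_restrict_mem S_meas] with y hy
      rw [← G.lap_ker_shift c x hy, mul_comm]
    have i3 : Integrable (fun y => ψ y * G.Lop c x (x - y)) Srf.mu := by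
      have hcont : Continuous (fun y => G.Lop c x (x - y)) := by
        unfold Lop
        have h1 := eta1_smooth.continuous
        have h2 := eta2_smooth.continuous
        fun_prop
      obtain ⟨B, hB⟩ := Srf.compact.exists_bound_of_continuousOn hcont.continuousOn
      refine hi.mul_bdd (c := B) hcont.aestronglyMeasurable ?_
      filter_upwards [ae_restrict_mem S_meas] with y hy using hB y hy
    simp only [sub_mul] at h0
    rw [integral_sub i1 i2] at h0
    simp only [mul_sub]
    rw [integral_sub i2' i3, ← G.lap_cv hc0 hi hx]
    congr 1
    have e1 : ∫ y, ψ y * G.Lop c y (y - x) ∂Srf.mu = ∫ y, lap W y * ψ y ∂Srf.mu := by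
      refine integral_congr_ae ?_
      filter_upwards [ae_restrict_mem S_meas] with y hy
      rw [← G.lap_ker_shift c x hy, mul_comm]
    have e2 : V x = ∫ y, W y * ψ y ∂Srf.mu := by
      rw [hV]; simp only [cv]
      refine integral_congr_ae ?_
      filter_upwards [ae_restrict_mem S_meas] with y hy
      rw [hW]; simp only
      rw [G.a_self hx, G.a_self hy, mul_comm, ← ker_neg, neg_sub]
    rw [e1, e2]; linarith
  have hs := G.schur_real hψ hψ2 (K := fun x y => G.Lop c y (y - x) - G.Lop c x (x - y)) (κ := K * ε) (A := C1 * (2 * ε) ^ 2) (r := 2 * ε)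
    (by positivity) (by positivity) (fun x hx y hy => (hcb ε hε hε1 x hx y hy).1) (fun x hx y hy => (hcb ε hε hε1 x hx y hy).2)
    (fun z hz => (hah (2 * ε) (by positivity) hε2 z hz).2)
  have e3 : ∫ x, (V x - lap V x) ^ 2 ∂Srf.mu = ∫ x, (∫ y, ψ y * (G.Lop c y (y - x) - G.Lop c x (x - y)) ∂Srf.mu) ^ 2 ∂Srf.mu := by
    refine integral_congr_ae ?_
    filter_upwards [ae_restrict_mem S_meas] with x hx
    rw [key x hx]
  have e4 : ∫ x, cv Srf ψ (ker c) x ^ 2 ∂Srf.mu = ∫ x, V x ^ 2 ∂Srf.mu := by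
    refine integral_congr_ae ?_
    filter_upwards [ae_restrict_mem S_meas] with x hx
    rw [hV]; simp only; rw [G.a_self hx]
  rw [e4]
  refine ((energy hVA).1.trans (e3.le.trans hs)).trans (le_of_eq ?_)
  ring

lemma orth_zero (G : Geo Srf) {ψ : E3 → ℝ} (hψ : Measurable ψ) (hψ2 : Integrable (fun y => ψ y ^ 2) Srf.mu)
    (horth : ∀ W, G.SmA W → ∫ y, (W y - lap W y) * ψ y ∂Srf.mu = 0) : ∫ y, ψ y ^ 2 ∂Srf.mu = 0 := by
  have := G.mu_finite
  obtain ⟨K, hK, ε1, hε1, hv⟩ := G.v_bound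
  obtain ⟨c1, hc1, C1, hC1, ε0, hε0, hah⟩ := G.ahlfors
  set P := ∫ y, ψ y ^ 2 ∂Srf.mu with hP
  have hP0 : 0 ≤ P := integral_nonneg fun y => sq_nonneg _
  set m0 := Srf.mu.real Set.univ with hm0
  have hm00 : 0 ≤ m0 := measureReal_nonneg
  have hi := G.int_of_sq hψ.aestronglyMeasurable hψ2
  have hψL : MemLp ψ 2 Srf.mu := (memLp_two_iff_integrable_sq hψ.aestronglyMeasurable).2 hψ2
  -- key: bound by τ²
  set Q := 2 * (3 * (K + (C1 * 4) ^ 2 + (C1 * 4) ^ 2 * m0) / c1 ^ 2) + 2 with hQ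
  have hmain : ∀ τ : ℝ, 0 < τ → P ≤ Q * τ ^ 2 := by
    intro τ hτ
    obtain ⟨φ, hφc, hφ1, hφ2, hφ3⟩ := hψL.exists_hasCompactSupport_eLpNorm_sub_le (by norm_num) (ε := ENNReal.ofReal τ) (by simpa using hτ)
    have hd : Integrable (fun y => (ψ y - φ y) ^ 2) Srf.mu := (memLp_two_iff_integrable_sq (hψL.sub hφ3).1).1 (hψL.sub hφ3)
    have hdτ : ∫ y, (ψ y - φ y) ^ 2 ∂Srf.mu ≤ τ ^ 2 := by
      have h1 : eLpNorm (ψ - φ) 2 Srf.mu ^ 2 ≤ ENNReal.ofReal (τ ^ 2) := by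
        rw [ENNReal.ofReal_pow hτ.le]; exact pow_le_pow_left' hφ1 2
      rw [eLpNorm_eq_lintegral_rpow_enorm_toReal (by norm_num) (by norm_num), ← ENNReal.rpow_natCast, ← ENNReal.rpow_mul] at h1
      norm_num at h1
      have e1 : ∀ x, ‖(ψ - φ) x‖ₑ ^ 2 = ENNReal.ofReal ((ψ x - φ x) ^ 2) := by
        intro x
        rw [Pi.sub_apply, Real.enorm_eq_ofReal_abs, ← ENNReal.ofReal_pow (abs_nonneg _), sq_abs]
      have h2 : ∫⁻ x, ENNReal.ofReal ((ψ x - φ x) ^ 2) ∂Srf.mu ≤ ENNReal.ofReal (τ ^ 2) := by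
        rw [← lintegral_congr e1]; simpa using h1
      rw [← ofReal_integral_eq_lintegral_ofReal hd (Filter.Eventually.of_forall fun x => sq_nonneg _)] at h2
      exact (ENNReal.ofReal_le_ofReal_iff (by positivity)).1 h2
    obtain ⟨d, hd0, hdu⟩ := Metric.uniformContinuous_iff.1 (hφc.uniformContinuous_of_continuous hφ2) τ hτ
    obtain ⟨ε, hε, hεa, hεb, hεc, hεd⟩ : ∃ ε : ℝ, 0 < ε ∧ ε ≤ ε1 ∧ 2 * ε ≤ ε0 ∧ 2 * ε < d ∧ ε ^ 2 * P ≤ τ ^ 2 := by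
      refine ⟨min (min ε1 (ε0 / 2)) (min (d / 3) (τ / (P + 1))), by positivity, ?_, ?_, ?_, ?_⟩
      · exact (min_le_left _ _).trans (min_le_left _ _)
      · have := (min_le_left (min ε1 (ε0 / 2)) (min (d / 3) (τ / (P + 1)))).trans (min_le_right _ _); linarith
      · have := (min_le_right (min ε1 (ε0 / 2)) (min (d / 3) (τ / (P + 1)))).trans (min_le_left _ _); linarith
      · have h1 := (min_le_right (min ε1 (ε0 / 2)) (min (d / 3) (τ / (P + 1)))).trans (min_le_right _ _)
        have h0 : 0 < min (min ε1 (ε0 / 2)) (min (d / 3) (τ / (P + 1))) := by positivity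
        set e := min (min ε1 (ε0 / 2)) (min (d / 3) (τ / (P + 1)))
        rw [le_div_iff₀ (by positivity)] at h1
        have h2 : (e * (P + 1)) ^ 2 ≤ τ ^ 2 := by gcongr
        nlinarith [mul_nonneg (sq_nonneg e) (sq_nonneg P), mul_nonneg (sq_nonneg e) hP0]
    set c := (ε ^ 2)⁻¹ with hc
    have hc0 : 0 < c := by positivity
    have hkc : Continuous (ker c) := (ker_smooth c).continuous
    have hball : ∀ z ∈ Srf.S, Srf.mu.real (closedBall z (2 * ε)) ≤ C1 * (2 * ε) ^ 2 := fun z hz => (hah (2 * ε) (by positivity) hεb z hz).2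
    have b1 := hv ε hε hεa ψ hψ hψ2 horth
    have b2 := G.schur_real (ψ := fun y => ψ y - φ y) (hψ.sub hφ2.measurable) hd (K := fun x y => ker c (x - y)) (κ := 1) (A := C1 * (2 * ε) ^ 2) (r := 2 * ε)
      (by norm_num) (by positivity) (fun x _ y _ => by rw [abs_of_nonneg (ker_nonneg _ _)]; exact ker_le _ _)
      (fun x _ y _ h => ker_zero hε (by rwa [dist_eq_norm] at h)) hball
    have hφi : Integrable φ Srf.mu := hφ3.integrable (by norm_num)
    have hpt : ∀ x ∈ Srf.S, c1 ^ 2 * ε ^ 4 * φ x ^ 2 ≤ 3 * (cv Srf ψ (ker c) x ^ 2 + (∫ y, (ψ y - φ y) * ker c (x - y) ∂Srf.mu) ^ 2 + (τ * (C1 * (2 * ε) ^ 2)) ^ 2) := by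
      intro x hx
      set m := ∫ y, ker c (x - y) ∂Srf.mu with hm
      have ik : Integrable (fun y => ker c (x - y)) Srf.mu :=
        Integrable.of_bound (C := 1) (by fun_prop : Continuous fun y => ker c (x - y)).aestronglyMeasurable
          (Filter.Eventually.of_forall fun y => by rw [Real.norm_of_nonneg (ker_nonneg _ _)]; exact ker_le _ _)
      have hm1 : c1 * ε ^ 2 ≤ m := by
        refine (hah ε hε (by linarith) x hx).1.trans ?_
        rw [hm, ← integral_indicator_one measurableSet_closedBall]
        refine integral_mono ((integrable_const (1 : ℝ)).indicator measurableSet_closedBall) ik fun y => ?_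
        by_cases h : y ∈ closedBall x ε
        · simp only [Set.indicator_of_mem h, Pi.one_apply]
          rw [ker_one hε]
          rwa [← dist_eq_norm, dist_comm]
        · simp only [Set.indicator_of_notMem h]; exact ker_nonneg _ _
      have j1 := cv_int Srf hi hkc (ker_cpt hc0) x
      have j2 := cv_int Srf hφi hkc (ker_cpt hc0) x
      have e : m * φ x = cv Srf ψ (ker c) x - (∫ y, (ψ y - φ y) * ker c (x - y) ∂Srf.mu) - ∫ y, (φ y - φ x) * ker c (x - y) ∂Srf.mu := by
        simp only [sub_mul]
        rw [integral_sub j1 j2, integral_sub j2 (ik.const_mul _), integral_const_mul, cv]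
        ring
      have hr : |∫ y, (φ y - φ x) * ker c (x - y) ∂Srf.mu| ≤ τ * (C1 * (2 * ε) ^ 2) := by
        have h1 : ‖∫ y, (φ y - φ x) * ker c (x - y) ∂Srf.mu‖ ≤ ∫ y, τ * (closedBall x (2 * ε)).indicator 1 y ∂Srf.mu := by
          refine norm_integral_le_of_norm_le (((integrable_const (1 : ℝ)).indicator measurableSet_closedBall).const_mul _) (Filter.Eventually.of_forall fun y => ?_)
          by_cases h : y ∈ closedBall x (2 * ε)
          · simp only [Set.indicator_of_mem h, mul_one, Pi.one_apply]
            rw [norm_mul]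
            have h2 : ‖φ y - φ x‖ ≤ τ := by
              rw [← dist_eq_norm]
              exact (hdu (lt_of_le_of_lt h hεc)).le
            calc _ ≤ τ * 1 := by
                  gcongr
                  rw [Real.norm_of_nonneg (ker_nonneg _ _)]; exact ker_le _ _
              _ = _ := mul_one _
          · simp only [Set.indicator_of_notMem h, mul_zero]
            rw [mem_closedBall, not_le, dist_comm, dist_eq_norm] at h
            rw [ker_zero hε h]; simp
        rw [integral_const_mul, integral_indicator_one measurableSet_closedBall] at h1
        refine h1.trans ?_
        gcongr
        exact hball x hx
      have h3 : (c1 * ε ^ 2) ^ 2 * φ x ^ 2 ≤ (m * φ x) ^ 2 := by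
        rw [mul_pow m]; gcongr
      have h4 : (∫ y, (φ y - φ x) * ker c (x - y) ∂Srf.mu) ^ 2 ≤ (τ * (C1 * (2 * ε) ^ 2)) ^ 2 := sq_le_sq' (abs_le.1 hr).1 (abs_le.1 hr).2
      set p := cv Srf ψ (ker c) x
      set q := ∫ y, (ψ y - φ y) * ker c (x - y) ∂Srf.mu
      set r := ∫ y, (φ y - φ x) * ker c (x - y) ∂Srf.mu
      have h5 : (p - q - r) ^ 2 ≤ 3 * (p ^ 2 + q ^ 2 + r ^ 2) := by
        nlinarith [sq_nonneg (p + q), sq_nonneg (p + r), sq_nonneg (q - r)]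
      rw [e] at h3
      calc c1 ^ 2 * ε ^ 4 * φ x ^ 2 = (c1 * ε ^ 2) ^ 2 * φ x ^ 2 := by ring
        _ ≤ _ := by linarith
    have icv : ∀ {θ : E3 → ℝ}, Integrable θ Srf.mu → Integrable (fun x => cv Srf θ (ker c) x ^ 2) Srf.mu := by
      intro θ hθ
      have hcc : Continuous (cv Srf θ (ker c)) := (cv_smooth Srf hθ (ker_smooth c) (ker_cpt hc0)).continuous
      obtain ⟨B, hB⟩ := Srf.compact.exists_bound_of_continuousOn (hcc.pow 2).continuousOn
      refine Integrable.of_bound (C := B) (hcc.pow 2).aestronglyMeasurable ?_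
      filter_upwards [ae_restrict_mem S_meas] with y hy using hB y hy
    have hφ2i : Integrable (fun y => φ y ^ 2) Srf.mu := (memLp_two_iff_integrable_sq hφ3.1).1 hφ3
    have k1 := icv hi
    have k2 : Integrable (fun x => (∫ y, (ψ y - φ y) * ker c (x - y) ∂Srf.mu) ^ 2) Srf.mu := icv (hi.sub hφi)
    have hintg : c1 ^ 2 * ε ^ 4 * ∫ x, φ x ^ 2 ∂Srf.mu ≤ 3 * (K * ε ^ 6 * P + (1 * (C1 * (2 * ε) ^ 2)) ^ 2 * τ ^ 2 + (τ * (C1 * (2 * ε) ^ 2)) ^ 2 * m0) := by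
      rw [← integral_const_mul]
      have h1 : ∫ x, c1 ^ 2 * ε ^ 4 * φ x ^ 2 ∂Srf.mu ≤ ∫ x, 3 * (cv Srf ψ (ker c) x ^ 2 + (∫ y, (ψ y - φ y) * ker c (x - y) ∂Srf.mu) ^ 2 + (τ * (C1 * (2 * ε) ^ 2)) ^ 2) ∂Srf.mu := by
        refine integral_mono_ae (hφ2i.const_mul _) (((k1.add k2).add (integrable_const _)).const_mul _) ?_
        filter_upwards [ae_restrict_mem S_meas] with x hx using hpt x hx
      refine h1.trans ?_
      rw [integral_const_mul, integral_add (f := fun x => cv Srf ψ (ker c) x ^ 2 + (∫ y, (ψ y - φ y) * ker c (x - y) ∂Srf.mu) ^ 2) (k1.add k2) (integrable_const _), integral_add k1 k2, integral_const, smul_eq_mul, mul_comm (Srf.mu.real Set.univ)]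
      have b3 : ∫ x, (∫ y, (ψ y - φ y) * ker c (x - y) ∂Srf.mu) ^ 2 ∂Srf.mu ≤ (1 * (C1 * (2 * ε) ^ 2)) ^ 2 * τ ^ 2 := b2.trans (by gcongr)
      linarith
    have hfin : ∫ x, φ x ^ 2 ∂Srf.mu ≤ 3 * (K + (C1 * 4) ^ 2 + (C1 * 4) ^ 2 * m0) / c1 ^ 2 * τ ^ 2 := by
      rw [div_mul_eq_mul_div, le_div_iff₀ (by positivity)]
      have h4 : 0 < ε ^ 4 := by positivity
      refine le_of_mul_le_mul_left ?_ h4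
      have : K * ε ^ 6 * P ≤ K * ε ^ 4 * τ ^ 2 := by
        calc K * ε ^ 6 * P = K * ε ^ 4 * (ε ^ 2 * P) := by ring
          _ ≤ _ := by gcongr
      nlinarith
    have hlast : P ≤ 2 * (∫ x, φ x ^ 2 ∂Srf.mu) + 2 * ∫ y, (ψ y - φ y) ^ 2 ∂Srf.mu := by
      rw [hP, ← integral_const_mul, ← integral_const_mul, ← integral_add (hφ2i.const_mul _) (hd.const_mul _)]
      refine integral_mono hψ2 ((hφ2i.const_mul _).add (hd.const_mul _)) fun y => ?_
      simp only
      nlinarith [sq_nonneg (ψ y - 2 * φ y)]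
    rw [hQ]
    nlinarith
  have hQ0 : 0 < Q := by positivity
  by_contra hne
  have hPp : 0 < P := lt_of_le_of_ne hP0 (Ne.symm hne)
  have h := hmain (Real.sqrt (P / (2 * Q))) (by positivity)
  rw [Real.sq_sqrt (by positivity)] at h
  have : Q * (P / (2 * Q)) = P / 2 := by field_simp
  linarith

end Geo
end

open MeasureTheory Metric
open scoped RealInnerProductSpace ENNReal NNReal Topology

noncomputable section

namespace Geo
variable {Srf : SmoothSurface}

lemma SmA.add {G : Geo Srf} {W V : E3 → ℝ} (h : G.SmA W) (h' : G.SmA V) : G.SmA (fun x => W x + V x) :=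
  ⟨h.sm.add h'.sm, fun x hx => by rw [h.inv x hx, h'.inv x hx]⟩

lemma SmA.smul {G : Geo Srf} {W : E3 → ℝ} (h : G.SmA W) (c : ℝ) : G.SmA (fun x => c * W x) :=
  ⟨Tube.Sm.mul (fun x _ => contDiffAt_const) h.sm, fun x hx => by rw [h.inv x hx]⟩

lemma pd_smul (c : ℝ) (k : Fin 3) (W : E3 → ℝ) : pd k (fun x => c * W x) = fun x => c * pd k W x := by
  ext x
  unfold pd
  have : fderiv ℝ (fun x => c * W x) x = c • fderiv ℝ W x := congrFun (fderiv_const_smul_field (𝕜 := ℝ) (f := W) c) x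
  rw [this]; rfl

lemma lap_smul (c : ℝ) (W : E3 → ℝ) (x : E3) : lap (fun x => c * W x) x = c * lap W x := by
  simp only [lap, pd_smul, Finset.mul_sum]

lemma SmA.A_memLp {G : Geo Srf} {W : E3 → ℝ} (h : G.SmA W) : MemLp (fun y => W y - lap W y) 2 Srf.mu := by
  have := G.mu_finite
  obtain ⟨C, hC⟩ := G.sm_bdd_S (h.sm.sub h.sm.lap)
  exact MemLp.of_bound (sm_int (h.sm.sub h.sm.lap)).1 C hC

/-- the range of the operator in `L²` -/
def ran (G : Geo Srf) : Submodule ℝ (Lp ℝ 2 Srf.mu) where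
  carrier := {g | ∃ W, G.SmA W ∧ g =ᵐ[Srf.mu] fun y => W y - lap W y}
  add_mem' := by
    rintro f g ⟨W, hW, e⟩ ⟨V, hV, e'⟩
    refine ⟨_, hW.add hV, ?_⟩
    filter_upwards [e, e', Lp.coeFn_add f g, ae_restrict_mem S_meas] with y h1 h2 h3 hy
    rw [h3, Pi.add_apply, h1, h2, hW.sm.lap_add hV.sm (G.S_sub hy)]; ring
  zero_mem' := by
    refine ⟨fun _ => 0, ⟨fun x _ => contDiffAt_const, fun _ _ => rfl⟩, ?_⟩
    filter_upwards [Lp.coeFn_zero ℝ 2 Srf.mu] with y h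
    rw [h]
    have := lap_smul 0 (fun _ => (0 : ℝ)) y
    simp only [mul_zero, zero_mul] at this
    rw [this]; simp
  smul_mem' := by
    rintro c f ⟨W, hW, e⟩
    refine ⟨_, hW.smul c, ?_⟩
    filter_upwards [e, Lp.coeFn_smul c f] with y h1 h2
    rw [h2, Pi.smul_apply, h1, lap_smul, smul_eq_mul]; ring

lemma ran_dense (G : Geo Srf) : G.ran.topologicalClosure = ⊤ := by
  have hb : G.ranᗮ = ⊥ := by
    rw [Submodule.eq_bot_iff]
    intro g hg
    have hgm := Lp.memLp g
    set ψ := hgm.1.aemeasurable.mk g with hψ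
    have hψm : Measurable ψ := hgm.1.aemeasurable.measurable_mk
    have he : g =ᵐ[Srf.mu] ψ := hgm.1.aemeasurable.ae_eq_mk
    have hψL : MemLp ψ 2 Srf.mu := (memLp_congr_ae he).1 hgm
    have hψ2 := (memLp_two_iff_integrable_sq hψL.1).1 hψL
    have h0 := G.orth_zero hψm hψ2 (fun W hW => by
      have h1 := (Submodule.mem_orthogonal _ _).1 hg (hW.A_memLp.toLp _) ⟨W, hW, MemLp.coeFn_toLp _⟩
      rw [L2.inner_def] at h1
      rw [← h1]
      refine integral_congr_ae ?_
      filter_upwards [he, hW.A_memLp.coeFn_toLp] with y h2 h3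
      rw [h3, h2]
      simp [mul_comm])
    rw [integral_eq_zero_iff_of_nonneg (fun y => sq_nonneg _) hψ2] at h0
    rw [Lp.eq_zero_iff_ae_eq_zero]
    filter_upwards [h0, he] with y h1 h2
    rw [h2]; simpa using h1
  exact (Submodule.topologicalClosure_eq_top_iff).2 hb

lemma l2_norm {g : E3 → ℝ} (hg : MemLp g 2 Srf.mu) : ‖hg.toLp g‖ ^ 2 = ∫ y, g y ^ 2 ∂Srf.mu := by
  rw [← real_inner_self_eq_norm_sq, L2.inner_def]
  refine integral_congr_ae ?_
  filter_upwards [hg.coeFn_toLp] with y h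
  rw [h]; simp [sq]

/-- duality: it suffices to test with the range of the operator -/
lemma dual (G : Geo Srf) {E : E3 → ℝ} (hE : MemLp E 2 Srf.mu) {M : ℝ} (hM : 0 ≤ M)
    (h : ∀ W, G.SmA W → |∫ y, (W y - lap W y) * E y ∂Srf.mu| ≤ M * Real.sqrt (∫ y, (W y - lap W y) ^ 2 ∂Srf.mu)) :
    Real.sqrt (∫ y, E y ^ 2 ∂Srf.mu) ≤ M := by
  set e := hE.toLp E with he
  have hcl : IsClosed {g : Lp ℝ 2 Srf.mu | |⟪g, e⟫| ≤ M * ‖g‖} := isClosed_le (by fun_prop) (by fun_prop)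
  have hsub : (G.ran : Set (Lp ℝ 2 Srf.mu)) ⊆ {g : Lp ℝ 2 Srf.mu | |⟪g, e⟫| ≤ M * ‖g‖} := by
    rintro g ⟨W, hW, hg⟩
    have hgW : g = hW.A_memLp.toLp _ := by
      refine Lp.ext ?_
      exact hg.trans hW.A_memLp.coeFn_toLp.symm
    have h1 : ‖g‖ = Real.sqrt (∫ y, (W y - lap W y) ^ 2 ∂Srf.mu) := by
      rw [← l2_norm hW.A_memLp, ← hgW, Real.sqrt_sq (norm_nonneg _)]
    have h2 : ⟪g, e⟫ = ∫ y, (W y - lap W y) * E y ∂Srf.mu := by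
      rw [L2.inner_def]
      refine integral_congr_ae ?_
      filter_upwards [hg, hE.coeFn_toLp] with y h3 h4
      rw [h3, he, h4]; simp [mul_comm]
    change |⟪g, e⟫| ≤ M * ‖g‖
    rw [h1, h2]; exact h W hW
  have hall : e ∈ {g : Lp ℝ 2 Srf.mu | |⟪g, e⟫| ≤ M * ‖g‖} := by
    refine hcl.closure_subset_iff.2 hsub ?_
    have : e ∈ (G.ran.topologicalClosure : Set (Lp ℝ 2 Srf.mu)) := by rw [ran_dense]; trivial
    exact this
  have h5 : |⟪e, e⟫| ≤ M * ‖e‖ := hall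
  rw [real_inner_self_eq_norm_sq, abs_of_nonneg (by positivity)] at h5
  rw [← l2_norm hE, Real.sqrt_sq (norm_nonneg _)]
  by_cases h0 : ‖e‖ = 0
  · rw [← he, h0]; exact hM
  · have : 0 < ‖e‖ := lt_of_le_of_ne (norm_nonneg _) (Ne.symm h0)
    nlinarith

end Geo
end

open MeasureTheory Metric
open scoped RealInnerProductSpace ENNReal NNReal Topology

noncomputable section

/-- a shape regular triangle with vertices on the surface -/
structure TriOK (Srf : SmoothSurface) (γ h : ℝ) (t : E3 × E3 × E3) : Prop where
  indep : AffineIndependent ℝ ![t.1, t.2.1, t.2.2]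
  verts : vertsOf t ⊆ Srf.S
  diam : Metric.diam (triOf t) ≤ h
  disk : ∃ y ∈ triOf t, closedBall y (γ * h) ∩ planeOf t ⊆ triOf t

lemma Triangulation.ok {Srf : SmoothSurface} {γ h : ℝ} (Tr : Triangulation Srf γ h) {t : E3 × E3 × E3} (ht : t ∈ Tr.T) :
    TriOK Srf γ h t := ⟨Tr.indep t ht, Tr.verts_on t ht, Tr.diam_le t ht, Tr.disk t ht⟩

lemma vertsOf_finite (t : E3 × E3 × E3) : (vertsOf t).Finite := by unfold vertsOf; exact Set.toFinite _

lemma tri_compact (t : E3 × E3 × E3) : IsCompact (triOf t) := (vertsOf_finite t).isCompact_convexHull (𝕜 := ℝ)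

lemma tri_convex (t : E3 × E3 × E3) : Convex ℝ (triOf t) := convex_convexHull ℝ _

lemma verts_sub (t : E3 × E3 × E3) : vertsOf t ⊆ triOf t := subset_convexHull ℝ _

lemma tri_sub {t : E3 × E3 × E3} {A : Set E3} (hA : Convex ℝ A) (h : vertsOf t ⊆ A) : triOf t ⊆ A := convexHull_min h hA

lemma tri_plane (t : E3 × E3 × E3) : triOf t ⊆ planeOf t := convexHull_subset_affineSpan _

lemma v0_mem (t : E3 × E3 × E3) : t.1 ∈ vertsOf t := by simp [vertsOf]

lemma sub_mem_dir {t : E3 × E3 × E3} {x y : E3} (hx : x ∈ triOf t) (hy : y ∈ triOf t) : x - y ∈ dirOf t :=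
  AffineSubspace.vsub_mem_direction (tri_plane t hx) (tri_plane t hy)

lemma add_dir_mem {t : E3 × E3 × E3} {x τ : E3} (hx : x ∈ triOf t) (hτ : τ ∈ dirOf t) : x + τ ∈ planeOf t := by
  have := AffineSubspace.vadd_mem_of_mem_direction hτ (tri_plane t hx)
  rwa [vadd_eq_add, add_comm] at this

lemma tri_dist {t : E3 × E3 × E3} {x y : E3} (hx : x ∈ triOf t) (hy : y ∈ triOf t) : ‖x - y‖ ≤ Metric.diam (triOf t) := by
  rw [← dist_eq_norm]; exact dist_le_diam_of_mem (tri_compact t).isBounded hx hy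

/-- an affine function small at the vertices is small, together with its derivative -/
lemma aff_small {Srf : SmoothSurface} {γ h : ℝ} {t : E3 × E3 × E3} (ht : TriOK Srf γ h t) (hγ : 0 < γ) (hh : 0 < h) {x : E3} (hx : x ∈ triOf t)
    (α : ℝ) (D : E3 →L[ℝ] ℝ) {ρ : ℝ} (hρ : ∀ v ∈ vertsOf t, |α + D (v - x)| ≤ ρ) :
    |α| ≤ ρ ∧ ∀ τ ∈ dirOf t, |D τ| ≤ 2 * ρ / (γ * h) * ‖τ‖ := by
  have hconv : Convex ℝ {y : E3 | |α + D (y - x)| ≤ ρ} := by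
    intro y hy z hz r s hr hs hrs
    simp only [Set.mem_ofPred_eq] at hy hz ⊢
    have : α + D (r • y + s • z - x) = r * (α + D (y - x)) + s * (α + D (z - x)) := by
      simp only [map_sub, map_add, map_smul, smul_eq_mul]
      have : s = 1 - r := by linarith
      subst this; ring
    rw [this]
    calc _ ≤ |r * (α + D (y - x))| + |s * (α + D (z - x))| := abs_add_le _ _
      _ = r * |α + D (y - x)| + s * |α + D (z - x)| := by rw [abs_mul, abs_mul, abs_of_nonneg hr, abs_of_nonneg hs]
      _ ≤ r * ρ + s * ρ := by gcongr
      _ = ρ := by rw [← add_mul, hrs, one_mul]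
  have hall : ∀ y ∈ triOf t, |α + D (y - x)| ≤ ρ := fun y hy => tri_sub hconv hρ hy
  refine ⟨by simpa using hall x hx, fun τ hτ => ?_⟩
  by_cases h0 : τ = 0
  · rw [h0]; simp
  have hn : 0 < ‖τ‖ := norm_pos_iff.2 h0
  obtain ⟨y, hy, hd⟩ := ht.disk
  set σ := (γ * h / ‖τ‖) • τ with hσ
  have hσm : σ ∈ dirOf t := Submodule.smul_mem _ _ hτ
  have hσn : ‖σ‖ = γ * h := by
    rw [hσ, norm_smul, Real.norm_of_nonneg (by positivity)]; field_simp
  have hy' : y + σ ∈ triOf t := hd ⟨by rw [mem_closedBall, dist_eq_norm, add_sub_cancel_left, hσn], add_dir_mem hy hσm⟩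
  have h1 := hall y hy
  have h2 := hall _ hy'
  have h3 : |D σ| ≤ 2 * ρ := by
    have : D σ = (α + D (y + σ - x)) - (α + D (y - x)) := by simp only [map_sub, map_add]; ring
    rw [this]
    refine (abs_sub _ _).trans ?_
    linarith
  have h4 : D σ = γ * h / ‖τ‖ * D τ := by rw [hσ, map_smul, smul_eq_mul]
  rw [h4, abs_mul, abs_of_nonneg (by positivity)] at h3
  rw [div_mul_eq_mul_div, le_div_iff₀ (by positivity)]
  rw [div_mul_eq_mul_div, div_le_iff₀ hn] at h3
  linarith

namespace Geo
variable {Srf : SmoothSurface}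

lemma tri_ball {γ h : ℝ} {t : E3 × E3 × E3} (ht : TriOK Srf γ h t) : triOf t ⊆ closedBall t.1 h := fun x hx => by
  rw [mem_closedBall, dist_eq_norm]; exact (tri_dist hx (verts_sub t (v0_mem t))).trans ht.diam

lemma tri_thick (G : Geo Srf) {γ h : ℝ} {t : E3 × E3 × E3} (ht : TriOK Srf γ h t) (hδ : h < G.δ) : triOf t ⊆ thickening G.δ Srf.S := fun x hx =>
  mem_thickening_iff.2 ⟨t.1, ht.verts (v0_mem t), lt_of_le_of_lt (tri_ball ht hx) hδ⟩

/-- flatness of the mesh -/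
lemma mesh_flat (G : Geo Srf) {γ : ℝ} (hγ : 0 < γ) : ∃ C ≥ 0, ∀ h : ℝ, 0 < h → h < G.δ → ∀ t, TriOK Srf γ h t → ∀ x ∈ triOf t,
    |G.q x| ≤ C * h ^ 2 ∧ ∀ τ ∈ dirOf t, |⟪G.nu x, τ⟫| ≤ C * h * ‖τ‖ := by
  obtain ⟨C, hC, -, -, -, hT⟩ := G.sm_q.bounds G.K_sub
  refine ⟨C + 2 * C / γ, by positivity, ?_⟩
  intro h hh hhδ t ht x hx
  have hv0 := ht.verts (v0_mem t)
  have hb : ∀ y ∈ triOf t, y ∈ closedBall t.1 G.δ := fun y hy => closedBall_subset_closedBall hhδ.le (tri_ball ht hy)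
  have key := aff_small ht hγ hh hx (G.q x) (fderiv ℝ G.q x) (ρ := C * h ^ 2) (by
    intro v hv
    have h1 := hT t.1 hv0 x (hb x hx) v (hb v (verts_sub t hv))
    rw [G.q_S (ht.verts hv)] at h1
    rw [Real.norm_eq_abs] at h1
    have h2 : |G.q x + fderiv ℝ G.q x (v - x)| = |0 - G.q x - fderiv ℝ G.q x (v - x)| := by
      rw [← abs_neg]; congr 1; ring
    rw [h2]
    refine h1.trans ?_
    gcongr
    exact (tri_dist (verts_sub t hv) hx).trans ht.diam)
  refine ⟨key.1.trans ?_, fun τ hτ => ?_⟩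
  · gcongr
    have : 0 ≤ 2 * C / γ := by positivity
    linarith
  · have h1 := key.2 τ hτ
    rw [G.dq (G.thick_sub (G.tri_thick ht hhδ hx))] at h1
    refine h1.trans ?_
    gcongr
    have : 2 * (C * h ^ 2) / (γ * h) = 2 * C / γ * h := by field_simp
    rw [this]
    gcongr
    linarith

end Geo
end

open MeasureTheory Metric
open scoped RealInnerProductSpace ENNReal NNReal Topology

noncomputable section

/-- mesh constants: quantitative closeness of small regular triangles to the surface -/
structure Geo.MC {Srf : SmoothSurface} (G : Geo Srf) (γ C h1 : ℝ) : Prop where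
  C1 : 1 ≤ C
  h1_pos : 0 < h1
  h1_lt : h1 < G.δ
  small : C * h1 ≤ 1 / 8
  q : ∀ h : ℝ, 0 < h → h ≤ h1 → ∀ t, TriOK Srf γ h t → ∀ x ∈ triOf t, |G.q x| ≤ C * h ^ 2
  nu : ∀ h : ℝ, 0 < h → h ≤ h1 → ∀ t, TriOK Srf γ h t → ∀ x ∈ triOf t, ∀ τ ∈ dirOf t, |⟪G.nu x, τ⟫| ≤ C * h * ‖τ‖
  dnu : ∀ x ∈ thickening G.δ Srf.S, ∀ v, ‖fderiv ℝ G.nu x v‖ ≤ C * ‖v‖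
  lip : ∀ h : ℝ, 0 < h → h ≤ h1 → ∀ t, TriOK Srf γ h t → ∀ x ∈ triOf t, ∀ y ∈ triOf t,
    ‖G.a y - G.a x‖ ≤ (1 + C * h ^ 2) * ‖y - x‖
  anti : ∀ h : ℝ, 0 < h → h ≤ h1 → ∀ t, TriOK Srf γ h t → ∀ x ∈ triOf t, ∀ y ∈ triOf t,
    ‖y - x‖ ≤ (1 + C * h ^ 2) * ‖G.a y - G.a x‖

namespace Geo
variable {Srf : SmoothSurface}

lemma mvt_a (G : Geo Srf) {γ h : ℝ} {t : E3 × E3 × E3} (ht : TriOK Srf γ h t) (hδ : h < G.δ) {x y : E3}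
    (hx : x ∈ triOf t) (hy : y ∈ triOf t) (e : E3) :
    ∃ z ∈ triOf t, ⟪G.a y - G.a x, e⟫ = ⟪fderiv ℝ G.a z (y - x), e⟫ := by
  have hz : ∀ s ∈ Set.Icc (0:ℝ) 1, x + s • (y - x) ∈ triOf t := fun s hs =>
    (tri_convex t).add_smul_sub_mem hx hy hs
  have hd : ∀ s ∈ Set.Icc (0:ℝ) 1, HasDerivAt (fun s : ℝ => ⟪G.a (x + s • (y - x)), e⟫)
      ⟪fderiv ℝ G.a (x + s • (y - x)) (y - x), e⟫ s := by
    intro s hs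
    have h1 := ((hasDerivAt_id s).smul_const (y - x)).const_add x
    simp only [one_smul] at h1
    have h2 := (G.a_diff (G.thick_sub (G.tri_thick ht hδ (hz s hs)))).hasFDerivAt.comp_hasDerivAt s h1
    have h3 := h2.inner ℝ (hasDerivAt_const s e)
    simp only [inner_zero_right, zero_add] at h3
    exact h3
  obtain ⟨s, hs, h⟩ := exists_hasDerivAt_eq_slope (fun s : ℝ => ⟪G.a (x + s • (y - x)), e⟫)
    (fun s => ⟪fderiv ℝ G.a (x + s • (y - x)) (y - x), e⟫) zero_lt_one
    (fun s hs => (hd s hs).continuousAt.continuousWithinAt) (fun s hs => hd s (Set.Ioo_subset_Icc_self hs))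
  refine ⟨_, hz s (Set.Ioo_subset_Icc_self hs), ?_⟩
  rw [h]
  simp [inner_sub_left]

lemma exists_MC (G : Geo Srf) {γ : ℝ} (hγ : 0 < γ) : ∃ C h1, G.MC γ C h1 := by
  obtain ⟨C0, hC0, hF⟩ := G.mesh_flat hγ
  obtain ⟨C1, hC1, hN⟩ := G.sm_nu.fderiv.bounds0 G.K_sub
  set A := C0 ^ 2 + C0 * C1 with hA
  have hA0 : 0 ≤ A := by positivity
  set C := 1 + C0 + C1 + 2 * A with hC
  have hCpos : 1 ≤ C := by linarith
  set h1 := min (G.δ / 2) (1 / (8 * C)) with hh1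
  have hh1p : 0 < h1 := lt_min (by linarith [G.δ_pos]) (by positivity)
  have hh1δ : h1 < G.δ := lt_of_le_of_lt (min_le_left _ _) (by linarith [G.δ_pos])
  have hsm : C * h1 ≤ 1 / 8 := by
    calc C * h1 ≤ C * (1 / (8 * C)) := by gcongr; exact min_le_right _ _
      _ = 1 / 8 := by field_simp
  have hh11 : h1 ≤ 1 := by linarith [G.δ_le]
  have hdnu : ∀ x ∈ thickening G.δ Srf.S, ∀ v, ‖fderiv ℝ G.nu x v‖ ≤ C1 * ‖v‖ := fun x hx v =>
    ((fderiv ℝ G.nu x).le_opNorm v).trans (by gcongr; exact hN x (thickening_subset_cthickening _ _ hx))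
  -- basic estimates for the differential
  have hup : ∀ h : ℝ, 0 < h → h ≤ h1 → ∀ t, TriOK Srf γ h t → ∀ x ∈ triOf t, ∀ τ, 
      ‖fderiv ℝ G.a x τ‖ ≤ (1 + A * h ^ 2) * ‖τ‖ := by
    intro h hh hhl t ht x hx τ
    have hxt := G.tri_thick ht (lt_of_le_of_lt hhl hh1δ) hx
    rw [G.da (G.thick_sub hxt)]
    have e1 : ‖τ - ⟪G.nu x, τ⟫ • G.nu x‖ ≤ ‖τ‖ := by
      have hn := G.nu_unit (G.thick_sub hxt)
      refine abs_le_of_sq_le_sq' ?_ (norm_nonneg _) |>.2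
      rw [norm_sub_sq_real, norm_smul, hn, inner_smul_right, real_inner_comm, Real.norm_eq_abs, mul_one, sq_abs]
      nlinarith [sq_nonneg ⟪G.nu x, τ⟫]
    have e2 : ‖G.q x • fderiv ℝ G.nu x τ‖ ≤ A * h ^ 2 * ‖τ‖ := by
      rw [norm_smul, Real.norm_eq_abs]
      calc |G.q x| * ‖fderiv ℝ G.nu x τ‖ ≤ (C0 * h ^ 2) * (C1 * ‖τ‖) := by
            gcongr
            · exact (hF h hh (lt_of_le_of_lt hhl hh1δ) t ht x hx).1
            · exact hdnu x hxt τ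
        _ ≤ A * h ^ 2 * ‖τ‖ := by
            have : (C0 * h ^ 2) * (C1 * ‖τ‖) = (C0 * C1) * h ^ 2 * ‖τ‖ := by ring
            rw [this]; gcongr; rw [hA]; nlinarith [sq_nonneg C0]
    refine (norm_sub_le _ _).trans ?_
    linarith
  have hlo : ∀ h : ℝ, 0 < h → h ≤ h1 → ∀ t, TriOK Srf γ h t → ∀ x ∈ triOf t, ∀ τ ∈ dirOf t,
      (1 - A * h ^ 2) * ‖τ‖ ^ 2 ≤ ⟪fderiv ℝ G.a x τ, τ⟫ := by
    intro h hh hhl t ht x hx τ hτ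
    have hxt := G.tri_thick ht (lt_of_le_of_lt hhl hh1δ) hx
    have hf := hF h hh (lt_of_le_of_lt hhl hh1δ) t ht x hx
    rw [G.da (G.thick_sub hxt), inner_sub_left, inner_sub_left, inner_smul_left, inner_smul_left, real_inner_self_eq_norm_sq]
    simp only [conj_trivial]
    have e1 : ⟪G.nu x, τ⟫ * ⟪G.nu x, τ⟫ ≤ C0 ^ 2 * h ^ 2 * ‖τ‖ ^ 2 := by
      have := hf.2 τ hτ
      rw [← sq, ← sq_abs]
      calc |⟪G.nu x, τ⟫| ^ 2 ≤ (C0 * h * ‖τ‖) ^ 2 := by gcongr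
        _ = _ := by ring
    have e2 : G.q x * ⟪fderiv ℝ G.nu x τ, τ⟫ ≤ C0 * C1 * h ^ 2 * ‖τ‖ ^ 2 := by
      refine (le_abs_self _).trans ?_
      rw [abs_mul]
      calc |G.q x| * |⟪fderiv ℝ G.nu x τ, τ⟫| ≤ (C0 * h ^ 2) * ((C1 * ‖τ‖) * ‖τ‖) := by
            gcongr
            · exact hf.1
            · exact (abs_real_inner_le_norm _ _).trans (by gcongr; exact hdnu x hxt τ)
        _ = _ := by ring
    rw [hA]; nlinarith
  refine ⟨C, h1, hCpos, hh1p, hh1δ, hsm, ?_, ?_, ?_, ?_, ?_⟩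
  · intro h hh hhl t ht x hx
    refine (hF h hh (lt_of_le_of_lt hhl hh1δ) t ht x hx).1.trans ?_
    gcongr; linarith
  · intro h hh hhl t ht x hx τ hτ
    refine ((hF h hh (lt_of_le_of_lt hhl hh1δ) t ht x hx).2 τ hτ).trans ?_
    gcongr; linarith
  · intro x hx v
    refine (hdnu x hx v).trans ?_
    gcongr; linarith
  · intro h hh hhl t ht x hx y hy
    obtain ⟨z, hz, he⟩ := G.mvt_a ht (lt_of_le_of_lt hhl hh1δ) hx hy (G.a y - G.a x)
    have h2 : ‖G.a y - G.a x‖ * ‖G.a y - G.a x‖ ≤ ((1 + C * h ^ 2) * ‖y - x‖) * ‖G.a y - G.a x‖ := by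
      rw [← real_inner_self_eq_norm_mul_norm, he]
      refine (real_inner_le_norm _ _).trans ?_
      gcongr
      refine (hup h hh hhl t ht z hz _).trans ?_
      gcongr; linarith
    by_cases h0 : ‖G.a y - G.a x‖ = 0
    · rw [h0]; positivity
    · exact le_of_mul_le_mul_right h2 (lt_of_le_of_ne (norm_nonneg _) (Ne.symm h0))
  · intro h hh hhl t ht x hx y hy
    obtain ⟨z, hz, he⟩ := G.mvt_a ht (lt_of_le_of_lt hhl hh1δ) hx hy (y - x)
    have h2 := hlo h hh hhl t ht z hz _ (sub_mem_dir hy hx)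
    rw [← he] at h2
    have h3 := h2.trans (real_inner_le_norm _ _)
    by_cases h0 : ‖y - x‖ = 0
    · rw [h0]; positivity
    have h0' : 0 < ‖y - x‖ := lt_of_le_of_ne (norm_nonneg _) (Ne.symm h0)
    have h4 : (1 - A * h ^ 2) * ‖y - x‖ ≤ ‖G.a y - G.a x‖ := by
      refine le_of_mul_le_mul_right ?_ h0'
      rw [mul_assoc, ← sq]; exact h3
    have h5 : A * h ^ 2 ≤ 1 / 4 := by
      have e1 : h ^ 2 ≤ h1 := by nlinarith
      have : A * h ^ 2 ≤ A * h1 := by gcongr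
      nlinarith
    have h6 : 1 ≤ (1 + C * h ^ 2) * (1 - A * h ^ 2) := by
      have : C * h ^ 2 ≥ 2 * (A * h ^ 2) := by
        have : (2 * A) * h ^ 2 ≤ C * h ^ 2 := by gcongr; linarith
        linarith
      have hAh : 0 ≤ A * h ^ 2 := by positivity
      nlinarith
    calc ‖y - x‖ = 1 * ‖y - x‖ := (one_mul _).symm
      _ ≤ ((1 + C * h ^ 2) * (1 - A * h ^ 2)) * ‖y - x‖ := by gcongr
      _ = (1 + C * h ^ 2) * ((1 - A * h ^ 2) * ‖y - x‖) := by ring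
      _ ≤ _ := by gcongr

end Geo
end

open MeasureTheory Metric
open scoped RealInnerProductSpace ENNReal NNReal Topology

noncomputable section

lemma restrict_finset_ae {α ι : Type*} {m0 : MeasurableSpace α} {μ : Measure α} (T : Finset ι) (s : ι → Set α)
    (hd : ∀ i ∈ T, ∀ j ∈ T, i ≠ j → μ (s i ∩ s j) = 0) (hm : ∀ i ∈ T, MeasurableSet (s i)) :
    μ.restrict (⋃ i ∈ T, s i) = ∑ i ∈ T, μ.restrict (s i) := by
  have h1 : (⋃ i ∈ T, s i) = ⋃ i : T, s i := by ext; simp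
  rw [h1, Measure.restrict_iUnion_ae, Measure.sum_fintype, Finset.sum_coe_sort T (fun i => μ.restrict (s i))]
  · intro i j hij
    exact hd i i.2 j j.2 (fun h => hij (Subtype.ext h))
  · exact fun i => (hm i i.2).nullMeasurableSet

lemma bilip_measure {X : Type*} [MetricSpace X] [MeasurableSpace X] [BorelSpace X] {t : Set X} (ht : MeasurableSet t)
    (f : X → X) (K : ℝ≥0) (h1 : LipschitzOnWith K f t) (h2 : ∀ x ∈ t, ∀ y ∈ t, edist x y ≤ K * edist (f x) (f y)) :
    Measure.map f ((μH[2] : Measure X).restrict t) ≤ (K : ℝ≥0∞) ^ (2:ℝ) • (μH[2] : Measure X).restrict (f '' t) ∧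
    (μH[2] : Measure X).restrict (f '' t) ≤ (K : ℝ≥0∞) ^ (2:ℝ) • Measure.map f ((μH[2] : Measure X).restrict t) := by
  have hf : AEMeasurable f ((μH[2] : Measure X).restrict t) := h1.continuousOn.aemeasurable ht
  have hA : ∀ E : Set X, E ∩ f '' t = f '' (f ⁻¹' E ∩ t) := fun E => (Set.image_preimage_inter f t E).symm ▸ rfl
  constructor
  · rw [Measure.le_iff]
    intro E hE
    rw [Measure.map_apply_of_aemeasurable hf hE, Measure.smul_apply, Measure.restrict_apply hE, Measure.restrict_apply' ht, hA,
      smul_eq_mul]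
    exact hausdorff_le_of_anti (by norm_num) (fun x hx y hy => h2 x hx.2 y hy.2)
  · rw [Measure.le_iff]
    intro E hE
    rw [Measure.smul_apply, Measure.map_apply_of_aemeasurable hf hE, Measure.restrict_apply hE, Measure.restrict_apply' ht, hA,
      smul_eq_mul]
    exact (h1.mono Set.inter_subset_right).hausdorffMeasure_image_le (by norm_num)

/-- all the quantitative information about a fine triangulation -/
structure Triangulation.Fine {Srf : SmoothSurface} {γ h : ℝ} (Tr : Triangulation Srf γ h) (G : Geo Srf) (C : ℝ) : Prop where
  hγ : 0 < γ
  C1 : 1 ≤ C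
  hpos : 0 < h
  hδ : h < G.δ
  small : C * h ≤ 1 / 8
  q : ∀ t ∈ Tr.T, ∀ x ∈ triOf t, |G.q x| ≤ C * h ^ 2
  nu : ∀ t ∈ Tr.T, ∀ x ∈ triOf t, ∀ τ ∈ dirOf t, |⟪G.nu x, τ⟫| ≤ C * h * ‖τ‖
  dnu : ∀ x ∈ thickening G.δ Srf.S, ∀ v, ‖fderiv ℝ G.nu x v‖ ≤ C * ‖v‖
  lip : ∀ t ∈ Tr.T, ∀ x ∈ triOf t, ∀ y ∈ triOf t, ‖G.a y - G.a x‖ ≤ (1 + C * h ^ 2) * ‖y - x‖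
  anti : ∀ t ∈ Tr.T, ∀ x ∈ triOf t, ∀ y ∈ triOf t, ‖y - x‖ ≤ (1 + C * h ^ 2) * ‖G.a y - G.a x‖

lemma Geo.MC.fine {Srf : SmoothSurface} {G : Geo Srf} {γ C h1 h : ℝ} (M : G.MC γ C h1) (hγ : 0 < γ) (hh : 0 < h) (hl : h ≤ h1)
    (Tr : Triangulation Srf γ h) : Tr.Fine G C where
  hγ := hγ
  C1 := M.C1
  hpos := hh
  hδ := lt_of_le_of_lt hl M.h1_lt
  small := le_trans (mul_le_mul_of_nonneg_left hl (by linarith [M.C1])) M.small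
  q := fun t ht => M.q h hh hl t (Tr.ok ht)
  nu := fun t ht => M.nu h hh hl t (Tr.ok ht)
  dnu := M.dnu
  lip := fun t ht => M.lip h hh hl t (Tr.ok ht)
  anti := fun t ht => M.anti h hh hl t (Tr.ok ht)

namespace Triangulation.Fine
variable {Srf : SmoothSurface} {γ h C : ℝ} {Tr : Triangulation Srf γ h} {G : Geo Srf}

lemma h1 (F : Tr.Fine G C) : h ≤ 1 := by linarith [F.hδ, G.δ_le]

lemma Ch2 (F : Tr.Fine G C) : C * h ^ 2 ≤ 1 / 2 := by
  have := F.h1; have := F.hpos; have := F.small; have := F.C1; nlinarith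

lemma Ch0 (F : Tr.Fine G C) : 0 ≤ C * h ^ 2 := by
  have := F.C1; positivity

lemma thick (F : Tr.Fine G C) {t : E3 × E3 × E3} (ht : t ∈ Tr.T) : triOf t ⊆ thickening G.δ Srf.S :=
  G.tri_thick (Tr.ok ht) F.hδ

lemma sub_Sh {t : E3 × E3 × E3} (ht : t ∈ Tr.T) : triOf t ⊆ Tr.Sh := fun x hx => by
  unfold Triangulation.Sh; exact Set.mem_biUnion ht hx

lemma Sh_mem {x : E3} (hx : x ∈ Tr.Sh) : ∃ t ∈ Tr.T, x ∈ triOf t := by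
  unfold Triangulation.Sh at hx; simpa using hx

lemma a_eq (F : Tr.Fine G C) {x : E3} (hx : x ∈ Tr.Sh) : Tr.a x = G.a x := by
  obtain ⟨t, ht, hxt⟩ := Sh_mem hx
  have h1 : x ∈ G.N := G.thick_sub (F.thick ht hxt)
  have h2 : x ∈ Tr.N := Tr.Sh_sub hx
  exact G.a_unique x h1 _ (Tr.a_mem x h2) (le_antisymm (Tr.a_nearest x h2 _ (G.a_mem x h1)) (G.a_nearest x h1 _ (Tr.a_mem x h2)))

lemma bij (F : Tr.Fine G C) : Set.BijOn G.a Tr.Sh Srf.S :=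
  Set.BijOn.congr Tr.a_bij (fun x hx => F.a_eq hx)

lemma inj (F : Tr.Fine G C) : Set.InjOn G.a Tr.Sh := F.bij.injOn

lemma S_eq (F : Tr.Fine G C) : Srf.S = ⋃ t ∈ Tr.T, G.a '' triOf t := by
  rw [← F.bij.image_eq]; unfold Triangulation.Sh; simp [Set.image_iUnion]

lemma lipOn (F : Tr.Fine G C) {t : E3 × E3 × E3} (ht : t ∈ Tr.T) : LipschitzOnWith (Real.toNNReal (1 + C * h ^ 2)) G.a (triOf t) := by
  refine LipschitzOnWith.of_dist_le_mul fun x hx y hy => ?_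
  rw [Real.coe_toNNReal _ (by linarith [F.Ch0]), dist_eq_norm, dist_eq_norm]
  exact F.lip t ht y hy x hx

lemma antiOn (F : Tr.Fine G C) {t : E3 × E3 × E3} (ht : t ∈ Tr.T) : ∀ x ∈ triOf t, ∀ y ∈ triOf t,
    edist x y ≤ (Real.toNNReal (1 + C * h ^ 2) : ℝ≥0∞) * edist (G.a x) (G.a y) := by
  intro x hx y hy
  have := F.anti t ht y hy x hx
  rw [edist_dist, edist_dist, dist_eq_norm, dist_eq_norm, ENNReal.coe_nnreal_eq, Real.coe_toNNReal _ (by linarith [F.Ch0]),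
    ← ENNReal.ofReal_mul (by linarith [F.Ch0])]
  exact ENNReal.ofReal_le_ofReal this

lemma tri_meas (t : E3 × E3 × E3) : MeasurableSet (triOf t) := (tri_compact t).isClosed.measurableSet

lemma a_aem (F : Tr.Fine G C) {t : E3 × E3 × E3} (ht : t ∈ Tr.T) : AEMeasurable G.a ((μH[2] : Measure E3).restrict (triOf t)) :=
  (F.lipOn ht).continuousOn.aemeasurable (tri_meas t)

lemma inter_null (F : Tr.Fine G C) {t t' : E3 × E3 × E3} (ht : t ∈ Tr.T) (ht' : t' ∈ Tr.T) (hne : t ≠ t') :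
    (μH[2] : Measure E3) (triOf t ∩ triOf t') = 0 := by
  have key : ∃ v w : E3, triOf t ∩ triOf t' ⊆ segment ℝ v w := by
    rcases Tr.meet t ht t' ht' hne with h | ⟨v, -, h⟩ | ⟨v, w, -, -, -, h⟩
    · exact ⟨0, 0, by simp [h]⟩
    · exact ⟨v, v, by simp [h]⟩
    · exact ⟨v, w, h.subset⟩
  obtain ⟨v, w, hvw⟩ := key
  refine measure_mono_null hvw ?_
  rcases Measure.hausdorffMeasure_zero_or_top (d₁ := 1) (d₂ := 2) (by norm_num) (segment ℝ v w) with h | h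
  · exact h
  · rw [hausdorffMeasure_segment] at h
    exact absurd h (edist_ne_top _ _)

lemma image_inter_null (F : Tr.Fine G C) {t t' : E3 × E3 × E3} (ht : t ∈ Tr.T) (ht' : t' ∈ Tr.T) (hne : t ≠ t') :
    (μH[2] : Measure E3) (G.a '' triOf t ∩ G.a '' triOf t') = 0 := by
  rw [← F.inj.image_inter (sub_Sh ht) (sub_Sh ht')]
  have h1 := ((F.lipOn ht).mono (Set.inter_subset_left (t := triOf t'))).hausdorffMeasure_image_le (d := 2) (by norm_num)
  rw [F.inter_null ht ht' hne, mul_zero] at h1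
  exact le_antisymm h1 (zero_le)

lemma Sh_restrict (F : Tr.Fine G C) : (μH[2] : Measure E3).restrict Tr.Sh = ∑ t ∈ Tr.T, (μH[2] : Measure E3).restrict (triOf t) := by
  unfold Triangulation.Sh
  exact restrict_finset_ae _ _ (fun t ht t' ht' hne => F.inter_null ht ht' hne) (fun t _ => tri_meas t)

lemma image_meas (F : Tr.Fine G C) {t : E3 × E3 × E3} (ht : t ∈ Tr.T) : MeasurableSet (G.a '' triOf t) :=
  ((tri_compact t).image_of_continuousOn (F.lipOn ht).continuousOn).isClosed.measurableSet

lemma mu_sum (F : Tr.Fine G C) : Srf.mu = ∑ t ∈ Tr.T, (μH[2] : Measure E3).restrict (G.a '' triOf t) := by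
  rw [SmoothSurface.mu, F.S_eq]
  exact restrict_finset_ae _ _ (fun t ht t' ht' hne => F.image_inter_null ht ht' hne) (fun t ht => F.image_meas ht)

/-- push-forward of the area of the polyhedral surface -/
def rho (Tr : Triangulation Srf γ h) (G : Geo Srf) : Measure E3 := ∑ t ∈ Tr.T, Measure.map G.a ((μH[2] : Measure E3).restrict (triOf t))

lemma K_le (F : Tr.Fine G C) : (Real.toNNReal (1 + C * h ^ 2) : ℝ≥0∞) ^ (2:ℝ) ≤ ENNReal.ofReal (1 + 3 * C * h ^ 2) := by
  rw [← ENNReal.ofReal, ENNReal.ofReal_rpow_of_nonneg (by linarith [F.Ch0]) (by norm_num)]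
  refine ENNReal.ofReal_le_ofReal ?_
  norm_num
  nlinarith [F.Ch0, F.Ch2]

lemma finset_measure_le {α ι : Type*} {m0 : MeasurableSpace α} (T : Finset ι) (μ ν : ι → Measure α) (c : ℝ≥0∞)
    (hh : ∀ i ∈ T, μ i ≤ c • ν i) : ∑ i ∈ T, μ i ≤ c • ∑ i ∈ T, ν i := by
  rw [Measure.le_iff]
  intro s hs
  simp only [Measure.smul_apply, Measure.finsetSum_apply, smul_eq_mul, Finset.mul_sum]
  exact Finset.sum_le_sum fun i hi => hh i hi s

lemma rho_le (F : Tr.Fine G C) : rho Tr G ≤ ENNReal.ofReal (1 + 3 * C * h ^ 2) • Srf.mu := by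
  rw [F.mu_sum]
  refine finset_measure_le _ _ _ _ fun t ht => ?_
  refine (bilip_measure (tri_meas t) G.a _ (F.lipOn ht) (F.antiOn ht)).1.trans ?_
  rw [Measure.le_iff]; intro s _
  simp only [Measure.smul_apply, smul_eq_mul]
  gcongr; exact F.K_le

lemma le_rho (F : Tr.Fine G C) : Srf.mu ≤ ENNReal.ofReal (1 + 3 * C * h ^ 2) • rho Tr G := by
  rw [F.mu_sum]
  refine finset_measure_le _ _ _ _ fun t ht => ?_
  refine (bilip_measure (tri_meas t) G.a _ (F.lipOn ht) (F.antiOn ht)).2.trans ?_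
  rw [Measure.le_iff]; intro s _
  simp only [Measure.smul_apply, smul_eq_mul]
  gcongr; exact F.K_le

/-- a.e. properties transfer from the surface to the triangles -/
lemma ae_tri (F : Tr.Fine G C) {p : E3 → Prop} (hp : ∀ᵐ y ∂Srf.mu, p y) {t : E3 × E3 × E3} (ht : t ∈ Tr.T) :
    ∀ᵐ x ∂(μH[2] : Measure E3).restrict (triOf t), p (G.a x) := by
  refine ae_of_ae_map (F.a_aem ht) ?_
  have h1 : Measure.map G.a ((μH[2] : Measure E3).restrict (triOf t)) ≤ rho Tr G :=
    Finset.single_le_sum (f := fun t => Measure.map G.a ((μH[2] : Measure E3).restrict (triOf t))) (fun _ _ => Measure.zero_le _) ht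
  have h2 : Measure.map G.a ((μH[2] : Measure E3).restrict (triOf t)) ≪ Srf.mu :=
    Measure.absolutelyContinuous_of_le_smul (h1.trans F.rho_le)
  exact h2.ae_le hp

lemma int_tri (F : Tr.Fine G C) {g : E3 → ℝ} (hg : Integrable g Srf.mu) {t : E3 × E3 × E3} (ht : t ∈ Tr.T) :
    Integrable (fun x => g (G.a x)) ((μH[2] : Measure E3).restrict (triOf t)) := by
  have h0 : Integrable g (rho Tr G) := (hg.smul_measure ENNReal.ofReal_ne_top).mono_measure F.rho_le
  have h1 := (integrable_finsetSum_measure.1 h0) t ht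
  exact (integrable_map_measure h1.aestronglyMeasurable (F.a_aem ht)).1 h1

/-- comparison of integrals on the two surfaces -/
lemma compare (F : Tr.Fine G C) {g : E3 → ℝ} (hg : Integrable g Srf.mu) :
    |∑ t ∈ Tr.T, ∫ x in triOf t, g (G.a x) ∂μH[2] - ∫ y, g y ∂Srf.mu| ≤ 3 * C * h ^ 2 * ∫ y, |g y| ∂Srf.mu := by
  have h0 := integral_compare (η := 3 * C * h ^ 2) (by linarith [F.Ch0]) F.rho_le F.le_rho hg
  have h1 := integrable_finsetSum_measure.1 h0.1
  have h2 : ∫ y, g y ∂rho Tr G = ∑ t ∈ Tr.T, ∫ x in triOf t, g (G.a x) ∂μH[2] := by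
    rw [rho, integral_finsetSum_measure h1]
    exact Finset.sum_congr rfl fun t ht => integral_map (F.a_aem ht) (h1 t ht).aestronglyMeasurable
  rw [← h2]; exact h0.2

lemma sum_le (F : Tr.Fine G C) {g : E3 → ℝ} (hg : Integrable g Srf.mu) (h0 : ∀ y, 0 ≤ g y) :
    ∑ t ∈ Tr.T, ∫ x in triOf t, g (G.a x) ∂μH[2] ≤ 3 * ∫ y, g y ∂Srf.mu := by
  have h1 := F.compare hg
  simp only [abs_of_nonneg (h0 _)] at h1
  have h2 : 0 ≤ ∫ y, g y ∂Srf.mu := integral_nonneg h0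
  nlinarith [(abs_le.1 h1).2, F.Ch2]

lemma le_sum (F : Tr.Fine G C) {g : E3 → ℝ} (hg : Integrable g Srf.mu) (h0 : ∀ y, 0 ≤ g y) :
    ∫ y, g y ∂Srf.mu ≤ 3 * ∑ t ∈ Tr.T, ∫ x in triOf t, g (G.a x) ∂μH[2] := by
  have hintg : ∀ t ∈ Tr.T, Integrable g (Measure.map G.a ((μH[2] : Measure E3).restrict (triOf t))) :=
    integrable_finsetSum_measure.1 ((hg.smul_measure ENNReal.ofReal_ne_top).mono_measure F.rho_le)
  have h3 : Integrable g (rho Tr G) := integrable_finsetSum_measure.2 hintg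
  have h2 : ∫ y, g y ∂rho Tr G = ∑ t ∈ Tr.T, ∫ x in triOf t, g (G.a x) ∂μH[2] := by
    rw [rho, integral_finsetSum_measure hintg]
    exact Finset.sum_congr rfl fun t ht => integral_map (F.a_aem ht) (hintg t ht).aestronglyMeasurable
  rw [← h2]
  have h4 := integral_mono_measure (f := g) F.le_rho (Filter.Eventually.of_forall h0) (h3.smul_measure ENNReal.ofReal_ne_top)
  rw [integral_smul_measure, ENNReal.toReal_ofReal (by linarith [F.Ch0]), smul_eq_mul] at h4
  have h5 : 0 ≤ ∫ y, g y ∂rho Tr G := integral_nonneg h0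
  nlinarith [F.Ch2]

end Triangulation.Fine
end

open MeasureTheory Metric
open scoped RealInnerProductSpace ENNReal NNReal Topology

noncomputable section

lemma cover_lip {ι : Type*} [DecidableEq ι] (g : ℝ → ℝ) (Cs : ι → Set ℝ) (hc : ∀ i, IsClosed (Cs i)) {K : ℝ}
    (hK : ∀ i, ∀ s ∈ Cs i, ∀ s' ∈ Cs i, |g s' - g s| ≤ K * |s' - s|) (F : Finset ι) :
    ∀ a b : ℝ, a ≤ b → Set.Icc a b ⊆ ⋃ i ∈ F, Cs i → |g b - g a| ≤ K * (b - a) := by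
  induction F using Finset.strongInduction with
  | H F ih =>
  intro a b hab hcov
  obtain ⟨i, hi, hai⟩ : ∃ i ∈ F, a ∈ Cs i := by simpa using hcov (Set.left_mem_Icc.2 hab)
  have hcomp : IsCompact (Set.Icc a b ∩ Cs i) := isCompact_Icc.inter_right (hc i)
  set s := sSup (Set.Icc a b ∩ Cs i) with hs
  have hsm : s ∈ Set.Icc a b ∩ Cs i := hcomp.sSup_mem ⟨a, Set.left_mem_Icc.2 hab, hai⟩
  have hub : ∀ x ∈ Set.Icc a b ∩ Cs i, x ≤ s := fun x hx => le_csSup hcomp.bddAbove hx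
  have h1 := hK i a hai s hsm.2
  rw [abs_of_nonneg (sub_nonneg.2 hsm.1.1)] at h1
  rcases eq_or_lt_of_le hsm.1.2 with h | h
  · rw [h] at h1; exact h1
  · have h2 : Set.Icc s b ⊆ ⋃ j ∈ F.erase i, Cs j := by
      have hcl : IsClosed (⋃ j ∈ F.erase i, Cs j) := isClosed_biUnion_finset fun j _ => hc j
      rw [← closure_Ioc h.ne]
      refine closure_minimal ?_ hcl
      intro x hx
      have hxi : x ∈ Set.Icc a b := ⟨hsm.1.1.trans hx.1.le, hx.2⟩
      obtain ⟨j, hj, hxj⟩ : ∃ j ∈ F, x ∈ Cs j := by simpa using hcov hxi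
      refine Set.mem_biUnion (x := j) (Finset.mem_coe.2 (Finset.mem_erase.2 ⟨?_, hj⟩)) hxj
      rintro rfl
      exact absurd (hub x ⟨hxi, hxj⟩) (not_le.2 hx.1)
    have h3 := ih _ (Finset.erase_ssubset hi) s b h.le h2
    have h4 : g b - g a = (g b - g s) + (g s - g a) := by ring
    rw [h4]
    refine (abs_add_le _ _).trans ?_
    linarith

namespace Triangulation.Fine
variable {Srf : SmoothSurface} {γ h C : ℝ} {Tr : Triangulation Srf γ h} {G : Geo Srf}

/-- the normal extension of the lift of a function on `S_h` -/
def lf (Tr : Triangulation Srf γ h) (G : Geo Srf) (v : E3 → ℝ) : E3 → ℝ := fun x => Tr.liftS v (G.a x)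

lemma liftS_a (F : Tr.Fine G C) (v : E3 → ℝ) {x : E3} (hx : x ∈ Tr.Sh) : Tr.liftS v (G.a x) = v x := by
  rw [← F.a_eq hx, Triangulation.liftS]
  congr 1
  exact Tr.a_bij.injOn.leftInvOn_invFunOn hx

lemma lf_eq (F : Tr.Fine G C) (v : E3 → ℝ) {t : E3 × E3 × E3} (ht : t ∈ Tr.T) {x : E3} (hx : x ∈ triOf t) : lf Tr G v x = v x :=
  F.liftS_a v (sub_Sh ht hx)

lemma lf_a (F : Tr.Fine G C) (v : E3 → ℝ) {t : E3 × E3 × E3} (ht : t ∈ Tr.T) {x : E3} (hx : x ∈ triOf t) : lf Tr G v (G.a x) = v x := by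
  rw [lf, G.a_self (G.a_mem _ (G.thick_sub (F.thick ht hx)))]; exact F.liftS_a v (sub_Sh ht hx)

lemma lf_S (v : E3 → ℝ) {y : E3} (hy : y ∈ Srf.S) : lf Tr G v y = Tr.liftS v y := by rw [lf, G.a_self hy]

lemma vh_lip {v : E3 → ℝ} (hv : Tr.IsVh v) : ∃ M ≥ 0, ∀ t ∈ Tr.T, ∀ x ∈ triOf t, ∀ y ∈ triOf t, |v y - v x| ≤ M * ‖y - x‖ := by
  have h1 : ∀ t ∈ Tr.T, ∃ M : ℝ, 0 ≤ M ∧ ∀ x ∈ triOf t, ∀ y ∈ triOf t, |v y - v x| ≤ M * ‖y - x‖ := by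
    intro t ht
    obtain ⟨L, c, hL⟩ := hv.2 t ht
    refine ⟨‖LinearMap.toContinuousLinearMap L‖, norm_nonneg _, fun x hx y hy => ?_⟩
    rw [hL x hx, hL y hy]
    have := (LinearMap.toContinuousLinearMap L).le_opNorm (y - x)
    simp only [map_sub, LinearMap.coe_toContinuousLinearMap'] at this
    rw [Real.norm_eq_abs] at this
    convert this using 2; ring
  choose! M hM using h1
  refine ⟨∑ t ∈ Tr.T, M t, Finset.sum_nonneg fun t ht => (hM t ht).1, fun t ht x hx y hy => ((hM t ht).2 x hx y hy).trans ?_⟩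
  gcongr
  exact Finset.single_le_sum (f := M) (fun t ht => (hM t ht).1) ht

lemma Sh_compact : IsCompact Tr.Sh := by
  unfold Triangulation.Sh; exact Tr.T.isCompact_biUnion fun t _ => tri_compact t

lemma lift_lip (F : Tr.Fine G C) {v : E3 → ℝ} (hv : Tr.IsVh v) : ∃ L, LipschitzOnWith L (Tr.liftS v) Srf.S := by
  classical
  obtain ⟨M, hM, hMl⟩ := vh_lip hv
  obtain ⟨CL, hCL, -, -, hL, -⟩ := G.sm_a.bounds G.K_sub
  obtain ⟨B, hB⟩ := (Sh_compact (Tr := Tr)).exists_bound_of_continuousOn hv.1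
  have hB0 : ∀ y ∈ Srf.S, |Tr.liftS v y| ≤ |B| := by
    intro y hy
    obtain ⟨x, hx, rfl⟩ := F.bij.surjOn hy
    rw [F.liftS_a v hx]; exact (hB x hx).trans (le_abs_self _)
  have hδ := G.δ_pos
  set K := 2 * M * CL + 2 * |B| / G.δ with hKdef
  have hK0 : 0 ≤ K := by positivity
  have hpiece : ∀ t ∈ Tr.T, ∀ y ∈ G.a '' triOf t, ∀ y' ∈ G.a '' triOf t, |Tr.liftS v y' - Tr.liftS v y| ≤ 2 * M * ‖y' - y‖ := by
    rintro t ht _ ⟨x, hx, rfl⟩ _ ⟨x', hx', rfl⟩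
    rw [F.liftS_a v (sub_Sh ht hx), F.liftS_a v (sub_Sh ht hx')]
    refine (hMl t ht x hx x' hx').trans ?_
    calc M * ‖x' - x‖ ≤ M * (2 * ‖G.a x' - G.a x‖) := by
          gcongr
          refine (F.anti t ht x hx x' hx').trans ?_
          gcongr; linarith [F.Ch2]
      _ = _ := by ring
  refine ⟨Real.toNNReal K, LipschitzOnWith.of_dist_le_mul fun y1 hy1 y2 hy2 => ?_⟩
  rw [Real.coe_toNNReal _ hK0, dist_comm, dist_comm y1, Real.dist_eq, dist_eq_norm]
  by_cases hfar : G.δ ≤ ‖y2 - y1‖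
  · calc |Tr.liftS v y2 - Tr.liftS v y1| ≤ |B| + |B| := (abs_sub _ _).trans (add_le_add (hB0 _ hy2) (hB0 _ hy1))
      _ = 2 * |B| / G.δ * G.δ := by field_simp; ring
      _ ≤ K * ‖y2 - y1‖ := by
          gcongr
          rw [hKdef]; have : 0 ≤ 2 * M * CL := by positivity
          linarith
  push Not at hfar
  have hseg : ∀ s ∈ Set.Icc (0:ℝ) 1, y1 + s • (y2 - y1) ∈ closedBall y1 G.δ := by
    intro s hs
    rw [mem_closedBall, dist_eq_norm, add_sub_cancel_left, norm_smul, Real.norm_of_nonneg hs.1]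
    nlinarith [hs.2, norm_nonneg (y2 - y1)]
  set γ' : ℝ → E3 := fun s => G.a (y1 + s • (y2 - y1)) with hγ'
  have hγl : ∀ s ∈ Set.Icc (0:ℝ) 1, ∀ s' ∈ Set.Icc (0:ℝ) 1, ‖γ' s' - γ' s‖ ≤ CL * ‖y2 - y1‖ * |s' - s| := by
    intro s hs s' hs'
    refine (hL y1 hy1 _ (hseg s hs) _ (hseg s' hs')).trans ?_
    rw [add_sub_add_left_eq_sub, ← sub_smul, norm_smul, Real.norm_eq_abs]
    exact le_of_eq (by ring)
  have hγc : ContinuousOn γ' (Set.Icc 0 1) := by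
    refine ((G.sm_a).contOn G.K_sub).comp (t := cthickening G.δ Srf.S) (Continuous.continuousOn (by fun_prop)) ?_
    exact fun s hs => Tube.ball_sub hy1 (hseg s hs)
  have hγS : ∀ s ∈ Set.Icc (0:ℝ) 1, γ' s ∈ Srf.S := fun s hs => G.a_mem _ (G.K_sub (Tube.ball_sub hy1 (hseg s hs)))
  have hmain := cover_lip (fun s => Tr.liftS v (γ' s)) (fun t : Tr.T => Set.Icc 0 1 ∩ γ' ⁻¹' (G.a '' triOf t))
    (fun t => hγc.preimage_isClosed_of_isClosed isClosed_Icc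
      ((tri_compact _).image_of_continuousOn (F.lipOn t.2).continuousOn).isClosed)
    (K := 2 * M * (CL * ‖y2 - y1‖))
    (by
      intro t s hs s' hs'
      refine (hpiece t t.2 _ hs.2 _ hs'.2).trans ?_
      rw [mul_assoc (2 * M)]
      exact mul_le_mul_of_nonneg_left (hγl s hs.1 s' hs'.1) (by positivity)) Finset.univ 0 1 zero_le_one
    (by
      intro s hs
      have := hγS s hs
      rw [F.S_eq] at this
      simp only [Set.mem_iUnion] at this ⊢
      obtain ⟨t, ht, h⟩ := this
      exact ⟨⟨t, ht⟩, Finset.mem_univ _, hs, h⟩)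
  simp only [hγ', one_smul, zero_smul, add_zero, add_sub_cancel, sub_zero, mul_one, G.a_self hy1, G.a_self hy2] at hmain
  refine hmain.trans ?_
  rw [← mul_assoc]
  gcongr
  rw [hKdef]; have : 0 ≤ 2 * |B| / G.δ := by positivity
  linarith

lemma lf_lipA (F : Tr.Fine G C) {v : E3 → ℝ} (hv : Tr.IsVh v) : G.LipA (lf Tr G v) := by
  obtain ⟨L, hL⟩ := F.lift_lip hv
  exact G.lipA_of_lip hL

end Triangulation.Fine
end

open MeasureTheory Metric
open scoped RealInnerProductSpace ENNReal NNReal Topology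

noncomputable section

lemma finrank_dir {t : E3 × E3 × E3} (h : AffineIndependent ℝ ![t.1, t.2.1, t.2.2]) : Module.finrank ℝ (dirOf t) = 2 := by
  have h1 := h.finrank_vectorSpan (n := 2) (by simp)
  have h2 : Set.range ![t.1, t.2.1, t.2.2] = vertsOf t := by
    rw [vertsOf]; ext x; simp; tauto
  rw [h2, ← direction_affineSpan] at h1
  exact h1

lemma gradTri_inner {t : E3 × E3 × E3} {v : E3 → ℝ} {x : E3} (hx : x ∈ triOf t) {D : E3 →L[ℝ] ℝ}
    (hD : HasFDerivWithinAt v D (triOf t) x) {τ : E3} (hτ : τ ∈ dirOf t) : ⟪gradTri t v x, τ⟫ = D τ := by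
  rw [gradTri, tGrad_inner _ _ _ _ hτ]
  have h1 := hD.differentiableWithinAt.hasFDerivWithinAt.unique_on hD
  have h2 : ∀ y ∈ triOf t, fderivWithin ℝ v (triOf t) x (y - x) = D (y - x) := fun y hy =>
    h1 (mem_tangentConeAt_of_segment_subset ((tri_convex t).segment_subset hx hy))
  rw [dirOf, direction_affineSpan, vectorSpan_def] at hτ
  induction hτ using Submodule.span_induction with
  | mem z hz =>
    obtain ⟨y, hy, w, hw, rfl⟩ := Set.mem_vsub.1 hz
    have e : y -ᵥ w = (y - x) - (w - x) := by rw [vsub_eq_sub]; abel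
    rw [e, (fderivWithin ℝ v (triOf t) x).map_sub (y - x), D.map_sub (y - x), h2 y (verts_sub t hy), h2 w (verts_sub t hw)]
  | zero => simp
  | add a b _ _ ha hb => rw [map_add, map_add, ha, hb]
  | smul c a _ ha => rw [map_smul, map_smul, ha]

/-- linear algebra of two almost parallel planes -/
lemma plane_lemma {P : Submodule ℝ E3} (hP : Module.finrank ℝ P = 2) {ν p r : E3} (hν : ‖ν‖ = 1) {ε κ : ℝ} (hε : ε ≤ 1 / 8)
    (hνP : ∀ τ ∈ P, |⟪ν, τ⟫| ≤ ε * ‖τ‖) (hp : ⟪p, ν⟫ = 0) (hr : r ∈ P) (hκ0 : 0 ≤ κ)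
    (hκ : ∀ τ ∈ P, |⟪r, τ⟫ - ⟪p, τ⟫| ≤ κ * ‖p‖ * ‖τ‖) :
    ∃ s ∈ P, p - s ∈ Pᗮ ∧ ‖p - s‖ ≤ 2 * ε * ‖p‖ ∧ ‖r - s‖ ≤ κ * ‖p‖ := by
  have hspl : ∀ z : E3, ∃ s ∈ P, z - s ∈ Pᗮ := fun z =>
    ⟨P.starProjection z, Submodule.starProjection_apply_mem _ _, Submodule.sub_starProjection_mem_orthogonal z⟩
  obtain ⟨s, hs, hps⟩ := hspl p
  obtain ⟨σ, hσ, hνσ⟩ := hspl ν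
  have hor : ∀ a ∈ P, ∀ b ∈ Pᗮ, ⟪a, b⟫ = 0 := fun a ha b hb => (Submodule.mem_orthogonal P b).1 hb a ha
  have hσn : ‖σ‖ ≤ ε := by
    have h1 := hνP σ hσ
    have h2 : ⟪ν, σ⟫ = ‖σ‖ * ‖σ‖ := by
      have := hor σ hσ _ hνσ
      rw [inner_sub_right, real_inner_self_eq_norm_mul_norm, real_inner_comm] at this
      linarith
    rw [h2, abs_of_nonneg (by positivity)] at h1
    by_cases h0 : ‖σ‖ = 0
    · have h3 : ∃ τ ∈ P, τ ≠ 0 := by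
        by_contra hcon
        push Not at hcon
        have : P = ⊥ := (Submodule.eq_bot_iff P).2 hcon
        rw [this] at hP; simp at hP
      obtain ⟨τ, hτ, hτ0⟩ := h3
      have h4 := (abs_nonneg _).trans (hνP τ hτ)
      rw [h0]
      exact nonneg_of_mul_nonneg_left h4 (norm_pos_iff.2 hτ0)
    · exact le_of_mul_le_mul_right h1 (lt_of_le_of_ne (norm_nonneg _) (Ne.symm h0))
  have hε0 : 0 ≤ ε := (norm_nonneg _).trans hσn
  have hm : 1 / 2 ≤ ‖ν - σ‖ := by
    have := norm_sub_norm_le ν σ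
    rw [hν] at this; linarith
  refine ⟨s, hs, hps, ?_, ?_⟩
  · have hfr : Module.finrank ℝ Pᗮ = 1 := by
      have := P.finrank_add_finrank_orthogonal
      rw [hP, finrank_euclideanSpace, Fintype.card_fin] at this
      omega
    obtain ⟨c, hc⟩ := exists_smul_eq_of_finrank_eq_one hfr (x := ⟨ν - σ, hνσ⟩) (by
      intro h
      have : ν - σ = 0 := congrArg Subtype.val h
      rw [this, norm_zero] at hm; norm_num at hm) ⟨p - s, hps⟩
    have hc' : c • (ν - σ) = p - s := congrArg Subtype.val hc
    have h1 : c * (‖ν - σ‖ * ‖ν - σ‖) = - ⟪p, σ⟫ := by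
      have h2 : ⟪p - s, ν - σ⟫ = ⟪p, ν - σ⟫ := by rw [inner_sub_left, hor s hs _ hνσ, sub_zero]
      rw [← hc', inner_smul_left, real_inner_self_eq_norm_mul_norm, inner_sub_right, hp] at h2
      simpa using h2
    have h3 : ‖p - s‖ * ‖ν - σ‖ ≤ ‖p‖ * ε := by
      rw [← hc', norm_smul, Real.norm_eq_abs]
      calc |c| * ‖ν - σ‖ * ‖ν - σ‖ = |c * (‖ν - σ‖ * ‖ν - σ‖)| := by
            rw [abs_mul, abs_of_nonneg (by positivity : 0 ≤ ‖ν - σ‖ * ‖ν - σ‖)]; ring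
        _ = |⟪p, σ⟫| := by rw [h1, abs_neg]
        _ ≤ ‖p‖ * ‖σ‖ := abs_real_inner_le_norm _ _
        _ ≤ _ := by gcongr
    nlinarith [norm_nonneg (p - s)]
  · have h1 := hκ (r - s) (P.sub_mem hr hs)
    have h2 : ⟪r, r - s⟫ - ⟪p, r - s⟫ = ‖r - s‖ * ‖r - s‖ := by
      have h3 : ⟪r - s, p - s⟫ = 0 := hor _ (P.sub_mem hr hs) _ hps
      rw [← real_inner_self_eq_norm_mul_norm, ← inner_sub_left, real_inner_comm]
      have : r - p = (r - s) - (p - s) := by abel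
      rw [this, inner_sub_right, h3, sub_zero]
    rw [h2, abs_of_nonneg (by positivity)] at h1
    by_cases h0 : ‖r - s‖ = 0
    · rw [h0]; positivity
    · exact le_of_mul_le_mul_right h1 (lt_of_le_of_ne (norm_nonneg _) (Ne.symm h0))

lemma plane_norm {P : Submodule ℝ E3} (hP : Module.finrank ℝ P = 2) {ν p r : E3} (hν : ‖ν‖ = 1) {ε κ : ℝ} (hε : ε ≤ 1 / 8)
    (hνP : ∀ τ ∈ P, |⟪ν, τ⟫| ≤ ε * ‖τ‖) (hp : ⟪p, ν⟫ = 0) (hr : r ∈ P) (hκ0 : 0 ≤ κ) (hκ1 : κ ≤ 1 / 8)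
    (hκ : ∀ τ ∈ P, |⟪r, τ⟫ - ⟪p, τ⟫| ≤ κ * ‖p‖ * ‖τ‖) : ‖p‖ ≤ 2 * ‖r‖ := by
  obtain ⟨s, -, -, h2, h3⟩ := plane_lemma hP hν hε hνP hp hr hκ0 hκ
  have h4 : ‖p‖ ≤ ‖p - s‖ + ‖r - s‖ + ‖r‖ := by
    have : p = (p - s) - (r - s) + r := by abel
    calc ‖p‖ = ‖(p - s) - (r - s) + r‖ := by rw [← this]
      _ ≤ ‖(p - s) - (r - s)‖ + ‖r‖ := norm_add_le _ _
      _ ≤ _ := by gcongr; exact norm_sub_le _ _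
  nlinarith [norm_nonneg p]

lemma plane_pair {P : Submodule ℝ E3} (hP : Module.finrank ℝ P = 2) {ν p r p' r' : E3} (hν : ‖ν‖ = 1) {ε : ℝ} (hε0 : 0 ≤ ε) (hε : ε ≤ 1 / 8)
    (hνP : ∀ τ ∈ P, |⟪ν, τ⟫| ≤ ε * ‖τ‖) (hp : ⟪p, ν⟫ = 0) (hr : r ∈ P) (hp' : ⟪p', ν⟫ = 0) (hr' : r' ∈ P)
    (hκ : ∀ τ ∈ P, |⟪r, τ⟫ - ⟪p, τ⟫| ≤ ε ^ 2 * ‖p‖ * ‖τ‖) (hκ' : ∀ τ ∈ P, |⟪r', τ⟫ - ⟪p', τ⟫| ≤ ε ^ 2 * ‖p'‖ * ‖τ‖) :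
    |⟪r, r'⟫ - ⟪p, p'⟫| ≤ 7 * ε ^ 2 * (‖p‖ * ‖p'‖) := by
  obtain ⟨s, hs, h1, h2, h3⟩ := plane_lemma hP hν hε hνP hp hr (sq_nonneg ε) hκ
  obtain ⟨s', hs', h1', h2', h3'⟩ := plane_lemma hP hν hε hνP hp' hr' (sq_nonneg ε) hκ'
  have hor : ∀ a ∈ P, ∀ b ∈ Pᗮ, ⟪a, b⟫ = 0 := fun a ha b hb => (Submodule.mem_orthogonal P b).1 hb a ha
  have e1 : ⟪r, r'⟫ - ⟪p, p'⟫ = ⟪r - s, p'⟫ + ⟪p, r' - s'⟫ + ⟪r - s, r' - s'⟫ - ⟪p - s, p' - s'⟫ := by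
    have a1 := hor s hs _ h1'
    have a2 := hor s' hs' _ h1
    have a3 := hor (r - s) (P.sub_mem hr hs) _ h1'
    have a4 := hor (r' - s') (P.sub_mem hr' hs') _ h1
    rw [real_inner_comm] at a2 a4
    simp only [inner_sub_left, inner_sub_right] at a1 a2 a3 a4 ⊢
    linarith
  rw [e1]
  have b1 : |⟪r - s, p'⟫| ≤ ε ^ 2 * (‖p‖ * ‖p'‖) := (abs_real_inner_le_norm _ _).trans (by
    calc ‖r - s‖ * ‖p'‖ ≤ (ε ^ 2 * ‖p‖) * ‖p'‖ := by gcongr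
      _ = _ := by ring)
  have b2 : |⟪p, r' - s'⟫| ≤ ε ^ 2 * (‖p‖ * ‖p'‖) := (abs_real_inner_le_norm _ _).trans (by
    calc ‖p‖ * ‖r' - s'‖ ≤ ‖p‖ * (ε ^ 2 * ‖p'‖) := by gcongr
      _ = _ := by ring)
  have b3 : |⟪r - s, r' - s'⟫| ≤ ε ^ 2 * (‖p‖ * ‖p'‖) := (abs_real_inner_le_norm _ _).trans (by
    calc ‖r - s‖ * ‖r' - s'‖ ≤ (ε ^ 2 * ‖p‖) * (ε ^ 2 * ‖p'‖) := by gcongr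
      _ = (ε ^ 2) * (ε ^ 2 * (‖p‖ * ‖p'‖)) := by ring
      _ ≤ 1 * (ε ^ 2 * (‖p‖ * ‖p'‖)) := by gcongr; nlinarith
      _ = _ := by ring)
  have b4 : |⟪p - s, p' - s'⟫| ≤ 4 * ε ^ 2 * (‖p‖ * ‖p'‖) := (abs_real_inner_le_norm _ _).trans (by
    calc ‖p - s‖ * ‖p' - s'‖ ≤ (2 * ε * ‖p‖) * (2 * ε * ‖p'‖) := by gcongr
      _ = _ := by ring)
  rw [abs_le] at *
  constructor <;> linarith [b1.1, b1.2, b2.1, b2.2, b3.1, b3.2, b4.1, b4.2]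

/-- full gradient as a vector -/
def gv (Φ : E3 → ℝ) (y : E3) : E3 := (InnerProductSpace.toDual ℝ E3).symm (fderiv ℝ Φ y)

lemma gv_inner (Φ : E3 → ℝ) (y v : E3) : ⟪gv Φ y, v⟫ = fderiv ℝ Φ y v := by
  rw [gv, InnerProductSpace.toDual_symm_apply]

lemma gv_pd (Φ Ψ : E3 → ℝ) (y : E3) : ⟪gv Φ y, gv Ψ y⟫ = ∑ i, pd i Φ y * pd i Ψ y := by
  rw [← sum_inner_ei]; simp only [gv_inner, pd]

lemma gv_norm (Φ : E3 → ℝ) (y : E3) : ‖gv Φ y‖ ^ 2 = ∑ i, pd i Φ y ^ 2 := by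
  rw [← real_inner_self_eq_norm_sq, gv_pd]; simp only [sq]

namespace Triangulation.Fine
variable {Srf : SmoothSurface} {γ h C : ℝ} {Tr : Triangulation Srf γ h} {G : Geo Srf}

lemma inv_nu {Φ : E3 → ℝ} (hΦ : ∀ x ∈ thickening G.δ Srf.S, Φ x = Φ (G.a x)) {y : E3} (hy : y ∈ Srf.S)
    (hd : DifferentiableAt ℝ Φ y) : fderiv ℝ Φ y (G.nu y) = 0 := by
  have hyt := Geo.S_thick G.δ_pos hy
  have h1 := G.inv_fderiv hΦ hyt (by rwa [G.a_self hy])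
  rw [h1.fderiv, ContinuousLinearMap.comp_apply, G.da_nu hyt, map_zero]

/-- relation between derivatives on the triangle and on the surface -/
lemma deriv_rel (F : Tr.Fine G C) {Φ : E3 → ℝ} (hΦ : ∀ x ∈ thickening G.δ Srf.S, Φ x = Φ (G.a x)) {t : E3 × E3 × E3} (ht : t ∈ Tr.T)
    {x : E3} (hx : x ∈ triOf t) (hd : DifferentiableAt ℝ Φ (G.a x)) :
    ⟪gv Φ (G.a x), G.nu x⟫ = 0 ∧ HasFDerivAt Φ (fderiv ℝ Φ x) x ∧
    ∀ τ, |fderiv ℝ Φ x τ - ⟪gv Φ (G.a x), τ⟫| ≤ (C * h) ^ 2 * ‖gv Φ (G.a x)‖ * ‖τ‖ := by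
  have hxt := F.thick ht hx
  have hxN := G.thick_sub hxt
  have hyS := G.a_mem x hxN
  have h1 := G.inv_fderiv hΦ hxt hd
  have hnu : G.nu (G.a x) = G.nu x := by rw [G.nu_S hyS]; rfl
  have h0 : fderiv ℝ Φ (G.a x) (G.nu x) = 0 := by rw [← hnu]; exact inv_nu hΦ hyS hd
  refine ⟨by rw [gv_inner, h0], h1.differentiableAt.hasFDerivAt, fun τ => ?_⟩
  rw [h1.fderiv, ContinuousLinearMap.comp_apply, G.da hxN, map_sub, map_sub, map_smul, map_smul, h0, gv_inner, ← gv_inner Φ _ (fderiv ℝ G.nu x τ)]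
  have e : fderiv ℝ Φ (G.a x) τ - ⟪G.nu x, τ⟫ • (0:ℝ) - G.q x • ⟪gv Φ (G.a x), fderiv ℝ G.nu x τ⟫ - fderiv ℝ Φ (G.a x) τ
      = - (G.q x * ⟪gv Φ (G.a x), fderiv ℝ G.nu x τ⟫) := by simp only [smul_eq_mul]; ring
  rw [e, abs_neg, abs_mul]
  calc |G.q x| * |⟪gv Φ (G.a x), fderiv ℝ G.nu x τ⟫| ≤ (C * h ^ 2) * (‖gv Φ (G.a x)‖ * (C * ‖τ‖)) := by
        have := F.Ch0
        gcongr
        · exact F.q t ht x hx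
        · refine (abs_real_inner_le_norm _ _).trans ?_
          gcongr
          exact F.dnu x hxt τ
    _ = _ := by ring

lemma Chh (F : Tr.Fine G C) : 0 ≤ C * h := by have := F.C1; have := F.hpos; positivity

lemma grad_pt (F : Tr.Fine G C) {v w : E3 → ℝ} {Φ Ψ : E3 → ℝ} (hΦ : ∀ x ∈ thickening G.δ Srf.S, Φ x = Φ (G.a x))
    (hΨ : ∀ x ∈ thickening G.δ Srf.S, Ψ x = Ψ (G.a x)) {t : E3 × E3 × E3} (ht : t ∈ Tr.T)
    (hv : ∀ x ∈ triOf t, v x = Φ x) (hw : ∀ x ∈ triOf t, w x = Ψ x)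
    {x : E3} (hx : x ∈ triOf t) (hd : DifferentiableAt ℝ Φ (G.a x)) (hd' : DifferentiableAt ℝ Ψ (G.a x)) :
    |⟪gradTri t v x, gradTri t w x⟫ - ⟪gv Φ (G.a x), gv Ψ (G.a x)⟫| ≤ 7 * (C * h) ^ 2 * (‖gv Φ (G.a x)‖ * ‖gv Ψ (G.a x)‖) := by
  obtain ⟨a1, a2, a3⟩ := F.deriv_rel hΦ ht hx hd
  obtain ⟨b1, b2, b3⟩ := F.deriv_rel hΨ ht hx hd'
  have hvD : HasFDerivWithinAt v (fderiv ℝ Φ x) (triOf t) x := a2.hasFDerivWithinAt.congr (fun y hy => hv y hy) (hv x hx)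
  have hwD : HasFDerivWithinAt w (fderiv ℝ Ψ x) (triOf t) x := b2.hasFDerivWithinAt.congr (fun y hy => hw y hy) (hw x hx)
  refine plane_pair (finrank_dir (Tr.indep t ht)) (G.nu_unit (G.thick_sub (F.thick ht hx))) F.Chh F.small
    (fun τ hτ => F.nu t ht x hx τ hτ) a1 (tGrad_mem _ _ _ _) b1 (tGrad_mem _ _ _ _) ?_ ?_
  · intro τ hτ
    rw [gradTri_inner hx hvD hτ]; exact a3 τ
  · intro τ hτ
    rw [gradTri_inner hx hwD hτ]; exact b3 τ

/-- the surface gradient is controlled by derivatives along the triangle -/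
lemma gv_le (F : Tr.Fine G C) {Φ : E3 → ℝ} (hΦ : ∀ x ∈ thickening G.δ Srf.S, Φ x = Φ (G.a x)) {t : E3 × E3 × E3} (ht : t ∈ Tr.T)
    {x : E3} (hx : x ∈ triOf t) (hd : DifferentiableAt ℝ Φ (G.a x)) {ρ : ℝ} (hρ : ∀ τ ∈ dirOf t, |fderiv ℝ Φ x τ| ≤ ρ * ‖τ‖) :
    ‖gv Φ (G.a x)‖ ≤ 2 * ρ := by
  obtain ⟨a1, a2, a3⟩ := F.deriv_rel hΦ ht hx hd
  have h1 : ‖gv Φ (G.a x)‖ ≤ 2 * ‖gradTri t Φ x‖ :=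
    plane_norm (κ := (C * h) ^ 2) (finrank_dir (Tr.indep t ht)) (G.nu_unit (G.thick_sub (F.thick ht hx))) F.small
      (fun τ hτ => F.nu t ht x hx τ hτ) a1 (tGrad_mem _ _ _ _) (sq_nonneg _) (by nlinarith [F.small, F.Chh]) (by
        intro τ hτ
        rw [gradTri_inner hx a2.hasFDerivWithinAt hτ]; exact a3 τ)
  have hmem : gradTri t Φ x ∈ dirOf t := tGrad_mem _ _ _ _
  have h2 : ‖gradTri t Φ x‖ * ‖gradTri t Φ x‖ ≤ ρ * ‖gradTri t Φ x‖ := by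
    rw [← real_inner_self_eq_norm_mul_norm, gradTri_inner hx a2.hasFDerivWithinAt hmem]
    exact (le_abs_self _).trans (hρ _ hmem)
  by_cases h0 : ‖gradTri t Φ x‖ = 0
  · have h4 : 0 ≤ ρ := by
      by_contra hcon
      push Not at hcon
      have hfr := finrank_dir (Tr.indep t ht)
      have h3 : ∃ τ ∈ dirOf t, τ ≠ 0 := by
        by_contra hc
        push Not at hc
        have : dirOf t = ⊥ := (Submodule.eq_bot_iff _).2 hc
        rw [this] at hfr; simp at hfr
      obtain ⟨τ, hτ, hτ0⟩ := h3
      have := (abs_nonneg _).trans (hρ τ hτ)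
      nlinarith [norm_pos_iff.2 hτ0]
    linarith
  · have := le_of_mul_le_mul_right h2 (lt_of_le_of_ne (norm_nonneg _) (Ne.symm h0))
    linarith

end Triangulation.Fine
end

open MeasureTheory Metric
open scoped RealInnerProductSpace ENNReal NNReal Topology

noncomputable section

/-- full first order quadratic form density -/
def qf (Φ Ψ : E3 → ℝ) (y : E3) : ℝ := ∑ i, pd i Φ y * pd i Ψ y + Φ y * Ψ y

def en (Φ : E3 → ℝ) (y : E3) : ℝ := Real.sqrt (qf Φ Φ y)

lemma qf_nonneg (Φ : E3 → ℝ) (y : E3) : 0 ≤ qf Φ Φ y :=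
  add_nonneg (Finset.sum_nonneg fun i _ => mul_self_nonneg _) (mul_self_nonneg _)

lemma qf_self (Φ : E3 → ℝ) (y : E3) : qf Φ Φ y = ‖gv Φ y‖ ^ 2 + Φ y ^ 2 := by
  rw [gv_norm, qf]; simp only [sq]

lemma en_nonneg (Φ : E3 → ℝ) (y : E3) : 0 ≤ en Φ y := Real.sqrt_nonneg _

lemma en_sq (Φ : E3 → ℝ) (y : E3) : en Φ y ^ 2 = qf Φ Φ y := Real.sq_sqrt (qf_nonneg _ _)

lemma en_cs (Φ Ψ : E3 → ℝ) (y : E3) : ‖gv Φ y‖ * ‖gv Ψ y‖ + |Φ y| * |Ψ y| ≤ en Φ y * en Ψ y := by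
  rw [en, en, ← Real.sqrt_mul (qf_nonneg _ _), qf_self, qf_self]
  apply Real.le_sqrt_of_sq_le
  rw [← sq_abs (Φ y), ← sq_abs (Ψ y)]
  nlinarith [sq_nonneg (‖gv Φ y‖ * |Ψ y| - ‖gv Ψ y‖ * |Φ y|)]

lemma qf_le (Φ Ψ : E3 → ℝ) (y : E3) : |qf Φ Ψ y| ≤ en Φ y * en Ψ y := by
  refine le_trans ?_ (en_cs Φ Ψ y)
  rw [qf, ← gv_pd]
  refine (abs_add_le _ _).trans (add_le_add (abs_real_inner_le_norm _ _) (abs_mul _ _).le)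

lemma gv_le_en (Φ Ψ : E3 → ℝ) (y : E3) : ‖gv Φ y‖ * ‖gv Ψ y‖ ≤ en Φ y * en Ψ y :=
  le_trans (le_add_of_nonneg_right (by positivity)) (en_cs Φ Ψ y)

lemma abs_le_en (Φ : E3 → ℝ) (y : E3) : |Φ y| ≤ en Φ y :=
  Real.abs_le_sqrt (by rw [qf_self]; nlinarith [sq_nonneg ‖gv Φ y‖])

lemma cs_int {X : Type*} [MeasurableSpace X] {μ : Measure X} {f g : X → ℝ} (hf : MemLp f 2 μ) (hg : MemLp g 2 μ)
    (f0 : ∀ x, 0 ≤ f x) (g0 : ∀ x, 0 ≤ g x) :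
    ∫ x, f x * g x ∂μ ≤ Real.sqrt (∫ x, f x ^ 2 ∂μ) * Real.sqrt (∫ x, g x ^ 2 ∂μ) := by
  have h := integral_mul_le_Lp_mul_Lq_of_nonneg (μ := μ) (Real.HolderConjugate.two_two) (f := f) (g := g)
    (Filter.Eventually.of_forall f0) (Filter.Eventually.of_forall g0) (by simpa using hf) (by simpa using hg)
  simpa [Real.sqrt_eq_rpow] using h

namespace Geo
variable {Srf : SmoothSurface} {G : Geo Srf}

def B (Srf : SmoothSurface) (Φ Ψ : E3 → ℝ) : ℝ := ∫ y, qf Φ Ψ y ∂Srf.mu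

def Nm (Srf : SmoothSurface) (Φ : E3 → ℝ) : ℝ := Real.sqrt (B Srf Φ Φ)

lemma Nm_nonneg (Φ : E3 → ℝ) : 0 ≤ Nm Srf Φ := Real.sqrt_nonneg _

lemma B_comm (Φ Ψ : E3 → ℝ) : B Srf Φ Ψ = B Srf Ψ Φ := by
  simp only [B, qf, mul_comm]

lemma B_nonneg (Φ : E3 → ℝ) : 0 ≤ B Srf Φ Φ := integral_nonneg fun y => qf_nonneg Φ y

lemma Nm_sq (Φ : E3 → ℝ) : Nm Srf Φ ^ 2 = B Srf Φ Φ := Real.sq_sqrt (B_nonneg _)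

lemma LipA.sub {Φ Ψ : E3 → ℝ} (h : G.LipA Φ) (h' : G.LipA Ψ) : G.LipA (fun x => Φ x - Ψ x) := by
  obtain ⟨L, hL⟩ := h.lip
  obtain ⟨L', hL'⟩ := h'.lip
  refine ⟨⟨L + L', hL.sub hL'⟩, fun x hx => ?_⟩
  rw [h.inv x hx, h'.inv x hx]

lemma LipA.memLp (h : G.LipA Φ) : MemLp Φ 2 Srf.mu := by
  have := G.mu_finite
  obtain ⟨C, _, hC⟩ := h.bdd
  refine MemLp.of_bound h.aesm_S C ?_
  filter_upwards [ae_restrict_mem S_meas] with y hy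
  exact hC y (thickening_subset_cthickening _ _ (S_thick G.δ_pos hy))

lemma LipA.qf_aesm {Φ Ψ : E3 → ℝ} (h : G.LipA Φ) (h' : G.LipA Ψ) : AEStronglyMeasurable (qf Φ Ψ) Srf.mu := by
  unfold qf
  refine AEStronglyMeasurable.add ?_ (h.aesm_S.mul h'.aesm_S)
  exact (Finset.measurable_sum _ fun i _ => (measurable_pd i Φ).mul (measurable_pd i Ψ)).aestronglyMeasurable

lemma LipA.en_memLp {Φ : E3 → ℝ} (h : G.LipA Φ) : MemLp (en Φ) 2 Srf.mu := by
  have := G.mu_finite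
  obtain ⟨C, C0, hC⟩ := h.bdd
  obtain ⟨L, hL⟩ := h.fderiv_le
  refine MemLp.of_bound (Real.continuous_sqrt.comp_aestronglyMeasurable (h.qf_aesm h)) (Real.sqrt (L^2+L^2+L^2+C^2)) ?_
  filter_upwards [ae_restrict_mem S_meas] with y hy
  have h1 := hC y (thickening_subset_cthickening _ _ (S_thick G.δ_pos hy))
  have h2 : ∀ i, pd i Φ y * pd i Φ y ≤ L ^ 2 := fun i => by
    have := (abs_pd_le i Φ y).trans (hL y (S_thick G.δ_pos hy))
    nlinarith [abs_le.1 this, abs_mul_abs_self (pd i Φ y), abs_nonneg (pd i Φ y)]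
  rw [Real.norm_eq_abs, abs_of_nonneg (en_nonneg _ _), en]
  apply Real.sqrt_le_sqrt
  rw [qf, Fin.sum_univ_three]
  have h3 : Φ y * Φ y ≤ C ^ 2 := by nlinarith [abs_mul_abs_self (Φ y), abs_nonneg (Φ y)]
  linarith [h2 0, h2 1, h2 2]

lemma LipA.en_int {Φ Ψ : E3 → ℝ} (h : G.LipA Φ) (h' : G.LipA Ψ) : Integrable (fun y => en Φ y * en Ψ y) Srf.mu :=
  h.en_memLp.integrable_mul h'.en_memLp

lemma LipA.qf_int {Φ Ψ : E3 → ℝ} (h : G.LipA Φ) (h' : G.LipA Ψ) : Integrable (qf Φ Ψ) Srf.mu :=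
  (h.en_int h').mono' (h.qf_aesm h') (Filter.Eventually.of_forall fun y => qf_le Φ Ψ y)

lemma LipA.en_le {Φ Ψ : E3 → ℝ} (h : G.LipA Φ) (h' : G.LipA Ψ) : ∫ y, en Φ y * en Ψ y ∂Srf.mu ≤ Nm Srf Φ * Nm Srf Ψ := by
  have := cs_int h.en_memLp h'.en_memLp (en_nonneg Φ) (en_nonneg Ψ)
  simpa only [en_sq, Nm, B] using this

lemma LipA.abs_le {Φ Ψ : E3 → ℝ} (h : G.LipA Φ) (h' : G.LipA Ψ) : ∫ y, |qf Φ Ψ y| ∂Srf.mu ≤ Nm Srf Φ * Nm Srf Ψ :=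
  (integral_mono (h.qf_int h').abs (h.en_int h') fun y => qf_le Φ Ψ y).trans (h.en_le h')

lemma LipA.B_le {Φ Ψ : E3 → ℝ} (h : G.LipA Φ) (h' : G.LipA Ψ) : |B Srf Φ Ψ| ≤ Nm Srf Φ * Nm Srf Ψ :=
  (abs_integral_le_integral_abs).trans (h.abs_le h')

lemma LipA.B_sub {Φ Ψ X : E3 → ℝ} (h : G.LipA Φ) (h' : G.LipA Ψ) (hX : G.LipA X) :
    B Srf (fun x => Φ x - Ψ x) X = B Srf Φ X - B Srf Ψ X := by
  rw [B, B, B, ← integral_sub (h.qf_int hX) (h'.qf_int hX)]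
  apply integral_congr_ae
  filter_upwards [h.ae_diff, h'.ae_diff] with y h1 h2
  simp only [qf, pd_sub h1 h2, Fin.sum_univ_three]
  ring

lemma LipA.N_sub {Φ Ψ : E3 → ℝ} (h : G.LipA Φ) (h' : G.LipA Ψ) :
    Nm Srf (fun x => Φ x - Ψ x) ≤ Nm Srf Φ + Nm Srf Ψ := by
  refine abs_le_of_sq_le_sq' ?_ (add_nonneg (Nm_nonneg _) (Nm_nonneg _)) |>.2
  rw [Nm_sq, h.B_sub h' (h.sub h'), B_comm Φ, h.B_sub h' h, B_comm Ψ (fun x => Φ x - Ψ x), h.B_sub h' h', B_comm Ψ Φ, ← Nm_sq, ← Nm_sq]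
  nlinarith [_root_.abs_le.1 (h.B_le h')]

lemma LipA.l2_le {Φ : E3 → ℝ} (h : G.LipA Φ) : Real.sqrt (∫ y, Φ y ^ 2 ∂Srf.mu) ≤ Nm Srf Φ := by
  apply Real.sqrt_le_sqrt
  refine integral_mono h.memLp.integrable_sq (h.qf_int h) fun y => ?_
  simp only [qf_self]; nlinarith [sq_nonneg ‖gv Φ y‖]

lemma l2_mul {f g : E3 → ℝ} (hf : MemLp f 2 Srf.mu) (hg : MemLp g 2 Srf.mu) :
    ∫ y, |f y * g y| ∂Srf.mu ≤ Real.sqrt (∫ y, f y ^ 2 ∂Srf.mu) * Real.sqrt (∫ y, g y ^ 2 ∂Srf.mu) := by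
  have := cs_int hf.abs hg.abs (fun x => abs_nonneg (f x)) (fun x => abs_nonneg _)
  simpa only [Pi.abs_apply, sq_abs, abs_mul] using this

/-- weak formulation against Lipschitz functions -/
lemma B_green (G : Geo Srf) {Φ W : E3 → ℝ} (h : G.LipA Φ) (hW : G.SmA W) : B Srf Φ W = ∫ y, Φ y * (W y - lap W y) ∂Srf.mu := by
  obtain ⟨h1, h2, h3⟩ := G.green_gr h hW
  have h4 : Integrable (fun y => Φ y * W y) Srf.mu := h.memLp.integrable_mul hW.lipA.memLp
  unfold B qf
  have h5 : ∫ y, Φ y * (W y - lap W y) ∂Srf.mu = ∫ y, (Φ y * W y - Φ y * lap W y) ∂Srf.mu := by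
    congr 1; ext y; ring
  rw [integral_add h1 h4, h3, h5, integral_sub h4 h2]
  ring

end Geo

namespace Triangulation

lemma IsVh.sub {Srf : SmoothSurface} {γ h : ℝ} {Tr : Triangulation Srf γ h} {v w : E3 → ℝ} (hv : Tr.IsVh v) (hw : Tr.IsVh w) :
    Tr.IsVh (fun x => v x - w x) := by
  refine ⟨hv.1.sub hw.1, fun t ht => ?_⟩
  obtain ⟨L, c, h1⟩ := hv.2 t ht
  obtain ⟨L', c', h2⟩ := hw.2 t ht
  refine ⟨L - L', c - c', fun x hx => ?_⟩
  simp only [h1 x hx, h2 x hx, LinearMap.sub_apply]; ring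

namespace Fine
variable {Srf : SmoothSurface} {γ h C : ℝ} {Tr : Triangulation Srf γ h} {G : Geo Srf}

lemma gradTri_const {v : E3 → ℝ} (hv : Tr.IsVh v) {t : E3 × E3 × E3} (ht : t ∈ Tr.T) {x y : E3} (hx : x ∈ triOf t) (hy : y ∈ triOf t) :
    gradTri t v x = gradTri t v y := by
  obtain ⟨L, c, h1⟩ := hv.2 t ht
  have hD : ∀ z ∈ triOf t, HasFDerivWithinAt v (LinearMap.toContinuousLinearMap L) (triOf t) z := fun z hz => by
    refine HasFDerivWithinAt.congr (f := fun x => LinearMap.toContinuousLinearMap L x + c) ?_ (fun x hx => h1 x hx) (h1 z hz)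
    exact ((LinearMap.toContinuousLinearMap L).hasFDerivAt.add_const c).hasFDerivWithinAt
  have hm : gradTri t v x - gradTri t v y ∈ dirOf t := Submodule.sub_mem _ (tGrad_mem _ _ _ _) (tGrad_mem _ _ _ _)
  have h0 : ⟪gradTri t v x - gradTri t v y, gradTri t v x - gradTri t v y⟫ = 0 := by
    rw [inner_sub_left, gradTri_inner hx (hD x hx) hm, gradTri_inner hy (hD y hy) hm, sub_self]
  exact sub_eq_zero.1 (inner_self_eq_zero.1 h0)

lemma tri_fin (F : Tr.Fine G C) {t : E3 × E3 × E3} (ht : t ∈ Tr.T) : IsFiniteMeasure ((μH[2] : Measure E3).restrict (triOf t)) := by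
  have := G.mu_finite
  have h1 := F.int_tri (integrable_const (1:ℝ)) ht
  rw [integrable_const_iff] at h1
  rcases h1 with h1 | h1
  · norm_num at h1
  · exact h1

lemma tri_int (F : Tr.Fine G C) {v w : E3 → ℝ} (hv : Tr.IsVh v) (hw : Tr.IsVh w) {t : E3 × E3 × E3} (ht : t ∈ Tr.T) :
    Integrable (fun x => ⟪gradTri t v x, gradTri t w x⟫ + v x * w x) ((μH[2] : Measure E3).restrict (triOf t)) := by
  have := F.tri_fin ht
  obtain ⟨x0, hx0⟩ : (triOf t).Nonempty := ⟨_, verts_sub _ (v0_mem t)⟩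
  refine Integrable.congr (f := fun x => ⟪gradTri t v x0, gradTri t w x0⟫ + v x * w x) ?_ ?_
  · refine (integrable_const _).add ?_
    have hc : ContinuousOn (fun x => v x * w x) (triOf t) := (hv.1.mono (sub_Sh ht)).mul (hw.1.mono (sub_Sh ht))
    obtain ⟨K, hK⟩ := (tri_compact t).exists_bound_of_continuousOn hc
    refine Integrable.of_bound (C := K) (hc.aestronglyMeasurable (tri_meas t)) ?_
    filter_upwards [ae_restrict_mem (tri_meas t)] with x hx using hK x hx
  · filter_upwards [ae_restrict_mem (tri_meas t)] with x hx
    rw [gradTri_const hv ht hx hx0, gradTri_const hw ht hx hx0]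

/-- comparison of the bilinear forms -/
lemma form_compare (F : Tr.Fine G C) {v w : E3 → ℝ} (hv : Tr.IsVh v) (hw : Tr.IsVh w) :
    |Tr.ahForm v w - Geo.B Srf (lf Tr G v) (lf Tr G w)| ≤ 24 * C ^ 2 * h ^ 2 * (Geo.Nm Srf (lf Tr G v) * Geo.Nm Srf (lf Tr G w)) := by
  have hΦ := F.lf_lipA hv
  have hΨ := F.lf_lipA hw
  set Φ := lf Tr G v with hΦd
  set Ψ := lf Tr G w with hΨd
  have h1 := F.compare (hΦ.qf_int hΨ)
  have h2 : |Tr.ahForm v w - ∑ t ∈ Tr.T, ∫ x in triOf t, qf Φ Ψ (G.a x) ∂μH[2]| ≤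
      7 * (C * h) ^ 2 * ∑ t ∈ Tr.T, ∫ x in triOf t, en Φ (G.a x) * en Ψ (G.a x) ∂μH[2] := by
    rw [ahForm, ← Finset.sum_sub_distrib, Finset.mul_sum]
    refine (Finset.abs_sum_le_sum_abs _ _).trans (Finset.sum_le_sum fun t ht => ?_)
    rw [← integral_sub (F.tri_int hv hw ht) (F.int_tri (hΦ.qf_int hΨ) ht), ← integral_const_mul]
    refine abs_integral_le_integral_abs.trans ?_
    refine integral_mono_ae ((F.tri_int hv hw ht).sub (F.int_tri (hΦ.qf_int hΨ) ht)).abs ((F.int_tri (hΦ.en_int hΨ) ht).const_mul _) ?_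
    filter_upwards [ae_restrict_mem (tri_meas t), F.ae_tri hΦ.ae_diff ht, F.ae_tri hΨ.ae_diff ht] with x hx hd hd'
    have h3 := F.grad_pt hΦ.inv hΨ.inv ht (fun x hx => (F.lf_eq v ht hx).symm) (fun x hx => (F.lf_eq w ht hx).symm) hx hd hd'
    have h4 : ⟪gradTri t v x, gradTri t w x⟫ + v x * w x - qf Φ Ψ (G.a x) =
        ⟪gradTri t v x, gradTri t w x⟫ - ⟪gv Φ (G.a x), gv Ψ (G.a x)⟫ := by
      rw [qf, gv_pd, ← hΦ.inv x (F.thick ht hx), ← hΨ.inv x (F.thick ht hx), hΦd, hΨd, F.lf_eq v ht hx, F.lf_eq w ht hx]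
      ring
    simp only [h4]
    exact h3.trans (mul_le_mul_of_nonneg_left (gv_le_en _ _ _) (by positivity))
  have h5 := F.sum_le (hΦ.en_int hΨ) (fun y => mul_nonneg (en_nonneg _ _) (en_nonneg _ _))
  have h6 := hΦ.en_le hΨ
  have h7 := hΦ.abs_le hΨ
  have hC := F.C1
  have hh := F.hpos
  set NN := Geo.Nm Srf Φ * Geo.Nm Srf Ψ
  have hNN : 0 ≤ NN := mul_nonneg (Geo.Nm_nonneg _) (Geo.Nm_nonneg _)
  have h8 : 7 * (C * h) ^ 2 * ∑ t ∈ Tr.T, ∫ x in triOf t, en Φ (G.a x) * en Ψ (G.a x) ∂μH[2] ≤ 7 * (C * h) ^ 2 * (3 * NN) :=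
    mul_le_mul_of_nonneg_left (by linarith) (by positivity)
  have h9 : 3 * C * h ^ 2 * ∫ y, |qf Φ Ψ y| ∂Srf.mu ≤ 3 * C * h ^ 2 * NN := mul_le_mul_of_nonneg_left h7 (by positivity)
  have h10 : 3 * C * h ^ 2 * NN ≤ 3 * C ^ 2 * h ^ 2 * NN := by
    have : C ≤ C ^ 2 := by nlinarith
    gcongr
  have := abs_sub_le (Tr.ahForm v w) (∑ t ∈ Tr.T, ∫ x in triOf t, qf Φ Ψ (G.a x) ∂μH[2]) (Geo.B Srf Φ Ψ)
  have h11 : |∑ t ∈ Tr.T, ∫ x in triOf t, qf Φ Ψ (G.a x) ∂μH[2] - Geo.B Srf Φ Ψ| ≤ 3 * C ^ 2 * h ^ 2 * NN := h1.trans (h9.trans h10)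
  nlinarith

/-- comparison of the right-hand sides -/
lemma rhs_compare (F : Tr.Fine G C) {f v : E3 → ℝ} (hf : G.SmA (fun x => f (G.a x))) (hv : Tr.IsVh v) :
    |∫ x in Tr.Sh, f (Tr.a x) * v x ∂μH[2] - ∫ y, f (G.a y) * lf Tr G v y ∂Srf.mu| ≤
      3 * C * h ^ 2 * (Real.sqrt (∫ y, f (G.a y) ^ 2 ∂Srf.mu) * Geo.Nm Srf (lf Tr G v)) := by
  have hΦ := F.lf_lipA hv
  have hfm := hf.lipA.memLp
  have hi : Integrable (fun y => f (G.a y) * lf Tr G v y) Srf.mu := hfm.integrable_mul hΦ.memLp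
  have h1 := F.compare hi
  have e1 : ∀ t ∈ Tr.T, ∀ x ∈ triOf t, f (G.a (G.a x)) * lf Tr G v (G.a x) = f (Tr.a x) * v x := fun t ht x hx => by
    rw [G.a_a (G.thick_sub (F.thick ht hx)), F.a_eq (sub_Sh ht hx), ← hΦ.inv x (F.thick ht hx), F.lf_eq v ht hx]
  have e2 : ∫ x in Tr.Sh, f (Tr.a x) * v x ∂μH[2] = ∑ t ∈ Tr.T, ∫ x in triOf t, f (G.a (G.a x)) * lf Tr G v (G.a x) ∂μH[2] := by
    rw [F.Sh_restrict, integral_finsetSum_measure]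
    · exact Finset.sum_congr rfl fun t ht => (setIntegral_congr_fun (tri_meas t) (e1 t ht)).symm
    · intro t ht
      refine (F.int_tri hi ht).congr ?_
      filter_upwards [ae_restrict_mem (tri_meas t)] with x hx using e1 t ht x hx
  rw [e2]
  refine h1.trans ?_
  have hC := F.C1
  have hh := F.hpos
  refine mul_le_mul_of_nonneg_left ?_ (by positivity)
  refine (Geo.l2_mul hfm hΦ.memLp).trans (mul_le_mul_of_nonneg_left hΦ.l2_le (Real.sqrt_nonneg _))

end Fine
end Triangulation
end

open MeasureTheory Metric
open scoped RealInnerProductSpace ENNReal NNReal Topology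

noncomputable section

lemma exists_affine {t : E3 × E3 × E3} (ht : AffineIndependent ℝ ![t.1, t.2.1, t.2.2]) (g : E3 → ℝ) :
    ∃ (L : E3 →ₗ[ℝ] ℝ) (c : ℝ), ∀ v ∈ vertsOf t, L v + c = g v := by
  have h1 := (affineIndependent_iff_linearIndependent_vsub ℝ _ (0 : Fin 3)).1 ht
  let b := Module.Basis.span h1
  let φ := b.constr ℝ (fun i => g (![t.1, t.2.1, t.2.2] i.1) - g t.1)
  obtain ⟨L, hL⟩ := LinearMap.exists_extend φ
  have h2 : ∀ i : {x : Fin 3 // x ≠ 0}, L (![t.1, t.2.1, t.2.2] i.1 - t.1) = g (![t.1, t.2.1, t.2.2] i.1) - g t.1 := by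
    intro i
    have h3 : φ (b i) = g (![t.1, t.2.1, t.2.2] i.1) - g t.1 := b.constr_basis ℝ _ i
    have h4 : ((b i : _) : E3) = ![t.1, t.2.1, t.2.2] i.1 - t.1 := by
      exact congrArg Subtype.val (Module.Basis.span_apply h1 i)
    rw [← h3, ← hL, LinearMap.comp_apply, Submodule.subtype_apply, h4]
  refine ⟨L, g t.1 - L t.1, fun v hv => ?_⟩
  have a1 := h2 ⟨1, by decide⟩
  have a2 := h2 ⟨2, by decide⟩
  simp at a1 a2
  rcases hv with rfl | rfl | rfl
  · ring
  · linarith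
  · linarith

namespace Triangulation
variable {Srf : SmoothSurface} {γ h : ℝ}

/-- existence of the nodal interpolant -/
lemma exists_interp (Tr : Triangulation Srf γ h) (g : E3 → ℝ) : ∃ v, Tr.IsVh v ∧ ∀ t ∈ Tr.T, ∀ p ∈ vertsOf t, v p = g p := by
  classical
  have hex : ∀ t : E3 × E3 × E3, ∃ (L : E3 →ₗ[ℝ] ℝ) (c : ℝ), t ∈ Tr.T → ∀ v ∈ vertsOf t, L v + c = g v := fun t => by
    by_cases ht : t ∈ Tr.T
    · obtain ⟨L, c, h1⟩ := exists_affine (Tr.indep t ht) g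
      exact ⟨L, c, fun _ => h1⟩
    · exact ⟨0, 0, fun h => absurd h ht⟩
  choose L c hLc using hex
  have hcons : ∀ t ∈ Tr.T, ∀ t' ∈ Tr.T, ∀ x, x ∈ triOf t → x ∈ triOf t' → L t x + c t = L t' x + c t' := by
    intro t ht t' ht' x hx hx'
    by_cases hne : t = t'
    · rw [hne]
    rcases Tr.meet t ht t' ht' hne with h1 | ⟨v, ⟨hv, hv'⟩, h1⟩ | ⟨v, w, -, ⟨hv, hv'⟩, ⟨hw, hw'⟩, h1⟩
    · have : x ∈ triOf t ∩ triOf t' := ⟨hx, hx'⟩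
      rw [h1] at this; exact absurd this (Set.notMem_empty _)
    · have : x ∈ triOf t ∩ triOf t' := ⟨hx, hx'⟩
      rw [h1] at this; rw [Set.mem_singleton_iff.1 this, hLc t ht v hv, hLc t' ht' v hv']
    · have : x ∈ triOf t ∩ triOf t' := ⟨hx, hx'⟩
      rw [h1] at this
      obtain ⟨α, β, hα, hβ, hαβ, rfl⟩ := this
      have e1 : L t v + c t = L t' v + c t' := by rw [hLc t ht v hv, hLc t' ht' v hv']
      have e2 : L t w + c t = L t' w + c t' := by rw [hLc t ht w hw, hLc t' ht' w hw']
      simp only [map_add, map_smul, smul_eq_mul]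
      have hβ' : β = 1 - α := by linarith
      subst hβ'
      linear_combination α * e1 + (1 - α) * e2
  let v : E3 → ℝ := fun x => if hx : ∃ t ∈ Tr.T, x ∈ triOf t then L hx.choose x + c hx.choose else 0
  have hv : ∀ t ∈ Tr.T, ∀ x ∈ triOf t, v x = L t x + c t := by
    intro t ht x hx
    have hx' : ∃ t ∈ Tr.T, x ∈ triOf t := ⟨t, ht, hx⟩
    simp only [v, dif_pos hx']
    exact hcons _ hx'.choose_spec.1 t ht x hx'.choose_spec.2 hx
  refine ⟨v, ⟨?_, fun t ht => ⟨L t, c t, hv t ht⟩⟩, fun t ht p hp => ?_⟩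
  · have h1 : Tr.Sh = ⋃ t : Tr.T, triOf t.1 := by
      rw [Triangulation.Sh, Set.iUnion_subtype]
    rw [h1]
    refine (locallyFinite_of_finite _).continuousOn_iUnion (fun t => (tri_compact t.1).isClosed) fun t => ?_
    refine ContinuousOn.congr (f := fun x => L t.1 x + c t.1) ?_ (hv t.1 t.2)
    exact ((L t.1).continuous_of_finiteDimensional.add continuous_const).continuousOn
  · rw [hv t ht p (verts_sub t hp), hLc t ht p hp]

end Triangulation
end

open MeasureTheory Metric
open scoped RealInnerProductSpace ENNReal NNReal Topology

noncomputable section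

/-- averaging along rays towards a vertex is bounded on `L²` of the triangle -/
lemma ray_lint {t : Set E3} (ht : MeasurableSet t) (hc : Convex ℝ t) [IsFiniteMeasure ((μH[2] : Measure E3).restrict t)]
    {v : E3} (hv : v ∈ t) {f : E3 → ℝ≥0∞} (hf : Measurable f) :
    ∫⁻ x in t, (∫⁻ s in Set.Icc (0:ℝ) 1, ENNReal.ofReal (1 - s) * f (x + s • (v - x))) ^ 2 ∂μH[2] ≤ ∫⁻ x in t, f x ^ 2 ∂μH[2] := by
  have hm : Measurable (fun p : E3 × ℝ => ENNReal.ofReal (1 - p.2) * f (p.1 + p.2 • (v - p.1))) := by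
    refine Measurable.mul (by fun_prop) (hf.comp ?_)
    exact Continuous.measurable (by fun_prop)
  have h1 : ∀ x, (∫⁻ s in Set.Icc (0:ℝ) 1, ENNReal.ofReal (1 - s) * f (x + s • (v - x))) ^ 2 ≤
      ∫⁻ s in Set.Icc (0:ℝ) 1, (ENNReal.ofReal (1 - s) * f (x + s • (v - x))) ^ 2 := fun x => by
    have := cs_lint (volume.restrict (Set.Icc (0:ℝ) 1)) (f := fun s => ENNReal.ofReal (1 - s) * f (x + s • (v - x))) (g := fun _ => 1)
      (hm.comp (measurable_const.prodMk measurable_id)).aemeasurable aemeasurable_const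
    simpa using this
  refine (lintegral_mono h1).trans ?_
  rw [lintegral_lintegral_swap (hm.pow_const 2).aemeasurable]
  have h2 : ∀ s ∈ Set.Icc (0:ℝ) 1, ∫⁻ x in t, (ENNReal.ofReal (1 - s) * f (x + s • (v - x))) ^ 2 ∂μH[2] ≤ ∫⁻ x in t, f x ^ 2 ∂μH[2] := by
    intro s hs
    rcases eq_or_lt_of_le hs.2 with rfl | hs1
    · simp
    have hr : 0 < 1 - s := by linarith
    have e1 : ∀ x, x + s • (v - x) = AffineMap.homothety v (1 - s) x := fun x => by
      rw [AffineMap.homothety_apply, vsub_eq_sub, vadd_eq_add]; module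
    have hφm : Measurable (AffineMap.homothety v (1 - s) : E3 → E3) := by
      have : (AffineMap.homothety v (1 - s) : E3 → E3) = fun x => x + s • (v - x) := by ext1 x; rw [e1]
      rw [this]; exact Continuous.measurable (by fun_prop)
    simp only [mul_pow]
    rw [lintegral_const_mul' _ _ (by finiteness)]
    have h3 : ((μH[2] : Measure E3).restrict t).map (AffineMap.homothety v (1 - s)) ≤
        (ENNReal.ofReal (1 - s) ^ 2)⁻¹ • (μH[2] : Measure E3).restrict t := by
      refine Measure.le_iff.2 fun A hA => ?_
      rw [Measure.map_apply hφm hA, Measure.restrict_apply (hφm hA), Measure.smul_apply, Measure.restrict_apply hA]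
      have h4 : (AffineMap.homothety v (1 - s) : E3 → E3) ⁻¹' A ∩ t ⊆ (AffineMap.homothety v (1 - s) : E3 → E3) ⁻¹' (A ∩ t) := by
        rintro x ⟨hx1, hx2⟩
        refine ⟨hx1, ?_⟩
        rw [← e1]; exact hc.add_smul_sub_mem hx2 hv hs
      refine (measure_mono h4).trans ?_
      rw [hausdorffMeasure_homothety_preimage (by norm_num) v hr.ne']
      refine le_of_eq ?_
      rw [ENNReal.smul_def, smul_eq_mul, smul_eq_mul]
      congr 1
      rw [ENNReal.ofReal, ← ENNReal.coe_pow, ← ENNReal.coe_inv]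
      · congr 1
        have : ‖1 - s‖₊ = Real.toNNReal (1 - s) := by
          rw [Real.toNNReal_of_nonneg hr.le]; ext; simp [abs_of_pos hr]
        rw [this, NNReal.inv_rpow]; norm_cast
      · exact pow_ne_zero _ (by simpa using hr)
    have h5 : ∫⁻ x in t, f (x + s • (v - x)) ^ 2 ∂μH[2] = ∫⁻ y, f y ^ 2 ∂(((μH[2] : Measure E3).restrict t).map (AffineMap.homothety v (1 - s))) := by
      rw [lintegral_map (hf.pow_const 2) hφm]; simp only [e1]
    rw [h5]
    calc _ ≤ ENNReal.ofReal (1 - s) ^ 2 * ∫⁻ y, f y ^ 2 ∂((ENNReal.ofReal (1 - s) ^ 2)⁻¹ • (μH[2] : Measure E3).restrict t) := by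
          gcongr
      _ = _ := by
          rw [lintegral_smul_measure, smul_eq_mul, ← mul_assoc, ENNReal.mul_inv_cancel, one_mul]
          · exact pow_ne_zero _ (by simpa using hr)
          · finiteness
  calc _ ≤ ∫⁻ s in Set.Icc (0:ℝ) 1, ∫⁻ x in t, f x ^ 2 ∂μH[2] := setLIntegral_mono' measurableSet_Icc h2
    _ = _ := by simp

/-- second order Taylor expansion with an integral remainder -/
lemma taylor_int {g g' g'' k : ℝ → ℝ} (h1 : ∀ s ∈ Set.Icc (0:ℝ) 1, HasDerivAt g (g' s) s) (h2 : ∀ s ∈ Set.Icc (0:ℝ) 1, HasDerivAt g' (g'' s) s)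
    (hc : ContinuousOn g'' (Set.Icc 0 1)) (hk : ContinuousOn k (Set.Icc 0 1)) (hle : ∀ s ∈ Set.Icc (0:ℝ) 1, |g'' s| ≤ k s) :
    |g 1 - g 0 - g' 0| ≤ ∫ s in Set.Icc (0:ℝ) 1, (1 - s) * k s := by
  have hu : Set.uIcc (0:ℝ) 1 = Set.Icc 0 1 := Set.uIcc_of_le zero_le_one
  have hi : IntervalIntegrable (fun s => (1 - s) * g'' s) volume 0 1 := by
    apply ContinuousOn.intervalIntegrable; rw [hu]
    exact (by fun_prop : Continuous fun s : ℝ => 1 - s).continuousOn.mul hc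
  have h3 : ∫ s in (0:ℝ)..1, (1 - s) * g'' s = ((1 - 1) * g' 1 + g 1) - ((1 - 0) * g' 0 + g 0) := by
    refine intervalIntegral.integral_eq_sub_of_hasDerivAt (f := fun s => (1 - s) * g' s + g s) (fun s hs => ?_) hi
    rw [hu] at hs
    have := (((hasDerivAt_id s).const_sub 1).mul (h2 s hs)).add (h1 s hs)
    refine (this.congr_deriv ?_)
    simp only [id]; ring
  have h4 : g 1 - g 0 - g' 0 = ∫ s in Set.Icc (0:ℝ) 1, (1 - s) * g'' s := by
    rw [integral_Icc_eq_integral_Ioc, ← intervalIntegral.integral_of_le zero_le_one, h3]; ring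
  rw [h4]
  refine abs_integral_le_integral_abs.trans ?_
  have hc1 : ContinuousOn (fun s : ℝ => (1 - s)) (Set.Icc 0 1) := by fun_prop
  refine setIntegral_mono_on (hc1.mul hc).abs.integrableOn_Icc (hc1.mul hk).integrableOn_Icc measurableSet_Icc fun s hs => ?_
  rw [abs_mul, abs_of_nonneg (by linarith [hs.2])]
  exact mul_le_mul_of_nonneg_left (hle s hs) (by linarith [hs.2])

end

open MeasureTheory Metric
open scoped RealInnerProductSpace ENNReal NNReal Topology

noncomputable section

def Hf (W : E3 → ℝ) (y : E3) : ℝ := ∑ i, ∑ j, |pd j (pd i W) y| + ∑ i, |pd i W y|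

lemma Hf_nonneg (W : E3 → ℝ) (y : E3) : 0 ≤ Hf W y :=
  add_nonneg (Finset.sum_nonneg fun _ _ => Finset.sum_nonneg fun _ _ => abs_nonneg _) (Finset.sum_nonneg fun _ _ => abs_nonneg _)

lemma le_Hf2 (W : E3 → ℝ) (y : E3) (i j : Fin 3) : |pd j (pd i W) y| ≤ Hf W y := by
  have h1 : |pd j (pd i W) y| ≤ ∑ j, |pd j (pd i W) y| :=
    Finset.single_le_sum (f := fun j => |pd j (pd i W) y|) (fun _ _ => abs_nonneg _) (Finset.mem_univ j)
  have h2 : ∑ j, |pd j (pd i W) y| ≤ ∑ i, ∑ j, |pd j (pd i W) y| :=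
    Finset.single_le_sum (f := fun i => ∑ j, |pd j (pd i W) y|) (fun _ _ => Finset.sum_nonneg fun _ _ => abs_nonneg _) (Finset.mem_univ i)
  have h3 : 0 ≤ ∑ i, |pd i W y| := Finset.sum_nonneg fun _ _ => abs_nonneg _
  unfold Hf; linarith

lemma le_Hf1 (W : E3 → ℝ) (y : E3) (i : Fin 3) : |pd i W y| ≤ Hf W y := by
  have h1 : |pd i W y| ≤ ∑ i, |pd i W y| :=
    Finset.single_le_sum (f := fun i => |pd i W y|) (fun _ _ => abs_nonneg _) (Finset.mem_univ i)
  have h3 : 0 ≤ ∑ i, ∑ j, |pd j (pd i W) y| := Finset.sum_nonneg fun _ _ => Finset.sum_nonneg fun _ _ => abs_nonneg _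
  unfold Hf; linarith

lemma Hf_sq (W : E3 → ℝ) (y : E3) : Hf W y ^ 2 ≤ 12 * (∑ i, ∑ j, pd j (pd i W) y ^ 2 + ∑ i, pd i W y ^ 2) := by
  unfold Hf
  simp only [← Fintype.sum_prod_type' (f := fun i j : Fin 3 => |pd j (pd i W) y|), ← Fintype.sum_prod_type' (f := fun i j : Fin 3 => pd j (pd i W) y ^ 2)]
  have h1 := sq_sum_le_card_mul_sum_sq (s := Finset.univ) (f := fun p : Fin 3 × Fin 3 => |pd p.2 (pd p.1 W) y|)
  have h2 := sq_sum_le_card_mul_sum_sq (s := Finset.univ) (f := fun p : Fin 3 => |pd p W y|)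
  simp only [sq_abs, Finset.card_univ, Fintype.card_prod, Fintype.card_fin] at h1 h2
  push_cast at h1 h2
  set a := ∑ x : Fin 3 × Fin 3, |pd x.2 (pd x.1 W) y|
  set b := ∑ x : Fin 3, |pd x W y|
  nlinarith [sq_nonneg (a - 3 * b)]

namespace Geo
variable {Srf : SmoothSurface}

lemma hess_bd (G : Geo Srf) : ∃ M ≥ 0, ∀ W, G.SmA W → ∀ z ∈ thickening G.δ Srf.S, ∀ i j, |pd j (pd i W) z| ≤ M * Hf W (G.a z) := by
  have hb : ∀ i j k : Fin 3, ∃ C ≥ 0, ∀ x ∈ cthickening G.δ Srf.S, |pd i (fun x => G.a x k) x| ≤ C ∧ |pd j (pd i (fun x => G.a x k)) x| ≤ C := by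
    intro i j k
    obtain ⟨C1, h1, h1'⟩ := Tube.Sm.bounds0 ((G.sm_a.coord k).pd i) G.K_sub
    obtain ⟨C2, h2, h2'⟩ := Tube.Sm.bounds0 (((G.sm_a.coord k).pd i).pd j) G.K_sub
    exact ⟨max C1 C2, le_max_of_le_left h1, fun x hx => ⟨(h1' x hx).trans (le_max_left _ _), (h2' x hx).trans (le_max_right _ _)⟩⟩
  choose Cc hC0 hC using hb
  set M0 := ∑ i, ∑ j, ∑ k, Cc i j k with hM0
  have hle : ∀ i j k, Cc i j k ≤ M0 := fun i j k => by
    have a1 := Finset.single_le_sum (f := fun k => Cc i j k) (fun k _ => hC0 i j k) (Finset.mem_univ k)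
    have a2 := Finset.single_le_sum (f := fun j => ∑ k, Cc i j k) (fun j _ => Finset.sum_nonneg fun k _ => hC0 i j k) (Finset.mem_univ j)
    have a3 := Finset.single_le_sum (f := fun i => ∑ j, ∑ k, Cc i j k) (fun i _ => Finset.sum_nonneg fun j _ => Finset.sum_nonneg fun k _ => hC0 i j k) (Finset.mem_univ i)
    linarith
  have hM : 0 ≤ M0 := (hC0 0 0 0).trans (hle 0 0 0)
  refine ⟨3 * (M0 + M0 * (3 * M0)), by positivity, fun W hW z hz i j => ?_⟩
  have hzN := G.thick_sub hz
  have hzK := thickening_subset_cthickening _ _ hz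
  have e1 : pd j (pd i W) z = pd j (fun x => ∑ k, pd k W (G.a x) * pd i (fun x => G.a x k) x) z := by
    apply pd_congr
    filter_upwards [thick_nhds hz] with x hx
    rw [← Tube.Sm.pd_comp_a hW.sm i (G.thick_sub hx)]
    apply pd_congr
    filter_upwards [thick_nhds hx] with y hy using hW.inv y hy
  rw [e1, pd_sum (fun k _ => ((hW.sm.pd k).comp_a'.mul ((G.sm_a.coord k).pd i)).diff hzN)]
  have h2 : ∀ k ∈ (Finset.univ : Finset (Fin 3)), |pd j (fun x => pd k W (G.a x) * pd i (fun x => G.a x k) x) z| ≤ (M0 + M0 * (3 * M0)) * Hf W (G.a z) := by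
    intro k _
    rw [pd_mul (((hW.sm.pd k).comp_a').diff hzN) (((G.sm_a.coord k).pd i).diff hzN), Tube.Sm.pd_comp_a (hW.sm.pd k) j hzN]
    have b1 := (hC i j k z hzK).1.trans (hle i j k)
    have b2 := (hC i j k z hzK).2.trans (hle i j k)
    have b3 : |∑ l, pd l (pd k W) (G.a z) * pd j (fun x => G.a x l) z| ≤ 3 * (Hf W (G.a z) * M0) := by
      refine (Finset.abs_sum_le_sum_abs _ _).trans ?_
      refine (Finset.sum_le_card_nsmul _ _ (Hf W (G.a z) * M0) fun l _ => ?_).trans (by simp)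
      rw [abs_mul]
      exact mul_le_mul (le_Hf2 _ _ _ _) ((hC j j l z hzK).1.trans (hle _ _ _)) (abs_nonneg _) (Hf_nonneg _ _)
    refine (abs_add_le _ _).trans ?_
    rw [abs_mul, abs_mul]
    have b4 := mul_le_mul (le_Hf1 W (G.a z) k) b2 (abs_nonneg _) (Hf_nonneg _ _)
    have b5 := mul_le_mul b1 b3 (abs_nonneg _) hM
    linarith
  refine (Finset.abs_sum_le_sum_abs _ _).trans ?_
  refine (Finset.sum_le_card_nsmul _ _ _ h2).trans (le_of_eq ?_)
  simp; ring

/-- Taylor remainder along a segment in the tube -/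
lemma taylor_seg {G : Geo Srf} {W : E3 → ℝ} (hW : G.SmA W) {M : ℝ} (hM : ∀ z ∈ thickening G.δ Srf.S, ∀ i j, |pd j (pd i W) z| ≤ M * Hf W (G.a z))
    {x p : E3} (hseg : ∀ s ∈ Set.Icc (0:ℝ) 1, x + s • (p - x) ∈ thickening G.δ Srf.S) {h : ℝ} (hxp : ‖p - x‖ ≤ h)
    (hc : ContinuousOn (fun s : ℝ => Hf W (G.a (x + s • (p - x)))) (Set.Icc 0 1)) :
    |W p - W x - fderiv ℝ W x (p - x)| ≤ 9 * M * h ^ 2 * ∫ s in Set.Icc (0:ℝ) 1, (1 - s) * Hf W (G.a (x + s • (p - x))) := by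
  set d := p - x with hd
  have hline : ∀ s : ℝ, HasDerivAt (fun s : ℝ => x + s • d) d s := fun s => by
    have := ((hasDerivAt_id s).smul_const d).const_add x
    simp only [one_smul] at this
    exact this
  have hN : ∀ s ∈ Set.Icc (0:ℝ) 1, x + s • d ∈ G.N := fun s hs => G.thick_sub (hseg s hs)
  have h1 : ∀ F : E3 → ℝ, G.Sm F → ∀ s ∈ Set.Icc (0:ℝ) 1, HasDerivAt (fun s : ℝ => F (x + s • d)) (fderiv ℝ F (x + s • d) d) s := fun F hF s hs =>
    (hF.diff (hN s hs)).hasFDerivAt.comp_hasDerivAt s (hline s)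
  have h2 : ∀ s ∈ Set.Icc (0:ℝ) 1, HasDerivAt (fun s : ℝ => fderiv ℝ W (x + s • d) d) (∑ i, d i * ∑ j, d j * pd j (pd i W) (x + s • d)) s := by
    intro s hs
    have e : (fun s : ℝ => fderiv ℝ W (x + s • d) d) = fun s => ∑ i, d i * pd i W (x + s • d) := by
      ext s; rw [fderiv_eq_pd]
    rw [e]
    refine HasDerivAt.fun_sum fun i _ => ?_
    have := (h1 _ (hW.sm.pd i) s hs).const_mul (d i)
    rwa [fderiv_eq_pd] at this
  have hdh : ∀ i, |d i| ≤ h := fun i => (abs_coord_le d i).trans hxp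
  have hh : 0 ≤ h := (norm_nonneg _).trans hxp
  have h3 := taylor_int (g := fun s => W (x + s • d)) (g' := fun s => fderiv ℝ W (x + s • d) d)
    (g'' := fun s => ∑ i, d i * ∑ j, d j * pd j (pd i W) (x + s • d)) (k := fun s => 9 * M * h ^ 2 * Hf W (G.a (x + s • d)))
    (h1 W hW.sm) h2 (by
      refine continuousOn_finset_sum _ fun i _ => continuousOn_const.mul (continuousOn_finset_sum _ fun j _ => continuousOn_const.mul ?_)
      exact fun s hs => ((h1 _ ((hW.sm.pd i).pd j) s hs).continuousAt).continuousWithinAt) (continuousOn_const.mul hc) (by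
      intro s hs
      have a1 : ∀ i ∈ (Finset.univ : Finset (Fin 3)), |d i * ∑ j, d j * pd j (pd i W) (x + s • d)| ≤ h * (3 * (h * (M * Hf W (G.a (x + s • d))))) := by
        intro i _
        rw [abs_mul]
        refine mul_le_mul (hdh i) ?_ (abs_nonneg _) hh
        refine (Finset.abs_sum_le_sum_abs _ _).trans ?_
        refine (Finset.sum_le_card_nsmul _ _ (h * (M * Hf W (G.a (x + s • d)))) fun j _ => ?_).trans (by simp)
        rw [abs_mul]
        exact mul_le_mul (hdh j) (hM _ (hseg s hs) i j) (abs_nonneg _) hh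
      refine (Finset.abs_sum_le_sum_abs _ _).trans ((Finset.sum_le_card_nsmul _ _ _ a1).trans (le_of_eq ?_))
      simp; ring)
  simp only [one_smul, zero_smul, add_zero] at h3
  rw [show x + d = p by rw [hd]; abel] at h3
  refine h3.trans (le_of_eq ?_)
  rw [← integral_const_mul]
  congr 1; ext s; ring

end Geo
end

open MeasureTheory Metric
open scoped RealInnerProductSpace ENNReal NNReal Topology

noncomputable section
namespace Triangulation
namespace Fine
variable {Srf : SmoothSurface} {γ h C : ℝ} {Tr : Triangulation Srf γ h} {G : Geo Srf}

lemma K_cont (F : Tr.Fine G C) {W : E3 → ℝ} (hW : G.SmA W) {t : E3 × E3 × E3} (ht : t ∈ Tr.T) :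
    ContinuousOn (fun x => Hf W (G.a x)) (triOf t) := by
  have hS : ContinuousOn (Hf W) Srf.S := by
    unfold Hf
    refine ContinuousOn.add (continuousOn_finset_sum _ fun i _ => continuousOn_finset_sum _ fun j _ => ?_) (continuousOn_finset_sum _ fun i _ => ?_)
    · exact (((hW.sm.pd i).pd j).contOn G.S_sub).abs
    · exact ((hW.sm.pd i).contOn G.S_sub).abs
  exact hS.comp (G.sm_a.contOn fun x hx => G.thick_sub (F.thick ht hx)) fun x hx => G.a_mem x (G.thick_sub (F.thick ht hx))

/-- average of the second derivatives along a ray -/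
def ray (G : Geo Srf) (W : E3 → ℝ) (p x : E3) : ℝ := ∫ s in Set.Icc (0:ℝ) 1, (1 - s) * Hf W (G.a (x + s • (p - x)))

lemma ray_nonneg (W : E3 → ℝ) (p x : E3) : 0 ≤ ray G W p x :=
  setIntegral_nonneg measurableSet_Icc fun s hs => mul_nonneg (by linarith [hs.2]) (Hf_nonneg _ _)

lemma interp_pt (F : Tr.Fine G C) {W : E3 → ℝ} (hW : G.SmA W) {M : ℝ} (hM0 : 0 ≤ M)
    (hM : ∀ z ∈ thickening G.δ Srf.S, ∀ i j, |pd j (pd i W) z| ≤ M * Hf W (G.a z)) {v : E3 → ℝ} (hv : Tr.IsVh v)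
    (hp : ∀ t ∈ Tr.T, ∀ p ∈ vertsOf t, v p = W p) {t : E3 × E3 × E3} (ht : t ∈ Tr.T) {x : E3} (hx : x ∈ triOf t)
    (hd : DifferentiableAt ℝ (lf Tr G v) (G.a x)) :
    qf (fun x => W x - lf Tr G v x) (fun x => W x - lf Tr G v x) (G.a x) ≤
      (16 / γ ^ 2 + 1) * (9 * M) ^ 2 * h ^ 2 * (3 * (ray G W t.1 x ^ 2 + ray G W t.2.1 x ^ 2 + ray G W t.2.2 x ^ 2)) := by
  have hE := hW.lipA.sub (F.lf_lipA hv)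
  set E : E3 → ℝ := fun x => W x - lf Tr G v x with hEd
  have hxt := F.thick ht hx
  have hdE : DifferentiableAt ℝ E (G.a x) := (hW.sm.diff (G.thick_sub (Geo.a_thick hxt))).sub hd
  obtain ⟨L, c, hL⟩ := hv.2 t ht
  set D : E3 →L[ℝ] ℝ := fderiv ℝ W x - LinearMap.toContinuousLinearMap L with hDd
  set R := ray G W t.1 x + ray G W t.2.1 x + ray G W t.2.2 x with hR
  have r0 := ray_nonneg (G := G) W t.1 x
  have r1 := ray_nonneg (G := G) W t.2.1 x
  have r2 := ray_nonneg (G := G) W t.2.2 x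
  have hh := F.hpos
  have hEt : ∀ y ∈ triOf t, E y = W y - (L y + c) := fun y hy => by simp only [hEd]; rw [F.lf_eq v ht hy, hL y hy]
  have hρ : ∀ p ∈ vertsOf t, |E x + D (p - x)| ≤ 9 * M * h ^ 2 * R := by
    intro p hpt
    have hpT := verts_sub t hpt
    have e0 : E p = 0 := by simp only [hEd]; rw [F.lf_eq v ht hpT, hp t ht p hpt, sub_self]
    have e1 : E x + D (p - x) = -(W p - W x - fderiv ℝ W x (p - x)) := by
      have e2 := hEt p hpT
      have e3 := hEt x hx
      have e4 : D (p - x) = fderiv ℝ W x (p - x) - (L p - L x) := by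
        rw [hDd, _root_.sub_apply, LinearMap.coe_toContinuousLinearMap', L.map_sub]
      rw [e4]; linarith
    have hseg : ∀ s ∈ Set.Icc (0:ℝ) 1, x + s • (p - x) ∈ triOf t := fun s hs => (tri_convex t).add_smul_sub_mem hx hpT hs
    rw [e1, abs_neg]
    refine (Geo.taylor_seg hW hM (fun s hs => F.thick ht (hseg s hs)) ((tri_dist hpT hx).trans (Tr.diam_le t ht)) ?_).trans ?_
    · exact (F.K_cont hW ht).comp (by fun_prop) hseg
    · refine mul_le_mul_of_nonneg_left ?_ (by positivity)
      change ray G W p x ≤ R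
      rcases hpt with rfl | rfl | rfl <;> linarith
  obtain ⟨q1, q2⟩ := aff_small (Tr.ok ht) F.hγ hh hx (E x) D hρ
  set ρ := 9 * M * h ^ 2 * R
  have hρ0 : 0 ≤ ρ := by positivity
  obtain ⟨a1, a2, a3⟩ := F.deriv_rel hE.inv ht hx hdE
  have hD' : HasFDerivWithinAt E D (triOf t) x := by
    have : HasFDerivWithinAt (fun y => W y - (LinearMap.toContinuousLinearMap L y + c)) D (triOf t) x :=
      ((hW.sm.diff (G.thick_sub hxt)).hasFDerivAt.sub ((LinearMap.toContinuousLinearMap L).hasFDerivAt.add_const c)).hasFDerivWithinAt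
    exact this.congr (fun y hy => hEt y hy) (hEt x hx)
  have h5 := F.gv_le hE.inv ht hx hdE (ρ := 2 * ρ / (γ * h)) (fun τ hτ => by
    rw [← gradTri_inner hx a2.hasFDerivWithinAt hτ, gradTri_inner hx hD' hτ]; exact q2 τ hτ)
  have hγ := F.hγ
  have hEa : E (G.a x) = E x := (hE.inv x hxt).symm
  rw [qf_self, hEa]
  have h6 : ‖gv E (G.a x)‖ ^ 2 ≤ (2 * (2 * ρ / (γ * h))) ^ 2 := pow_le_pow_left₀ (norm_nonneg _) h5 2
  have h7 : E x ^ 2 ≤ ρ ^ 2 := sq_le_sq' (abs_le.1 q1).1 (abs_le.1 q1).2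
  have h8 : (2 * (2 * ρ / (γ * h))) ^ 2 = 16 / γ ^ 2 * (9 * M) ^ 2 * h ^ 2 * R ^ 2 := by
    simp only [ρ]; field_simp; ring
  have h9 : ρ ^ 2 ≤ (9 * M) ^ 2 * h ^ 2 * R ^ 2 := by
    have : ρ ^ 2 = (9 * M) ^ 2 * h ^ 2 * R ^ 2 * h ^ 2 := by simp only [ρ]; ring
    rw [this]
    have h1 := F.h1
    exact mul_le_of_le_one_right (by positivity) (by nlinarith)
  have h10 : R ^ 2 ≤ 3 * (ray G W t.1 x ^ 2 + ray G W t.2.1 x ^ 2 + ray G W t.2.2 x ^ 2) := by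
    rw [hR]; nlinarith [sq_nonneg (ray G W t.1 x - ray G W t.2.1 x), sq_nonneg (ray G W t.1 x - ray G W t.2.2 x), sq_nonneg (ray G W t.2.1 x - ray G W t.2.2 x)]
  calc ‖gv E (G.a x)‖ ^ 2 + E x ^ 2 ≤ (16 / γ ^ 2 + 1) * (9 * M) ^ 2 * h ^ 2 * R ^ 2 := by linarith
    _ ≤ _ := mul_le_mul_of_nonneg_left h10 (by positivity)

lemma ray_l2 (F : Tr.Fine G C) {W : E3 → ℝ} (hW : G.SmA W) {t : E3 × E3 × E3} (ht : t ∈ Tr.T) {p : E3} (hp : p ∈ triOf t) :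
    ∃ g : E3 → ℝ≥0∞, Measurable g ∧ (∀ x ∈ triOf t, ENNReal.ofReal (ray G W p x ^ 2) = g x) ∧
      ∫⁻ x in triOf t, g x ∂μH[2] ≤ ENNReal.ofReal (∫ x in triOf t, Hf W (G.a x) ^ 2 ∂μH[2]) := by
  have := F.tri_fin ht
  have hK := F.K_cont hW ht
  classical
  set f : E3 → ℝ≥0∞ := (triOf t).piecewise (fun x => ENNReal.ofReal (Hf W (G.a x))) (fun _ => 0)
  have hf : Measurable f := ContinuousOn.measurable_piecewise (ENNReal.continuous_ofReal.comp_continuousOn hK) continuousOn_const (tri_meas t)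
  have hft : ∀ x ∈ triOf t, f x = ENNReal.ofReal (Hf W (G.a x)) := fun x hx => Set.piecewise_eq_of_mem _ _ _ hx
  have hm : Measurable (fun q : E3 × ℝ => ENNReal.ofReal (1 - q.2) * f (q.1 + q.2 • (p - q.1))) := by
    refine Measurable.mul (by fun_prop) (hf.comp ?_)
    exact Continuous.measurable (by fun_prop)
  refine ⟨fun x => (∫⁻ s in Set.Icc (0:ℝ) 1, ENNReal.ofReal (1 - s) * f (x + s • (p - x))) ^ 2, (hm.lintegral_prod_right').pow_const 2, ?_, ?_⟩
  · intro x hx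
    have hseg : ∀ s ∈ Set.Icc (0:ℝ) 1, x + s • (p - x) ∈ triOf t := fun s hs => (tri_convex t).add_smul_sub_mem hx hp hs
    rw [ENNReal.ofReal_pow (ray_nonneg W p x)]
    congr 1
    rw [ray, ofReal_integral_eq_lintegral_ofReal]
    · refine setLIntegral_congr_fun measurableSet_Icc fun s hs => ?_
      rw [ENNReal.ofReal_mul (by linarith [hs.2]), hft _ (hseg s hs)]
    · have hc1 : ContinuousOn (fun s : ℝ => (1 - s)) (Set.Icc 0 1) := by fun_prop
      exact (hc1.mul (hK.comp (by fun_prop) hseg)).integrableOn_Icc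
    · filter_upwards [ae_restrict_mem measurableSet_Icc] with s hs
      exact mul_nonneg (by linarith [hs.2]) (Hf_nonneg _ _)
  · refine (ray_lint (tri_meas t) (tri_convex t) hp hf).trans (le_of_eq ?_)
    rw [ofReal_integral_eq_lintegral_ofReal]
    · refine setLIntegral_congr_fun (tri_meas t) fun x hx => ?_
      rw [hft x hx, ENNReal.ofReal_pow (Hf_nonneg _ _)]
    · have hc := hK.pow 2
      obtain ⟨B, hB⟩ := (tri_compact t).exists_bound_of_continuousOn hc
      refine Integrable.of_bound (C := B) (hc.aestronglyMeasurable (tri_meas t)) ?_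
      filter_upwards [ae_restrict_mem (tri_meas t)] with x hx using hB x hx
    · exact Filter.Eventually.of_forall fun x => sq_nonneg _

/-- interpolation estimate on a triangle -/
lemma interp_tri (F : Tr.Fine G C) {W : E3 → ℝ} (hW : G.SmA W) {M : ℝ} (hM0 : 0 ≤ M)
    (hM : ∀ z ∈ thickening G.δ Srf.S, ∀ i j, |pd j (pd i W) z| ≤ M * Hf W (G.a z)) {v : E3 → ℝ} (hv : Tr.IsVh v)
    (hp : ∀ t ∈ Tr.T, ∀ p ∈ vertsOf t, v p = W p) {t : E3 × E3 × E3} (ht : t ∈ Tr.T) :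
    ∫ x in triOf t, qf (fun x => W x - lf Tr G v x) (fun x => W x - lf Tr G v x) (G.a x) ∂μH[2] ≤
      9 * ((16 / γ ^ 2 + 1) * (9 * M) ^ 2 * h ^ 2) * ∫ x in triOf t, Hf W (G.a x) ^ 2 ∂μH[2] := by
  have hE := hW.lipA.sub (F.lf_lipA hv)
  set K := (16 / γ ^ 2 + 1) * (9 * M) ^ 2 * h ^ 2 with hK
  have hγ := F.hγ
  have hK0 : 0 ≤ K := by positivity
  set I := ∫ x in triOf t, Hf W (G.a x) ^ 2 ∂μH[2] with hI
  have hI0 : 0 ≤ I := integral_nonneg fun x => sq_nonneg _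
  obtain ⟨g0, m0, e0, i0⟩ := F.ray_l2 hW ht (p := t.1) (verts_sub t (by simp [vertsOf]))
  obtain ⟨g1, m1, e1, i1⟩ := F.ray_l2 hW ht (p := t.2.1) (verts_sub t (by simp [vertsOf]))
  obtain ⟨g2, m2, e2, i2⟩ := F.ray_l2 hW ht (p := t.2.2) (verts_sub t (by simp [vertsOf]))
  have hi := F.int_tri (hE.qf_int hE) ht
  rw [integral_eq_lintegral_of_nonneg_ae (Filter.Eventually.of_forall fun x => qf_nonneg _ _) hi.1]
  refine ENNReal.toReal_le_of_le_ofReal (by positivity) ?_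
  calc _ ≤ ∫⁻ x in triOf t, ENNReal.ofReal (K * 3) * (g0 x + g1 x + g2 x) ∂μH[2] := by
        apply lintegral_mono_ae
        filter_upwards [ae_restrict_mem (tri_meas t), F.ae_tri (F.lf_lipA hv).ae_diff ht] with x hx hd
        have h1 := F.interp_pt hW hM0 hM hv hp ht hx hd
        refine (ENNReal.ofReal_le_ofReal h1).trans (le_of_eq ?_)
        rw [← e0 x hx, ← e1 x hx, ← e2 x hx, ← ENNReal.ofReal_add (by positivity) (by positivity),
          ← ENNReal.ofReal_add (by positivity) (by positivity), ← ENNReal.ofReal_mul (by positivity), mul_assoc K]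
    _ = ENNReal.ofReal (K * 3) * (∫⁻ x in triOf t, g0 x ∂μH[2] + ∫⁻ x in triOf t, g1 x ∂μH[2] + ∫⁻ x in triOf t, g2 x ∂μH[2]) := by
        rw [lintegral_const_mul' _ _ (by finiteness), lintegral_add_right _ m2, lintegral_add_right _ m1]
    _ ≤ ENNReal.ofReal (K * 3) * (ENNReal.ofReal I + ENNReal.ofReal I + ENNReal.ofReal I) := by gcongr
    _ = _ := by
        rw [← ENNReal.ofReal_add hI0 hI0, ← ENNReal.ofReal_add (by positivity) hI0, ← ENNReal.ofReal_mul (by positivity)]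
        congr 1; ring

end Fine
end Triangulation

/-- the interpolation estimate -/
lemma Geo.interp {Srf : SmoothSurface} (G : Geo Srf) (γ : ℝ) (hγ : 0 < γ) : ∃ Ci ≥ 0, ∀ (h C : ℝ) (Tr : Triangulation Srf γ h), Tr.Fine G C → ∀ W, G.SmA W →
    ∃ v, Tr.IsVh v ∧ Geo.Nm Srf (fun x => W x - Triangulation.Fine.lf Tr G v x) ≤ Ci * h * Real.sqrt (∫ y, (W y - lap W y) ^ 2 ∂Srf.mu) := by
  obtain ⟨M, hM0, hM⟩ := G.hess_bd
  obtain ⟨C2, hC2, hH2⟩ := G.H2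
  set A := 9 * ((16 / γ ^ 2 + 1) * (9 * M) ^ 2) with hA
  have hA0 : 0 ≤ A := by positivity
  refine ⟨Real.sqrt (9 * A * (12 * (C2 + 1))), Real.sqrt_nonneg _, fun h C Tr F W hW => ?_⟩
  obtain ⟨v, hv, hp⟩ := Tr.exists_interp W
  refine ⟨v, hv, ?_⟩
  have hh := F.hpos
  have hE := hW.lipA.sub (F.lf_lipA hv)
  have i2 : Integrable (fun y => ∑ i, ∑ j, pd j (pd i W) y ^ 2) Srf.mu :=
    integrable_finsetSum _ fun i _ => integrable_finsetSum _ fun j _ => G.sm_int (((hW.sm.pd i).pd j).sq)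
  have i1 : Integrable (fun y => ∑ i, pd i W y ^ 2) Srf.mu :=
    integrable_finsetSum _ fun i _ => G.sm_int ((hW.sm.pd i).sq)
  have hHm : AEStronglyMeasurable (fun y => Hf W y ^ 2) Srf.mu := by
    refine Measurable.aestronglyMeasurable (Measurable.pow_const ?_ 2)
    unfold Hf
    exact (Finset.measurable_sum _ fun i _ => Finset.measurable_sum _ fun j _ => (measurable_pd j _).abs).add
      (Finset.measurable_sum _ fun i _ => (measurable_pd i _).abs)
  have iH : Integrable (fun y => Hf W y ^ 2) Srf.mu := by
    refine ((i2.add i1).const_mul 12).mono' hHm (Filter.Eventually.of_forall fun y => ?_)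
    rw [Real.norm_eq_abs, abs_of_nonneg (sq_nonneg _)]
    exact Hf_sq W y
  set Q := ∫ y, (W y - lap W y) ^ 2 ∂Srf.mu with hQ
  have hQ0 : 0 ≤ Q := integral_nonneg fun y => sq_nonneg _
  have b1 : ∫ y, Hf W y ^ 2 ∂Srf.mu ≤ 12 * (C2 + 1) * Q := by
    calc _ ≤ ∫ y, 12 * (∑ i, ∑ j, pd j (pd i W) y ^ 2 + ∑ i, pd i W y ^ 2) ∂Srf.mu :=
          integral_mono iH ((i2.add i1).const_mul 12) fun y => Hf_sq W y
      _ = 12 * (∫ y, ∑ i, ∑ j, pd j (pd i W) y ^ 2 ∂Srf.mu + ∫ y, ∑ i, pd i W y ^ 2 ∂Srf.mu) := by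
          rw [integral_const_mul, integral_add i2 i1]
      _ ≤ _ := by
          have := hH2 W hW
          have := (G.energy hW).2
          nlinarith
  have b2 : Geo.B Srf (fun x => W x - Triangulation.Fine.lf Tr G v x) (fun x => W x - Triangulation.Fine.lf Tr G v x) ≤
      9 * A * (12 * (C2 + 1)) * h ^ 2 * Q := by
    have c1 := F.le_sum (hE.qf_int hE) (fun y => qf_nonneg _ _)
    have c2 := F.sum_le iH (fun y => sq_nonneg _)
    have c3 := Finset.sum_le_sum fun t ht => F.interp_tri hW hM0 (hM W hW) hv hp (t := t) ht
    rw [← Finset.mul_sum] at c3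
    have c4 : 9 * ((16 / γ ^ 2 + 1) * (9 * M) ^ 2 * h ^ 2) * ∑ t ∈ Tr.T, ∫ x in triOf t, Hf W (G.a x) ^ 2 ∂μH[2] ≤
        9 * ((16 / γ ^ 2 + 1) * (9 * M) ^ 2 * h ^ 2) * (3 * (12 * (C2 + 1) * Q)) :=
      mul_le_mul_of_nonneg_left (by linarith) (by positivity)
    have c5 : Geo.B Srf (fun x => W x - Triangulation.Fine.lf Tr G v x) (fun x => W x - Triangulation.Fine.lf Tr G v x) ≤
      3 * (9 * ((16 / γ ^ 2 + 1) * (9 * M) ^ 2 * h ^ 2) * (3 * (12 * (C2 + 1) * Q))) := c1.trans (mul_le_mul_of_nonneg_left (c3.trans c4) (by norm_num))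
    refine c5.trans (le_of_eq ?_)
    rw [hA]; ring
  rw [Geo.Nm]
  refine (Real.sqrt_le_sqrt b2).trans (le_of_eq ?_)
  rw [Real.sqrt_mul (by positivity), Real.sqrt_mul (by positivity), Real.sqrt_sq hh.le]

end

open MeasureTheory Metric
open scoped RealInnerProductSpace ENNReal NNReal Topology

noncomputable section

namespace Geo
variable {Srf : SmoothSurface} {G : Geo Srf}
open Triangulation.Fine (lf)

/-- energy of a smooth function in terms of the right-hand side -/
lemma Nm_le_A {W : E3 → ℝ} (hW : G.SmA W) : Nm Srf W ≤ 2 * Real.sqrt (∫ y, (W y - lap W y) ^ 2 ∂Srf.mu) := by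
  have i1 : Integrable (fun y => ∑ i, pd i W y ^ 2) Srf.mu :=
    integrable_finsetSum _ fun i _ => G.sm_int ((hW.sm.pd i).sq)
  obtain ⟨e1, e2⟩ := G.energy hW
  set Q := ∫ y, (W y - lap W y) ^ 2 ∂Srf.mu
  have hQ0 : 0 ≤ Q := integral_nonneg fun y => sq_nonneg _
  have h1 : B Srf W W = ∫ y, ∑ i, pd i W y ^ 2 ∂Srf.mu + ∫ y, W y ^ 2 ∂Srf.mu := by
    rw [B, ← integral_add i1 hW.lipA.memLp.integrable_sq]
    simp only [qf, sq]
  rw [Nm, Real.sqrt_le_left (by positivity), mul_pow, Real.sq_sqrt hQ0]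
  linarith

lemma l2_estimate (F : Triangulation.Fine (Srf := Srf) (γ := γ) (h := h) Tr G C) {Ci : ℝ} (hCi : 0 ≤ Ci)
    (hI : ∀ W, G.SmA W → ∃ v, Tr.IsVh v ∧ Nm Srf (fun x => W x - lf Tr G v x) ≤ Ci * h * Real.sqrt (∫ y, (W y - lap W y) ^ 2 ∂Srf.mu))
    {f u uh : E3 → ℝ} (hf : SmoothNear f Srf.S) (hu : IsSolution Srf f u) (huh : Tr.IsDiscreteSolution f uh) :
    Real.sqrt (∫ y, (u y - Tr.liftS uh y) ^ 2 ∂Srf.mu) ≤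
      (2 * (Ci + 96 * C ^ 2) * Ci + 96 * C ^ 2 * (2 + Ci)) * h ^ 2 * Real.sqrt (∫ y, f y ^ 2 ∂Srf.mu) := by
  have hfA := smoothNear_smA (G := G) hf
  have hU := smoothNear_smA (G := G) hu.1
  have hst := strong hf hu G
  set U : E3 → ℝ := fun x => u (G.a x) with hUd
  have hUH := F.lf_lipA huh.1
  set UH := lf Tr G uh with hUHd
  have hE := hU.lipA.sub hUH
  set E : E3 → ℝ := fun x => U x - UH x with hEd
  have hC := F.C1
  have hh := F.hpos
  have hh1 := F.h1
  have hsm := F.small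
  have hfs : ∫ y, f (G.a y) ^ 2 ∂Srf.mu = ∫ y, f y ^ 2 ∂Srf.mu := by
    apply integral_congr_ae
    filter_upwards [ae_restrict_mem S_meas] with y hy
    rw [G.a_self hy]
  have hUs : ∀ᵐ y ∂Srf.mu, U y - lap U y = f (G.a y) := by
    filter_upwards [ae_restrict_mem S_meas, hst] with y hy h1
    rw [G.a_self hy, h1, hUd]; simp only [G.a_self hy]
  have hUq : ∫ y, (U y - lap U y) ^ 2 ∂Srf.mu = ∫ y, f y ^ 2 ∂Srf.mu := by
    rw [← hfs]
    apply integral_congr_ae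
    filter_upwards [hUs] with y hy
    rw [hy]
  set Fn := Real.sqrt (∫ y, f y ^ 2 ∂Srf.mu) with hFn
  have hF0 : 0 ≤ Fn := Real.sqrt_nonneg _
  set K := 24 * C ^ 2 with hK
  have hK0 : 0 ≤ K := by positivity
  have h3C : 3 * C ≤ K := by rw [hK]; nlinarith
  have hKh : K * h ^ 2 ≤ 1 / 2 := by
    have : (C * h) ^ 2 ≤ (1 / 8) ^ 2 := pow_le_pow_left₀ (by positivity) hsm 2
    rw [hK]; nlinarith
  -- weak form of the equation
  have hUB : ∀ P, G.LipA P → B Srf U P = ∫ y, f (G.a y) * P y ∂Srf.mu := fun P hP => by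
    rw [B_comm, B_green G hP hU]
    apply integral_congr_ae
    filter_upwards [hUs] with y hy
    rw [hy, mul_comm]
  -- Galerkin consistency
  have hcons : ∀ φ, Tr.IsVh φ → |B Srf E (lf Tr G φ)| ≤ K * h ^ 2 * (Fn + Nm Srf UH) * Nm Srf (lf Tr G φ) := fun φ hφ => by
    have hP := F.lf_lipA hφ
    have h1 := F.rhs_compare hfA hφ
    have h2 := F.form_compare huh.1 hφ
    rw [huh.2 φ hφ] at h2
    rw [hfs, ← hFn] at h1
    rw [hEd, hU.lipA.B_sub hUH hP, hUB _ hP]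
    have hn := Nm_nonneg (Srf := Srf) (lf Tr G φ)
    have h3 : 3 * C * h ^ 2 * (Fn * Nm Srf (lf Tr G φ)) ≤ K * h ^ 2 * (Fn * Nm Srf (lf Tr G φ)) := by gcongr
    rw [abs_le] at h1 h2 ⊢
    constructor <;> linarith [h1.1, h1.2, h2.1, h2.2]
  -- stability
  have hstab : Nm Srf UH ≤ 3 * Fn := by
    have h1 := hcons uh huh.1
    rw [← hUHd, hEd, hU.lipA.B_sub hUH hUH, hUB _ hUH, ← Nm_sq] at h1
    have h2 : |∫ y, f (G.a y) * UH y ∂Srf.mu| ≤ Fn * Nm Srf UH := by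
      refine abs_integral_le_integral_abs.trans ((l2_mul hfA.lipA.memLp hUH.memLp).trans ?_)
      rw [hfs]
      exact mul_le_mul_of_nonneg_left hUH.l2_le (Real.sqrt_nonneg _)
    have hn := Nm_nonneg (Srf := Srf) UH
    by_contra hlt
    push Not at hlt
    have hpos : 0 < Nm Srf UH := by linarith
    have h3 : K * h ^ 2 * (Fn + Nm Srf UH) * Nm Srf UH ≤ 1 / 2 * (Fn + Nm Srf UH) * Nm Srf UH := by gcongr
    have h4 : Nm Srf UH * Nm Srf UH ≤ (3 / 2 * Fn + 1 / 2 * Nm Srf UH) * Nm Srf UH := by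
      nlinarith [(_root_.abs_le.1 h1).1, (_root_.abs_le.1 h2).2]
    have h5 := le_of_mul_le_mul_right h4 hpos
    linarith
  have hcons' : ∀ φ, Tr.IsVh φ → |B Srf E (lf Tr G φ)| ≤ 4 * K * h ^ 2 * Fn * Nm Srf (lf Tr G φ) := fun φ hφ => by
    refine (hcons φ hφ).trans ?_
    have hn := Nm_nonneg (Srf := Srf) (lf Tr G φ)
    have : K * h ^ 2 * (Fn + Nm Srf UH) ≤ K * h ^ 2 * (4 * Fn) := by gcongr; linarith
    calc _ ≤ K * h ^ 2 * (4 * Fn) * Nm Srf (lf Tr G φ) := by gcongr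
      _ = _ := by ring
  -- energy estimate
  have hen : Nm Srf E ≤ 2 * ((Ci + 4 * K) * h * Fn) := by
    obtain ⟨v, hv, hvN⟩ := hI U hU
    rw [hUq, ← hFn] at hvN
    have hX := hU.lipA.sub (F.lf_lipA hv)
    set X : E3 → ℝ := fun x => U x - lf Tr G v x with hXd
    have hP := hcons' _ (hv.sub huh.1)
    have hPe : lf Tr G (fun x => v x - uh x) = fun x => E x - X x := by
      ext x
      have : lf Tr G (fun x => v x - uh x) x = lf Tr G v x - lf Tr G uh x := rfl
      rw [this]; simp only [hEd, hXd, hUHd]; ring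
    rw [hPe, B_comm, hE.B_sub hX hE, ← Nm_sq, B_comm X] at hP
    have h1 := hE.N_sub hX
    have h2 := hE.B_le hX
    have hn := Nm_nonneg (Srf := Srf) E
    have hnX := Nm_nonneg (Srf := Srf) X
    set n := Nm Srf E
    set A := (Ci + 4 * K) * h * Fn with hA
    have h3 : n ^ 2 ≤ A * n + A ^ 2 := by
      have a1 : n * Nm Srf X ≤ n * (Ci * h * Fn) := by gcongr
      have a2 : 4 * K * h ^ 2 * Fn * Nm Srf (fun x => E x - X x) ≤ 4 * K * h ^ 2 * Fn * (n + Ci * h * Fn) := by gcongr; linarith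
      have a3 : 4 * K * h ^ 2 * Fn * (n + Ci * h * Fn) ≤ 4 * K * h * Fn * (n + Ci * h * Fn) := by
        have : h ^ 2 ≤ h := by nlinarith
        gcongr
      have a4 : 4 * K * h * Fn * (Ci * h * Fn) ≤ A ^ 2 := by
        have : A ^ 2 - 4 * K * h * Fn * (Ci * h * Fn) = (Ci ^ 2 + 4 * K * Ci + (4 * K) ^ 2) * (h * Fn) ^ 2 := by rw [hA]; ring
        have : 0 ≤ (Ci ^ 2 + 4 * K * Ci + (4 * K) ^ 2) * (h * Fn) ^ 2 := by positivity
        linarith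
      have a5 : A * n = Ci * h * Fn * n + 4 * K * h * Fn * n := by rw [hA]; ring
      nlinarith [(_root_.abs_le.1 hP).2, (_root_.abs_le.1 h2).2]
    have hA0 : 0 ≤ A := by positivity
    by_contra hlt
    push Not at hlt
    nlinarith
  -- duality
  have hdual := G.dual hE.memLp (M := (2 * (Ci + 4 * K) * Ci + 4 * K * (2 + Ci)) * h ^ 2 * Fn) (by positivity) (by
    intro W hW
    obtain ⟨v, hv, hvN⟩ := hI W hW
    have hX := hW.lipA.sub (F.lf_lipA hv)
    have hV := F.lf_lipA hv
    have hWA := Nm_le_A hW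
    have e1 : ∫ y, (W y - lap W y) * E y ∂Srf.mu = B Srf E W := by
      rw [B_green G hE hW]; congr 1; ext y; ring
    rw [e1]
    set Q := Real.sqrt (∫ y, (W y - lap W y) ^ 2 ∂Srf.mu)
    have hQ : 0 ≤ Q := Real.sqrt_nonneg _
    set X : E3 → ℝ := fun x => W x - lf Tr G v x with hXd
    have e2 : B Srf E X = B Srf E W - B Srf E (lf Tr G v) := by
      rw [B_comm, hW.lipA.B_sub hV hE, B_comm, B_comm (lf Tr G v)]
    have e3 : lf Tr G v = fun x => W x - X x := by ext x; simp only [hXd]; ring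
    have n1 : Nm Srf (lf Tr G v) ≤ (2 + Ci) * Q := by
      have := hW.lipA.N_sub hX
      rw [← e3] at this
      have h2 : Ci * h * Q ≤ Ci * Q := by
        rw [mul_assoc]; exact mul_le_mul_of_nonneg_left (mul_le_of_le_one_left hQ hh1) hCi
      linarith
    have b1 : |B Srf E X| ≤ 2 * ((Ci + 4 * K) * h * Fn) * (Ci * h * Q) :=
      (hE.B_le hX).trans (mul_le_mul hen hvN (Nm_nonneg _) (by positivity))
    have b2 : |B Srf E (lf Tr G v)| ≤ 4 * K * h ^ 2 * Fn * ((2 + Ci) * Q) :=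
      (hcons' v hv).trans (mul_le_mul_of_nonneg_left n1 (by positivity))
    have e4 : B Srf E W = B Srf E X + B Srf E (lf Tr G v) := by linarith
    rw [e4]
    refine (abs_add_le _ _).trans ((add_le_add b1 b2).trans (le_of_eq ?_))
    ring)
  have hlast : ∫ y, (u y - Tr.liftS uh y) ^ 2 ∂Srf.mu = ∫ y, E y ^ 2 ∂Srf.mu := by
    apply integral_congr_ae
    filter_upwards [ae_restrict_mem S_meas] with y hy
    simp only [hEd, hUd, hUHd, G.a_self hy]
    rw [Triangulation.Fine.lf_S uh hy]
  rw [hlast]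
  refine hdual.trans (le_of_eq ?_)
  rw [hK]; ring

end Geo

theorem l2_error_main (Srf : SmoothSurface) (γ₀ : ℝ) (hγ₀ : 0 < γ₀) :
    ∃ c > 0, ∃ h₀ > 0, ∀ h : ℝ, 0 < h → h ≤ h₀ →
      ∀ Tr : Triangulation Srf γ₀ h,
      ∀ f u uh : E3 → ℝ, SmoothNear f Srf.S →
        IsSolution Srf f u → Tr.IsDiscreteSolution f uh →
        Real.sqrt (∫ x in Srf.S, (u x - Tr.liftS uh x) ^ 2 ∂μH[2]) ≤
          c * h ^ 2 * Real.sqrt (∫ x in Srf.S, f x ^ 2 ∂μH[2]) := by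
  by_cases hex : ∃ h, Nonempty (Triangulation Srf γ₀ h)
  · obtain ⟨hb, ⟨Tr0⟩⟩ := hex
    let G : Geo Srf := Tr0.tube.geo
    obtain ⟨C, h1, hMC⟩ := G.exists_MC hγ₀
    obtain ⟨Ci, hCi, hI⟩ := G.interp γ₀ hγ₀
    have hC := hMC.C1
    refine ⟨2 * (Ci + 96 * C ^ 2) * Ci + 96 * C ^ 2 * (2 + Ci), by positivity, h1, hMC.h1_pos, fun h hh hl Tr f u uh hf hu huh => ?_⟩
    have F := hMC.fine hγ₀ hh hl Tr
    exact Geo.l2_estimate F hCi (hI h C Tr F) hf hu huh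
  · exact ⟨1, one_pos, 1, one_pos, fun h hh hl Tr => absurd ⟨h, ⟨Tr⟩⟩ hex⟩
end

noncomputable section

/-- **L²-error estimate.** `‖u − U_h‖_{L²(S)} ≤ c h² ‖f‖_{L²(S)}`. -/
theorem l2_error_estimate (Srf : SmoothSurface) (γ₀ : ℝ) (hγ₀ : 0 < γ₀) :
    ∃ c > 0, ∃ h₀ > 0,
      ∀ h : ℝ, 0 < h → h ≤ h₀ →
        ∀ Tr : Triangulation Srf γ₀ h, ∀ f u uh : E3 → ℝ,
          SmoothNear f Srf.S →
          IsSolution Srf f u →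
          Tr.IsDiscreteSolution f uh →
          Real.sqrt (∫ x in Srf.S, (u x - Tr.liftS uh x) ^ 2 ∂μH[2]) ≤
            c * h ^ 2 * Real.sqrt (∫ x in Srf.S, f x ^ 2 ∂μH[2]) := by
  exact l2_error_main Srf γ₀ hγ₀

end
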